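/- Let ∂G be piecewise analytic, with the smallest exterior angle λπ, 0 < λ < 2, at the junction points of its analytic arcs. Suppose ζ ∈ F, where F ⊂ G is compact. Then there is a constant C₂(G,F) > 0, depending only on G and F, such that for every n ∈ ℕ: ‖φ − J_{2n+1}‖_∞ ≤ C₂(G,F) · n^{−λ/(4−2λ)}. -/

import Mathlib

open Complex MeasureTheory Set Filter Metric

noncomputable section

/-- A bounded Jordan domain `G ⊆ ℂ` whose boundary is a rectifiable Jordan curve
of length `l`, given together with a unit-speed (arclength) parametrization `γ`
of the boundary curve `L = frontier G`. -/
structure JordanDomain where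
  /-- the domain -/
  G : Set ℂ
  isOpen : IsOpen G
  nonempty : G.Nonempty
  bounded : Bornology.IsBounded G
  connected : IsConnected G
  simplyConnected : SimplyConnectedSpace ↥G
  /-- the length of the boundary curve -/
  l : ℝ
  l_pos : 0 < l
  /-- arclength parametrization of the boundary curve -/
  γ : ℝ → ℂ
  γ_cont : Continuous γ
  γ_periodic : Function.Periodic γ l
  γ_injOn : InjOn γ (Ico 0 l)
  γ_boundary : γ '' Ico 0 l = frontier G
  /-- `γ` is a unit-speed (arclength) parametrization; in particular the boundary
  is rectifiable with length `l`. -/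
  γ_unitSpeed : ∀ s t : ℝ, s ≤ t → t ≤ s + l →
    eVariationOn γ (Icc s t) = ENNReal.ofReal (t - s)

/-- The `E₂(G)`-norm of (the boundary trace of) a function, computed through the
arclength parametrization of the boundary: `‖g‖₂ = ((1/l) ∫₀^l ‖g(s)‖² ds)^{1/2}`. -/
def JordanDomain.bnorm (D : JordanDomain) (g : ℝ → ℂ) : ℝ :=
  Real.sqrt ((1 / D.l) * ∫ s in (0:ℝ)..D.l, ‖g s‖ ^ 2)

/-- `p` is the sequence of orthonormal polynomials of `E₂(G)` obtained by Gram–Schmidt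
orthonormalization of the monomials `1, z, z², …`: `deg p k = k`, the leading
coefficients are positive reals, and the polynomials are orthonormal with respect to
the arclength inner product `(f,g) = (1/l) ∫_L f conj(g) |dz|`. -/
def JordanDomain.IsONPolys (D : JordanDomain) (p : ℕ → Polynomial ℂ) : Prop :=
  (∀ k, (p k).natDegree = k) ∧
  (∀ k, ∃ c : ℝ, 0 < c ∧ (p k).leadingCoeff = (c : ℂ)) ∧
  (∀ j k, (1 / (D.l : ℂ)) * (∫ s in (0:ℝ)..D.l,
      (p j).eval (D.γ s) * (starRingEnd ℂ) ((p k).eval (D.γ s))) =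
    if j = k then 1 else 0)

/-- The `n`-th partial sum `Σ_{k=0}^n conj(p_k(ζ))·p_k(z)` of the Szegő kernel expansion. -/
def partialSum (p : ℕ → Polynomial ℂ) (ζ : ℂ) (n : ℕ) : ℂ → ℂ := fun z =>
  ∑ k ∈ Finset.range (n + 1), (starRingEnd ℂ) ((p k).eval ζ) * (p k).eval z

/-- The Szegő kernel `K(z,ζ) = Σ_{k=0}^∞ conj(p_k(ζ))·p_k(z)`. -/
def szegoKernel (p : ℕ → Polynomial ℂ) (ζ z : ℂ) : ℂ :=
  ∑' k : ℕ, (starRingEnd ℂ) ((p k).eval ζ) * (p k).eval z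

/-- The approximating polynomials
`J_{2n+1}(z) = (2π/l)·(∫_ζ^z (Σ_{k=0}^n conj(p_k(ζ))p_k(t))² dt) / (Σ_{k=0}^n |p_k(ζ)|²)`;
the (path-independent) integral of the polynomial integrand is written out explicitly,
using `∫_ζ^z t^i dt = (z^{i+1} - ζ^{i+1})/(i+1)`. -/
def Jfun (D : JordanDomain) (p : ℕ → Polynomial ℂ) (ζ : ℂ) (n : ℕ) : ℂ → ℂ := fun z =>
  let S : Polynomial ℂ :=
    (∑ k ∈ Finset.range (n + 1), Polynomial.C ((starRingEnd ℂ) ((p k).eval ζ)) * p k) ^ 2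
  (((2 * Real.pi / D.l : ℝ) : ℂ) / (∑ k ∈ Finset.range (n + 1), ((‖(p k).eval ζ‖ : ℂ)) ^ 2)) *
    ∑ i ∈ Finset.range (S.natDegree + 1),
      S.coeff i * ((z ^ (i + 1) - ζ ^ (i + 1)) / ((i : ℂ) + 1))

/-- `Q_n(z) = ((l/2π)·Σ_{k=0}^n |p_k(ζ)|²)^{-1/2} · Σ_{k=0}^n conj(p_k(ζ))·p_k(z)`,
so that `J'_{2n+1} = Q_n²`. -/
def Qfun (D : JordanDomain) (p : ℕ → Polynomial ℂ) (ζ : ℂ) (n : ℕ) : ℂ → ℂ := fun z =>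
  ((Real.sqrt ((D.l / (2 * Real.pi)) *
      ∑ k ∈ Finset.range (n + 1), ‖(p k).eval ζ‖ ^ 2) : ℝ) : ℂ)⁻¹ * partialSum p ζ n z

/-- The sup norm `⨆_{z ∈ K} ‖f(z)‖` on a set `K ⊆ ℂ`. -/
def supNormOn (K : Set ℂ) (f : ℂ → ℂ) : ℝ := ⨆ z : K, ‖f (z : ℂ)‖

/-- `g` has nontangential limit `v` at the boundary point `w` of `G`:
`g(z) → v` as `z → w` inside every cone `{z ∈ G : ‖z - w‖ ≤ M·dist(z, ∂G)}`. -/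
def NTLim (G : Set ℂ) (g : ℂ → ℂ) (w v : ℂ) : Prop :=
  ∀ M : ℝ, 1 < M →
    Tendsto g (nhdsWithin w {z | z ∈ G ∧ ‖z - w‖ ≤ M * infDist z (frontier G)}) (nhds v)

/-- `φ` is the conformal map of `G` onto the unit disk `D` normalized by
`φ(ζ) = 0` and `φ'(ζ) > 0`. -/
structure ConformalOnto (G : Set ℂ) (φ : ℂ → ℂ) (ζ : ℂ) : Prop where
  differentiable : ∀ z ∈ G, DifferentiableAt ℂ φ z
  bijOn : BijOn φ G (ball (0 : ℂ) 1)
  map_center : φ ζ = 0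
  deriv_center_pos : ∃ c : ℝ, 0 < c ∧ deriv φ ζ = (c : ℂ)

/-- `G` is a Smirnov domain: for any conformal map `ψ` of the unit disk onto `G`,
`log|ψ'|` is represented by the Poisson integral of its (radial) boundary values.
(By the Keldysh–Lavrentiev theorem this is equivalent to polynomials being dense
in the Smirnov classes `E_p(G)`.) -/
def IsSmirnovDomain (G : Set ℂ) : Prop :=
  ∀ ψ : ℂ → ℂ,
    (∀ w ∈ ball (0 : ℂ) 1, DifferentiableAt ℂ ψ w) →
    BijOn ψ (ball (0 : ℂ) 1) G →
    ∃ h : ℝ → ℝ,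
      IntervalIntegrable h volume 0 (2 * Real.pi) ∧
      (∀ᵐ (θ : ℝ) ∂(volume.restrict (Ioc (0 : ℝ) (2 * Real.pi))),
        Tendsto (fun r : ℝ => Real.log ‖deriv ψ ((r : ℂ) * Complex.exp ((θ : ℂ) * Complex.I))‖)
          (nhdsWithin 1 (Iio 1)) (nhds (h θ))) ∧
      (∀ w ∈ ball (0 : ℂ) 1,
        Real.log ‖deriv ψ w‖ =
          (1 / (2 * Real.pi)) * ∫ θ in (0 : ℝ)..(2 * Real.pi),
            ((1 - ‖w‖ ^ 2) / ‖Complex.exp ((θ : ℂ) * Complex.I) - w‖ ^ 2) * h θ)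

/-- The (interior) opening angle of `G` at the boundary point `z₀` equals `a`:
the angular measure of the set of directions in which `G` is seen from `z₀`
at distance `r` tends to `a` as `r → 0⁺`. -/
def HasCornerAngle (G : Set ℂ) (z₀ : ℂ) (a : ℝ) : Prop :=
  Tendsto (fun r : ℝ =>
      (volume {θ : ℝ | θ ∈ Ico 0 (2 * Real.pi) ∧
        z₀ + (r : ℂ) * Complex.exp ((θ : ℂ) * Complex.I) ∈ G}).toReal)
    (nhdsWithin 0 (Ioi 0)) (nhds a)

/-- The boundary of the Jordan domain `D` is piecewise analytic: it is a union of
finitely many analytic arcs `τ i '' [0,1]` (each `τ i` is conformal, i.e. injective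
and holomorphic, on an open neighborhood `U i` of the segment `[0,1]`), consecutive
arcs are joined at the junction points `τ i 1 = τ (i+1) 0`, and at the junction
point `τ i 1` the exterior angle of `G` is `extAngle i · π` (so the interior
opening angle there is `(2 - extAngle i) · π`). -/
structure PiecewiseAnalyticBoundary (D : JordanDomain) where
  /-- number of analytic arcs -/
  m : ℕ
  m_pos : 0 < m
  /-- conformal parametrizations of the arcs -/
  τ : Fin m → ℂ → ℂ
  /-- neighborhoods of the segment `[0,1]` on which the `τ i` are conformal -/
  U : Fin m → Set ℂ
  U_open : ∀ i, IsOpen (U i)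
  seg_sub : ∀ i, (Complex.ofReal '' Icc (0 : ℝ) 1) ⊆ U i
  analytic : ∀ i, DifferentiableOn ℂ (τ i) (U i)
  inj : ∀ i, InjOn (τ i) (U i)
  cover : (⋃ i, τ i '' (Complex.ofReal '' Icc (0 : ℝ) 1)) = frontier D.G
  junction : ∀ i : Fin m,
    τ i 1 = τ (Fin.mk ((i.val + 1) % m) (Nat.mod_lt _ m_pos)) 0
  /-- `extAngle i · π` is the exterior angle at the junction point `τ i 1` -/
  extAngle : Fin m → ℝ
  extAngle_mem : ∀ i, extAngle i ∈ Ioo (0 : ℝ) 2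
  extAngle_spec : ∀ i, HasCornerAngle D.G (τ i 1) ((2 - extAngle i) * Real.pi)

end

section
open scoped Interval Topology
theorem cm_rect_half {f : ℂ → ℂ} (z w : ℂ)
    (Hc : ContinuousOn f ([[z.re, w.re]] ×ℂ [[z.im, w.im]]))
    (Hd : ∀ p ∈ [[z.re, w.re]] ×ℂ [[z.im, w.im]], p.im ≠ 0 → DifferentiableAt ℂ f p)
    (hs : 0 ∉ Ioo (min z.im w.im) (max z.im w.im)) :
    (∫ x : ℝ in z.re..w.re, f (x + z.im * I)) - (∫ x : ℝ in z.re..w.re, f (x + w.im * I)) +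
      I • (∫ y : ℝ in z.im..w.im, f (re w + y * I)) -
      I • (∫ y : ℝ in z.im..w.im, f (re z + y * I)) = 0 := by
  apply integral_boundary_rect_eq_zero_of_continuousOn_of_differentiableOn f z w Hc
  intro p hp
  refine (Hd p ?_ ?_).differentiableWithinAt
  · rw [mem_reProdIm] at hp ⊢
    exact ⟨Ioo_subset_Icc_self hp.1, Ioo_subset_Icc_self hp.2⟩
  · intro h0
    rw [mem_reProdIm, h0] at hp
    exact hs hp.2
/-- Painlevé removability across the real axis. -/
theorem cm_painleve {f : ℂ → ℂ} {U : Set ℂ} (hU : IsOpen U) (hc : ContinuousOn f U)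
    (hd : ∀ p ∈ U, p.im ≠ 0 → DifferentiableAt ℂ f p) : DifferentiableOn ℂ f U := by
  rw [← isConservativeOn_and_continuousOn_iff_isDifferentiableOn hU]
  refine ⟨?_, hc⟩
  intro z w hzw
  rw [← add_eq_zero_iff_eq_neg, wedgeIntegral_add_wedgeIntegral_eq]
  have hR : [[z.re, w.re]] ×ℂ [[z.im, w.im]] ⊆ U := hzw
  by_cases h0 : (0:ℝ) ∈ Ioo (min z.im w.im) (max z.im w.im)
  · -- split at the axis
    have h0' : (0:ℝ) ∈ [[z.im, w.im]] := Ioo_subset_Icc_self h0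
    have hs1 : [[z.im, (0:ℝ)]] ⊆ [[z.im, w.im]] := uIcc_subset_uIcc left_mem_uIcc h0'
    have hs2 : [[(0:ℝ), w.im]] ⊆ [[z.im, w.im]] := uIcc_subset_uIcc h0' right_mem_uIcc
    have e1 := cm_rect_half (f := f) z ⟨w.re, 0⟩
      (hc.mono (Subset.trans (by exact reProdIm_subset_iff.2 (prod_mono_right hs1)) hR))
      (fun p hp => hd p (hR (by
        simp only [mem_reProdIm] at hp ⊢; exact ⟨hp.1, hs1 hp.2⟩)))
      (by simp only [mem_Ioo, not_and, not_lt]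
          intro h
          rcases le_total z.im 0 with h1 | h1
          · simp [h1]
          · simp [h1] at h)
    have e2 := cm_rect_half (f := f) ⟨z.re, 0⟩ w
      (hc.mono (Subset.trans (by exact reProdIm_subset_iff.2 (prod_mono_right hs2)) hR))
      (fun p hp => hd p (hR (by
        simp only [mem_reProdIm] at hp ⊢; exact ⟨hp.1, hs2 hp.2⟩)))
      (by simp only [mem_Ioo, not_and, not_lt]
          intro h
          rcases le_total w.im 0 with h1 | h1
          · simp [h1]
          · simp [h1] at h)
    have int : ∀ x ∈ [[z.re, w.re]], ∀ S : ℝ, ∀ T : ℝ, [[S, T]] ⊆ [[z.im, w.im]] →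
        IntervalIntegrable (fun y : ℝ => f (x + y * I)) volume S T := by
      intro x hx S T hST
      apply ContinuousOn.intervalIntegrable
      refine hc.comp (by fun_prop) ?_
      intro y hy
      apply hR
      simp only [mem_reProdIm]
      simpa using ⟨hx, hST hy⟩
    have a1 := intervalIntegral.integral_add_adjacent_intervals
      (int w.re right_mem_uIcc z.im 0 hs1) (int w.re right_mem_uIcc 0 w.im hs2)
    have a2 := intervalIntegral.integral_add_adjacent_intervals
      (int z.re left_mem_uIcc z.im 0 hs1) (int z.re left_mem_uIcc 0 w.im hs2)
    simp only [smul_eq_mul] at *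
    rw [← a1, ← a2]
    linear_combination e1 + e2
  · exact cm_rect_half z w (hc.mono hR) (fun p hp => hd p (hR hp)) h0
/-- holomorphic logarithm on a ball -/
theorem cm_log_ball {f : ℂ → ℂ} {c : ℂ} {r : ℝ} (hf : DifferentiableOn ℂ f (ball c r))
    (h0 : ∀ z ∈ ball c r, f z ≠ 0) :
    ∃ g : ℂ → ℂ, DifferentiableOn ℂ g (ball c r) ∧ ∀ z ∈ ball c r, exp (g z) = f z := by
  rcases le_or_gt r 0 with hr | hr
  · exact ⟨0, by rw [ball_eq_empty.2 hr]; exact differentiableOn_empty, by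
      rw [ball_eq_empty.2 hr]; simp⟩
  have hd' : DifferentiableOn ℂ (deriv f) (ball c r) := hf.deriv isOpen_ball
  have hq : DifferentiableOn ℂ (fun z => deriv f z / f z) (ball c r) := hd'.div hf h0
  obtain ⟨g, hg0, hg⟩ := (hq.isExactOn_ball).with_val_at c (log (f c))
  have hgd : DifferentiableOn ℂ g (ball c r) :=
    fun z hz => (hg z hz).differentiableAt.differentiableWithinAt
  refine ⟨g, hgd, ?_⟩
  have hconst : ∀ z ∈ ball c r, exp (- g z) * f z = exp (- g c) * f c := by
    intro z hz
    have hder : ∀ x ∈ ball c r, HasDerivAt (fun z => exp (- g z) * f z) 0 x := by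
      intro x hx
      have h1 := (hg x hx).neg.cexp.mul ((hf.differentiableAt (isOpen_ball.mem_nhds hx)).hasDerivAt)
      refine HasDerivAt.congr_deriv h1 ?_
      have := h0 x hx
      rw [mul_assoc, ← mul_add]
      simp [this]
    exact (isOpen_ball.is_const_of_deriv_eq_zero (convex_ball c r).isPreconnected
      (fun x hx => (hder x hx).differentiableAt.differentiableWithinAt)
      (fun x hx => (hder x hx).deriv) hz (mem_ball_self hr))
  intro z hz
  have := hconst z hz
  rw [hg0, exp_neg, exp_neg, exp_log (h0 c (mem_ball_self hr)),
    inv_mul_cancel₀ (h0 c (mem_ball_self hr)),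
    inv_mul_eq_one₀ (exp_ne_zero _)] at this
  exact this
theorem cm_root_ball {f : ℂ → ℂ} {c : ℂ} {r : ℝ} (hf : DifferentiableOn ℂ f (ball c r))
    (h0 : ∀ z ∈ ball c r, f z ≠ 0) (k : ℕ) (hk : k ≠ 0) :
    ∃ g : ℂ → ℂ, DifferentiableOn ℂ g (ball c r) ∧ (∀ z ∈ ball c r, g z ≠ 0) ∧
      ∀ z ∈ ball c r, g z ^ k = f z := by
  obtain ⟨g, hg, he⟩ := cm_log_ball hf h0
  refine ⟨fun z => exp (g z / k), (hg.div_const _).cexp, fun z _ => exp_ne_zero _, fun z hz => ?_⟩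
  rw [← exp_nat_mul, mul_div_cancel₀ _ (by exact_mod_cast hk), he z hz]
/-- A3 -/
theorem cm_deriv_bound {Ψ : ℂ → ℂ} {z : ℂ} {ρ M : ℝ} (hρ : 0 < ρ) (hM : 0 < M)
    (hd : DifferentiableOn ℂ Ψ (ball z ρ))
    (h1 : ∀ p ∈ ball z ρ, Real.exp (-M) ≤ ‖Ψ p‖) (h2 : ∀ p ∈ ball z ρ, ‖Ψ p‖ ≤ Real.exp M) :
    ‖deriv Ψ z‖ ≤ 8 * M / ρ * Real.exp M := by
  have h0 : ∀ p ∈ ball z ρ, Ψ p ≠ 0 := fun p hp => by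
    have := h1 p hp
    have h3 := Real.exp_pos (-M)
    exact norm_pos_iff.1 (lt_of_lt_of_le h3 this)
  obtain ⟨g, hg, he⟩ := cm_log_ball hd h0
  have hre : ∀ p ∈ ball z ρ, |(g p).re| ≤ M := by
    intro p hp
    have a := h1 p hp
    have b := h2 p hp
    rw [← he p hp, norm_exp, Real.exp_le_exp] at a b
    exact abs_le.2 ⟨a, b⟩
  have hz := mem_ball_self (x := z) hρ
  -- shifted function
  set k : ℂ → ℂ := fun u => g (z + u) - g z with hk
  have hmaps : ∀ u ∈ ball (0:ℂ) ρ, z + u ∈ ball z ρ := by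
    intro u hu; simpa [mem_ball, dist_eq_norm] using hu
  have hkd : DifferentiableOn ℂ k (ball 0 ρ) :=
    (hg.comp (by fun_prop) hmaps).sub_const _
  have hkb : ∀ u ∈ sphere (0:ℂ) (ρ/2), ‖k u‖ ≤ 4 * M := by
    intro u hu
    have hu' : ‖u‖ = ρ/2 := by simpa using hu
    have := borelCaratheodory_zero (M := 2*M) (by positivity) hkd
      (fun v hv => by
        have a := abs_le.1 (hre _ (hmaps v hv)); have b := abs_le.1 (hre z hz)
        simp only [hk, mem_ofPred_eq, sub_re]; linarith) hρ
      (z := u) (by rw [mem_ball_zero_iff, hu']; linarith) (by simp [hk])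
    rw [hu'] at this
    calc ‖k u‖ ≤ _ := this
      _ = 4 * M := by field_simp; ring
  have hD : DiffContOnCl ℂ k (ball 0 (ρ/2)) :=
    (hkd.mono (closedBall_subset_ball (by linarith))).diffContOnCl_ball (subset_rfl)
  have hder := norm_deriv_le_of_forall_mem_sphere_norm_le (by positivity) hD hkb
  have e1 : deriv k 0 = deriv g z := by
    have := deriv_comp_const_add (f := g) z 0
    simp only [hk, deriv_sub_const]
    simpa using this
  have hgz := (hg.differentiableAt (isOpen_ball.mem_nhds hz)).hasDerivAt
  have hΨ : deriv Ψ z = exp (g z) * deriv g z := by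
    refine HasDerivAt.deriv ?_
    refine hgz.cexp.congr_of_eventuallyEq ?_
    filter_upwards [isOpen_ball.mem_nhds hz] with p hp using (he p hp).symm
  rw [hΨ, norm_mul, he z hz, mul_comm]
  rw [e1] at hder
  calc _ ≤ (4 * M / (ρ/2)) * Real.exp M := by
        gcongr
        exact h2 z hz
    _ = _ := by field_simp; ring
theorem cm_inj_deriv_ne {f : ℂ → ℂ} {U : Set ℂ} (hU : IsOpen U) (hf : DifferentiableOn ℂ f U)
    (hi : InjOn f U) {z : ℂ} (hz : z ∈ U) : deriv f z ≠ 0 := by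
  intro hd
  have han : AnalyticAt ℂ f z := hf.analyticAt (hU.mem_nhds hz)
  have han' : AnalyticAt ℂ (fun p => f p - f z) z := han.sub analyticAt_const
  have hne : ¬ ∀ᶠ p in 𝓝 z, f p - f z = 0 := by
    intro h
    have h2 : ∀ᶠ p in 𝓝 z, p = z := by
      filter_upwards [h, hU.mem_nhds hz] with p hp hpU
      exact hi hpU hz (sub_eq_zero.1 hp)
    have h3 : ∀ᶠ p in 𝓝[≠] z, p = z := h2.filter_mono nhdsWithin_le_nhds
    obtain ⟨p, hp1, hp2⟩ := (h3.and eventually_mem_nhdsWithin).exists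
    exact hp2 hp1
  obtain ⟨n, g, hg, hg0, hfg⟩ := han'.exists_eventuallyEq_pow_smul_nonzero_iff.2 hne
  have hn0 : n ≠ 0 := by
    rintro rfl
    have := hfg.self_of_nhds
    simp at this
    exact hg0 this.symm
  obtain ⟨r, hr, hrb⟩ : ∃ r > 0, ball z r ⊆ U ∩ {p | AnalyticAt ℂ g p ∧ g p ≠ 0 ∧
      f p - f z = (p - z) ^ n • g p} := by
    apply Metric.mem_nhds_iff.1
    apply inter_mem (hU.mem_nhds hz)
    filter_upwards [hg.eventually_analyticAt, hg.continuousAt.eventually_ne hg0, hfg] with p a b c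
    exact ⟨a, b, c⟩
  obtain ⟨k, hk, hk0, hkg⟩ := cm_root_ball (f := g) (c := z) (r := r)
    (fun p hp => (hrb hp).2.1.differentiableAt.differentiableWithinAt)
    (fun p hp => (hrb hp).2.2.1) n hn0
  have hzb := mem_ball_self (x := z) hr
  set h : ℂ → ℂ := fun p => (p - z) * k p with hh
  have hkan : AnalyticAt ℂ k z := hk.analyticAt (isOpen_ball.mem_nhds hzb)
  have hhan : AnalyticAt ℂ h z := (analyticAt_id.sub analyticAt_const).mul hkan
  have hfh : ∀ p ∈ ball z r, f p = f z + h p ^ n := by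
    intro p hp
    have := (hrb hp).2.2.2
    simp only [hh, mul_pow, hkg p hp, smul_eq_mul] at this ⊢
    linear_combination this
  have hhd : HasDerivAt h (k z) z := by
    have := ((hasDerivAt_id z).sub_const z).mul hkan.differentiableAt.hasDerivAt
    exact this.congr_deriv (by simp)
  have hhs : HasStrictDerivAt h (k z) z := by
    have := hhan.hasStrictDerivAt
    rwa [hhd.deriv] at this
  have hn1 : n ≠ 1 := by
    rintro rfl
    have : HasDerivAt f (k z) z := by
      refine (hhd.const_add (f z)).congr_of_eventuallyEq ?_
      filter_upwards [isOpen_ball.mem_nhds hzb] with p hp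
      simpa using hfh p hp
    exact hk0 z hzb (by rw [← this.deriv, hd])
  have hmap := hhs.map_nhds_eq (hk0 z hzb)
  have hh0 : h z = 0 := by simp [hh]
  rw [hh0] at hmap
  have him : h '' ball z r ∈ 𝓝 (0:ℂ) := by
    rw [← hmap]; exact image_mem_map (isOpen_ball.mem_nhds hzb)
  obtain ⟨ε, hε, hεb⟩ := Metric.mem_nhds_iff.1 him
  set ω : ℂ := exp (2 * Real.pi * I / n) with hω
  have hprim := Complex.isPrimitiveRoot_exp n hn0
  have hωn : ω ^ n = 1 := hprim.pow_eq_one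
  have hω1 : ω ≠ 1 := hprim.ne_one (by omega)
  have hωnorm : ‖ω‖ = 1 := hprim.norm'_eq_one hn0
  obtain ⟨a, ha, hae⟩ : ((ε/2 : ℝ) : ℂ) ∈ h '' ball z r := hεb (by
    simp [abs_of_pos hε]; linarith)
  obtain ⟨b, hb, hbe⟩ : ((ε/2 : ℝ) : ℂ) * ω ∈ h '' ball z r := hεb (by
    simp [abs_of_pos hε, hωnorm]; linarith)
  have : f a = f b := by
    rw [hfh a ha, hfh b hb, hae, hbe, mul_pow, hωn, mul_one]
  have hab := hi (hrb ha).1 (hrb hb).1 this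
  rw [hab, hbe] at hae
  apply hω1
  have h2 : ((ε/2 : ℝ) : ℂ) ≠ 0 := by
    norm_cast; positivity
  exact mul_left_cancel₀ h2 (by rw [hae, mul_one])
theorem cm_normSq_id (a w : ℂ) : ‖1 - (starRingEnd ℂ) a * w‖^2 - ‖w - a‖^2
    = (1 - ‖a‖^2) * (1 - ‖w‖^2) := by
  simp only [← normSq_eq_norm_sq, normSq_apply]
  simp
  ring
theorem cm_schwarz_pick {Φ : ℂ → ℂ} {c p : ℂ} {ρ : ℝ}
    (hd : DifferentiableOn ℂ Φ (ball c ρ)) (hm : MapsTo Φ (ball c ρ) (ball 0 1))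
    (hp : p ∈ ball c ρ) :
    (1 - (dist p c / ρ)^2) * (1 - ‖Φ c‖) / 2 ≤ 1 - ‖Φ p‖^2 := by
  have hρ : 0 < ρ := nonempty_ball.1 ⟨p, hp⟩
  have hc : c ∈ ball c ρ := mem_ball_self hρ
  set a := Φ c with ha
  have ha1 : ‖a‖ < 1 := by simpa using hm hc
  have hden : ∀ z ∈ ball c ρ, 1 - (starRingEnd ℂ) a * Φ z ≠ 0 := by
    intro z hz h
    have h1 : ‖Φ z‖ < 1 := by simpa using hm hz
    have : ‖(starRingEnd ℂ) a * Φ z‖ = 1 := by rw [← sub_eq_zero.1 h]; simp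
    rw [norm_mul, RCLike.norm_conj] at this
    nlinarith [norm_nonneg a, norm_nonneg (Φ z)]
  set T : ℂ → ℂ := fun z => (Φ z - a) / (1 - (starRingEnd ℂ) a * Φ z) with hT
  have hTd : DifferentiableOn ℂ T (ball c ρ) :=
    (hd.sub_const a).div ((differentiableOn_const _).sub ((differentiableOn_const _).mul hd)) hden
  have hTc : T c = 0 := by simp [hT, ha]
  have hTm : MapsTo T (ball c ρ) (closedBall (T c) 1) := by
    intro z hz
    have h1 : ‖Φ z‖ < 1 := by simpa using hm hz
    rw [hTc, mem_closedBall_zero_iff, hT]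
    simp only [norm_div]
    apply div_le_one_of_le₀ _ (norm_nonneg _)
    have := cm_normSq_id a (Φ z)
    refine (sq_le_sq₀ (norm_nonneg _) (norm_nonneg _)).1 ?_
    nlinarith [norm_nonneg a, norm_nonneg (Φ z), mul_nonneg (by nlinarith [norm_nonneg a] : 0 ≤ 1 - ‖a‖^2) (by nlinarith [norm_nonneg (Φ z)] : 0 ≤ 1 - ‖Φ z‖^2)]
  have hle := dist_le_div_mul_dist_of_mapsTo_ball hTd hTm hp
  rw [hTc, dist_zero_right, hT] at hle
  simp only [norm_div] at hle
  have hdp : 0 < ‖1 - (starRingEnd ℂ) a * Φ p‖ := norm_pos_iff.2 (hden p hp)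
  rw [div_le_iff₀ hdp] at hle
  set s := dist p c / ρ with hs
  have hs' : 1 / ρ * dist p c = s := by rw [hs]; ring
  rw [hs'] at hle
  have hs0 : 0 ≤ s := by positivity
  have hs1 : s < 1 := by rw [hs, div_lt_one hρ]; exact hp
  have hid := cm_normSq_id a (Φ p)
  have hsq : ‖Φ p - a‖^2 ≤ s^2 * ‖1 - (starRingEnd ℂ) a * Φ p‖^2 := by
    rw [← mul_pow]; exact pow_le_pow_left₀ (norm_nonneg _) hle 2
  have h1 : ‖Φ p‖ < 1 := by simpa using hm hp
  have hlow : 1 - ‖a‖ ≤ ‖1 - (starRingEnd ℂ) a * Φ p‖ := by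
    have := norm_sub_norm_le (1:ℂ) ((starRingEnd ℂ) a * Φ p)
    rw [norm_one, norm_mul, RCLike.norm_conj] at this
    nlinarith [norm_nonneg a]
  have hlow2 : (1 - ‖a‖)^2 ≤ ‖1 - (starRingEnd ℂ) a * Φ p‖^2 :=
    pow_le_pow_left₀ (by linarith) hlow 2
  have h5 : (1 - s^2) * (1 - ‖a‖)^2 ≤ (1 - ‖a‖^2) * (1 - ‖Φ p‖^2) := by
    have : (1 - s^2) * (1 - ‖a‖)^2 ≤ (1 - s^2) * ‖1 - (starRingEnd ℂ) a * Φ p‖^2 :=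
      mul_le_mul_of_nonneg_left hlow2 (by nlinarith)
    nlinarith
  have h6 : (1 - s^2) * (1 - ‖a‖) ≤ (1 + ‖a‖) * (1 - ‖Φ p‖^2) := by
    have : (1 - ‖a‖) * ((1 - s^2) * (1 - ‖a‖)) ≤ (1 - ‖a‖) * ((1 + ‖a‖) * (1 - ‖Φ p‖^2)) := by
      nlinarith
    exact le_of_mul_le_mul_left this (by linarith)
  have h7 : 0 ≤ 1 - ‖Φ p‖^2 := by nlinarith [norm_nonneg (Φ p)]
  nlinarith
/-- Hopf -/
theorem cm_hopf {Φ : ℂ → ℂ} {R : ℝ} (hR : 0 < R) (hd : DifferentiableOn ℂ Φ (ball 0 R))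
    (h1 : ∀ u ∈ ball (0:ℂ) R, 0 < u.im → ‖Φ u‖ < 1) (h0 : ‖Φ 0‖ = 1) : deriv Φ 0 ≠ 0 := by
  intro hder
  set ρ := R / 4 with hρ
  set c : ℂ := (ρ : ℂ) * I with hc
  have hρ0 : 0 < ρ := by positivity
  have hcn : ‖c‖ = ρ := by simp [hc, abs_of_pos hρ0]
  have hsub : ∀ u ∈ ball c ρ, u ∈ ball (0:ℂ) R ∧ 0 < u.im := by
    intro u hu
    rw [mem_ball, dist_eq_norm] at hu
    constructor
    · rw [mem_ball_zero_iff]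
      have := norm_add_le (u - c) c
      rw [sub_add_cancel] at this
      linarith
    · have := abs_lt.1 (lt_of_le_of_lt (abs_im_le_norm (u - c)) hu)
      simp [hc] at this
      linarith
  have hΦc : ‖Φ c‖ < 1 := h1 c (hsub c (mem_ball_self hρ0)).1 (hsub c (mem_ball_self hρ0)).2
  have hm : MapsTo Φ (ball c ρ) (ball 0 1) := fun u hu => by
    simpa using h1 u (hsub u hu).1 (hsub u hu).2
  have hdc := hd.mono (fun u hu => (hsub u hu).1 : ball c ρ ⊆ ball 0 R)
  have hD : HasDerivAt Φ 0 0 := by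
    have := (hd.differentiableAt (isOpen_ball.mem_nhds (mem_ball_self hR))).hasDerivAt
    rwa [hder] at this
  have hlit := hD.isLittleO
  set κ := (1 - ‖Φ c‖) / (8 * ρ) with hκ
  have hκ0 : 0 < κ := by rw [hκ]; apply div_pos <;> linarith
  have hb := hlit.def hκ0
  obtain ⟨δ, hδ, hδb⟩ := Metric.mem_nhds_iff.1 hb
  set y := min (δ/2) ρ with hy
  have hy0 : 0 < y := by rw [hy]; positivity
  have hyδ : y < δ := lt_of_le_of_lt (min_le_left _ _) (by linarith)
  have hyρ : y ≤ ρ := min_le_right _ _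
  have hyn : ‖(y:ℂ) * I‖ = y := by simp [abs_of_pos hy0]
  have hb1 : (y:ℂ) * I ∈ ball (0:ℂ) δ := by rw [mem_ball_zero_iff, hyn]; exact hyδ
  have hb2 := hδb hb1
  simp only [mem_ofPred_eq, sub_zero, smul_zero, hyn] at hb2
  have hdist : dist ((y:ℂ) * I) c = ρ - y := by
    rw [dist_eq_norm, hc, ← sub_mul, ← ofReal_sub, norm_mul, norm_I, norm_real, mul_one,
      Real.norm_eq_abs, abs_sub_comm, abs_of_nonneg (by linarith)]
  have hsp := cm_schwarz_pick hdc hm (p := (y:ℂ)*I) (by rw [mem_ball, hdist]; linarith)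
  rw [hdist] at hsp
  have h3 : 1 - κ * y ≤ ‖Φ ((y:ℂ)*I)‖ := by
    have := norm_sub_norm_le (Φ 0) (Φ ((y:ℂ)*I))
    rw [norm_sub_rev, h0] at this
    linarith
  have h4 : 1 - ‖Φ ((y:ℂ)*I)‖^2 ≤ 2 * (κ * y) := by nlinarith [norm_nonneg (Φ ((y:ℂ)*I)), sq_nonneg (1 - ‖Φ ((y:ℂ)*I)‖)]
  have h5 : y / ρ ≤ 1 - ((ρ - y)/ρ)^2 := by
    have : (ρ - y)/ρ = 1 - y/ρ := by field_simp
    rw [this]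
    have a : y/ρ ≤ 1 := by rw [div_le_one hρ0]; exact hyρ
    have b : 0 < y/ρ := by positivity
    nlinarith
  have h6 : y / ρ * (1 - ‖Φ c‖) / 2 ≤ 2 * (κ * y) := by
    have : y / ρ * (1 - ‖Φ c‖) / 2 ≤ (1 - ((ρ - y)/ρ)^2) * (1 - ‖Φ c‖) / 2 := by
      have : 0 ≤ 1 - ‖Φ c‖ := by linarith
      gcongr
    linarith
  have h7 : y / ρ * (1 - ‖Φ c‖) / 2 = 4 * (κ * y) := by rw [hκ]; field_simp; ring
  have : 0 < κ * y := by positivity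
  linarith
theorem cm_reflect {Φ0 : ℂ → ℂ} {R : ℝ}
    (hc : ContinuousOn Φ0 (ball 0 R ∩ {u | 0 ≤ u.im}))
    (hd : ∀ u ∈ ball (0:ℂ) R, 0 < u.im → DifferentiableAt ℂ Φ0 u)
    (h1 : ∀ u ∈ ball (0:ℂ) R, u.im = 0 → ‖Φ0 u‖ = 1)
    (hn : ∀ u ∈ ball (0:ℂ) R, 0 ≤ u.im → Φ0 u ≠ 0) :
    ∃ Φ : ℂ → ℂ, DifferentiableOn ℂ Φ (ball 0 R) ∧
      (∀ u ∈ ball (0:ℂ) R, 0 ≤ u.im → Φ u = Φ0 u) ∧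
      (∀ u ∈ ball (0:ℂ) R, u.im ≤ 0 →
        Φ u = ((starRingEnd ℂ) (Φ0 ((starRingEnd ℂ) u)))⁻¹) := by
  classical
  set Φ : ℂ → ℂ := fun u => if 0 ≤ u.im then Φ0 u else
    ((starRingEnd ℂ) (Φ0 ((starRingEnd ℂ) u)))⁻¹ with hΦ
  have hconj : ∀ u ∈ ball (0:ℂ) R, (starRingEnd ℂ) u ∈ ball (0:ℂ) R := by
    intro u hu; simpa using hu
  have hup : ∀ u ∈ ball (0:ℂ) R, 0 ≤ u.im → Φ u = Φ0 u := fun u _ h => by simp [hΦ, h]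
  have hlow : ∀ u ∈ ball (0:ℂ) R, u.im ≤ 0 →
        Φ u = ((starRingEnd ℂ) (Φ0 ((starRingEnd ℂ) u)))⁻¹ := by
    intro u hu h
    rcases h.lt_or_eq with h | h
    · simp [hΦ, not_le.2 h]
    · have e : (starRingEnd ℂ) u = u := Complex.conj_eq_iff_im.2 h
      rw [hup u hu h.ge, e]
      have := h1 u hu h
      rw [eq_comm, inv_eq_iff_eq_inv, inv_def, normSq_eq_norm_sq, this]; simp
  refine ⟨Φ, cm_painleve isOpen_ball ?_ ?_, hup, hlow⟩
  · have hcu : ContinuousOn Φ (ball 0 R ∩ {u | 0 ≤ u.im}) :=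
      hc.congr (fun u hu => hup u hu.1 hu.2)
    have hcl : ContinuousOn Φ (ball 0 R ∩ {u | u.im ≤ 0}) := by
      have : ContinuousOn (fun u => ((starRingEnd ℂ) (Φ0 ((starRingEnd ℂ) u)))⁻¹)
          (ball 0 R ∩ {u | u.im ≤ 0}) := by
        have hm : MapsTo (starRingEnd ℂ) (ball (0:ℂ) R ∩ {u | u.im ≤ 0})
            (ball 0 R ∩ {u | 0 ≤ u.im}) := by
          intro u hu
          exact ⟨hconj u hu.1, by have := hu.2; simpa using this⟩
        refine ContinuousOn.inv₀ ?_ ?_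
        · exact continuous_conj.comp_continuousOn (hc.comp continuous_conj.continuousOn hm)
        · intro u hu
          rw [Ne, map_eq_zero]
          exact hn _ (hm hu).1 (hm hu).2
      exact this.congr (fun u hu => hlow u hu.1 hu.2)
    have hclosed1 : IsClosed {u : ℂ | 0 ≤ u.im} := isClosed_le continuous_const continuous_im
    have hclosed2 : IsClosed {u : ℂ | u.im ≤ 0} := isClosed_le continuous_im continuous_const
    intro x hx
    have hun : ball (0:ℂ) R = (ball 0 R ∩ {u | 0 ≤ u.im}) ∪ (ball 0 R ∩ {u | u.im ≤ 0}) := by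
      ext u; simp only [mem_union, mem_inter_iff, mem_ofPred_eq]
      constructor
      · intro h; rcases le_total 0 u.im with a | a
        · exact Or.inl ⟨h, a⟩
        · exact Or.inr ⟨h, a⟩
      · rintro (h | h) <;> exact h.1
    rw [hun]
    refine ContinuousWithinAt.union ?_ ?_
    · by_cases h : 0 ≤ x.im
      · exact hcu x ⟨hx, h⟩
      · refine continuousWithinAt_of_notMem_closure fun h2 => h ?_
        exact hclosed1.closure_subset_iff.2 inter_subset_right h2
    · by_cases h : x.im ≤ 0
      · exact hcl x ⟨hx, h⟩
      · refine continuousWithinAt_of_notMem_closure fun h2 => h ?_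
        exact hclosed2.closure_subset_iff.2 inter_subset_right h2
  · intro p hp hp0
    rcases lt_or_gt_of_ne hp0 with h | h
    · have hcp := hconj p hp
      have h' : 0 < ((starRingEnd ℂ) p).im := by simpa using h
      have hdd := (hd _ hcp h').conj_conj
      rw [Complex.conj_conj] at hdd
      have hne : ((starRingEnd ℂ) ∘ Φ0 ∘ (starRingEnd ℂ)) p ≠ 0 := by
        simp only [Function.comp, Ne, map_eq_zero]; exact hn _ hcp h'.le
      have := hdd.inv hne
      refine this.congr_of_eventuallyEq ?_
      filter_upwards [(isOpen_lt continuous_im continuous_const).mem_nhds h,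
        isOpen_ball.mem_nhds hp] with q hq hq2
      rw [hlow q hq2 (le_of_lt hq)]; rfl
    · refine (hd p hp h).congr_of_eventuallyEq ?_
      filter_upwards [(isOpen_lt continuous_const continuous_im).mem_nhds h,
        isOpen_ball.mem_nhds hp] with q hq hq2
      exact hup q hq2 (le_of_lt hq)
/-- continuous square roots are holomorphic -/
theorem cm_sqrt_diff {f g : ℂ → ℂ} {U : Set ℂ} (hU : IsOpen U) (hf : ContinuousOn f U)
    (hg : DifferentiableOn ℂ g U) (h : ∀ z ∈ U, f z ^ 2 = g z) (h0 : ∀ z ∈ U, g z ≠ 0) :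
    DifferentiableOn ℂ f U := by
  intro z hz
  obtain ⟨r, hr, hrb⟩ := Metric.isOpen_iff.1 hU z hz
  obtain ⟨k, hk, hk0, hkg⟩ := cm_root_ball (hg.mono hrb) (fun p hp => h0 p (hrb hp)) 2 (by norm_num)
  have hnb := isOpen_ball.mem_nhds (mem_ball_self (x := z) hr)
  have := (convex_ball z r).isPreconnected.eq_or_eq_neg_of_sq_eq (hf.mono hrb) hk.continuousOn
    (fun p hp => by simp only [Pi.pow_apply]; rw [h p (hrb hp), hkg p hp]) (fun {p} hp => hk0 p hp)
  have hkz := hk.differentiableAt hnb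
  apply DifferentiableAt.differentiableWithinAt
  rcases this with h' | h'
  · exact hkz.congr_of_eventuallyEq (by filter_upwards [hnb] with p hp using h' hp)
  · exact hkz.neg.congr_of_eventuallyEq (by filter_upwards [hnb] with p hp using h' hp)
theorem cm_sqrt_sc {g : ℂ → ℂ} {U : Set ℂ} (hU : IsOpen U) (hs : SimplyConnectedSpace U)
    (hg : DifferentiableOn ℂ g U) (h0 : ∀ z ∈ U, g z ≠ 0) :
    ∃ f : ℂ → ℂ, DifferentiableOn ℂ f U ∧ ∀ z, f z ^ 2 = g z := by
  obtain ⟨f, hf, hfg⟩ := Complex.exists_continuousOn_pow_eq (U := U) hs hU hg.continuousOn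
    (by rintro ⟨z, hz, h⟩; exact h0 z hz h) (n := 2) (by norm_num)
  exact ⟨f, cm_sqrt_diff hU hf hg (fun z _ => hfg z) h0, hfg⟩
/-- local quantitative injectivity -/
theorem cm_bilip {τ : ℂ → ℂ} {δ : ℝ} (hδ : 0 < δ) (hd : DifferentiableOn ℂ τ (ball 0 δ))
    (hi : InjOn τ (ball 0 δ)) :
    ∃ R c C : ℝ, 0 < R ∧ R ≤ δ ∧ 0 < c ∧ 0 < C ∧
      (∀ u ∈ ball (0:ℂ) R, ∀ v ∈ ball (0:ℂ) R, c * ‖u - v‖ ≤ ‖τ u - τ v‖) ∧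
      (∀ u ∈ ball (0:ℂ) R, ∀ v ∈ ball (0:ℂ) R, ‖τ u - τ v‖ ≤ C * ‖u - v‖) ∧
      (∀ u ∈ ball (0:ℂ) R, ‖τ u - τ 0 - deriv τ 0 * u‖ ≤ C * ‖u‖^2) ∧
      (∀ u s, 0 < s → closedBall u s ⊆ ball (0:ℂ) R →
        ball (τ u) (c * s / 2) ⊆ τ '' closedBall u s) := by
  have h0 : (0:ℂ) ∈ ball (0:ℂ) δ := mem_ball_self hδ
  have hnb := isOpen_ball.mem_nhds h0
  have han : AnalyticAt ℂ τ 0 := hd.analyticAt hnb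
  have hne := cm_inj_deriv_ne isOpen_ball hd hi h0
  have hs := han.hasStrictDerivAt
  set c := ‖deriv τ 0‖ / 2 with hc
  have hc0 : 0 < c := by have := norm_pos_iff.2 hne; positivity
  have hso := (hasStrictDerivAt_iff_hasStrictFDerivAt.1 hs).isLittleO.def hc0
  rw [nhds_prod_eq] at hso
  obtain ⟨t, ht, hts⟩ := Filter.eventually_prod_self_iff'.1 hso
  -- second order
  obtain ⟨C2, hC2⟩ : ∃ C2 : ℝ, ∀ᶠ u in 𝓝 (0:ℂ), ‖τ u - τ 0 - deriv τ 0 * u‖ ≤ C2 * ‖u‖^2 := by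
    have hp := han.hasFPowerSeriesAt
    have := hp.isBigO_sub_partialSum_pow 2
    obtain ⟨C2, hb⟩ := this.bound
    refine ⟨C2, ?_⟩
    filter_upwards [hb] with u hu
    simp [FormalMultilinearSeries.partialSum, Finset.sum_range_succ] at hu
    calc _ = ‖τ u - (τ 0 + u * deriv τ 0)‖ := by congr 1; ring
      _ ≤ _ := hu
  obtain ⟨R, hR, hRb⟩ := Metric.mem_nhds_iff.1 (inter_mem (inter_mem ht hnb) hC2)
  have hub : ∀ u ∈ ball (0:ℂ) R, ∀ v ∈ ball (0:ℂ) R,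
      ‖τ u - τ v - (u - v) * deriv τ 0‖ ≤ c * ‖u - v‖ := by
    intro u hu v hv
    have := hts u (hRb hu).1.1 v (hRb hv).1.1
    simpa using this
  have hmulnorm : ∀ u v : ℂ, ‖(u - v) * deriv τ 0‖ = 2 * c * ‖u - v‖ := by
    intro u v; rw [norm_mul, hc]; ring
  have hlow : ∀ u ∈ ball (0:ℂ) R, ∀ v ∈ ball (0:ℂ) R, c * ‖u - v‖ ≤ ‖τ u - τ v‖ := by
    intro u hu v hv
    have := norm_sub_norm_le ((u - v) * deriv τ 0) (τ u - τ v)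
    rw [norm_sub_rev ((u - v) * deriv τ 0), hmulnorm] at this
    have := hub u hu v hv
    linarith
  have hRδ : ball (0:ℂ) R ⊆ ball 0 δ := fun u hu => (hRb hu).1.2
  refine ⟨min R δ, c, max (3 * c) C2, by positivity, min_le_right _ _, hc0, by positivity, ?_, ?_, ?_, ?_⟩
  · exact fun u hu v hv => hlow u (ball_subset_ball (min_le_left _ _) hu) v
      (ball_subset_ball (min_le_left _ _) hv)
  · intro u hu v hv
    have := hub u (ball_subset_ball (min_le_left _ _) hu) v
      (ball_subset_ball (min_le_left _ _) hv)
    have h2 := norm_le_norm_add_norm_sub' (τ u - τ v) ((u - v) * deriv τ 0)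
    rw [hmulnorm] at h2
    calc ‖τ u - τ v‖ ≤ 3 * c * ‖u - v‖ := by linarith
      _ ≤ _ := by gcongr; exact le_max_left _ _
  · intro u hu
    calc _ ≤ C2 * ‖u‖^2 := (hRb (ball_subset_ball (min_le_left _ _) hu)).2
      _ ≤ _ := by gcongr; exact le_max_right _ _
  · intro u s hs0 hsub
    have hsub' := hsub.trans (ball_subset_ball (min_le_left R δ))
    have hu := hsub' (mem_closedBall_self hs0.le)
    have hD : DiffContOnCl ℂ τ (ball u s) :=
      (hd.mono (hsub'.trans hRδ)).diffContOnCl_ball subset_rfl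
    refine hD.ball_subset_image_closedBall hs0 ?_ ?_
    · intro v hv
      have hv' := hsub' (sphere_subset_closedBall hv)
      have := hlow v hv' u hu
      rwa [← dist_eq_norm v u, mem_sphere.1 hv] at this
    · have : ∀ᶠ v in 𝓝[≠] u, τ v ≠ τ u := by
        filter_upwards [eventually_mem_nhdsWithin,
          mem_nhdsWithin_of_mem_nhds (isOpen_ball.mem_nhds hu)] with v hv hv2 he
        exact hv (hi (hRδ hv2) (hRδ hu) he)
      exact this.frequently.filter_mono nhdsWithin_le_nhds
/-- the Cauchy-Riemann operator -/
noncomputable def cmDbar (F : ℂ → ℂ) (z : ℂ) : ℂ :=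
  (1/2) * (fderiv ℝ F z 1 + I * fderiv ℝ F z I)
theorem cm_pompeiu {F : ℂ → ℂ} (hF : ContDiff ℝ 1 F) (hs : HasCompactSupport F) (z : ℂ) :
    ∫ t, cmDbar F t / (t - z) = - Real.pi * F z := by
  have hF' : Continuous (fderiv ℝ F) := hF.continuous_fderiv one_ne_zero
  have hdF : Differentiable ℝ F := hF.differentiable one_ne_zero
  set ex : ℝ → ℂ := fun θ => exp (θ * I) with hex
  have hexc : Continuous ex := by fun_prop
  obtain ⟨R, hR0, hR⟩ : ∃ R : ℝ, 0 < R ∧ ∀ t, R ≤ ‖t - z‖ → F t = 0 ∧ fderiv ℝ F t = 0 := by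
    obtain ⟨R, hR⟩ := hs.isCompact.isBounded.subset_ball z
    refine ⟨max R 1, by positivity, fun t ht => ?_⟩
    have : t ∉ tsupport F := fun h => by
      have := hR h
      rw [mem_ball, dist_eq_norm] at this
      linarith [le_max_left R 1]
    exact ⟨image_eq_zero_of_notMem_tsupport this,
      by by_contra h; exact this (support_fderiv_subset ℝ (by simpa using h))⟩
  set P1 : ℝ × ℝ → ℂ := fun p => fderiv ℝ F (p.1 * ex p.2 + z) (ex p.2)
  set P2 : ℝ × ℝ → ℂ := fun p => fderiv ℝ F (p.1 * ex p.2 + z) (I * ex p.2)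
  have hP1 : Continuous P1 := by fun_prop
  have hP2 : Continuous P2 := by fun_prop
  have hcirc : ∀ θ : ℝ, ‖ex θ‖ = 1 := fun θ => norm_exp_ofReal_mul_I θ
  have hexne : ∀ θ : ℝ, ex θ ≠ 0 := fun θ => exp_ne_zero _
  have key : ∀ p ∈ polarCoord.target,
      p.1 • ((fun t => cmDbar F (t + z) / t) (Complex.polarCoord.symm p)) =
        (Iio R ×ˢ univ).indicator (fun p => (1/2) * (P1 p + I * P2 p)) p := by
    rintro ⟨r, θ⟩ hp
    have hr : 0 < r := hp.1
    have hsy : Complex.polarCoord.symm (r, θ) = r * ex θ := by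
      rw [Complex.polarCoord_symm_apply, hex]; simp only; rw [exp_mul_I]; simp
    rw [hsy]
    have hr' : (r:ℂ) ≠ 0 := by exact_mod_cast hr.ne'
    have main : r • (cmDbar F (r * ex θ + z) / (r * ex θ)) = (1/2) * (P1 (r,θ) + I * P2 (r,θ)) := by
      simp only [P1, P2, cmDbar]
      set L := fderiv ℝ F (r * ex θ + z)
      have e1 : ex θ = (Real.cos θ : ℝ) • (1:ℂ) + (Real.sin θ : ℝ) • I := by
        simp only [hex, exp_mul_I]; simp
      have e2 : I * ex θ = (-Real.sin θ : ℝ) • (1:ℂ) + (Real.cos θ : ℝ) • I := by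
        rw [e1]; simp; ring_nf; rw [I_sq]; ring
      have l1 : L (ex θ) = Real.cos θ * L 1 + Real.sin θ * L I := by
        rw [e1, map_add, map_smul, map_smul]; simp
      have l2 : L (I * ex θ) = -Real.sin θ * L 1 + Real.cos θ * L I := by
        rw [e2, map_add, map_smul, map_smul]; simp
      rw [l1, l2, real_smul]
      have h1 : ex θ * (Real.cos θ - Real.sin θ * I) = 1 := by
        rw [e1]; simp only [real_smul, mul_one]
        have : (Real.cos θ : ℂ)^2 + (Real.sin θ : ℂ)^2 = 1 := by
          exact_mod_cast Real.cos_sq_add_sin_sq θ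
        ring_nf; rw [I_sq]; linear_combination this
      field_simp [hexne θ]
      linear_combination (-(L 1 + I * L I)) * h1 - (ex θ * (Real.sin θ) * L I) * I_sq
    by_cases h : r < R
    · rw [indicator_of_mem (by simpa using h)]; exact main
    · rw [indicator_of_notMem (by simpa using h)]
      simp only [main]
      have := (hR (r * ex θ + z) (by simp [hcirc, abs_of_pos hr]; linarith)).2
      simp [P1, P2, this]
  have h0 : ∫ t, cmDbar F t / (t - z) = ∫ t, cmDbar F (t + z) / t := by
    rw [← integral_add_right_eq_self _ z]; simp
  rw [h0, ← Complex.integral_comp_polarCoord_symm,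
    setIntegral_congr_fun (by exact (measurableSet_Ioi.prod measurableSet_Ioo)) key,
    setIntegral_indicator (measurableSet_Iio.prod .univ)]
  have hset : polarCoord.target ∩ Iio R ×ˢ univ = Ioo 0 R ×ˢ Ioo (-Real.pi) Real.pi := by
    ext ⟨a, b⟩; simp [polarCoord_target]; tauto
  rw [hset]
  have hint : ∀ P : ℝ × ℝ → ℂ, Continuous P →
      IntegrableOn P (Ioo 0 R ×ˢ Ioo (-Real.pi) Real.pi) volume := fun P hP =>
    (hP.continuousOn.integrableOn_compact (isCompact_Icc.prod isCompact_Icc)).mono_set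
      (prod_mono Ioo_subset_Icc_self Ioo_subset_Icc_self)
  have hpi : -Real.pi ≤ Real.pi := by linarith [Real.pi_pos]
  rw [integral_const_mul, integral_add (hint _ hP1) (hint _ (by fun_prop)), integral_const_mul]
  have i2 : ∫ p in Ioo 0 R ×ˢ Ioo (-Real.pi) Real.pi, P2 p = 0 := by
    rw [Measure.volume_eq_prod, setIntegral_prod _ (hint _ hP2)]
    refine setIntegral_eq_zero_of_forall_eq_zero fun r hr => ?_
    rw [← integral_Ioc_eq_integral_Ioo, ← intervalIntegral.integral_of_le hpi]
    have hd : ∀ θ ∈ [[-Real.pi, Real.pi]],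
        HasDerivAt (fun θ : ℝ => (r:ℂ)⁻¹ * F (r * ex θ + z)) (P2 (r, θ)) θ := by
      intro θ _
      have h1 : HasDerivAt (fun θ : ℝ => (r:ℂ) * ex θ + z) (r * (I * ex θ)) θ := by
        have := ((hasDerivAt_id θ).ofReal_comp.mul_const I).cexp
        exact ((this.const_mul (r:ℂ)).add_const z).congr_deriv (by simp only [hex, id, ofReal_one]; ring)
      have h2 := ((hdF _).hasFDerivAt.comp_hasDerivAt θ h1).const_mul (r:ℂ)⁻¹
      refine h2.congr_deriv ?_
      have : (r:ℂ) * (I * ex θ) = r • (I * ex θ) := by simp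
      rw [this, map_smul, real_smul]
      have hr' : (r:ℂ) ≠ 0 := by exact_mod_cast hr.1.ne'
      exact inv_mul_cancel_left₀ hr' _
    rw [intervalIntegral.integral_eq_sub_of_hasDerivAt hd
      (Continuous.intervalIntegrable (by fun_prop) _ _)]
    have : ex (-Real.pi) = ex Real.pi := by simp [hex, exp_neg]
    rw [this, sub_self]
  have i1 : ∫ p in Ioo 0 R ×ˢ Ioo (-Real.pi) Real.pi, P1 p = -(2 * Real.pi) * F z := by
    rw [Measure.volume_eq_prod, ← setIntegral_prod_swap, setIntegral_prod _ (by
      have := hint _ hP1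
      rw [Measure.volume_eq_prod] at this
      exact this.swap)]
    have : ∀ θ ∈ Ioo (-Real.pi) Real.pi, (∫ r in Ioo 0 R, P1 ((θ, r) : ℝ×ℝ).swap) = - F z := by
      intro θ _
      rw [← integral_Ioc_eq_integral_Ioo, ← intervalIntegral.integral_of_le hR0.le]
      have hd : ∀ r ∈ [[0, R]],
          HasDerivAt (fun r : ℝ => F (r * ex θ + z)) (P1 (r, θ)) r := by
        intro r _
        have h1 : HasDerivAt (fun r : ℝ => (r:ℂ) * ex θ + z) (ex θ) r :=
          (((hasDerivAt_id r).ofReal_comp.mul_const (ex θ)).add_const z).congr_deriv (by simp)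
        exact (hdF _).hasFDerivAt.comp_hasDerivAt r h1
      simp only [Prod.swap_prod_mk]
      rw [intervalIntegral.integral_eq_sub_of_hasDerivAt hd
        (Continuous.intervalIntegrable (by fun_prop) _ _),
        (hR _ (by simp [hcirc, abs_of_pos hR0])).1]
      simp
    rw [setIntegral_congr_fun measurableSet_Ioo this]
    simp [Real.pi_pos.le]; ring_nf; simp
  rw [i1, i2]; ring
theorem cm_invert {a b : ℝ → ℂ} {p q p' q' : ℝ} (ha : ContinuousOn a (Icc p q))
    (hai : InjOn a (Icc p q)) (hb : ContinuousOn b (Icc p' q')) (hbi : InjOn b (Icc p' q'))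
    (hpq : p' ≤ q') (hsub : ∀ s ∈ Icc p' q', b s ∈ a '' Icc p q) :
    ∃ t : ℝ → ℝ, ContinuousOn t (Icc p' q') ∧ (∀ s ∈ Icc p' q', t s ∈ Icc p q ∧ a (t s) = b s) ∧
      (StrictMonoOn t (Icc p' q') ∨ StrictAntiOn t (Icc p' q')) := by
  choose! t ht using hsub
  have hc : ContinuousOn t (Icc p' q') := by
    have hemb : Topology.IsClosedEmbedding ((Icc p q).domRestrict a) :=
      ha.domRestrict.isClosedEmbedding (injOn_iff_injective.1 hai)
    have : Continuous (fun s : Icc p' q' => (⟨t s, (ht s s.2).1⟩ : Icc p q)) := by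
      rw [hemb.isInducing.continuous_iff]
      have : (Icc p q).domRestrict a ∘ (fun s : Icc p' q' => (⟨t s, (ht s s.2).1⟩ : Icc p q))
        = (Icc p' q').domRestrict b := by ext s; exact (ht s s.2).2
      rw [this]; exact hb.domRestrict
    exact continuousOn_iff_continuous_domRestrict.2 (continuous_subtype_val.comp this)
  refine ⟨t, hc, ht, hc.strictMonoOn_of_injOn_Icc' hpq ?_⟩
  intro s hs s' hs' h
  exact hbi hs hs' (by rw [← (ht s hs).2, ← (ht s' hs').2, h])
/-- a piecewise analytic closed curve -/
structure CmCurve (L E : Set ℂ) (l : ℝ) (γ : ℝ → ℂ) : Prop where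
  lpos : 0 < l
  cont : Continuous γ
  per : Function.Periodic γ l
  inj : ∀ s t, |s - t| < l → γ s = γ t → s = t
  mem : ∀ z, z ∈ L ↔ ∃ s, γ s = z
  fin : E.Finite
  speed : ∀ s t : ℝ, s ≤ t → t ≤ s + l → eVariationOn γ (Icc s t) = ENNReal.ofReal (t - s)
  arc : ∀ z ∈ L, ∃ (τ : ℂ → ℂ) (U : Set ℂ), IsOpen U ∧ (∀ t ∈ Icc (0:ℝ) 1, (t:ℂ) ∈ U) ∧
    DifferentiableOn ℂ τ U ∧ InjOn τ U ∧ (∀ t ∈ Icc (0:ℝ) 1, τ t ∈ L) ∧ τ 0 ∈ E ∧ τ 1 ∈ E ∧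
    ∃ t ∈ Icc (0:ℝ) 1, τ t = z
namespace CmCurve
variable {L E : Set ℂ} {l : ℝ} {γ : ℝ → ℂ}
theorem rev (h : CmCurve L E l γ) : CmCurve L E l (fun s => γ (-s)) where
  lpos := h.lpos
  cont := h.cont.comp continuous_neg
  per := fun s => by
    have := h.per (-s - l)
    simp only [neg_add_rev] ; rw [sub_add_cancel] at this; rw [this]; ring_nf
  inj := fun s t hs he => by
    have := h.inj (-s) (-t) (by rwa [show -s - -t = -(s - t) by ring, abs_neg]) he
    linarith
  mem := fun z => by
    rw [h.mem]; exact ⟨fun ⟨s, hs⟩ => ⟨-s, by simpa⟩, fun ⟨s, hs⟩ => ⟨-s, hs⟩⟩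
  fin := h.fin
  speed := fun s t hst htl => by
    have h1 := h.speed (-t) (-s) (by linarith) (by linarith)
    have h2 := eVariationOn.comp_eq_of_antitoneOn γ (fun s => -s) (t := Icc s t)
      (fun x _ y _ hxy => neg_le_neg hxy)
    rw [image_neg_eq_neg, neg_Icc, h1] at h2
    rw [show (fun s => γ (-s)) = γ ∘ (fun s => -s) from rfl, h2]; ring_nf
  arc := h.arc
theorem memL (h : CmCurve L E l γ) (s : ℝ) : γ s ∈ L := (h.mem _).2 ⟨s, rfl⟩
theorem injOn (h : CmCurve L E l γ) {a b : ℝ} (hab : b - a < l) : InjOn γ (Icc a b) :=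
  fun s hs t ht he => h.inj s t (by rw [abs_lt]; constructor <;> linarith [hs.1, hs.2, ht.1, ht.2]) he
theorem exParam (h : CmCurve L E l γ) {z : ℂ} (hz : z ∈ L) (s0 : ℝ) :
    ∃ s ∈ Ico s0 (s0 + l), γ s = z := by
  obtain ⟨s, hs⟩ := (h.mem z).1 hz
  obtain ⟨t, ht, h2⟩ := h.per.exists_mem_Ico h.lpos s s0
  exact ⟨t, ht, by rw [← h2, hs]⟩
/-- parameters of points of `L` near `γ s0` are near `s0` -/
theorem near (h : CmCurve L E l γ) (s0 : ℝ) {ε : ℝ} (hε : 0 < ε) :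
    ∃ ρ > 0, ∀ z ∈ L, dist z (γ s0) < ρ → ∃ s, |s - s0| < ε ∧ γ s = z := by
  have hcl : IsClosed (γ '' (Icc (s0 + ε) (s0 + l - ε))) :=
    (isCompact_Icc.image h.cont).isClosed
  rcases lt_or_ge l ε with hl | hl
  · refine ⟨1, one_pos, fun z hz _ => ?_⟩
    obtain ⟨s, hs, e⟩ := h.exParam hz s0
    exact ⟨s, by rw [abs_lt]; constructor <;> linarith [hs.1, hs.2], e⟩
  have hn : γ s0 ∈ (γ '' (Icc (s0 + ε) (s0 + l - ε)))ᶜ := by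
    rintro ⟨s, hs, e⟩
    have := h.inj s s0 (by rw [abs_lt]; constructor <;> linarith [hs.1, hs.2]) e
    linarith [hs.1]
  obtain ⟨ρ, hρ, hb⟩ := Metric.isOpen_iff.1 hcl.isOpen_compl _ hn
  refine ⟨ρ, hρ, fun z hz hd => ?_⟩
  obtain ⟨s, hs, e⟩ := h.exParam hz s0
  rcases lt_or_ge s (s0 + ε) with h1 | h1
  · exact ⟨s, by rw [abs_lt]; constructor <;> linarith [hs.1], e⟩
  · refine ⟨s - l, ?_, by rw [h.per.sub_eq, e]⟩
    have : ¬ s ≤ s0 + l - ε := fun h2 => hb hd ⟨s, ⟨h1, h2⟩, e⟩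
    rw [abs_lt]; constructor <;> linarith [hs.2]
/-- openness of arcs -/
theorem arcOpen (h : CmCurve L E l γ) {τ : ℂ → ℂ} {U : Set ℂ}
    (hU : ∀ t ∈ Icc (0:ℝ) 1, (t:ℂ) ∈ U) (hd : DifferentiableOn ℂ τ U)
    (hi : InjOn τ U) (hL : ∀ t ∈ Icc (0:ℝ) 1, τ t ∈ L) {t1 s1 : ℝ} (ht : t1 ∈ Ioo (0:ℝ) 1)
    (he : τ t1 = γ s1) :
    ∀ᶠ s in 𝓝 s1, ∃ t ∈ Icc (0:ℝ) 1, τ t = γ s := by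
  have hb : ContinuousOn (fun t : ℝ => τ t) (Icc (0:ℝ) 1) :=
    hd.continuousOn.comp continuous_ofReal.continuousOn hU
  obtain ⟨ρ, hρ, hn⟩ := h.near s1 (ε := l/4) (by linarith [h.lpos])
  have hca : ContinuousAt (fun t : ℝ => τ t) t1 := hb.continuousAt (Icc_mem_nhds ht.1 ht.2)
  have : ∀ᶠ t in 𝓝 t1, dist (τ (t:ℝ)) (γ s1) < ρ ∧ t ∈ Ioo (0:ℝ) 1 := by
    refine (Metric.tendsto_nhds.1 hca ρ hρ |>.mono fun t h => ?_).and (Ioo_mem_nhds ht.1 ht.2)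
    rwa [← he]
  obtain ⟨δ, hδ, hball⟩ := Metric.eventually_nhds_iff_ball.1 this
  have hIcc : ∀ t ∈ Icc (t1 - δ/2) (t1 + δ/2), dist (τ (t:ℝ)) (γ s1) < ρ ∧ t ∈ Ioo (0:ℝ) 1 := by
    intro t ht; apply hball; rw [Metric.mem_ball, Real.dist_eq, abs_lt]
    constructor <;> linarith [ht.1, ht.2]
  obtain ⟨g, hg, hg2, hmono⟩ := cm_invert (a := γ) (b := fun t : ℝ => τ t) (p := s1 - l/4)
    (q := s1 + l/4) (p' := t1 - δ/2) (q' := t1 + δ/2) h.cont.continuousOn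
    (h.injOn (by linarith [h.lpos])) (hb.mono fun t ht => Ioo_subset_Icc_self (hIcc t ht).2)
    (fun s hs t ht he => by
      have := hi (hU s (Ioo_subset_Icc_self (hIcc s hs).2)) (hU t (Ioo_subset_Icc_self (hIcc t ht).2)) he
      exact_mod_cast this) (by linarith) (fun s hs => by
      obtain ⟨x, hx, hx2⟩ := hn _ (hL s (Ioo_subset_Icc_self (hIcc s hs).2)) (hIcc s hs).1
      rw [abs_lt] at hx
      exact ⟨x, ⟨by linarith [hx.1], by linarith [hx.2]⟩, hx2⟩)
  have m1 : t1 ∈ Icc (t1 - δ/2) (t1 + δ/2) := ⟨by linarith, by linarith⟩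
  have m2 : t1 - δ/2 ∈ Icc (t1 - δ/2) (t1 + δ/2) := ⟨by linarith, by linarith⟩
  have m3 : t1 + δ/2 ∈ Icc (t1 - δ/2) (t1 + δ/2) := ⟨by linarith, by linarith⟩
  have hg1 : g t1 = s1 := by
    have := hg2 t1 m1
    exact h.inj _ _ (by rw [abs_lt]; constructor <;> linarith [this.1.1, this.1.2, h.lpos]) (by rw [this.2, he])
  have hiv := intermediate_value_uIcc (f := g) (a := t1 - δ/2) (b := t1 + δ/2)
    (by rwa [uIcc_of_le (by linarith)])
  have hnb : [[g (t1 - δ/2), g (t1 + δ/2)]] ∈ 𝓝 s1 := by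
    rcases hmono with hm | hm
    · have a1 := hm m2 m1 (by linarith)
      have a2 := hm m1 m3 (by linarith)
      rw [hg1] at a1 a2
      rw [uIcc_of_le (by linarith)]; exact Icc_mem_nhds a1 a2
    · have a1 := hm m2 m1 (by linarith)
      have a2 := hm m1 m3 (by linarith)
      rw [hg1] at a1 a2
      rw [uIcc_of_ge (by linarith)]; exact Icc_mem_nhds a2 a1
  filter_upwards [hnb] with s hs
  obtain ⟨t, ht', e⟩ := hiv hs
  rw [uIcc_of_le (by linarith)] at ht'
  exact ⟨t, Ioo_subset_Icc_self (hIcc t ht').2, by rw [← (hg2 t ht').2, e]⟩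
theorem finE (h : CmCurve L E l γ) (s0 : ℝ) : {s ∈ Ico s0 (s0 + l) | γ s ∈ E}.Finite := by
  refine Finite.of_finite_image (f := γ) (h.fin.subset ?_) ?_
  · rintro _ ⟨s, hs, rfl⟩; exact hs.2
  · intro s hs t ht he
    exact h.inj s t (by rw [abs_lt]; constructor <;> linarith [hs.1.1, hs.1.2, ht.1.1, ht.1.2]) he
theorem gap (h : CmCurve L E l γ) (s0 : ℝ) :
    ∃ ε > 0, ε < l ∧ ∀ s, 0 < |s - s0| → |s - s0| < ε → γ s ∉ E := by
  have hfin := ((h.finE s0).union (h.finE (s0 - l))).subset (sdiff_subset (t := {s0}))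
  have : ((({s ∈ Ico s0 (s0 + l) | γ s ∈ E} ∪ {s ∈ Ico (s0 - l) (s0 - l + l) | γ s ∈ E}) \ {s0}))ᶜ ∈ 𝓝 s0 :=
    hfin.isClosed.isOpen_compl.mem_nhds (by simp)
  obtain ⟨ε, hε, hb⟩ := Metric.mem_nhds_iff.1 this
  refine ⟨min ε (l/2), by have := h.lpos; positivity, by linarith [min_le_right ε (l/2), h.lpos], fun s h0 hs hE => ?_⟩
  have h1 : |s - s0| < ε := hs.trans_le (min_le_left _ _)
  have h2 : |s - s0| < l / 2 := hs.trans_le (min_le_right _ _)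
  refine hb (by rwa [Metric.mem_ball, Real.dist_eq]) ⟨?_, fun e => by rw [mem_singleton_iff.1 e] at h0; simp at h0⟩
  rw [abs_lt] at h2
  rcases le_total s0 s with h3 | h3
  · exact Or.inl ⟨⟨h3, by linarith⟩, hE⟩
  · refine Or.inr ⟨⟨by linarith, lt_of_le_of_ne (by linarith) fun e => ?_⟩, hE⟩
    rw [e] at h0; simp at h0
/-- on an interval free of corner parameters, one arc suffices -/
theorem oneArc (h : CmCurve L E l γ) {a b : ℝ} (hab : a < b) (hbl : b - a < l)
    (hE : ∀ s ∈ Ioo a b, γ s ∉ E) : ∃ (τ : ℂ → ℂ) (U : Set ℂ) (t : ℝ → ℝ), IsOpen U ∧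
    (∀ t ∈ Icc (0:ℝ) 1, (t:ℂ) ∈ U) ∧
    DifferentiableOn ℂ τ U ∧ InjOn τ U ∧ (∀ t ∈ Icc (0:ℝ) 1, τ t ∈ L) ∧ τ 0 ∈ E ∧ τ 1 ∈ E ∧
    ContinuousOn t (Icc a b) ∧ (∀ s ∈ Icc a b, t s ∈ Icc (0:ℝ) 1 ∧ τ (t s) = γ s) ∧
      (StrictMonoOn t (Icc a b) ∨ StrictAntiOn t (Icc a b)) := by
  obtain ⟨τ, U, hUo, hU, hd, hi, hL, h0, h1, t0, ht0, e0⟩ := h.arc _ (h.memL ((a+b)/2))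
  have hb : ContinuousOn (fun t : ℝ => τ t) (Icc (0:ℝ) 1) :=
    hd.continuousOn.comp continuous_ofReal.continuousOn hU
  set K := (fun t : ℝ => τ t) '' Icc (0:ℝ) 1 with hK
  have hKc : IsClosed K := (isCompact_Icc.image_of_continuousOn hb).isClosed
  have hopen : IsOpen (Ioo a b ∩ γ ⁻¹' K) := by
    rw [isOpen_iff_mem_nhds]
    rintro s1 ⟨hs1, t1, ht1, e1⟩
    have ht : t1 ∈ Ioo (0:ℝ) 1 := by
      refine ⟨lt_of_le_of_ne ht1.1 fun e => hE s1 hs1 ?_, lt_of_le_of_ne ht1.2 fun e => hE s1 hs1 ?_⟩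
      · rw [← e1, ← e]; simpa using h0
      · rw [← e1, e]; simpa using h1
    filter_upwards [isOpen_Ioo.mem_nhds hs1, h.arcOpen hU hd hi hL ht e1] with s hs ⟨t, h1, h2⟩
    exact ⟨hs, t, h1, h2⟩
  have hsub : Ioo a b ⊆ Ioo a b ∩ γ ⁻¹' K := by
    refine isPreconnected_Ioo.subset_left_of_subset_union hopen
      ((isOpen_Ioo (a := a) (b := b)).inter (hKc.isOpen_compl.preimage h.cont)) ?_ ?_ ?_
    · exact Set.disjoint_left.2 fun s hs hs2 => hs2.2 hs.2
    · intro s hs; by_cases hk : γ s ∈ K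
      · exact Or.inl ⟨hs, hk⟩
      · exact Or.inr ⟨hs, hk⟩
    · exact ⟨(a+b)/2, ⟨by linarith, by linarith⟩, ⟨by linarith, by linarith⟩, t0, ht0, e0⟩
  have hsub2 : Icc a b ⊆ γ ⁻¹' K := by
    rw [← closure_Ioo hab.ne]
    exact (hKc.preimage h.cont).closure_subset_iff.2 (hsub.trans inter_subset_right)
  obtain ⟨t, ht⟩ := cm_invert hb (fun s hs t ht he => by exact_mod_cast hi (hU s hs) (hU t ht) he)
    h.cont.continuousOn (h.injOn hbl) hab.le hsub2
  exact ⟨τ, U, t, hUo, hU, hd, hi, hL, h0, h1, ht⟩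
end CmCurve
namespace CmCurve
variable {L E : Set ℂ} {l : ℝ} {γ : ℝ → ℂ}
theorem lip (h : CmCurve L E l γ) (s t : ℝ) (hst : |t - s| ≤ l) : ‖γ t - γ s‖ ≤ |t - s| := by
  wlog hle : s ≤ t generalizing s t
  · rw [norm_sub_rev, abs_sub_comm]; exact this t s (by rwa [abs_sub_comm]) (le_of_not_ge hle)
  rw [abs_of_nonneg (by linarith)] at hst ⊢
  have h1 := eVariationOn.edist_le γ (s := Icc s t) (right_mem_Icc.2 hle) (left_mem_Icc.2 hle)
  rw [h.speed s t hle (by linarith), edist_dist, dist_eq_norm] at h1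
  exact (ENNReal.ofReal_le_ofReal_iff (by linarith)).1 h1
theorem var_le (h : CmCurve L E l γ) {τ : ℂ → ℂ} {u : ℝ → ℝ} {s t C : ℝ} (hC : 0 ≤ C) (hst : s ≤ t)
    (hl : t ≤ s + l) (hu : MonotoneOn u (Icc s t)) (hγ : ∀ x ∈ Icc s t, τ (u x) = γ x)
    (hτ : ∀ x ∈ Icc (u s) (u t), ∀ y ∈ Icc (u s) (u t), ‖τ x - τ y‖ ≤ C * |x - y|) :
    t - s ≤ C * (u t - u s) := by
  have h1 : eVariationOn γ (Icc s t) = eVariationOn ((fun x : ℝ => τ x) ∘ u) (Icc s t) :=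
    eVariationOn.eq_of_eqOn fun x hx => (hγ x hx).symm
  have h2 : LipschitzOnWith ⟨C, hC⟩ (fun x : ℝ => τ x) (Icc (u s) (u t)) :=
    LipschitzOnWith.of_dist_le_mul fun x hx y hy => by
      rw [dist_eq_norm, Real.dist_eq]; exact hτ x hx y hy
  have hm : MapsTo u (Icc s t) (Icc (u s) (u t)) := fun x hx =>
    ⟨hu (left_mem_Icc.2 hst) hx hx.1, hu hx (right_mem_Icc.2 hst) hx.2⟩
  have h3 := h2.comp_eVariationOn_le hm
  have h4 := (hu.eVariationOn_eq (left_mem_Icc.2 hst) (right_mem_Icc.2 hst)).le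
  rw [inter_self] at h4
  rw [← h1, h.speed s t hst hl] at h3
  have h5 : ENNReal.ofReal (t - s) ≤ ENNReal.ofReal (C * (u t - u s)) := by
    rw [ENNReal.ofReal_mul hC]
    refine h3.trans (mul_le_mul' ?_ h4)
    exact (ENNReal.ofReal_eq_coe_nnreal hC).ge
  have hut : u s ≤ u t := hu (left_mem_Icc.2 hst) (right_mem_Icc.2 hst) hst
  exact (ENNReal.ofReal_le_ofReal_iff (mul_nonneg hC (by linarith))).1 h5
theorem germ0 (h : CmCurve L E l γ) {a b : ℝ} (hab : a < b) (hbl : b - a < l)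
    (hE : ∀ s ∈ Ioo a b, γ s ∉ E) {s1 : ℝ} (hs1 : s1 ∈ Icc a b) :
    ∃ (τ : ℂ → ℂ) (u : ℝ → ℝ) (R : ℝ), 0 < R ∧ DifferentiableOn ℂ τ (ball 0 R) ∧
      InjOn τ (ball 0 R) ∧ ContinuousOn u (Icc a b) ∧ StrictMonoOn u (Icc a b) ∧ u s1 = 0 ∧
      (∀ s ∈ Icc a b, τ (u s) = γ s) ∧
      (∀ v ∈ ball (0:ℂ) R, ∀ s ∈ Icc a b, τ v = γ s → v = u s) := by
  obtain ⟨τ, U, t, hUo, hU, hd, hi, hL, h0, h1, htc, ht, hm⟩ := h.oneArc hab hbl hE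
  obtain ⟨σ, hσ, hmono⟩ : ∃ σ : ℝ, σ * σ = 1 ∧ StrictMonoOn (fun s => σ * (t s - t s1)) (Icc a b) := by
    rcases hm with hm | hm
    · exact ⟨1, by norm_num, fun x hx y hy hxy => by have := hm hx hy hxy; simp only; linarith⟩
    · exact ⟨-1, by norm_num, fun x hx y hy hxy => by have := hm hx hy hxy; simp only; linarith⟩
  have hσ' : (σ:ℂ) * σ = 1 := by exact_mod_cast hσ
  have hσ0 : (σ:ℂ) ≠ 0 := by rintro e; rw [e] at hσ'; simp at hσ'
  set A : ℂ → ℂ := fun v => t s1 + σ * v with hA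
  have hAc : Continuous A := by fun_prop
  have hAi : Function.Injective A := fun x y e => by
    simp only [hA] at e; exact mul_left_cancel₀ hσ0 (add_left_cancel e)
  have hA0 : A ⁻¹' U ∈ 𝓝 (0:ℂ) := (hUo.preimage hAc).mem_nhds (by
    simp only [mem_preimage, hA, mul_zero, add_zero]; exact hU _ (ht s1 hs1).1)
  obtain ⟨R, hR, hRb⟩ := Metric.mem_nhds_iff.1 hA0
  have hAu : ∀ s, A ((σ * (t s - t s1) : ℝ) : ℂ) = t s := fun s => by
    simp only [hA]; push_cast; linear_combination ((t s : ℂ) - t s1) * hσ'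
  refine ⟨fun v => τ (A v), fun s => σ * (t s - t s1), R, hR, ?_, ?_, ?_, hmono, by simp, ?_, ?_⟩
  · exact hd.comp (by fun_prop) hRb
  · exact fun x hx y hy e => hAi (hi (hRb hx) (hRb hy) e)
  · fun_prop
  · intro s hs; simp only; rw [hAu, (ht s hs).2]
  · intro v hv s hs e
    apply hAi
    rw [hAu]
    exact hi (hRb hv) (hU _ (ht s hs).1) (by rw [(ht s hs).2]; exact e)
/-- right germ -/
theorem germ (h : CmCurve L E l γ) (s0 : ℝ) :
    ∃ (τ : ℂ → ℂ) (R ε c : ℝ), 0 < R ∧ 0 < ε ∧ ε < l ∧ 0 < c ∧ DifferentiableOn ℂ τ (ball 0 R) ∧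
      InjOn τ (ball 0 R) ∧ τ 0 = γ s0 ∧ (∀ v : ℝ, 0 ≤ v → v < R → τ v ∈ L) ∧
      (∀ s, s0 ≤ s → s < s0 + ε → ∃ v : ℝ, 0 ≤ v ∧ v < R ∧ τ v = γ s) ∧
      (∀ s, s0 ≤ s → s < s0 + ε → c * (s - s0) ≤ ‖γ s - γ s0‖) := by
  obtain ⟨ε, hε, hεl, hE⟩ := h.gap s0
  obtain ⟨τ, u, R0, hR0, hd, hi, huc, hum, hu0, huγ, -⟩ := h.germ0 (a := s0) (b := s0 + ε)
    (by linarith) (by linarith) (fun s hs => hE s (by rw [abs_of_pos]; all_goals linarith [hs.1])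
      (by rw [abs_of_pos]; all_goals linarith [hs.1, hs.2])) (s1 := s0) ⟨le_rfl, by linarith⟩
  obtain ⟨R, c, C, hR, hRR, hc, hC, hlo, hup, -, -⟩ := cm_bilip hR0 hd hi
  have hm0 : s0 ∈ Icc s0 (s0 + ε) := ⟨le_rfl, by linarith⟩
  obtain ⟨ε', hε', hεε, hlt⟩ : ∃ ε', 0 < ε' ∧ ε' ≤ ε ∧ u (s0 + ε') < R := by
    have h1 := (huc s0 hm0).eventually_lt_const (show u s0 < R by rw [hu0]; exact hR)
    obtain ⟨δ, hδ, hb⟩ := Metric.mem_nhdsWithin_iff.1 h1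
    refine ⟨min (δ/2) ε, by positivity, min_le_right _ _, hb ⟨?_, ?_, ?_⟩⟩
    · rw [Metric.mem_ball, Real.dist_eq, add_sub_cancel_left, abs_of_pos (by positivity)]
      linarith [min_le_left (δ/2) ε]
    · have : 0 < min (δ/2) ε := by positivity
      linarith
    · linarith [min_le_right (δ/2) ε]
  have hm1 : s0 + ε' ∈ Icc s0 (s0 + ε) := ⟨by linarith, by linarith⟩
  have hIcc : ∀ s, s0 ≤ s → s < s0 + ε' → s ∈ Icc s0 (s0 + ε) := fun s h1 h2 => ⟨h1, by linarith⟩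
  have hpos : 0 < u (s0 + ε') := by rw [← hu0]; exact hum hm0 hm1 (by linarith)
  have hu2 : ∀ s, s0 ≤ s → s < s0 + ε' → 0 ≤ u s ∧ u s < u (s0 + ε') := fun s h1 h2 =>
    ⟨by rw [← hu0]; exact hum.monotoneOn hm0 (hIcc s h1 h2) h1, hum (hIcc s h1 h2) hm1 h2⟩
  have hball : ball (0:ℂ) (u (s0 + ε')) ⊆ ball 0 R0 := ball_subset_ball (by linarith)
  have hreal : ∀ x : ℝ, 0 ≤ x → x ≤ u (s0+ε') → (x:ℂ) ∈ ball (0:ℂ) R := fun x h0 h1 => by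
    simp [abs_of_nonneg h0]; linarith
  have hτ0 : τ 0 = γ s0 := by rw [← huγ s0 hm0, hu0]; simp
  refine ⟨τ, u (s0 + ε'), ε', c / C, hpos, hε', by linarith, by positivity, hd.mono hball,
    hi.mono hball, hτ0, ?_, ?_, ?_⟩
  · intro v h0 h1
    obtain ⟨s, hs, e⟩ := intermediate_value_Icc (a := s0) (b := s0 + ε') (by linarith)
      (huc.mono (Icc_subset_Icc_right (by linarith))) (show v ∈ Icc _ _ from ⟨by rw [hu0]; exact h0, h1.le⟩)
    rw [← e, huγ s ⟨hs.1, by linarith [hs.2]⟩]; exact h.memL _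
  · exact fun s h1 h2 => ⟨u s, (hu2 s h1 h2).1, (hu2 s h1 h2).2, huγ s (hIcc s h1 h2)⟩
  · intro s h1 h2
    have hs := hIcc s h1 h2
    have hle : u s ≤ u (s0 + ε') := (hu2 s h1 h2).2.le
    have a1 := h.var_le (τ := τ) (u := u) (s := s0) (t := s) hC.le h1 (by linarith)
      (hum.monotoneOn.mono (Icc_subset_Icc_right hs.2)) (fun x hx => huγ x ⟨hx.1, hx.2.trans hs.2⟩) (by
        rw [hu0]
        intro x hx y hy
        have := hup x (hreal x hx.1 (hx.2.trans hle)) y (hreal y hy.1 (hy.2.trans hle))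
        rwa [← ofReal_sub, norm_real] at this)
    have a2 := hlo _ (hreal (u s) (hu2 s h1 h2).1 hle) 0 (mem_ball_self hR)
    rw [hτ0, huγ s hs, sub_zero, norm_real, Real.norm_eq_abs, abs_of_nonneg (hu2 s h1 h2).1] at a2
    rw [hu0, sub_zero] at a1
    calc c / C * (s - s0) ≤ c / C * (C * u s) := by gcongr
      _ = c * u s := by field_simp
      _ ≤ _ := a2
/-- smooth points -/
theorem smooth (h : CmCurve L E l γ) {s1 : ℝ} (hs1 : γ s1 ∉ E) :
    ∃ (τ : ℂ → ℂ) (R : ℝ), 0 < R ∧ DifferentiableOn ℂ τ (ball 0 R) ∧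
      InjOn τ (ball 0 R) ∧ τ 0 = γ s1 ∧ (∀ v ∈ ball (0:ℂ) R, τ v ∈ L ↔ v.im = 0) ∧
      HasDerivAt γ (deriv τ 0 / ‖deriv τ 0‖) s1 := by
  obtain ⟨ε, hε, hεl, hE⟩ := h.gap s1
  obtain ⟨τ, u, R0, hR0, hd, hi, huc, hum, hu0, huγ, hun⟩ := h.germ0 (a := s1 - ε/2) (b := s1 + ε/2)
    (by linarith) (by linarith) (fun s hs => by
      by_cases e : s = s1
      · rwa [e]
      · exact hE s (abs_pos.2 (sub_ne_zero.2 e)) (by rw [abs_lt]; constructor <;> linarith [hs.1, hs.2]))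
    (s1 := s1) ⟨by linarith, by linarith⟩
  have hm1 : s1 ∈ Icc (s1 - ε/2) (s1 + ε/2) := ⟨by linarith, by linarith⟩
  have hnbI : Icc (s1 - ε/2) (s1 + ε/2) ∈ 𝓝 s1 := Icc_mem_nhds (by linarith) (by linarith)
  have hcu : ContinuousAt u s1 := huc.continuousAt hnbI
  have hτ0 : τ 0 = γ s1 := by rw [← huγ s1 hm1, hu0]; simp
  have hnb := isOpen_ball.mem_nhds (mem_ball_self (x := (0:ℂ)) hR0)
  have hca : ContinuousAt τ 0 := (hd.differentiableAt hnb).continuousAt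
  obtain ⟨ρ, hρ, hn⟩ := h.near s1 (ε := ε/2) (by linarith)
  have hpa := hum (show s1 - ε/2 ∈ Icc _ _ from ⟨le_rfl, by linarith⟩) hm1 (by linarith)
  have hpb := hum hm1 (show s1 + ε/2 ∈ Icc _ _ from ⟨by linarith, le_rfl⟩) (by linarith)
  rw [hu0] at hpa hpb
  obtain ⟨R1, hR1, hb1⟩ := Metric.mem_nhds_iff.1 (hca (Metric.ball_mem_nhds _ hρ))
  set R := min (min R0 R1) (min (-u (s1 - ε/2)) (u (s1 + ε/2))) with hRdef
  have hRpos : 0 < R := by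
    refine lt_min (lt_min hR0 hR1) (lt_min ?_ ?_) <;> linarith
  have hRR0 : R ≤ R0 := (min_le_left _ _).trans (min_le_left _ _)
  have hsub : ball (0:ℂ) R ⊆ ball 0 R0 := ball_subset_ball hRR0
  refine ⟨τ, R, hRpos, hd.mono hsub, hi.mono hsub, hτ0, ?_, ?_⟩
  · intro v hv
    constructor
    · intro hvL
      have : dist (τ v) (γ s1) < ρ := by
        rw [← hτ0]; exact hb1 (ball_subset_ball ((min_le_left _ _).trans (min_le_right _ _)) hv)
      obtain ⟨s, hs, e⟩ := hn _ hvL this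
      rw [abs_lt] at hs
      rw [hun v (hsub hv) s ⟨by linarith, by linarith⟩ e.symm, ofReal_im]
    · intro hv0
      have hvr : v = (v.re : ℂ) := by apply Complex.ext <;> simp [hv0]
      have hvn : |v.re| < R := by
        have := hv; rw [hvr] at this; simpa using this
      rw [abs_lt] at hvn
      have r1 : R ≤ -u (s1 - ε/2) := (min_le_right _ _).trans (min_le_left _ _)
      have r2 : R ≤ u (s1 + ε/2) := (min_le_right _ _).trans (min_le_right _ _)
      obtain ⟨s, hs, e⟩ := intermediate_value_Icc (by linarith) huc
        (show v.re ∈ Icc _ _ from ⟨by linarith, by linarith⟩)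
      rw [hvr, ← e, huγ s hs]; exact h.memL _
  · set d := deriv τ 0
    have hne : d ≠ 0 := cm_inj_deriv_ne isOpen_ball hd hi (mem_ball_self hR0)
    have hD : 0 < ‖d‖ := norm_pos_iff.2 hne
    have hs := (hd.analyticAt hnb).hasStrictDerivAt
    have hder : HasDerivAt u (1 / ‖d‖) s1 := by
      rw [hasDerivAt_iff_isLittleO, Asymptotics.isLittleO_iff]
      intro c hc
      set η := min (‖d‖/2) (c * ‖d‖^2 / 2) with hη
      have hη0 : 0 < η := by positivity
      have hso := (hasStrictDerivAt_iff_hasStrictFDerivAt.1 hs).isLittleO.def hη0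
      rw [nhds_prod_eq] at hso
      obtain ⟨t, ht, hts⟩ := Filter.eventually_prod_self_iff'.1 hso
      obtain ⟨δ, hδ, hbt⟩ := Metric.mem_nhds_iff.1 ht
      have hts' : ∀ x y : ℝ, |x| < δ → |y| < δ → ‖τ x - τ y - (x - y) * d‖ ≤ η * |x - y| := by
        intro x y hx hy
        have := hts x (hbt (by simpa using hx)) y (hbt (by simpa using hy))
        simp only [ContinuousLinearMap.toSpanSingleton_apply, smul_eq_mul] at this
        rwa [← ofReal_sub, norm_real, Real.norm_eq_abs, ofReal_sub] at this
      have hu1 : ∀ᶠ s in 𝓝 s1, |u s| < δ := by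
        exact hcu.abs.eventually_lt_const (by simpa [hu0] using hδ)
      filter_upwards [hu1, hnbI] with s hsδ hsI
      have hds : ‖((u s : ℂ)) * d‖ = |u s| * ‖d‖ := by simp
      have hsl : |s - s1| ≤ l := by rw [abs_le]; constructor <;> linarith [hsI.1, hsI.2]
      have a1 : |u s| * (‖d‖ - η) ≤ |s - s1| := by
        have b1 := hts' (u s) 0 hsδ (by simpa using hδ)
        rw [huγ s hsI] at b1
        simp only [ofReal_zero, sub_zero, hτ0] at b1
        have b2 := h.lip s1 s hsl
        have b3 := norm_sub_norm_le ((u s : ℂ) * d) (γ s - γ s1)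
        rw [norm_sub_rev ((u s : ℂ) * d), hds] at b3
        linarith
      have a2 : |s - s1| ≤ (‖d‖ + η) * |u s| := by
        have hlipτ : ∀ x y : ℝ, |x| < δ → |y| < δ → ‖τ x - τ y‖ ≤ (‖d‖ + η) * |x - y| := by
          intro x y hx hy
          have b1 := hts' x y hx hy
          have b2 := norm_le_norm_add_norm_sub' (τ x - τ y) ((x - y) * d)
          rw [norm_mul, ← ofReal_sub, norm_real, Real.norm_eq_abs, ofReal_sub] at b2
          linarith
        rw [abs_lt] at hsδ
        rcases le_total s1 s with hss | hss
        · have hus : 0 ≤ u s := by rw [← hu0]; exact hum.monotoneOn hm1 hsI hss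
          have := h.var_le (τ := τ) (u := u) (s := s1) (t := s) (C := ‖d‖ + η) (by positivity) hss
            (by linarith [hsI.2]) (hum.monotoneOn.mono (Icc_subset_Icc hm1.1 hsI.2))
            (fun x hx => huγ x ⟨hm1.1.trans hx.1, hx.2.trans hsI.2⟩) (by
              rw [hu0]; intro x hx y hy
              exact hlipτ x y (by rw [abs_lt]; constructor <;> linarith [hx.1, hx.2])
                (by rw [abs_lt]; constructor <;> linarith [hy.1, hy.2]))
          rw [abs_of_nonneg (by linarith), abs_of_nonneg hus]; rwa [hu0, sub_zero] at this
        · have hus : u s ≤ 0 := by rw [← hu0]; exact hum.monotoneOn hsI hm1 hss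
          have := h.var_le (τ := τ) (u := u) (s := s) (t := s1) (C := ‖d‖ + η) (by positivity) hss
            (by linarith [hsI.1]) (hum.monotoneOn.mono (Icc_subset_Icc hsI.1 hm1.2))
            (fun x hx => huγ x ⟨hsI.1.trans hx.1, hx.2.trans hm1.2⟩) (by
              rw [hu0]; intro x hx y hy
              exact hlipτ x y (by rw [abs_lt]; constructor <;> linarith [hx.1, hx.2])
                (by rw [abs_lt]; constructor <;> linarith [hy.1, hy.2]))
          rw [abs_of_nonpos (by linarith), abs_of_nonpos hus]
          rw [hu0, zero_sub] at this; linarith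
      have hη1 : η ≤ ‖d‖/2 := min_le_left _ _
      have hη2 : η ≤ c * ‖d‖^2 / 2 := min_le_right _ _
      have a3 : |u s| * ‖d‖ ≤ 2 * |s - s1| := by nlinarith [abs_nonneg (u s)]
      rw [hu0, sub_zero, smul_eq_mul, Real.norm_eq_abs, Real.norm_eq_abs]
      have a4 : |‖d‖ * u s - (s - s1)| ≤ η * |u s| := by
        rcases le_total s1 s with hss | hss
        · have hus : 0 ≤ u s := by rw [← hu0]; exact hum.monotoneOn hm1 hsI hss
          rw [abs_of_nonneg (by linarith : 0 ≤ s - s1), abs_of_nonneg hus] at *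
          rw [abs_le]; constructor <;> linarith
        · have hus : u s ≤ 0 := by rw [← hu0]; exact hum.monotoneOn hsI hm1 hss
          rw [abs_of_nonpos (by linarith : s - s1 ≤ 0), abs_of_nonpos hus] at *
          rw [abs_le]; constructor <;> linarith
      have a5 : |u s - (s - s1) * (1/‖d‖)| * ‖d‖ = |‖d‖ * u s - (s - s1)| := by
        rw [← abs_of_pos hD, ← abs_mul, abs_of_pos hD]; congr 1; field_simp
      have a6 : |u s - (s - s1) * (1/‖d‖)| * ‖d‖ * ‖d‖ ≤ c * |s - s1| * ‖d‖ * ‖d‖ := by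
        rw [a5]
        calc |‖d‖ * u s - (s - s1)| * ‖d‖ ≤ η * (|u s| * ‖d‖) := by nlinarith
          _ ≤ (c * ‖d‖^2/2) * (2 * |s - s1|) := by gcongr
          _ = _ := by ring
      exact le_of_mul_le_mul_right (le_of_mul_le_mul_right a6 hD) hD
    have h1 : HasDerivAt (fun s => τ (u s)) (d * ((1 / ‖d‖ : ℝ) : ℂ)) s1 := by
      have hh : HasDerivAt τ d ((u s1 : ℝ) : ℂ) := by rw [hu0]; exact_mod_cast hs.hasDerivAt
      exact hh.comp s1 hder.ofReal_comp
    refine (h1.congr_of_eventuallyEq ?_).congr_deriv (by push_cast; field_simp)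
    filter_upwards [hnbI] with s hs using (huγ s hs).symm
end CmCurve
theorem cm_norm_bd {G : Set ℂ} {φ : ℂ → ℂ} {ζ : ℂ} (hG : IsOpen G) (hφ : ConformalOnto G φ ζ)
    (hc : ContinuousOn φ (closure G)) : ∀ z ∈ frontier G, ‖φ z‖ = 1 := by
  intro z hz
  have hzc := frontier_subset_closure hz
  have hzG : z ∉ G := by rw [hG.frontier_eq] at hz; exact hz.2
  have hle : ‖φ z‖ ≤ 1 := by
    have := (hc z hzc).mono subset_closure
    have h2 := this.mem_closure hzc (t := ball 0 1) hφ.bijOn.mapsTo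
    have := closure_ball_subset_closedBall h2
    simpa using this
  by_contra hne
  have hlt : ‖φ z‖ < 1 := lt_of_le_of_ne hle hne
  obtain ⟨z', hz', e⟩ := hφ.bijOn.surjOn (show φ z ∈ ball (0:ℂ) 1 by simpa using hlt)
  have hdz : z ≠ z' := fun h => hzG (h ▸ hz')
  have hd : DifferentiableOn ℂ φ G := fun p hp => (hφ.differentiable p hp).differentiableWithinAt
  have hder := cm_inj_deriv_ne hG hd hφ.bijOn.injOn hz'
  have hmap := (hd.analyticAt (hG.mem_nhds hz')).hasStrictDerivAt.map_nhds_eq hder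
  obtain ⟨u, v, hu, hv, hzu, hzv, huv⟩ := t2_separation hdz
  have hv' : φ '' (v ∩ G) ∈ 𝓝 (φ z') := by
    rw [← hmap]; exact image_mem_map (inter_mem (hv.mem_nhds hzv) (hG.mem_nhds hz'))
  rw [e] at hv'
  have h1 : ∀ᶠ p in 𝓝[G] z, φ p ∈ φ '' (v ∩ G) := ((hc z hzc).mono subset_closure) hv'
  have h2 : ∀ᶠ p in 𝓝[G] z, p ∈ u ∧ p ∈ G :=
    Filter.inter_mem (mem_nhdsWithin_of_mem_nhds (hu.mem_nhds hzu)) self_mem_nhdsWithin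
  have : (𝓝[G] z).NeBot := mem_closure_iff_nhdsWithin_neBot.1 hzc
  obtain ⟨p, ⟨q, hq, hqe⟩, hpu, hpG⟩ := (h1.and h2).exists
  have := hφ.bijOn.injOn hq.2 hpG hqe
  exact Set.disjoint_left.1 huv hpu (this ▸ hq.1)
theorem cm_conn_side {G S : Set ℂ} (hG : IsOpen G) (hS : IsPreconnected S)
    (h : ∀ z ∈ S, z ∉ frontier G) : S ⊆ G ∨ S ⊆ (closure G)ᶜ := by
  refine isPreconnected_iff_subset_of_disjoint.1 hS G _ hG isClosed_closure.isOpen_compl ?_ ?_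
  · intro z hz
    by_cases hc : z ∈ closure G
    · left; by_contra hn; exact h z hz (by rw [hG.frontier_eq]; exact ⟨hc, hn⟩)
    · exact Or.inr hc
  · rw [Set.eq_empty_iff_forall_notMem]; exact fun z hz => hz.2.2 (subset_closure hz.2.1)
/-- existence of a conformal map, continuous up to the boundary -/
def CmConf (G : Set ℂ) : Prop := ∃ φ ζ, ConformalOnto G φ ζ ∧ ContinuousOn φ (closure G)
theorem cm_sides {G V : Set ℂ} {τ : ℂ → ℂ} (hG : IsOpen G) (hconf : CmConf G) (hV : IsOpen V)
    (hVc : Convex ℝ V) (hd : DifferentiableOn ℂ τ V) (hi : InjOn τ V)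
    (hL : ∀ v ∈ V, τ v ∈ frontier G ↔ v.im = 0) {v0 : ℂ} (hv0 : v0 ∈ V) (him : v0.im = 0) :
    ((∀ v ∈ V, 0 < v.im → τ v ∈ G) ∧ (∀ v ∈ V, v.im < 0 → τ v ∈ (closure G)ᶜ)) ∨
    ((∀ v ∈ V, 0 < v.im → τ v ∈ (closure G)ᶜ) ∧ (∀ v ∈ V, v.im < 0 → τ v ∈ G)) := by
  have hcc : Convex ℝ (V ∩ {v | 0 < v.im}) := hVc.inter (convex_halfSpace_im_gt 0)
  have hcc' : Convex ℝ (V ∩ {v | v.im < 0}) := hVc.inter (convex_halfSpace_im_lt 0)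
  have s1 := cm_conn_side hG (hcc.isPreconnected.image τ (hd.continuousOn.mono inter_subset_left)) (by
    rintro _ ⟨v, hv, rfl⟩ h; exact (ne_of_gt hv.2) ((hL v hv.1).1 h))
  have s2 := cm_conn_side hG (hcc'.isPreconnected.image τ (hd.continuousOn.mono inter_subset_left)) (by
    rintro _ ⟨v, hv, rfl⟩ h; exact (ne_of_lt hv.2) ((hL v hv.1).1 h))
  have hanti : ∀ z ∈ G, z ∉ frontier G := fun z hz h => by rw [hG.frontier_eq] at h; exact h.2 hz
  rw [image_subset_iff, image_subset_iff] at s1 s2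
  rcases s1 with s1 | s1 <;> rcases s2 with s2 | s2
  · exfalso
    obtain ⟨φ, ζ, hφ, hc⟩ := hconf
    have hcl : ∀ v ∈ V, τ v ∈ closure G := by
      intro v hv
      rcases lt_trichotomy v.im 0 with h | h | h
      · exact subset_closure (s2 ⟨hv, h⟩)
      · exact frontier_subset_closure ((hL v hv).2 h)
      · exact subset_closure (s1 ⟨hv, h⟩)
    have hdiff : DifferentiableOn ℂ (φ ∘ τ) V := by
      refine cm_painleve hV (hc.comp hd.continuousOn hcl) fun p hp h => ?_
      have : τ p ∈ G := by
        rcases lt_or_gt_of_ne h with h | h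
        · exact s2 ⟨hp, h⟩
        · exact s1 ⟨hp, h⟩
      exact (hφ.differentiable _ this).comp p (hd.differentiableAt (hV.mem_nhds hp))
    have hle : ∀ z ∈ closure G, ‖φ z‖ ≤ 1 := by
      intro z hz
      by_cases h : z ∈ G
      · have := hφ.bijOn.mapsTo h; simp at this; exact this.le
      · exact (cm_norm_bd hG hφ hc z (by rw [hG.frontier_eq]; exact ⟨hz, h⟩)).le
    have h1 : ‖(φ ∘ τ) v0‖ = 1 := cm_norm_bd hG hφ hc _ ((hL v0 hv0).2 him)
    have := Complex.norm_eventually_eq_of_isLocalMax (f := φ ∘ τ) (c := v0)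
      (by filter_upwards [hV.mem_nhds hv0] with v hv using hdiff.differentiableAt (hV.mem_nhds hv))
      (by filter_upwards [hV.mem_nhds hv0] with v hv; simp only [Function.comp] at h1 ⊢; rw [h1]
          exact hle _ (hcl v hv))
    obtain ⟨δ, hδ, hb⟩ := Metric.mem_nhds_iff.1 (this.and (hV.mem_nhds hv0))
    have hm : v0 + (δ/2 : ℝ) * I ∈ ball v0 δ := by
      simp [abs_of_pos hδ]; linarith
    have hb' := hb hm
    have hin : τ (v0 + (δ/2 : ℝ) * I) ∈ G := s1 ⟨hb'.2, by simp [him]; linarith⟩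
    have h3 := hφ.bijOn.mapsTo hin
    have h4 := hb'.1
    rw [h1] at h4
    rw [mem_ball_zero_iff] at h3
    simp only [Function.comp] at h4
    linarith
  · exact Or.inl ⟨fun v hv h => s1 ⟨hv, h⟩, fun v hv h => s2 ⟨hv, h⟩⟩
  · exact Or.inr ⟨fun v hv h => s1 ⟨hv, h⟩, fun v hv h => s2 ⟨hv, h⟩⟩
  · exfalso
    have hder := cm_inj_deriv_ne hV hd hi hv0
    have hmap := (hd.analyticAt (hV.mem_nhds hv0)).hasStrictDerivAt.map_nhds_eq hder
    have hnb : τ '' V ∈ 𝓝 (τ v0) := by rw [← hmap]; exact image_mem_map (hV.mem_nhds hv0)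
    obtain ⟨_, ⟨v, hv, rfl⟩, hvG⟩ := mem_closure_iff_nhds.1
      (frontier_subset_closure ((hL v0 hv0).2 him)) _ hnb
    rcases lt_trichotomy v.im 0 with h | h | h
    · exact s2 ⟨hv, h⟩ (subset_closure hvG)
    · exact hanti _ hvG ((hL v hv).2 h)
    · exact s1 ⟨hv, h⟩ (subset_closure hvG)
theorem cm_cone_conn {k δ : ℝ} (hk : k ∈ Ico (-1:ℝ) 1) :
    IsPreconnected {x : ℂ | 0 < ‖x‖ ∧ ‖x‖ < δ ∧ k * ‖x‖ < x.re} := by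
  have h1 : IsPreconnected (Ioo 0 δ ×ˢ Ioo (-Real.arccos k) (Real.arccos k)) :=
    isPreconnected_Ioo.prod isPreconnected_Ioo
  have h2 := h1.image (fun p : ℝ × ℝ => (p.1 : ℂ) * exp (p.2 * I)) (by fun_prop)
  convert h2 using 1
  ext x
  simp only [mem_ofPred_eq, mem_image, mem_prod, mem_Ioo, Prod.exists]
  constructor
  · rintro ⟨h0, hδ, hr⟩
    refine ⟨‖x‖, arg x, ⟨⟨h0, hδ⟩, abs_lt.1 ?_⟩, norm_mul_exp_arg_mul_I x⟩
    have hc : k < Real.cos (arg x) := by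
      rw [cos_arg (norm_pos_iff.1 h0), lt_div_iff₀ h0]; exact hr
    rw [← Real.cos_abs, ← Real.cos_arccos hk.1 hk.2.le] at hc
    by_contra hcon
    exact absurd (Real.cos_le_cos_of_nonneg_of_le_pi (Real.arccos_nonneg k) (abs_arg_le_pi x)
      (not_lt.1 hcon)) (not_le.2 hc)
  · rintro ⟨r, θ, ⟨⟨h0, hδ⟩, hθ⟩, rfl⟩
    have hn : ‖(r:ℂ) * exp (θ * I)‖ = r := by rw [norm_mul, norm_exp_ofReal_mul_I]; simp [h0.le]
    rw [hn]
    refine ⟨h0, hδ, ?_⟩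
    rw [re_ofReal_mul, exp_ofReal_mul_I_re, mul_comm]
    gcongr
    rw [← Real.cos_abs, ← Real.cos_arccos hk.1 hk.2.le]
    exact Real.cos_lt_cos_of_nonneg_of_le_pi (abs_nonneg _) (Real.arccos_le_pi k) (abs_lt.2 hθ)
theorem cm_angle {G : Set ℂ} (hG : IsOpen G) {z0 e : ℂ} (he : ‖e‖ = 1) {a θ1 : ℝ}
    (hθ : θ1 ∈ Icc 0 Real.pi)
    (ha : HasCornerAngle G z0 a)
    (H : ∀ η > 0, ∃ δ > 0, ∀ r θ : ℝ, 0 < r → r < δ → |θ| ≤ Real.pi →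
      (|θ| < θ1 - η → z0 + e * (r * exp (θ * I)) ∉ G) ∧
      (θ1 + η < |θ| → z0 + e * (r * exp (θ * I)) ∈ G)) : a = 2 * Real.pi - 2 * θ1 := by
  refine tendsto_nhds_unique ha ?_
  have hpi := Real.pi_pos
  have key : ∀ r : ℝ, (volume {θ : ℝ | θ ∈ Ico 0 (2 * Real.pi) ∧
        z0 + (r : ℂ) * Complex.exp ((θ : ℂ) * Complex.I) ∈ G}).toReal =
      (volume {θ : ℝ | θ ∈ Ioc (-Real.pi) Real.pi ∧ z0 + e * (r * exp (θ * I)) ∈ G}).toReal := by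
    intro r
    set f : ℝ → ℝ := indicator {θ : ℝ | z0 + (r : ℂ) * Complex.exp ((θ : ℂ) * Complex.I) ∈ G} 1 with hf
    have hper : Function.Periodic f (2 * Real.pi) := by
      intro θ
      simp only [hf, indicator, mem_ofPred_eq]
      have : exp (((θ + 2 * Real.pi : ℝ) : ℂ) * I) = exp (θ * I) := by
        push_cast; rw [add_mul, exp_periodic]
      split_ifs <;> simp_all
    have hmeas : ∀ g : ℝ → ℂ, Continuous g → MeasurableSet {θ | g θ ∈ G} := fun g hg =>
      (hG.preimage hg).measurableSet
    have h1 : (volume {θ : ℝ | θ ∈ Ico 0 (2 * Real.pi) ∧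
        z0 + (r : ℂ) * Complex.exp ((θ : ℂ) * Complex.I) ∈ G}).toReal = ∫ θ in (0:ℝ)..(2*Real.pi), f θ := by
      rw [intervalIntegral.integral_of_le (by positivity), ← integral_Ico_eq_integral_Ioc,
        hf, setIntegral_indicator (hmeas _ (by fun_prop))]
      simp [Measure.real]; rfl
    have h2 : (volume {θ : ℝ | θ ∈ Ioc (-Real.pi) Real.pi ∧ z0 + e * (r * exp (θ * I)) ∈ G}).toReal
        = ∫ θ in (-Real.pi)..Real.pi, f (θ + arg e) := by
      have : ∀ θ : ℝ, f (θ + arg e) = indicator {θ : ℝ | z0 + e * (r * exp (θ * I)) ∈ G} 1 θ := by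
        intro θ
        simp only [hf, indicator, mem_ofPred_eq]
        have : (r:ℂ) * exp (((θ + arg e : ℝ) : ℂ) * I) = e * (r * exp (θ * I)) := by
          have h := norm_mul_exp_arg_mul_I e
          rw [he] at h; simp at h
          push_cast; rw [add_mul, Complex.exp_add, h]; ring
        split_ifs <;> simp_all
      simp only [this]
      rw [intervalIntegral.integral_of_le (by linarith), setIntegral_indicator (hmeas _ (by fun_prop))]
      simp [Measure.real]; rfl
    rw [h1, h2, intervalIntegral.integral_comp_add_right]
    have := hper.intervalIntegral_add_eq (-Real.pi + arg e) 0
    rw [show -Real.pi + arg e + 2 * Real.pi = Real.pi + arg e by ring, zero_add] at this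
    exact this.symm
  simp only [key]
  rw [Metric.tendsto_nhds]
  intro ε hε
  obtain ⟨δ, hδ, hH⟩ := H (ε/4) (by positivity)
  filter_upwards [Ioo_mem_nhdsGT hδ] with r hr
  set T := {θ : ℝ | θ ∈ Ioc (-Real.pi) Real.pi ∧ z0 + e * (r * exp (θ * I)) ∈ G}
  have hTfin : volume T ≠ ⊤ := ne_top_of_le_ne_top (by simp)
    (measure_mono (show T ⊆ Ioc (-Real.pi) Real.pi from fun θ h => h.1))
  have hab : ∀ θ ∈ Ioc (-Real.pi) Real.pi, |θ| ≤ Real.pi := fun θ h => abs_le.2 ⟨h.1.le, h.2⟩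
  have up : volume T ≤ ENNReal.ofReal (2 * (Real.pi - θ1 + ε/4)) := by
    have : T ⊆ Icc (θ1 - ε/4) Real.pi ∪ Icc (-Real.pi) (-(θ1 - ε/4)) := by
      intro θ hT
      have h1 := (hH r θ hr.1 hr.2 (hab θ hT.1)).1
      have h2 : θ1 - ε/4 ≤ |θ| := not_lt.1 fun h => h1 h hT.2
      rcases le_abs.1 h2 with h | h
      · exact Or.inl ⟨h, hT.1.2⟩
      · exact Or.inr ⟨hT.1.1.le, by linarith⟩
    refine (measure_mono this).trans ((measure_union_le _ _).trans ?_)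
    rw [Real.volume_Icc, Real.volume_Icc, ← ENNReal.ofReal_add (by linarith [hθ.2]) (by linarith [hθ.2])]
    apply ENNReal.ofReal_le_ofReal; linarith
  have lo : 2 * (Real.pi - θ1 - ε/4) ≤ (volume T).toReal := by
    rcases le_total (Real.pi - θ1 - ε/4) 0 with h0 | h0
    · exact le_trans (by linarith) ENNReal.toReal_nonneg
    have : Ioo (θ1 + ε/4) Real.pi ∪ Ioo (-Real.pi) (-(θ1 + ε/4)) ⊆ T := by
      rintro θ (h | h)
      · have hm : θ ∈ Ioc (-Real.pi) Real.pi := ⟨by linarith [h.1, hθ.1], h.2.le⟩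
        exact ⟨hm, (hH r θ hr.1 hr.2 (hab θ hm)).2 (lt_abs.2 (Or.inl h.1))⟩
      · have hm : θ ∈ Ioc (-Real.pi) Real.pi := ⟨h.1, by linarith [h.2, hθ.1]⟩
        exact ⟨hm, (hH r θ hr.1 hr.2 (hab θ hm)).2 (lt_abs.2 (Or.inr (by linarith [h.2])))⟩
    have h2 := measure_mono (μ := volume) this
    rw [measure_union (Set.disjoint_left.2 fun θ h h' => by linarith [h.1, h'.2, hθ.1]) measurableSet_Ioo,
      Real.volume_Ioo, Real.volume_Ioo, ← ENNReal.ofReal_add (by linarith) (by linarith)] at h2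
    have := (ENNReal.ofReal_le_iff_le_toReal hTfin).1 h2
    linarith
  have up' := ENNReal.toReal_le_of_le_ofReal (by linarith [hθ.2]) up
  rw [Real.dist_eq, abs_lt]
  constructor <;> linarith
/-- normalized germ of an analytic arc -/
structure CmGerm (L : Set ℂ) (z0 : ℂ) (τ : ℂ → ℂ) (R c C : ℝ) (D : ℂ) : Prop where
  R0 : 0 < R
  c0 : 0 < c
  C0 : 0 < C
  CR : C * R ≤ 1/2
  hd : DifferentiableOn ℂ τ (ball 0 R)
  hi : InjOn τ (ball 0 R)
  z : τ 0 = z0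
  D1 : ‖D‖ = 1
  hL : ∀ v : ℝ, 0 ≤ v → v < R → τ v ∈ L
  q : ∀ u ∈ ball (0:ℂ) R, ‖τ u - z0 - D * u‖ ≤ C * ‖u‖^2
  lo : ∀ u ∈ ball (0:ℂ) R, ∀ v ∈ ball (0:ℂ) R, c * ‖u - v‖ ≤ ‖τ u - τ v‖
  up : ∀ u ∈ ball (0:ℂ) R, ∀ v ∈ ball (0:ℂ) R, ‖τ u - τ v‖ ≤ C * ‖u - v‖
  op : ∀ u s, 0 < s → closedBall u s ⊆ ball (0:ℂ) R → ball (τ u) (c * s / 2) ⊆ τ '' closedBall u s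
theorem CmGerm.mono {L : Set ℂ} {z0 : ℂ} {τ : ℂ → ℂ} {R c C R' c' C' : ℝ} {D : ℂ}
    (g : CmGerm L z0 τ R c C D) (hR : 0 < R') (hR' : R' ≤ R) (hc : 0 < c') (hc' : c' ≤ c)
    (hC : C ≤ C') (hCR : C' * R' ≤ 1/2) : CmGerm L z0 τ R' c' C' D := by
  have hs := ball_subset_ball (x := (0:ℂ)) hR'
  exact ⟨hR, hc, g.C0.trans_le hC, hCR, g.hd.mono hs, g.hi.mono hs, g.z, g.D1,
    fun v h h' => g.hL v h (h'.trans_le hR'),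
    fun u hu => (g.q u (hs hu)).trans (by gcongr), fun u hu v hv => le_trans (by gcongr) (g.lo u (hs hu) v (hs hv)),
    fun u hu v hv => (g.up u (hs hu) v (hs hv)).trans (by gcongr),
    fun u s h h' => (ball_subset_ball (by gcongr)).trans (g.op u s h (h'.trans hs))⟩
theorem CmGerm.half {L : Set ℂ} {z0 : ℂ} {τ : ℂ → ℂ} {R c C : ℝ} {D : ℂ}
    (g : CmGerm L z0 τ R c C D) {u : ℂ} (hu : u ∈ ball (0:ℂ) R) : ‖u‖ ≤ 2 * ‖τ u - z0‖ ∧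
      ‖τ u - z0‖ ≤ 3/2 * ‖u‖ ∧ |‖τ u - z0‖ - ‖u‖| ≤ C * ‖u‖^2 := by
  have h1 := g.q u hu
  have h2 : |‖τ u - z0‖ - ‖D * u‖| ≤ C * ‖u‖^2 := (abs_norm_sub_norm_le _ _).trans h1
  rw [norm_mul, g.D1, one_mul] at h2
  have h3 : C * ‖u‖^2 ≤ 1/2 * ‖u‖ := by
    rw [pow_two, ← mul_assoc]
    have := (mul_le_mul_of_nonneg_left (mem_ball_zero_iff.1 hu).le g.C0.le).trans g.CR
    gcongr
  have := abs_le.1 h2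
  exact ⟨by linarith [this.1], by linarith [this.2], h2⟩
/-- pair of germs at a boundary point -/
structure CmPair (L : Set ℂ) (z0 : ℂ) (τ : Bool → ℂ → ℂ) (R c C ρ : ℝ) (D : Bool → ℂ) : Prop where
  g : ∀ b, CmGerm L z0 (τ b) R c C (D b)
  ρ0 : 0 < ρ
  cov : ∀ z ∈ L, ‖z - z0‖ < ρ → ∃ b, ∃ v : ℝ, 0 ≤ v ∧ v < R ∧ τ b v = z
theorem cm_nb {v R : ℝ} (h : 0 ≤ v) (h' : v < R) : (v:ℂ) ∈ ball (0:ℂ) R := by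
  simpa [abs_of_nonneg h] using h'
theorem CmPair.mono {L : Set ℂ} {z0 : ℂ} {τ : Bool → ℂ → ℂ} {R c C ρ R' : ℝ} {D : Bool → ℂ}
    (P : CmPair L z0 τ R c C ρ D) (hR : 0 < R') (hR' : R' ≤ R) :
    CmPair L z0 τ R' c C (min ρ (R'/2)) D := by
  refine ⟨fun b => (P.g b).mono hR hR' (P.g b).c0 le_rfl le_rfl
    ((mul_le_mul_of_nonneg_left hR' (P.g b).C0.le).trans (P.g b).CR), lt_min P.ρ0 (by linarith), ?_⟩
  intro z hz hd
  obtain ⟨b, v, h, h', rfl⟩ := P.cov z hz (hd.trans_le (min_le_left _ _))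
  refine ⟨b, v, h, ?_, rfl⟩
  have := ((P.g b).half (cm_nb h h')).1
  rw [norm_real, Real.norm_of_nonneg h] at this
  linarith [hd.trans_le (min_le_right _ _)]
theorem CmCurve.germN {L E : Set ℂ} {l : ℝ} {γ : ℝ → ℂ} (h : CmCurve L E l γ) (s0 : ℝ) :
    ∃ τ R c C D ε, CmGerm L (γ s0) τ R c C D ∧ 0 < ε ∧ ∀ s, s0 ≤ s → s < s0 + ε →
      ∃ v : ℝ, 0 ≤ v ∧ v < R ∧ τ v = γ s := by
  obtain ⟨τ0, R0, ε, -, hR0, hε, -, -, hd, hi, hz, hL, hs, -⟩ := h.germ s0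
  set d := deriv τ0 0
  have hd0 : d ≠ 0 := cm_inj_deriv_ne isOpen_ball hd hi (mem_ball_self hR0)
  have hdn := norm_pos_iff.2 hd0
  have hdc : ((‖d‖ : ℝ) : ℂ) ≠ 0 := by exact_mod_cast hdn.ne'
  have hmap : MapsTo (fun u : ℂ => u / (‖d‖ : ℝ)) (ball 0 (R0 * ‖d‖)) (ball 0 R0) := by
    intro u hu; rw [mem_ball_zero_iff] at hu ⊢
    rw [norm_div, norm_real, norm_norm, div_lt_iff₀ hdn]; exact hu
  set τ : ℂ → ℂ := fun u => τ0 (u / (‖d‖ : ℝ)) with hτ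
  have hτd : DifferentiableOn ℂ τ (ball 0 (R0 * ‖d‖)) := hd.comp (by fun_prop) hmap
  have hτi : InjOn τ (ball 0 (R0 * ‖d‖)) := fun u hu v hv e => by
    have := hi (hmap hu) (hmap hv) e
    simpa [div_left_inj' hdc] using this
  have hder : deriv τ 0 = d / (‖d‖ : ℝ) := by
    have h1 : HasDerivAt τ0 d (0 / (‖d‖ : ℝ)) := by
      rw [zero_div]; exact (hd.differentiableAt (isOpen_ball.mem_nhds (mem_ball_self hR0))).hasDerivAt
    have := h1.comp (0:ℂ) ((hasDerivAt_id (0:ℂ)).div_const ((‖d‖:ℝ):ℂ))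
    rw [mul_one_div] at this; exact this.deriv
  have hτ0 : τ 0 = γ s0 := by simp [hτ, hz]
  obtain ⟨R1, c, C, hR1, hR1', hc, hC, lo, up, q, op⟩ := cm_bilip (by positivity) hτd hτi
  set R := min R1 (1/(2*C))
  have hR : 0 < R := lt_min hR1 (by positivity)
  have hRs := ball_subset_ball (x := (0:ℂ)) (min_le_left R1 (1/(2*C)))
  have hop := fun u s h0 (h' : closedBall u s ⊆ ball (0:ℂ) R) => op u s h0 (h'.trans hRs)
  have hnb : ball (γ s0) (c * (R/2) / 2) ∈ 𝓝 (γ s0) := ball_mem_nhds _ (by positivity)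
  obtain ⟨ε', hε', hb⟩ := Metric.mem_nhds_iff.1 (h.cont.continuousAt hnb)
  refine ⟨τ, R, c, C, d / (‖d‖ : ℝ), min ε ε', ⟨hR, hc, hC, ?_, hτd.mono (hRs.trans (ball_subset_ball hR1')),
    hτi.mono (hRs.trans (ball_subset_ball hR1')), hτ0, by simp [hdn.ne'], ?_, ?_,
    fun u hu v hv => lo u (hRs hu) v (hRs hv), fun u hu v hv => up u (hRs hu) v (hRs hv), hop⟩, lt_min hε hε', ?_⟩
  · have := mul_le_mul_of_nonneg_left (min_le_right R1 (1/(2*C))) hC.le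
    refine this.trans (le_of_eq ?_); field_simp
  · intro v hv hv'
    have := hL (v / ‖d‖) (by positivity) (by
      rw [div_lt_iff₀ hdn]; exact (hv'.trans_le (min_le_left _ _)).trans_le hR1')
    simpa [hτ] using this
  · intro u hu; have := q u (hRs hu); rwa [hτ0, hder] at this
  · intro s h1 h2
    obtain ⟨v, hv, hvR, e⟩ := hs s h1 (h2.trans_le (by gcongr; exact min_le_left _ _))
    have h3 := hb (show s ∈ ball s0 ε' by
      rw [mem_ball, Real.dist_eq, abs_of_nonneg (by linarith)]
      linarith [min_le_right ε ε'])
    rw [mem_preimage, ← hτ0] at h3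
    obtain ⟨u, hu, hue⟩ := hop 0 (R/2) (by linarith) (closedBall_subset_ball (by linarith)) h3
    have hu' : u ∈ ball (0:ℂ) R := closedBall_subset_ball (by linarith) hu
    have e2 : τ ((v * ‖d‖ : ℝ) : ℂ) = γ s := by
      simp only [hτ]; push_cast; rw [mul_div_cancel_right₀ _ hdc, e]
    have := hτi (ball_subset_ball ((min_le_left _ _).trans hR1') hu')
      (cm_nb (by positivity) (by gcongr)) (hue.trans e2.symm)
    refine ⟨v * ‖d‖, by positivity, ?_, e2⟩
    rw [this, mem_ball_zero_iff, norm_real, Real.norm_of_nonneg (by positivity)] at hu'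
    exact hu'
theorem CmCurve.pair {L E : Set ℂ} {l : ℝ} {γ : ℝ → ℂ} (h : CmCurve L E l γ) (s0 : ℝ) :
    ∃ τ R c C ρ D, CmPair L (γ s0) τ R c C ρ D := by
  obtain ⟨τ1, R1, c1, C1, D1, ε1, g1, hε1, hs1⟩ := h.germN s0
  obtain ⟨τ2, R2, c2, C2, D2, ε2, g2, hε2, hs2⟩ := h.rev.germN (-s0)
  simp only [neg_neg] at g2 hs2
  have a1 := g1.C0; have a2 := g2.C0; have a3 := g1.R0; have a4 := g2.R0
  set C := max C1 C2
  have hC : 0 < C := lt_max_of_lt_left a1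
  set R := min (min R1 R2) (1/(2*C))
  have hR : 0 < R := lt_min (lt_min a3 a4) (by positivity)
  have hCR : C * R ≤ 1/2 := (mul_le_mul_of_nonneg_left (min_le_right _ (1/(2*C))) hC.le).trans
    (le_of_eq (by field_simp))
  obtain ⟨ρ, hρ, hn⟩ := h.near s0 (lt_min hε1 hε2)
  have hc := lt_min g1.c0 g2.c0
  have hr1 : R ≤ R1 := (min_le_left _ _).trans (min_le_left _ _)
  have hr2 : R ≤ R2 := (min_le_left _ _).trans (min_le_right _ _)
  refine ⟨fun b => if b then τ1 else τ2, R, min c1 c2, C, min ρ (R/2), fun b => if b then D1 else D2,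
    ⟨?_, lt_min hρ (by linarith), ?_⟩⟩
  · rintro (_|_)
    · exact g2.mono hR hr2 hc (min_le_right _ _) (le_max_right _ _) hCR
    · exact g1.mono hR hr1 hc (min_le_left _ _) (le_max_left _ _) hCR
  · intro z hz hd
    have hd2 := hd.trans_le (min_le_right _ _)
    obtain ⟨s, hs, rfl⟩ := hn z hz (by rw [dist_eq_norm]; exact hd.trans_le (min_le_left _ _))
    have hs' := abs_lt.1 hs
    have key : ∀ {τ R' c C D}, CmGerm L (γ s0) τ R' c C D → ∀ v : ℝ, 0 ≤ v → v < R' → τ v = γ s → v < R := by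
      intro τ R' c C D g v h h' e
      have := (g.half (cm_nb h h')).1
      rw [norm_real, Real.norm_of_nonneg h, e] at this; linarith
    rcases le_total s0 s with h1 | h1
    · obtain ⟨v, hv, hv', e⟩ := hs1 s h1 (by linarith [min_le_left ε1 ε2])
      exact ⟨true, v, hv, key g1 v hv hv' e, e⟩
    · obtain ⟨v, hv, hv', e⟩ := hs2 (-s) (by linarith) (by linarith [min_le_right ε1 ε2])
      rw [neg_neg] at e
      exact ⟨false, v, hv, key g2 v hv hv' e, e⟩
def CmCone (S : Set ℂ) (z0 e : ℂ) (k : ℝ) : Prop :=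
  ∀ m > 0, ∃ δ > 0, ∀ x : ℂ, x ≠ 0 → ‖x‖ < δ → (k + m) * ‖x‖ < x.re → z0 + e * x ∈ S
theorem cm_cone_side {G : Set ℂ} (hG : IsOpen G) {z0 e : ℂ} {k : ℝ} (hk : k ∈ Ico (-1:ℝ) 1)
    (h : CmCone (frontier G)ᶜ z0 e k) : CmCone G z0 e k ∨ CmCone (closure G)ᶜ z0 e k := by
  have key : ∀ m, 0 < m → m < 1 - k → ∃ δ > 0,
      (∀ x : ℂ, x ≠ 0 → ‖x‖ < δ → (k + m) * ‖x‖ < x.re → z0 + e * x ∈ G) ∨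
      (∀ x : ℂ, x ≠ 0 → ‖x‖ < δ → (k + m) * ‖x‖ < x.re → z0 + e * x ∈ (closure G)ᶜ) := by
    intro m hm hm1
    obtain ⟨δ, hδ, H⟩ := h m hm
    have hc := (cm_cone_conn (k := k + m) (δ := δ) ⟨by linarith [hk.1], by linarith⟩).image
      (fun x => z0 + e * x) (by fun_prop)
    refine ⟨δ, hδ, (cm_conn_side hG hc ?_).imp (fun h x h1 h2 h3 => h ⟨x, ⟨norm_pos_iff.2 h1, h2, h3⟩, rfl⟩)
      (fun h x h1 h2 h3 => h ⟨x, ⟨norm_pos_iff.2 h1, h2, h3⟩, rfl⟩)⟩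
    rintro _ ⟨x, ⟨h1, h2, h3⟩, rfl⟩; exact H x (norm_pos_iff.1 h1) h2 h3
  have hpt : ∀ m, m < 1 - k → ∀ t : ℝ, 0 < t → (t:ℂ) ≠ 0 ∧ ‖(t:ℂ)‖ = t ∧ (k + m) * ‖(t:ℂ)‖ < (t:ℂ).re := by
    intro m hm t ht
    rw [norm_real, Real.norm_of_nonneg ht.le, ofReal_re]
    exact ⟨by exact_mod_cast ht.ne', rfl, by nlinarith⟩
  have h0 : 0 < (1 - k)/2 := by linarith [hk.2]
  obtain ⟨δ0, hδ0, H0⟩ := key ((1-k)/2) h0 (by linarith)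
  refine H0.imp (fun H0 m hm => ?_) (fun H0 m hm => ?_)
  all_goals
    have hm2 : min m ((1-k)/2) < 1 - k := (min_le_right _ _).trans_lt (by linarith)
    obtain ⟨δ, hδ, H⟩ := key (min m ((1-k)/2)) (lt_min hm h0) hm2
    have ht : 0 < min δ δ0 / 2 := by have := lt_min hδ hδ0; linarith
    obtain ⟨a1, a2, a3⟩ := hpt _ hm2 _ ht
    obtain ⟨b1, b2, b3⟩ := hpt ((1-k)/2) (by linarith) _ ht
    have c1 := H0 _ b1 (by rw [b2]; linarith [min_le_right δ δ0]) b3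
    refine ⟨δ, hδ, fun x hx hx' hx2 => ?_⟩
    have hx3 : (k + min m ((1-k)/2)) * ‖x‖ < x.re :=
      lt_of_le_of_lt (by gcongr; exact min_le_left _ _) hx2
    rcases H with H | H
    · first
      | exact H x hx hx' hx3
      | exact absurd (subset_closure (H _ a1 (by rw [a2]; linarith [min_le_left δ δ0]) a3)) c1
    · first
      | exact H x hx hx' hx3
      | exact absurd (subset_closure c1) (H _ a1 (by rw [a2]; linarith [min_le_left δ δ0]) a3)
theorem CmPair.avoid {L : Set ℂ} {z0 : ℂ} {τ : Bool → ℂ → ℂ} {R c C ρ k : ℝ} {D q : Bool → ℂ} {e : ℂ}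
    (P : CmPair L z0 τ R c C ρ D) (he : ‖e‖ = 1) (hD : ∀ b, D b = e * q b) (hq : ∀ b, (q b).re = k) :
    CmCone Lᶜ z0 e k := by
  intro m hm
  have hC := (P.g true).C0
  refine ⟨min ρ (m / (8*C)), lt_min P.ρ0 (by positivity), fun x hx hx' hx2 hxL => ?_⟩
  have hxn : ‖z0 + e * x - z0‖ = ‖x‖ := by rw [add_sub_cancel_left, norm_mul, he, one_mul]
  obtain ⟨b, v, hv, hvR, ev⟩ := P.cov _ hxL (by rw [hxn]; exact hx'.trans_le (min_le_left _ _))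
  have hvb := cm_nb hv hvR
  obtain ⟨h1, h2, h3⟩ := (P.g b).half hvb
  have h4 := (P.g b).q _ hvb
  rw [ev, hxn, norm_real, Real.norm_of_nonneg hv] at h1 h3
  rw [ev, norm_real, Real.norm_of_nonneg hv, hD] at h4
  have h5 : ‖x - q b * v‖ ≤ C * v^2 := by
    rw [show z0 + e * x - z0 - e * q b * v = e * (x - q b * v) by ring, norm_mul, he, one_mul] at h4
    exact h4
  have h6 := (re_le_norm _).trans h5
  rw [sub_re, re_mul_ofReal, hq] at h6
  have hk : |k| ≤ 1 := by
    have := (abs_re_le_norm (q b)); rw [hq] at this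
    have h7 := (P.g b).D1; rw [hD, norm_mul, he, one_mul] at h7; rwa [h7] at this
  have h8 : k * v - k * ‖x‖ ≤ C * v^2 := by
    have : |k * (v - ‖x‖)| ≤ 1 * (C * v^2) := by
      rw [abs_mul, abs_sub_comm]; gcongr
    linarith [le_abs_self (k * (v - ‖x‖))]
  have hxp := norm_pos_iff.2 hx
  have h9 : ‖x‖ * (8 * C) < m := by
    have := hx'.trans_le (min_le_right _ _); rwa [lt_div_iff₀ (by positivity)] at this
  have h10 : C * v^2 ≤ C * (2*‖x‖)^2 := by gcongr
  nlinarith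
theorem CmPair.tri {L : Set ℂ} {z0 : ℂ} {τ : Bool → ℂ → ℂ} {R c C ρ : ℝ} {D : Bool → ℂ}
    (P : CmPair L z0 τ R c C ρ D) (hD : D true ≠ D false) : ∃ κ R' : ℝ, 0 < κ ∧ κ ≤ 1 ∧ 0 < R' ∧ R' ≤ R ∧
      ∀ b, ∀ u ∈ ball (0:ℂ) R', |u.im| < κ * u.re → (τ b u ∈ L ↔ u.im = 0) := by
  have hC := (P.g true).C0
  set Δ := ‖D true - D false‖
  have hΔ : 0 < Δ := norm_pos_iff.2 (sub_ne_zero.2 hD)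
  refine ⟨min 1 (Δ/8), min R (min (ρ/2) (Δ/(160*C))), lt_min one_pos (by positivity), min_le_left _ _,
    lt_min (P.g true).R0 (lt_min (half_pos P.ρ0) (by positivity)), min_le_left _ _, ?_⟩
  intro b u hu him
  have hu1 := mem_ball_zero_iff.1 hu
  have hur : ‖u‖ < R := hu1.trans_le (min_le_left _ _)
  have huρ : ‖u‖ < ρ/2 := hu1.trans_le ((min_le_right _ _).trans (min_le_left _ _))
  have huΔ : ‖u‖ < Δ/(160*C) := hu1.trans_le ((min_le_right _ _).trans (min_le_right _ _))
  have hub : u ∈ ball (0:ℂ) R := by simpa using hur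
  have hp : 0 < u.re := by
    by_contra hn
    have := abs_nonneg u.im
    have h0 : 0 < min 1 (Δ/8) := lt_min one_pos (by positivity)
    nlinarith
  constructor
  · intro hL
    obtain ⟨a1, a2, a3⟩ := (P.g b).half hub
    obtain ⟨b', v, hv, hvR, ev⟩ := P.cov _ hL (by linarith [norm_nonneg u])
    by_cases hb : b' = b
    · subst hb
      have := (P.g b').hi (cm_nb hv hvR) hub ev
      rw [← this]; simp
    · exfalso
      have hvb := cm_nb hv hvR
      have q1 := (P.g b).q u hub
      have q2 := (P.g b').q v hvb
      have h2 := ((P.g b').half hvb).1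
      rw [ev] at q2 h2
      rw [norm_real, Real.norm_of_nonneg hv] at q2 h2
      have hΔ' : ‖D b - D b'‖ = Δ := by
        cases b <;> cases b' <;> simp_all [Δ, norm_sub_rev]
      have e1 : ‖D b * u.re - D b' * v‖ ≤ C * ‖u‖^2 + C * v^2 + |u.im| := by
        have : D b * u.re - D b' * v = (τ b u - z0 - D b' * v) - (τ b u - z0 - D b * u)
          - D b * (u.im * I) := by
          linear_combination D b * re_add_im u
        rw [this]
        refine (norm_sub_le _ _).trans ?_
        have h3 : ‖D b * (u.im * I)‖ = |u.im| := by simp [(P.g b).D1]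
        have := norm_sub_le (τ b u - z0 - D b' * v) (τ b u - z0 - D b * u)
        linarith
      have e2 : Δ * u.re ≤ 2 * ‖D b * u.re - D b' * v‖ := by
        have i1 : |‖D b * u.re‖ - ‖D b' * v‖| ≤ ‖D b * u.re - D b' * v‖ := abs_norm_sub_norm_le _ _
        rw [norm_mul, norm_mul, (P.g b).D1, (P.g b').D1, norm_real, norm_real, Real.norm_of_nonneg hv,
          Real.norm_of_nonneg hp.le, one_mul, one_mul] at i1
        have i2 : (D b - D b') * u.re = (D b * u.re - D b' * v) - D b' * ((u.re - v : ℝ) : ℂ) := by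
          push_cast; ring
        have i3 := norm_sub_le (D b * u.re - D b' * v) (D b' * ((u.re - v : ℝ) : ℂ))
        rw [← i2, norm_mul, norm_mul, hΔ', (P.g b').D1, norm_real, norm_real, Real.norm_of_nonneg hp.le,
          Real.norm_eq_abs] at i3
        linarith
      have i4 : |u.im| ≤ Δ/8 * u.re := him.le.trans (by gcongr; exact min_le_right _ _)
      have i5 : |u.im| ≤ u.re := him.le.trans (by
        have := min_le_left 1 (Δ/8); nlinarith)
      have i6 : ‖u‖ ≤ 2 * u.re := (norm_le_abs_re_add_abs_im u).trans (by rw [abs_of_pos hp]; linarith)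
      have i7 : v ≤ 6 * u.re := by linarith
      have i8 : C * ‖u‖^2 ≤ C * (2 * u.re)^2 := by gcongr
      have i9 : C * v^2 ≤ C * (6 * u.re)^2 := by gcongr
      have i10 : u.re < Δ/(160*C) := (re_le_norm u).trans_lt huΔ
      rw [lt_div_iff₀ (by positivity)] at i10
      nlinarith
  · intro h
    have : u = (u.re : ℂ) := by apply Complex.ext <;> simp [h]
    rw [this]; exact (P.g b).hL _ hp.le ((re_le_norm u).trans_lt hur)
theorem CmGerm.link {L S : Set ℂ} {z0 : ℂ} {τ : ℂ → ℂ} {R c C k : ℝ} {D e q w : ℂ}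
    (g : CmGerm L z0 τ R c C D) (he : ‖e‖ = 1) (hD : D = e * q) (hk : |k| ≤ 1) (hS : CmCone S z0 e k)
    (hw : k * ‖w‖ < (q * w).re) (hw0 : w ≠ 0) : ∀ᶠ r : ℝ in 𝓝[>] 0, τ (r * w) ∈ S := by
  have hC := g.C0
  have hwn := norm_pos_iff.2 hw0
  set G := (q * w).re - k * ‖w‖
  have hG : 0 < G := sub_pos.2 hw
  obtain ⟨δ, hδ, H⟩ := hS (G / (3 * ‖w‖)) (by positivity)
  have hmn : 0 < min (R / ‖w‖) (min (δ / (2*‖w‖)) (G / (4 * C * ‖w‖^2))) :=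
    lt_min (div_pos g.R0 hwn) (lt_min (by positivity) (by positivity))
  filter_upwards [Ioo_mem_nhdsGT hmn] with r hr
  have r0 := hr.1
  have r1 : r * ‖w‖ < R := (lt_div_iff₀ hwn).1 (hr.2.trans_le (min_le_left _ _))
  have r2 := (lt_div_iff₀ (by positivity)).1 (hr.2.trans_le ((min_le_right _ _).trans (min_le_left _ _)))
  have r3 := (lt_div_iff₀ (by positivity)).1 (hr.2.trans_le ((min_le_right _ _).trans (min_le_right _ _)))
  have hun : ‖(r:ℂ) * w‖ = r * ‖w‖ := by rw [norm_mul, norm_real, Real.norm_of_nonneg r0.le]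
  have hu : (r:ℂ) * w ∈ ball (0:ℂ) R := by rw [mem_ball_zero_iff, hun]; exact r1
  obtain ⟨h1, h2, h3⟩ := g.half hu
  have h4 := g.q _ hu
  have he0 : e ≠ 0 := by rintro rfl; simp at he
  set x := (τ (r * w) - z0) / e with hx
  have hxe : z0 + e * x = τ (r * w) := by rw [hx]; field_simp; ring
  have hxn : ‖x‖ = ‖τ (r * w) - z0‖ := by rw [hx, norm_div, he, div_one]
  rw [← hxn, hun] at h1 h2 h3
  have h5 : ‖x - q * (r * w)‖ ≤ C * (r * ‖w‖)^2 := by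
    have : e * (x - q * (r * w)) = τ (r * w) - z0 - D * (r * w) := by rw [hD, ← hxe]; ring
    rw [← hun]; refine le_trans (le_of_eq ?_) h4
    rw [← this, norm_mul, he, one_mul]
  have h6 := (abs_le.1 ((abs_re_le_norm _).trans h5)).1
  have hre : (q * (r * w)).re = r * (q * w).re := by
    rw [show q * (r * w) = (r:ℂ) * (q * w) by ring, re_ofReal_mul]
  rw [sub_re, hre] at h6
  rw [← hxe]
  have hrw : 0 < r * ‖w‖ := by positivity
  refine H x (norm_pos_iff.1 (by linarith)) (by linarith) ?_
  have h7 : k * ‖x‖ - k * (r * ‖w‖) ≤ C * (r * ‖w‖)^2 := by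
    have : |k * (‖x‖ - r * ‖w‖)| ≤ 1 * (C * (r * ‖w‖)^2) := by rw [abs_mul]; gcongr
    linarith [le_abs_self (k * (‖x‖ - r * ‖w‖))]
  have h8 : G / (3 * ‖w‖) * ‖x‖ ≤ G / (3 * ‖w‖) * (3/2 * (r * ‖w‖)) := by gcongr
  have h9 : G / (3 * ‖w‖) * (3/2 * (r * ‖w‖)) = r * G / 2 := by field_simp
  have hGe : (q * w).re = G + k * ‖w‖ := by simp [G]
  rw [hGe] at h6
  nlinarith
theorem CmGerm.link2 {L S S' : Set ℂ} {z0 : ℂ} {τ : ℂ → ℂ} {R c C κ R' : ℝ} {D e q : ℂ}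
    (g : CmGerm L z0 τ R c C D) (he : ‖e‖ = 1) (hD : D = e * q) (hq : ‖q‖ = 1) (hs : q.im ≠ 0)
    (hA : CmCone S z0 e q.re) (hB : CmCone S' z0 (-e) (-q.re)) (hκ : 0 < κ) (hR' : 0 < R') :
    ∃ r t : ℝ, 0 < r ∧ 0 < t * q.im ∧ |t| < κ ∧ (r:ℂ) * (1 - t * I) ∈ ball (0:ℂ) R' ∧
      (r:ℂ) * (1 + t * I) ∈ ball (0:ℂ) R' ∧ τ (r * (1 - t * I)) ∈ S ∧ τ (r * (1 + t * I)) ∈ S' := by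
  set p := min 1 (κ/2)
  have hp : 0 < p := lt_min one_pos (by linarith)
  have hp1 : p ≤ 1 := min_le_left _ _
  have hs2 : 0 < q.im^2 := by positivity
  have hi1 : |q.im| ≤ 1 := hq ▸ abs_im_le_norm q
  have hr1 : |q.re| ≤ 1 := hq ▸ abs_re_le_norm q
  set t := p * q.im
  have hts : 0 < t * q.im := by rw [show t * q.im = p * q.im^2 by simp only [t]; ring]; positivity
  have hwn : ∀ σ : ℝ, σ^2 = 1 → 1 ≤ ‖(1:ℂ) + (σ * t : ℝ) * I‖ ∧ ‖(1:ℂ) + (σ * t : ℝ) * I‖ ≤ 1 + t^2/2 := by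
    intro σ hσ
    have h1 : ‖(1:ℂ) + (σ * t : ℝ) * I‖^2 = 1 + t^2 := by
      rw [← normSq_eq_norm_sq]; simp [normSq_apply]; linear_combination t^2 * hσ
    constructor
    · nlinarith [norm_nonneg ((1:ℂ) + (σ * t : ℝ) * I)]
    · refine le_of_sq_le_sq ?_ (by positivity)
      rw [h1]; nlinarith [sq_nonneg (t^2)]
  have hcx : ∀ σ : ℝ, σ^2 = 1 → σ * q.re * ‖(1:ℂ) + (σ * t : ℝ) * I‖ * σ * σ < σ * q.re + t * q.im := by
    intro σ hσ
    obtain ⟨h1, h2⟩ := hwn σ hσ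
    have h3 : σ * q.re * (‖(1:ℂ) + (σ * t : ℝ) * I‖ - 1) ≤ 1 * (t^2/2) := by
      refine (le_abs_self _).trans ?_
      rw [abs_mul, abs_mul, abs_of_nonneg (by linarith : 0 ≤ ‖(1:ℂ) + (σ * t : ℝ) * I‖ - 1)]
      have : |σ| = 1 := by rw [← sq_eq_sq₀ (abs_nonneg _) one_pos.le, sq_abs, hσ]; norm_num
      rw [this, one_mul]; gcongr; linarith
    have h4 : t^2/2 < t * q.im := by
      have e1 : t^2 = p * (p * q.im^2) := by simp only [t]; ring
      have e2 : t * q.im = p * q.im^2 := by simp only [t]; ring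
      rw [e1, e2]; nlinarith [mul_pos hp hs2]
    have : σ * q.re * ‖(1:ℂ) + (σ * t : ℝ) * I‖ * σ * σ = σ * q.re * ‖(1:ℂ) + (σ * t : ℝ) * I‖ := by
      linear_combination σ * q.re * ‖(1:ℂ) + (σ * t : ℝ) * I‖ * hσ
    linarith
  have w1 : (1:ℂ) - t * I = 1 + ((-1) * t : ℝ) * I := by push_cast; ring
  have w2 : (1:ℂ) + t * I = 1 + (1 * t : ℝ) * I := by push_cast; ring
  have w1n : (1:ℂ) - t * I ≠ 0 := by
    rw [w1]; exact norm_pos_iff.1 (by linarith [(hwn (-1) (by norm_num)).1])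
  have w2n : (1:ℂ) + t * I ≠ 0 := by
    rw [w2]; exact norm_pos_iff.1 (by linarith [(hwn 1 (by norm_num)).1])
  have l1 := g.link he hD hr1 hA (w := 1 - t * I) (by
    have h := hcx 1 (by norm_num)
    have e1 : ‖(1:ℂ) - t * I‖ = ‖(1:ℂ) + (1 * t : ℝ) * I‖ := by
      rw [← norm_conj]; simp
    rw [e1]; simp at h ⊢; linarith) w1n
  have l2 := g.link (e := -e) (q := -q) (by rwa [norm_neg]) (by rw [hD]; ring) (by rwa [abs_neg]) hB (w := 1 + t * I) (by
    have h := hcx (-1) (by norm_num)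
    have e1 : ‖(1:ℂ) + t * I‖ = ‖(1:ℂ) + ((-1) * t : ℝ) * I‖ := by
      rw [← norm_conj]; simp
    rw [e1]; simp at h ⊢; linarith) w2n
  have hev : ∀ w : ℂ, ∀ᶠ r : ℝ in 𝓝[>] 0, (r:ℂ) * w ∈ ball (0:ℂ) R' := fun w => by
    have : Continuous fun r : ℝ => (r:ℂ) * w := by fun_prop
    exact mem_nhdsWithin_of_mem_nhds (this.continuousAt (isOpen_ball.mem_nhds (by simpa using hR')))
  obtain ⟨r, ⟨⟨⟨h1, h2⟩, h3⟩, h4⟩, h5⟩ := ((((l1.and l2).and (hev (1 - t * I))).and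
    (hev (1 + t * I))).and self_mem_nhdsWithin).exists
  refine ⟨r, t, h5, hts, ?_, h3, h4, h1, h2⟩
  rw [abs_mul, abs_of_pos hp]
  have : p ≤ κ/2 := min_le_right _ _
  nlinarith [abs_nonneg q.im]
def cmSg (b : Bool) : ℝ := if b then 1 else -1
theorem cmSg_sq (b : Bool) : cmSg b * cmSg b = 1 := by cases b <;> simp [cmSg]
theorem cmSg_abs (b : Bool) : |cmSg b| = 1 := by cases b <;> simp [cmSg]
structure CmCorner (G : Set ℂ) (z0 e : ℂ) (θ : ℝ) (τ : Bool → ℂ → ℂ) (R c C ρ κ : ℝ) (D : Bool → ℂ) : Prop where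
  P : CmPair (frontier G) z0 τ R c C ρ D
  e1 : ‖e‖ = 1
  κ0 : 0 < κ
  κ1 : κ ≤ 1
  hθ : θ ∈ Ioo 0 Real.pi
  hD : ∀ b, D b = e * exp ((cmSg b * θ : ℝ) * I)
  A : CmCone (closure G)ᶜ z0 e (Real.cos θ)
  B : CmCone G z0 (-e) (-Real.cos θ)
  V : ∀ b, ∀ u ∈ ball (0:ℂ) R, |u.im| < κ * u.re →
    (0 < cmSg b * u.im → τ b u ∈ G) ∧ (cmSg b * u.im < 0 → τ b u ∈ (closure G)ᶜ)
theorem cm_Vset (κ R : ℝ) : IsOpen {u : ℂ | u ∈ ball (0:ℂ) R ∧ |u.im| < κ * u.re} ∧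
    Convex ℝ {u : ℂ | u ∈ ball (0:ℂ) R ∧ |u.im| < κ * u.re} := by
  have h : ∀ σ : ℝ, Convex ℝ {u : ℂ | σ * u.im - κ * u.re < 0} := fun σ =>
    convex_halfSpace_lt ⟨fun x y => by simp; ring, fun a x => by simp; ring⟩ 0
  have ho : ∀ σ : ℝ, IsOpen {u : ℂ | σ * u.im - κ * u.re < 0} := fun σ =>
    isOpen_lt (by fun_prop) continuous_const
  have e : {u : ℂ | u ∈ ball (0:ℂ) R ∧ |u.im| < κ * u.re} = ball 0 R ∩ ({u : ℂ | 1 * u.im - κ * u.re < 0} ∩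
      {u : ℂ | -1 * u.im - κ * u.re < 0}) := by
    ext u; simp only [mem_ofPred_eq, mem_inter_iff, abs_lt]
    refine and_congr_right fun _ => ⟨?_, ?_⟩ <;> rintro ⟨h1, h2⟩ <;> constructor <;> linarith
  rw [e]
  exact ⟨isOpen_ball.inter ((ho _).inter (ho _)), (convex_ball _ _).inter ((h _).inter (h _))⟩
theorem cm_triV {κ R r t : ℝ} (hr : 0 < r) (ht : |t| < κ) (h : (r:ℂ) * (1 + t * I) ∈ ball (0:ℂ) R) :
    (r:ℂ) * (1 + t * I) ∈ {u : ℂ | u ∈ ball (0:ℂ) R ∧ |u.im| < κ * u.re} ∧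
      ((r:ℂ) * (1 + t * I)).im = r * t := by
  refine ⟨⟨h, ?_⟩, by simp⟩
  simp [abs_mul, abs_of_pos hr]; nlinarith
theorem cm_corner1 {G : Set ℂ} (hG : IsOpen G) (hconf : CmConf G) {z0 e q : ℂ} {τ : Bool → ℂ → ℂ}
    {R c C ρ lam : ℝ} {D : Bool → ℂ} (P : CmPair (frontier G) z0 τ R c C ρ D) (he : ‖e‖ = 1)
    (hq : ‖q‖ = 1) (hs : 0 < q.im) (hDt : D true = e * q) (hDf : D false = e * (starRingEnd ℂ) q)
    (hA : CmCone (closure G)ᶜ z0 e q.re) (hB : CmCone G z0 (-e) (-q.re))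
    (ha : HasCornerAngle G z0 ((2 - lam) * Real.pi)) :
    ∃ R' ρ' κ, CmCorner G z0 e (lam * Real.pi / 2) τ R' c C ρ' κ D := by
  have hq0 : q ≠ 0 := by rintro rfl; simp at hq
  have hcos : Real.cos (arg q) = q.re := by rw [cos_arg hq0, hq, div_one]
  have hθ : arg q ∈ Ioo 0 Real.pi := by
    refine ⟨lt_of_le_of_ne (arg_nonneg_iff.2 hs.le) fun h => ?_, arg_lt_pi_iff.2 (Or.inr hs.ne')⟩
    have := (arg_eq_zero_iff.1 h.symm).2; linarith
  have hqe : q = exp (arg q * I) := by have := norm_mul_exp_arg_mul_I q; rw [hq] at this; simpa using this.symm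
  set θ := arg q
  have hang : (2 - lam) * Real.pi = 2 * Real.pi - 2 * θ := by
    refine cm_angle hG he (Ioo_subset_Icc_self hθ) ha fun η hη => ?_
    set η' := min η (min (θ/2) ((Real.pi - θ)/2))
    have h0 : 0 < η' := lt_min hη (lt_min (by linarith [hθ.1]) (by linarith [hθ.2]))
    have h1 : η' ≤ η := min_le_left _ _
    have h2 : η' ≤ θ/2 := (min_le_right _ _).trans (min_le_left _ _)
    have h3 : η' ≤ (Real.pi - θ)/2 := (min_le_right _ _).trans (min_le_right _ _)
    have c1 := Real.cos_lt_cos_of_nonneg_of_le_pi (x := θ - η') (y := θ) (by linarith [hθ.1]) hθ.2.le (by linarith)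
    have c2 := Real.cos_lt_cos_of_nonneg_of_le_pi (x := θ) (y := θ + η') hθ.1.le (by linarith [hθ.2]) (by linarith)
    obtain ⟨δ1, hδ1, H1⟩ := hA _ (sub_pos.2 c1)
    obtain ⟨δ2, hδ2, H2⟩ := hB _ (sub_pos.2 c2)
    refine ⟨min δ1 δ2, lt_min hδ1 hδ2, fun r t hr hrδ ht => ?_⟩
    have hn : ‖(r:ℂ) * exp (t * I)‖ = r := by rw [norm_mul, norm_exp_ofReal_mul_I]; simp [hr.le]
    have hre : ((r:ℂ) * exp (t * I)).re = r * Real.cos |t| := by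
      rw [re_ofReal_mul, exp_ofReal_mul_I_re, Real.cos_abs]
    have hne : (r:ℂ) * exp (t * I) ≠ 0 := by rw [← norm_pos_iff, hn]; exact hr
    constructor
    · intro hlt hmem
      refine H1 _ hne (by rw [hn]; exact hrδ.trans_le (min_le_left _ _)) ?_ (subset_closure hmem)
      rw [hn, hre]
      have := Real.cos_lt_cos_of_nonneg_of_le_pi (x := |t|) (y := θ - η') (abs_nonneg _) (by linarith [hθ.2]) (by linarith)
      rw [← hcos]; nlinarith
    · intro hlt
      have := H2 (-((r:ℂ) * exp (t * I))) (neg_ne_zero.2 hne) (by rw [norm_neg, hn]; exact hrδ.trans_le (min_le_right _ _)) (by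
        rw [norm_neg, neg_re, hn, hre]
        have := Real.cos_lt_cos_of_nonneg_of_le_pi (x := θ + η') (y := |t|) (by linarith [hθ.1]) ht (by linarith)
        rw [← hcos]; nlinarith)
      rwa [neg_mul_neg] at this
  have hth : lam * Real.pi / 2 = θ := by linarith
  rw [hth]
  have hne : D true ≠ D false := by
    have he0 : e ≠ 0 := by rintro rfl; simp at he
    rw [hDt, hDf]; intro h
    have := congrArg Complex.im (mul_left_cancel₀ he0 h); simp at this; linarith
  obtain ⟨κ, R', hκ, hκ1, hR', hRR, hV⟩ := P.tri hne
  refine ⟨R', _, κ, P.mono hR' hRR, he, hκ, hκ1, hθ, ?_, hcos ▸ hA, hcos ▸ hB, ?_⟩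
  · rintro (_|_)
    · rw [hDf]; conv_lhs => rw [hqe]
      rw [← exp_conj]; simp [cmSg]
    · rw [hDt]; conv_lhs => rw [hqe]
      simp [cmSg]
  · have hVs := cm_Vset κ R'
    have hsub : {u : ℂ | u ∈ ball (0:ℂ) R' ∧ |u.im| < κ * u.re} ⊆ ball 0 R := fun u hu => ball_subset_ball hRR hu.1
    intro b u hu hui
    have hm : (((R'/2 : ℝ)) : ℂ) ∈ {u : ℂ | u ∈ ball (0:ℂ) R' ∧ |u.im| < κ * u.re} :=
      ⟨cm_nb (by linarith) (by linarith), by simp; positivity⟩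
    have hsd := cm_sides hG hconf hVs.1 hVs.2 ((P.g b).hd.mono hsub) ((P.g b).hi.mono hsub)
      (fun v hv => hV b v hv.1 hv.2) hm (by simp)
    cases b
    · obtain ⟨r, t, hr, ht, htκ, m1, m2, l1, l2⟩ := (P.g false).link2 he hDf (by simpa using hq)
        (by simpa using hs.ne') (by simpa using hA) (by simpa using hB) hκ hR'
      rcases hsd with hsd | hsd
      · exfalso
        have := cm_triV hr htκ m2
        have h1 := hsd.2 _ this.1 (by rw [this.2]; simp at ht; nlinarith)
        exact h1 (subset_closure l2)
      · exact ⟨fun h => hsd.2 u ⟨hu, hui⟩ (by simpa [cmSg] using h), fun h => hsd.1 u ⟨hu, hui⟩ (by simpa [cmSg] using h)⟩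
    · obtain ⟨r, t, hr, ht, htκ, m1, m2, l1, l2⟩ := (P.g true).link2 he hDt hq hs.ne' hA hB hκ hR'
      rcases hsd with hsd | hsd
      · exact ⟨fun h => hsd.1 u ⟨hu, hui⟩ (by simpa [cmSg] using h), fun h => hsd.2 u ⟨hu, hui⟩ (by simpa [cmSg] using h)⟩
      · exfalso
        have := cm_triV hr htκ m2
        have h1 := hsd.1 _ this.1 (by rw [this.2]; have := (pos_iff_pos_of_mul_pos ht).2 hs; positivity)
        exact h1 (subset_closure l2)
theorem cm_corner {G E : Set ℂ} {l : ℝ} {γ : ℝ → ℂ} (hG : IsOpen G) (hconf : CmConf G)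
    (h : CmCurve (frontier G) E l γ) (s0 : ℝ) {lam : ℝ} (hl : lam ∈ Ioo (0:ℝ) 2)
    (ha : HasCornerAngle G (γ s0) ((2 - lam) * Real.pi)) :
    ∃ e τ R c C ρ κ D, CmCorner G (γ s0) e (lam * Real.pi / 2) τ R c C ρ κ D := by
  obtain ⟨τ, R, c, C, ρ, D, P⟩ := h.pair s0
  have hpi := Real.pi_pos
  have hDn := fun b => (P.g b).D1
  have hD0 : ∀ b, D b ≠ 0 := fun b => norm_pos_iff.1 (by rw [hDn]; norm_num)
  have hxn : ∀ r t : ℝ, 0 < r → ‖(r:ℂ) * exp (t * I)‖ = r ∧ ((r:ℂ) * exp (t * I)).re = r * Real.cos |t| ∧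
      (r:ℂ) * exp (t * I) ≠ 0 := fun r t hr => by
    refine ⟨by rw [norm_mul, norm_exp_ofReal_mul_I]; simp [hr.le],
      by rw [re_ofReal_mul, exp_ofReal_mul_I_re, Real.cos_abs], by simp [hr.ne']⟩
  by_cases hD : D true = D false
  · exfalso
    have hDb : ∀ b, D b = D true := by rintro (_|_) <;> simp [hD]
    rcases cm_cone_side hG (k := -1) (by norm_num) (P.avoid (e := -D true) (q := fun _ => -1) (by simp [hDn])
      (fun b => by simp [hDb b]) (by simp)) with hc | hc
    · have := cm_angle hG (hDn true) (θ1 := 0) ⟨le_rfl, hpi.le⟩ ha fun η hη => by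
        set η' := min η Real.pi
        have hη' : 0 < η' := lt_min hη hpi
        have c1 := Real.cos_lt_cos_of_nonneg_of_le_pi le_rfl (min_le_right _ _) hη'
        rw [Real.cos_zero] at c1
        obtain ⟨δ, hδ, H⟩ := hc (1 - Real.cos η') (by linarith)
        refine ⟨δ, hδ, fun r t hr hr' ht => ⟨fun h => by linarith [abs_nonneg t], fun h => ?_⟩⟩
        obtain ⟨x1, x2, x3⟩ := hxn r t hr
        have := H (-((r:ℂ) * exp (t * I))) (neg_ne_zero.2 x3) (by rwa [norm_neg, x1]) (by
          rw [norm_neg, neg_re, x1, x2]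
          have := Real.cos_lt_cos_of_nonneg_of_le_pi hη'.le ht (by linarith [min_le_left η Real.pi])
          nlinarith)
        rwa [neg_mul_neg] at this
      nlinarith [hl.1]
    · have := cm_angle hG (e := -D true) (by simp [hDn]) (θ1 := Real.pi) ⟨hpi.le, le_rfl⟩ ha fun η hη => by
        set η' := min η Real.pi
        have hη' : 0 < η' := lt_min hη hpi
        have c1 := Real.cos_lt_cos_of_nonneg_of_le_pi (x := Real.pi - η') (by linarith [min_le_right η Real.pi]) le_rfl (by linarith)
        rw [Real.cos_pi] at c1
        obtain ⟨δ, hδ, H⟩ := hc (Real.cos (Real.pi - η') + 1) (by linarith)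
        refine ⟨δ, hδ, fun r t hr hr' ht => ⟨fun h hm => ?_, fun h => by linarith⟩⟩
        obtain ⟨x1, x2, x3⟩ := hxn r t hr
        refine H _ x3 (by rwa [x1]) ?_ (subset_closure hm)
        rw [x1, x2]
        have := Real.cos_lt_cos_of_nonneg_of_le_pi (abs_nonneg t) (y := Real.pi - η') (by linarith) (by linarith [min_le_left η Real.pi])
        nlinarith
      nlinarith [hl.2]
  · obtain ⟨q, hq2⟩ := IsAlgClosed.exists_pow_nat_eq (D true / D false) (n := 2) (by norm_num)
    have hq : ‖q‖ = 1 := by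
      have := congrArg norm hq2
      rw [norm_pow, norm_div, hDn, hDn, div_one] at this
      exact (pow_eq_one_iff_of_nonneg (norm_nonneg q) (by norm_num)).1 this
    have hq0 : q ≠ 0 := by rintro rfl; simp at hq
    have hqq : q * (starRingEnd ℂ) q = 1 := by rw [mul_conj, normSq_eq_norm_sq, hq]; simp
    set e := D true / q
    have he : ‖e‖ = 1 := by simp [e, hDn, hq]
    have hDt : D true = e * q := by simp only [e]; field_simp
    have hDf : D false = e * (starRingEnd ℂ) q := by
      have h1 : D true = q^2 * D false := by rw [hq2]; field_simp [hD0]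
      simp only [e]; rw [div_mul_eq_mul_div, eq_div_iff hq0, h1]; linear_combination -q * D false * hqq
    have hs : q.im ≠ 0 := by
      intro h0
      have : (starRingEnd ℂ) q = q := conj_eq_iff_im.2 h0
      exact hD (by rw [hDt, hDf, this])
    have hk : q.re ∈ Ioo (-1:ℝ) 1 := by
      have h1 : q.re^2 + q.im^2 = 1 := by
        have := normSq_eq_norm_sq q; rw [hq, normSq_apply] at this; linarith
      have : 0 < q.im^2 := by positivity
      constructor <;> nlinarith
    set Q : Bool → ℂ := fun b => if b then q else (starRingEnd ℂ) q
    have hDQ : ∀ b, D b = e * Q b := by rintro (_|_) <;> simp [Q, hDt, hDf]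
    have hQr : ∀ b, (Q b).re = q.re := by rintro (_|_) <;> simp [Q]
    have sA := cm_cone_side hG ⟨hk.1.le, hk.2⟩ (P.avoid he hDQ hQr)
    have sB := cm_cone_side hG (k := -q.re) ⟨by linarith [hk.2], by linarith [hk.1]⟩ (P.avoid (e := -e) (q := fun b => - Q b)
      (by simpa using he) (fun b => by rw [hDQ]; ring) (by simp [hQr]))
    have Psw : CmPair (frontier G) (γ s0) (fun b => τ !b) R c C ρ (fun b => D !b) :=
      ⟨fun b => P.g _, P.ρ0, fun z hz hd => by
        obtain ⟨b, v, hv⟩ := P.cov z hz hd; exact ⟨!b, v, by simpa using hv⟩⟩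
    have opp : ∀ S : Set ℂ, CmCone S (γ s0) e q.re → CmCone S (γ s0) (-e) (-q.re) →
        (S = G ∨ S = (closure G)ᶜ) → False := by
      intro S h1 h2 hS
      obtain ⟨κ, R', hκ, hκ1, hR', hRR, hV⟩ := P.tri hD
      have hVs := cm_Vset κ R'
      have hsub : {u : ℂ | u ∈ ball (0:ℂ) R' ∧ |u.im| < κ * u.re} ⊆ ball 0 R := fun u hu => ball_subset_ball hRR hu.1
      have hm : (((R'/2 : ℝ)) : ℂ) ∈ {u : ℂ | u ∈ ball (0:ℂ) R' ∧ |u.im| < κ * u.re} :=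
        ⟨cm_nb (by linarith) (by linarith), by simp; positivity⟩
      have hsd := cm_sides hG hconf hVs.1 hVs.2 ((P.g true).hd.mono hsub) ((P.g true).hi.mono hsub)
        (fun v hv => hV true v hv.1 hv.2) hm (by simp)
      obtain ⟨r, t, hr, ht, htκ, m1, m2, l1, l2⟩ := (P.g true).link2 he hDt hq hs h1 h2 hκ hR'
      have e1 : (1:ℂ) - t * I = 1 + ((-t : ℝ) : ℂ) * I := by push_cast; ring
      rw [e1] at m1 l1
      have v1 := cm_triV hr (by rwa [abs_neg]) m1
      have v2 := cm_triV hr htκ m2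
      have ht0 : t ≠ 0 := by rintro rfl; simp at ht
      have contra : ∀ u ∈ {u : ℂ | u ∈ ball (0:ℂ) R' ∧ |u.im| < κ * u.re}, ∀ v ∈ {u : ℂ | u ∈ ball (0:ℂ) R' ∧ |u.im| < κ * u.re},
          0 < u.im → v.im < 0 → τ true u ∈ S → τ true v ∈ S → False := by
        intro u hu v hv hu0 hv0 hus hvs
        rcases hS with rfl | rfl <;> rcases hsd with hh | hh
        · exact hh.2 v hv hv0 (subset_closure hvs)
        · exact hh.1 u hu hu0 (subset_closure hus)
        · exact hus (subset_closure (hh.1 u hu hu0))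
        · exact hvs (subset_closure (hh.2 v hv hv0))
      rcases lt_or_gt_of_ne ht0 with h | h
      · exact contra _ v1.1 _ v2.1 (by rw [v1.2]; nlinarith) (by rw [v2.2]; nlinarith) l1 l2
      · exact contra _ v2.1 _ v1.1 (by rw [v2.2]; positivity) (by rw [v1.2]; nlinarith) l2 l1
    rcases sA with sA | sA <;> rcases sB with sB | sB
    · exact (opp _ sA sB (Or.inl rfl)).elim
    · rcases lt_or_gt_of_ne hs with h | h
      · obtain ⟨R', ρ', κ, H⟩ := cm_corner1 hG hconf P (e := -e) (q := -q) (by simpa using he) (by simpa using hq)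
          (by simpa using h) (by rw [hDt]; ring) (by rw [hDf, map_neg]; ring) (by simpa using sB) (by simpa using sA) ha
        exact ⟨_, _, _, _, _, _, _, _, H⟩
      · obtain ⟨R', ρ', κ, H⟩ := cm_corner1 hG hconf Psw (e := -e) (q := -(starRingEnd ℂ) q) (by simpa using he) (by simpa using hq)
          (by simpa using h) (by simp [hDf]) (by simp [hDt]) (by simpa using sB) (by simpa using sA) ha
        exact ⟨_, _, _, _, _, _, _, _, H⟩
    · rcases lt_or_gt_of_ne hs with h | h
      · obtain ⟨R', ρ', κ, H⟩ := cm_corner1 hG hconf Psw (e := e) (q := (starRingEnd ℂ) q) he (by simpa using hq)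
          (by simpa using h) (by simp [hDf]) (by simp [hDt]) (by simpa using sA) (by simpa using sB) ha
        exact ⟨_, _, _, _, _, _, _, _, H⟩
      · obtain ⟨R', ρ', κ, H⟩ := cm_corner1 hG hconf P he hq h hDt hDf sA sB ha
        exact ⟨_, _, _, _, _, _, _, _, H⟩
    · exact (opp _ sA sB (Or.inr rfl)).elim
theorem cm_rot {y : ℂ} {θ : ℝ} (hy : 0 ≤ y.im) (hθ : θ ∈ Icc 0 Real.pi) :
    (Real.cos θ * ‖y‖ ≤ y.re → y.im * Real.cos θ - y.re * Real.sin θ ≤ 0) ∧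
    (y.re ≤ Real.cos θ * ‖y‖ → 0 ≤ y.im * Real.cos θ - y.re * Real.sin θ) := by
  by_cases h0 : y = 0
  · simp [h0]
  have hn := norm_pos_iff.2 h0
  have ha : arg y ∈ Icc 0 Real.pi := ⟨arg_nonneg_iff.2 hy, arg_le_pi y⟩
  have e : y.im * Real.cos θ - y.re * Real.sin θ = ‖y‖ * Real.sin (arg y - θ) := by
    rw [Real.sin_sub, sin_arg, cos_arg h0]; field_simp
  have hc : Real.cos (arg y) * ‖y‖ = y.re := by rw [cos_arg h0]; field_simp
  rw [e, ← hc]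
  constructor
  · intro h
    have := (Real.strictAntiOn_cos.le_iff_ge hθ ha).1 (le_of_mul_le_mul_right h hn)
    exact mul_nonpos_of_nonneg_of_nonpos hn.le (Real.sin_nonpos_of_nonpos_of_neg_pi_le (by linarith) (by linarith [ha.1, hθ.2]))
  · intro h
    have := (Real.strictAntiOn_cos.le_iff_ge ha hθ).1 (le_of_mul_le_mul_right h hn)
    exact mul_nonneg hn.le (Real.sin_nonneg_of_nonneg_of_le_pi (by linarith) (by linarith [ha.2, hθ.1]))
theorem cmSg_ex (t : ℝ) : ∃ b, 0 ≤ cmSg b * t := by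
  rcases le_total 0 t with h | h
  · exact ⟨true, by simpa [cmSg] using h⟩
  · exact ⟨false, by simpa [cmSg] using h⟩
def CmChart (G : Set ℂ) (z : ℂ) (τ : ℂ → ℂ) (R r : ℝ) : Prop :=
  0 < R ∧ 0 < r ∧ DifferentiableOn ℂ τ (ball 0 R) ∧ InjOn τ (ball 0 R) ∧ τ 0 = z ∧
  ball z r ⊆ τ '' ball 0 R ∧ ∀ u ∈ ball (0:ℂ) R, (0 < u.im → τ u ∈ G) ∧ (u.im = 0 → τ u ∈ frontier G) ∧
    (u.im < 0 → τ u ∈ (closure G)ᶜ)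
def CmLC (G : Set ℂ) (z : ℂ) : Prop := ∃ O ∈ 𝓝 z, ∃ S, IsPreconnected S ∧ S ⊆ (closure G)ᶜ ∧ O ∩ (closure G)ᶜ ⊆ S
theorem CmChart.lc {G : Set ℂ} {z : ℂ} {τ : ℂ → ℂ} {R r : ℝ} (h : CmChart G z τ R r) : CmLC G z := by
  obtain ⟨hR, hr, hd, hi, hz, hb, hu⟩ := h
  refine ⟨ball z r, ball_mem_nhds _ hr, τ '' (ball 0 R ∩ {u | u.im < 0}),
    ((convex_ball _ _).inter (convex_halfSpace_im_lt 0)).isPreconnected.image τ (hd.continuousOn.mono inter_subset_left), ?_, ?_⟩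
  · rintro _ ⟨u, hu1, rfl⟩; exact (hu u hu1.1).2.2 hu1.2
  · rintro w ⟨hw, hwe⟩
    obtain ⟨u, hub, rfl⟩ := hb hw
    refine ⟨u, ⟨hub, ?_⟩, rfl⟩
    rcases lt_trichotomy u.im 0 with h | h | h
    · exact h
    · exact absurd (frontier_subset_closure ((hu u hub).2.1 h)) hwe
    · exact absurd (subset_closure ((hu u hub).1 h)) hwe
theorem cm_smooth_chart {G E : Set ℂ} {l : ℝ} {γ : ℝ → ℂ} (hG : IsOpen G) (hconf : CmConf G)
    (h : CmCurve (frontier G) E l γ) {s1 : ℝ} (hs : γ s1 ∉ E) : ∃ τ R r, CmChart G (γ s1) τ R r := by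
  obtain ⟨τ, R, hR, hd, hi, h0, hL, -⟩ := h.smooth hs
  have hm := mem_ball_self hR (x := (0:ℂ))
  have key : ∀ σ : ℂ → ℂ, DifferentiableOn ℂ σ (ball 0 R) → InjOn σ (ball 0 R) → σ 0 = γ s1 →
      ∃ r > 0, ball (γ s1) r ⊆ σ '' ball 0 R := by
    intro σ hd hi h0
    have hmap := (hd.analyticAt (isOpen_ball.mem_nhds hm)).hasStrictDerivAt.map_nhds_eq (cm_inj_deriv_ne isOpen_ball hd hi hm)
    rw [← h0]
    refine Metric.mem_nhds_iff.1 ?_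
    rw [← hmap]; exact image_mem_map (isOpen_ball.mem_nhds hm)
  rcases cm_sides hG hconf isOpen_ball (convex_ball 0 R) hd hi hL hm (by simp) with hs | hs
  · obtain ⟨r, hr, hb⟩ := key τ hd hi h0
    exact ⟨τ, R, r, hR, hr, hd, hi, h0, hb, fun u hu => ⟨hs.1 u hu, (hL u hu).2, hs.2 u hu⟩⟩
  · have hn : ∀ u ∈ ball (0:ℂ) R, -u ∈ ball (0:ℂ) R := fun u hu => by simpa using hu
    have hd' : DifferentiableOn ℂ (fun u => τ (-u)) (ball 0 R) := hd.comp (by fun_prop) hn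
    have hi' : InjOn (fun u => τ (-u)) (ball 0 R) := fun u hu v hv e => neg_injective (hi (hn u hu) (hn v hv) e)
    obtain ⟨r, hr, hb⟩ := key _ hd' hi' (by simpa using h0)
    exact ⟨_, R, r, hR, hr, hd', hi', by simpa using h0, hb, fun u hu =>
      ⟨fun h => hs.2 _ (hn u hu) (by simpa using h), fun h => (hL _ (hn u hu)).2 (by simpa using h),
        fun h => hs.1 _ (hn u hu) (by simpa using h)⟩⟩
theorem CmCurve.arcl {L E : Set ℂ} {l : ℝ} {γ : ℝ → ℂ} (h : CmCurve L E l γ) (s0 : ℝ) :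
    ∃ c > 0, ∀ s, |s - s0| ≤ l/2 → c * |s - s0| ≤ ‖γ s - γ s0‖ := by
  have hl := h.lpos
  obtain ⟨-, -, ε1, c1, -, hε1, -, hc1, -, -, -, -, -, H1⟩ := h.germ s0
  obtain ⟨-, -, ε2, c2, -, hε2, -, hc2, -, -, -, -, -, H2⟩ := h.rev.germ (-s0)
  simp only [neg_neg] at H2
  set ε := min ε1 ε2
  have hε : 0 < ε := lt_min hε1 hε2
  have hcomp : IsCompact {s : ℝ | ε ≤ |s - s0| ∧ |s - s0| ≤ l/2} := by
    refine (isCompact_closedBall s0 (l/2)).of_isClosed_subset ?_ fun s hs => by simpa [Real.dist_eq] using hs.2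
    have h1 : IsClosed {s : ℝ | ε ≤ |s - s0|} := isClosed_le continuous_const (by fun_prop)
    have h2 : IsClosed {s : ℝ | |s - s0| ≤ l/2} := isClosed_le (by fun_prop) continuous_const
    exact h1.inter h2
  have hc3 : ∃ c3 > 0, ∀ s ∈ {s : ℝ | ε ≤ |s - s0| ∧ |s - s0| ≤ l/2}, c3 ≤ ‖γ s - γ s0‖ := by
    rcases Set.eq_empty_or_nonempty {s : ℝ | ε ≤ |s - s0| ∧ |s - s0| ≤ l/2} with he | hne
    · exact ⟨1, one_pos, by rw [he]; simp⟩
    · obtain ⟨s, hs, hm⟩ := hcomp.exists_isMinOn hne (f := fun s => ‖γ s - γ s0‖)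
        ((h.cont.sub continuous_const).norm.continuousOn)
      refine ⟨_, norm_pos_iff.2 (sub_ne_zero.2 fun e => ?_), fun t ht => hm ht⟩
      have := h.inj s s0 (by linarith [hs.2]) e
      rw [this] at hs; simp at hs; linarith [hs.1]
  obtain ⟨c3, hc3, H3⟩ := hc3
  refine ⟨min (min c1 c2) (c3/l), lt_min (lt_min hc1 hc2) (by positivity), fun s hs => ?_⟩
  have k1 : min (min c1 c2) (c3/l) ≤ c1 := (min_le_left _ _).trans (min_le_left _ _)
  have k2 : min (min c1 c2) (c3/l) ≤ c2 := (min_le_left _ _).trans (min_le_right _ _)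
  have k3 : min (min c1 c2) (c3/l) ≤ c3/l := min_le_right _ _
  have e1 : ε ≤ ε1 := min_le_left _ _
  have e2 : ε ≤ ε2 := min_le_right _ _
  by_cases hlt : |s - s0| < ε
  · rcases le_total s0 s with hh | hh
    · rw [abs_of_nonneg (by linarith)] at hlt ⊢
      exact (mul_le_mul_of_nonneg_right k1 (by linarith)).trans (H1 s hh (by linarith))
    · rw [abs_of_nonpos (by linarith)] at hlt ⊢
      have := H2 (-s) (by linarith) (by linarith)
      rw [neg_neg] at this
      refine (mul_le_mul_of_nonneg_right k2 (by linarith)).trans (le_trans (le_of_eq (by ring)) this)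
  · refine (mul_le_mul k3 hs (abs_nonneg _) (by positivity)).trans ?_
    have := H3 s ⟨not_lt.1 hlt, hs⟩
    have e : c3 / l * (l/2) = c3/2 := by field_simp
    linarith
namespace CmCorner
variable {G : Set ℂ} {z0 e : ℂ} {θ : ℝ} {τ : Bool → ℂ → ℂ} {R c C ρ κ : ℝ} {D : Bool → ℂ}
theorem sin0 (K : CmCorner G z0 e θ τ R c C ρ κ D) : 0 < Real.sin θ := Real.sin_pos_of_mem_Ioo K.hθ
theorem e0 (K : CmCorner G z0 e θ τ R c C ρ κ D) : e ≠ 0 := by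
  have := K.e1; rintro rfl; simp at this
theorem cos1 (K : CmCorner G z0 e θ τ R c C ρ κ D) : Real.cos θ < 1 := by
  nlinarith [Real.sin_sq_add_cos_sq θ, K.sin0]
theorem cover (K : CmCorner G z0 e θ τ R c C ρ κ D) {η : ℝ} (hη : 0 < η) : ∃ m > 0, ∃ δ > 0, ∀ b, ∀ x : ℂ,
    x ≠ 0 → ‖x‖ < δ → 0 ≤ cmSg b * x.im → |x.re - Real.cos θ * ‖x‖| ≤ m * ‖x‖ →
    ∃ u ∈ ball (0:ℂ) R, ‖u - ‖x‖‖ ≤ η * ‖x‖ ∧ τ b u = z0 + e * x := by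
  have hs := K.sin0
  have hc := (K.P.g true).c0; have hC := (K.P.g true).C0; have hR := (K.P.g true).R0
  set s := Real.sin θ
  set co := Real.cos θ
  set m := c * η / 8 / (1 + 2/s) with hm
  have hm0 : 0 < m := by positivity
  have hmm : m + 2 * m / s = c * η / 8 := by rw [hm]; field_simp
  refine ⟨m, hm0, min (R/(1+η)) (c*η/(8*C)), lt_min (by positivity) (by positivity), fun b x hx hxδ hxb hxm => ?_⟩
  have hN := norm_pos_iff.2 hx
  set N := ‖x‖
  have n1 : N * (1 + η) < R := (lt_div_iff₀ (by positivity)).1 (hxδ.trans_le (min_le_left _ _))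
  have n2 : N * (8*C) < c*η := (lt_div_iff₀ (by positivity)).1 (hxδ.trans_le (min_le_right _ _))
  have hx2 : x.re^2 + x.im^2 = N^2 := by rw [← normSq_eq_norm_sq, normSq_apply]; ring
  set y := cmSg b * x.im
  have hy2 : y^2 = x.im^2 := by simp only [y]; linear_combination x.im^2 * cmSg_sq b
  have h1 : |y - s*N| * (s*N) ≤ (m*N) * (2*N) := by
    calc |y - s*N| * (s*N) ≤ |y - s*N| * |y + s*N| := by gcongr; exact le_trans (by linarith) (le_abs_self _)
      _ = |x.re - co*N| * |x.re + co*N| := by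
        rw [← abs_mul, ← abs_mul, ← abs_neg]; congr 1
        have : s^2 + co^2 = 1 := Real.sin_sq_add_cos_sq θ
        linear_combination -hy2 - hx2 + N^2 * this
      _ ≤ _ := by
        gcongr
        have a1 : |x.re| ≤ N := abs_re_le_norm x
        have a2 : |co*N| ≤ 1 * N := by rw [abs_mul, abs_of_pos hN]; gcongr; exact Real.abs_cos_le_one θ
        linarith [abs_add_le x.re (co*N)]
  have h2 : |y - s*N| ≤ 2*m/s*N := by
    rw [show 2*m/s*N = (m*N)*(2*N)/(s*N) by field_simp, le_div_iff₀ (by positivity)]; exact h1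
  set q := exp ((cmSg b * θ : ℝ) * I)
  have hqr : q.re = co := by
    simp only [q]; rw [exp_ofReal_mul_I_re]; cases b <;> simp [cmSg, co]
  have hqi : q.im = cmSg b * s := by
    simp only [q]; rw [exp_ofReal_mul_I_im]; cases b <;> simp [cmSg, s]
  have h3 : ‖x - q * N‖ ≤ c * η / 8 * N := by
    refine (norm_le_abs_re_add_abs_im _).trans ?_
    rw [sub_re, sub_im, re_mul_ofReal, im_mul_ofReal, hqr, hqi]
    have : |x.im - cmSg b * s * N| = |y - s*N| := by
      have : y - s * N = cmSg b * (x.im - cmSg b * s * N) := by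
        simp only [y]; linear_combination (s*N) * cmSg_sq b
      rw [this, abs_mul, cmSg_abs, one_mul]
    rw [this, ← hmm, add_mul]; linarith
  have hNb : (N:ℂ) ∈ ball (0:ℂ) R := cm_nb hN.le (by nlinarith)
  have h4 := (K.P.g b).q N hNb
  rw [K.hD, norm_real, Real.norm_of_nonneg hN.le] at h4
  have h5 : ‖z0 + e * x - τ b N‖ < c * (η * N) / 2 := by
    rw [show z0 + e * x - τ b N = e * (x - q * N) - (τ b N - z0 - e * q * N) by ring]
    refine (norm_sub_le _ _).trans_lt ?_
    rw [norm_mul, K.e1, one_mul]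
    nlinarith
  obtain ⟨u, hu, hue⟩ := (K.P.g b).op N (η*N) (by positivity) (fun v hv => by
    rw [mem_ball_zero_iff]
    have a1 : ‖v - N‖ ≤ η * N := by simpa [dist_eq_norm] using hv
    have a2 := norm_add_le (v - N) (N:ℂ)
    rw [sub_add_cancel, norm_real, Real.norm_of_nonneg hN.le] at a2
    linarith) (show z0 + e * x ∈ ball (τ b N) (c * (η*N)/2) by rwa [mem_ball, dist_eq_norm])
  refine ⟨u, ?_, by simpa [dist_eq_norm] using hu, hue⟩
  rw [mem_closedBall, dist_eq_norm] at hu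
  have a2 := norm_add_le (u - N) (N:ℂ)
  rw [sub_add_cancel, norm_real, Real.norm_of_nonneg hN.le] at a2
  rw [mem_ball_zero_iff]; linarith
theorem tb (K : CmCorner G z0 e θ τ R c C ρ κ D) {u : ℂ} {N : ℝ} (hN : 0 < N) (hu : ‖u - N‖ ≤ κ/4 * N) :
    |u.im| < κ * u.re := by
  have h1 := (abs_im_le_norm _).trans hu
  have h2 := (abs_le.1 ((abs_re_le_norm _).trans hu)).1
  simp at h1 h2
  have := K.κ0; have := K.κ1
  have : κ/4*N ≤ 1/4*N := by gcongr
  nlinarith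
theorem gf (K : CmCorner G z0 e θ τ R c C ρ κ D) : ∃ M > 0, ∃ δ > 0, ∀ b, ∀ x : ℂ, x ≠ 0 → ‖x‖ < δ →
    0 ≤ cmSg b * x.im → cmSg b * x.im * Real.cos θ - x.re * Real.sin θ < -M * ‖x‖^2 → z0 + e * x ∈ (closure G)ᶜ := by
  have hC := (K.P.g true).C0
  obtain ⟨m, hm, δ, hδ, H⟩ := K.cover (η := κ/4) (by have := K.κ0; linarith)
  obtain ⟨δA, hδA, HA⟩ := K.A m hm
  refine ⟨4*C, by positivity, min δ δA, lt_min hδ hδA, fun b x hx hxδ hxb hM => ?_⟩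
  have hN := norm_pos_iff.2 hx
  by_cases h1 : (Real.cos θ + m) * ‖x‖ < x.re
  · exact HA x hx (hxδ.trans_le (min_le_right _ _)) h1
  by_cases h2 : x.re < (Real.cos θ - m) * ‖x‖
  · exfalso
    set y : ℂ := ⟨x.re, cmSg b * x.im⟩
    have hyn : ‖y‖ = ‖x‖ := by
      rw [← sq_eq_sq₀ (norm_nonneg _) (norm_nonneg _), ← normSq_eq_norm_sq, ← normSq_eq_norm_sq, normSq_apply, normSq_apply]
      simp only [y]; linear_combination x.im^2 * cmSg_sq b
    have := (cm_rot (y := y) hxb (Ioo_subset_Icc_self K.hθ)).2 (by rw [hyn]; simp only [y]; nlinarith)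
    simp only [y] at this
    have : 0 ≤ 4*C*‖x‖^2 := by positivity
    linarith
  obtain ⟨u, hu, hun, hue⟩ := H b x hx (hxδ.trans_le (min_le_left _ _)) hxb (by
    rw [abs_le]; constructor <;> linarith)
  rw [← hue]
  refine (K.V b u hu (K.tb hN hun)).2 ?_
  have h4 := (K.P.g b).q u hu
  rw [K.hD] at h4
  set q := exp ((cmSg b * θ : ℝ) * I)
  have hqr : q.re = Real.cos θ := by
    simp only [q]; rw [exp_ofReal_mul_I_re]; cases b <;> simp [cmSg]
  have hqi : q.im = cmSg b * Real.sin θ := by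
    simp only [q]; rw [exp_ofReal_mul_I_im]; cases b <;> simp [cmSg]
  have hqn : ‖q‖ = 1 := norm_exp_ofReal_mul_I _
  have hqq : (starRingEnd ℂ) q * q = 1 := by rw [mul_comm, mul_conj, normSq_eq_norm_sq, hqn]; simp
  rw [hue, show z0 + e * x - z0 - e * q * u = e * (x - q * u) by ring, norm_mul, K.e1, one_mul] at h4
  have h5 : u = (starRingEnd ℂ) q * x - (starRingEnd ℂ) q * (x - q * u) := by linear_combination -u * hqq
  have h6 : ‖(starRingEnd ℂ) q * (x - q * u)‖ ≤ C * ‖u‖^2 := by rw [norm_mul, norm_conj, hqn, one_mul]; exact h4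
  have h7 : cmSg b * u.im = (cmSg b * x.im * Real.cos θ - x.re * Real.sin θ) -
      cmSg b * ((starRingEnd ℂ) q * (x - q * u)).im := by
    conv_lhs => rw [h5]
    rw [sub_im, mul_im, conj_re, conj_im, hqr, hqi]
    linear_combination -x.re * Real.sin θ * cmSg_sq b
  have h8 : |cmSg b * ((starRingEnd ℂ) q * (x - q * u)).im| ≤ C * ‖u‖^2 := by
    rw [abs_mul, cmSg_abs, one_mul]; exact (abs_im_le_norm _).trans h6
  have h9 : ‖u‖ ≤ 2 * ‖x‖ := by
    have a2 := norm_add_le (u - ‖x‖) (‖x‖:ℂ)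
    rw [sub_add_cancel, norm_real, norm_norm] at a2
    have := K.κ1; nlinarith
  have h10 : C * ‖u‖^2 ≤ C * (2*‖x‖)^2 := by gcongr
  rw [h7]; have := (abs_le.1 h8).1
  nlinarith
theorem lens (K : CmCorner G z0 e θ τ R c C ρ κ D) : ∃ a0 > 0, ∀ a : ℝ, 0 < a → a < a0 → z0 + e * a ∈ (closure G)ᶜ ∧
    ∀ w : ℂ, w ≠ 0 → Real.cos θ * ‖w‖ ≤ w.re → 1 + w ≠ 0 ∧ z0 + e * (a * w / (1 + w)) ∈ (closure G)ᶜ := by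
  obtain ⟨M, hM, δ, hδ, H⟩ := K.gf
  have hs := K.sin0
  refine ⟨min (δ * Real.sin θ) (Real.sin θ / M), lt_min (by positivity) (by positivity), fun a ha ha0 => ?_⟩
  have a1 := ha0.trans_le (min_le_left _ _)
  have a2 : a * M < Real.sin θ := (lt_div_iff₀ hM).1 (ha0.trans_le (min_le_right _ _))
  constructor
  · refine H true a (by exact_mod_cast ha.ne') ?_ (by simp) ?_
    · rw [norm_real, Real.norm_of_nonneg ha.le]; nlinarith [Real.sin_le_one θ]
    · rw [norm_real, Real.norm_of_nonneg ha.le]; simp; nlinarith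
  · intro w hw hwr
    have hwn := norm_pos_iff.2 hw
    have hsc := Real.sin_sq_add_cos_sq θ
    have hns : ‖1 + w‖^2 = 1 + 2 * w.re + ‖w‖^2 := by
      rw [← normSq_eq_norm_sq, ← normSq_eq_norm_sq, normSq_apply, normSq_apply]; simp; ring
    have h1 : (Real.sin θ * ‖w‖)^2 ≤ ‖1 + w‖^2 := by
      rw [hns]; nlinarith [sq_nonneg (1 + Real.cos θ * ‖w‖)]
    have h2 : Real.sin θ * ‖w‖ ≤ ‖1 + w‖ := le_of_sq_le_sq h1 (norm_nonneg _)
    have h3 : 0 < ‖1 + w‖ := lt_of_lt_of_le (by positivity) h2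
    have h4 : 1 + w ≠ 0 := norm_pos_iff.1 h3
    refine ⟨h4, ?_⟩
    obtain ⟨b, hb⟩ := cmSg_ex w.im
    have hac : (a:ℂ) ≠ 0 := by exact_mod_cast ha.ne'
    have hxn : ‖(a:ℂ) * w / (1 + w)‖ = a * ‖w‖ / ‖1 + w‖ := by
      rw [norm_div, norm_mul, norm_real, Real.norm_of_nonneg ha.le]
    have hx : (a:ℂ) * w / (1 + w) = ((a / ‖1 + w‖^2 : ℝ) : ℂ) * (w + (‖w‖^2 : ℝ)) := by
      rw [← normSq_eq_norm_sq, ← normSq_eq_norm_sq]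
      push_cast; rw [← mul_conj, ← mul_conj]
      have : (starRingEnd ℂ) (1 + w) ≠ 0 := (map_ne_zero _).2 h4
      field_simp
      rw [map_add, map_one]
    set x := (a:ℂ) * w / (1 + w)
    have hxr : x.re = a / ‖1 + w‖^2 * (w.re + ‖w‖^2) := by rw [hx, re_ofReal_mul, add_re, ofReal_re]
    have hxi : x.im = a / ‖1 + w‖^2 * w.im := by rw [hx, im_ofReal_mul, add_im, ofReal_im, add_zero]
    have hp : 0 < a / ‖1 + w‖^2 := by positivity
    refine H b x (by simp only [x]; exact div_ne_zero (mul_ne_zero hac hw) h4) ?_ ?_ ?_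
    · rw [hxn, div_lt_iff₀ h3]; nlinarith
    · rw [hxi, show cmSg b * (a / ‖1 + w‖^2 * w.im) = a / ‖1 + w‖^2 * (cmSg b * w.im) by ring]; positivity
    · set y : ℂ := ⟨w.re, cmSg b * w.im⟩
      have hyn : ‖y‖ = ‖w‖ := by
        rw [← sq_eq_sq₀ (norm_nonneg _) (norm_nonneg _), ← normSq_eq_norm_sq, ← normSq_eq_norm_sq, normSq_apply, normSq_apply]
        simp only [y]; linear_combination w.im^2 * cmSg_sq b
      have h5 := (cm_rot (y := y) hb (Ioo_subset_Icc_self K.hθ)).1 (by rw [hyn]; exact hwr)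
      simp only [y] at h5
      rw [hxi, hxr, hxn]
      have e1 : -M * (a * ‖w‖ / ‖1 + w‖)^2 = a / ‖1 + w‖^2 * (-(a * M) * ‖w‖^2) := by field_simp
      have e2 : cmSg b * (a / ‖1 + w‖^2 * w.im) * Real.cos θ - a / ‖1 + w‖^2 * (w.re + ‖w‖^2) * Real.sin θ =
        a / ‖1 + w‖^2 * (cmSg b * w.im * Real.cos θ - w.re * Real.sin θ - Real.sin θ * ‖w‖^2) := by ring
      rw [e1, e2]
      refine mul_lt_mul_of_pos_left ?_ hp
      have : a * M * ‖w‖^2 < Real.sin θ * ‖w‖^2 := by gcongr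
      linarith
theorem sector (K : CmCorner G z0 e θ τ R c C ρ κ D) {η : ℝ} (hη : 0 < η) : ∃ m > 0, ∃ δ > 0, ∀ x : ℂ, x ≠ 0 →
    ‖x‖ < δ → |x.re - Real.cos θ * ‖x‖| ≤ m * ‖x‖ → ∃ z ∈ frontier G, ‖z0 + e * x - z‖ ≤ η * ‖x‖ ∧ ‖x‖ ≤ 2 * ‖z - z0‖ := by
  have hC := (K.P.g true).C0
  obtain ⟨m, hm, δ, hδ, H⟩ := K.cover (η := η/C) (by positivity)
  refine ⟨m, hm, min δ R, lt_min hδ (K.P.g true).R0, fun x hx hxδ hxm => ?_⟩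
  have hN := norm_pos_iff.2 hx
  obtain ⟨b, hb⟩ := cmSg_ex x.im
  obtain ⟨u, hu, hun, hue⟩ := H b x hx (hxδ.trans_le (min_le_left _ _)) hb hxm
  have hNR := hxδ.trans_le (min_le_right _ _)
  refine ⟨τ b ‖x‖, (K.P.g b).hL _ hN.le hNR, ?_, ?_⟩
  · rw [← hue]
    refine ((K.P.g b).up u hu _ (cm_nb hN.le hNR)).trans ?_
    have := mul_le_mul_of_nonneg_left hun hC.le
    rwa [show C * (η / C * ‖x‖) = η * ‖x‖ by field_simp] at this
  · have := ((K.P.g b).half (cm_nb hN.le hNR)).1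
    rwa [norm_real, norm_norm] at this
theorem chart (K : CmCorner G z0 e θ τ R c C ρ κ D) : ∃ c' > 0, ∃ ρ' > 0, ∀ z ∈ frontier G, z ≠ z0 →
    ‖z - z0‖ < ρ' → ∃ σ R', CmChart G z σ R' (c' * ‖z - z0‖) ∧ σ '' ball 0 R' ⊆ ball z (‖z - z0‖/2) := by
  have hC := (K.P.g true).C0; have hc := (K.P.g true).c0; have hR := (K.P.g true).R0; have hκ := K.κ0
  set k := min (κ/4) (1/(5*C))
  have hk : 0 < k := lt_min (by linarith) (by positivity)
  have hk1 : k ≤ κ/4 := min_le_left _ _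
  have hk2 : C * k ≤ 1/5 := (mul_le_mul_of_nonneg_left (min_le_right _ (1/(5*C))) hC.le).trans (le_of_eq (by field_simp))
  have hk3 : k ≤ 1/4 := by have := K.κ1; linarith
  refine ⟨c*k/6, by positivity, min ρ (R/4), lt_min K.P.ρ0 (by linarith), fun z hz hne hd => ?_⟩
  obtain ⟨b, v, hv, hvR, rfl⟩ := K.P.cov z hz (hd.trans_le (min_le_left _ _))
  have g := K.P.g b
  obtain ⟨h1, h2, -⟩ := g.half (cm_nb hv hvR)
  rw [norm_real, Real.norm_of_nonneg hv] at h1 h2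
  have hv0 : 0 < v := lt_of_le_of_ne hv (by rintro rfl; exact hne (by simpa using g.z))
  have hv2 : v < R/2 := by linarith [hd.trans_le (min_le_right _ _)]
  have hsc : (cmSg b : ℂ) * cmSg b = 1 := by exact_mod_cast cmSg_sq b
  have hsn : ‖(cmSg b : ℂ)‖ = 1 := by rw [norm_real, Real.norm_eq_abs, cmSg_abs]
  have hmap : ∀ u ∈ ball (0:ℂ) (k*v), (v:ℂ) + cmSg b * u ∈ ball (0:ℂ) R := fun u hu => by
    rw [mem_ball_zero_iff] at hu ⊢
    refine (norm_add_le _ _).trans_lt ?_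
    rw [norm_mul, hsn, one_mul, norm_real, Real.norm_of_nonneg hv]; nlinarith
  refine ⟨fun u => τ b (v + cmSg b * u), k*v, ⟨by positivity, ?_, g.hd.comp (by fun_prop) hmap, ?_, by simp, ?_, ?_⟩, ?_⟩
  · have := norm_pos_iff.2 (sub_ne_zero.2 hne); positivity
  · intro u hu u' hu' he
    have := add_left_cancel (g.hi (hmap u hu) (hmap u' hu') he)
    calc u = cmSg b * (cmSg b * u) := by rw [← mul_assoc, hsc, one_mul]
      _ = u' := by rw [this, ← mul_assoc, hsc, one_mul]
  · intro w hw
    have hw2 : w ∈ ball (τ b v) (c * (k*v/2)/2) := by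
      rw [mem_ball] at hw ⊢; refine hw.trans_le ?_
      have := mul_le_mul_of_nonneg_left h2 (show 0 ≤ c*k/6 by positivity); linarith
    obtain ⟨u, hu, rfl⟩ := g.op v (k*v/2) (by positivity) (fun x hx => by
      have a1 : ‖x - v‖ ≤ k*v/2 := by simpa [dist_eq_norm] using hx
      have a2 := norm_add_le (x - v) (v:ℂ)
      rw [sub_add_cancel, norm_real, Real.norm_of_nonneg hv] at a2
      rw [mem_ball_zero_iff]; nlinarith) hw2
    refine ⟨cmSg b * (u - v), ?_, ?_⟩
    · rw [mem_ball_zero_iff, norm_mul, hsn, one_mul]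
      rw [mem_closedBall, dist_eq_norm] at hu; nlinarith [mul_pos hk hv0]
    · simp only; congr 1; linear_combination (u - v) * hsc
  · intro u hu
    have hub := hmap u hu
    have hun := mem_ball_zero_iff.1 hu
    have him : ((v:ℂ) + cmSg b * u).im = cmSg b * u.im := by simp
    have htb := K.tb (u := v + cmSg b * u) hv0 (by
      rw [add_sub_cancel_left, norm_mul, hsn, one_mul]; nlinarith)
    have hsg : cmSg b * (cmSg b * u.im) = u.im := by rw [← mul_assoc, cmSg_sq, one_mul]
    have hV := K.V b _ hub htb
    rw [him, hsg] at hV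
    refine ⟨hV.1, fun h => ?_, hV.2⟩
    have hre : (v:ℂ) + cmSg b * u = ((v + cmSg b * u.re : ℝ) : ℂ) := by
      apply Complex.ext <;> simp [h]
    have hpos : 0 ≤ v + cmSg b * u.re := by
      have a1 : |cmSg b * u.re| ≤ ‖u‖ := by rw [abs_mul, cmSg_abs, one_mul]; exact abs_re_le_norm u
      have := (abs_le.1 a1).1; nlinarith
    show τ b (v + cmSg b * u) ∈ _
    rw [hre] at hub ⊢
    rw [mem_ball_zero_iff, norm_real, Real.norm_of_nonneg hpos] at hub
    exact g.hL _ hpos hub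
  · rintro _ ⟨u, hu, rfl⟩
    have h3 := g.up _ (hmap u hu) _ (cm_nb hv hvR)
    rw [add_sub_cancel_left, norm_mul, hsn, one_mul] at h3
    rw [mem_ball, dist_eq_norm]
    have hun := mem_ball_zero_iff.1 hu
    have : C * ‖u‖ ≤ C * (k * v) := by gcongr
    simp only; nlinarith
theorem lc (K : CmCorner G z0 e θ τ R c C ρ κ D) (hG : IsOpen G) : CmLC G z0 := by
  have hκ := K.κ0; have hc1 := K.cos1
  obtain ⟨m0, hm0, δ, hδ, H⟩ := K.cover (η := κ/4) (by linarith)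
  set co := Real.cos θ
  have hco : -1 ≤ co := Real.neg_one_le_cos θ
  set m := min m0 ((1 - co)/2)
  have hm : 0 < m := lt_min hm0 (by linarith)
  have hmm : m ≤ m0 := min_le_left _ _
  have hm1 : m ≤ (1 - co)/2 := min_le_right _ _
  obtain ⟨δA, hδA, HA⟩ := K.A (m/2) (by linarith)
  obtain ⟨δB, hδB, HB⟩ := K.B m hm
  set d := min δ (min δA δB)
  have hd : 0 < d := lt_min hδ (lt_min hδA hδB)
  have d1 : d ≤ δ := min_le_left _ _
  have d2 : d ≤ δA := (min_le_right _ _).trans (min_le_left _ _)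
  have d3 : d ≤ δB := (min_le_right _ _).trans (min_le_right _ _)
  set T : Bool → Set ℂ := fun b => τ b '' ({u : ℂ | u ∈ ball (0:ℂ) R ∧ |u.im| < κ * u.re} ∩ {u | cmSg b * u.im < 0})
  set A := (fun x => z0 + e * x) '' {x : ℂ | 0 < ‖x‖ ∧ ‖x‖ < d ∧ (co + m/2) * ‖x‖ < x.re}
  have hT : ∀ b, IsPreconnected (T b) := fun b => by
    refine ((cm_Vset κ R).2.inter (convex_halfSpace_lt (f := fun u : ℂ => cmSg b * u.im) ⟨fun x y => by simp; ring, fun a x => by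
      simp; ring⟩ 0)).isPreconnected.image _ ((K.P.g b).hd.continuousOn.mono fun u hu => hu.1.1)
  have hA : IsPreconnected A := (cm_cone_conn ⟨by linarith, by linarith⟩).image _ (by fun_prop)
  have hTE : ∀ b, T b ⊆ (closure G)ᶜ := by
    rintro b _ ⟨u, hu, rfl⟩; exact (K.V b u hu.1.1 hu.1.2).2 hu.2
  have hAE : A ⊆ (closure G)ᶜ := by
    rintro _ ⟨x, ⟨h1, h2, h3⟩, rfl⟩; exact HA x (norm_pos_iff.1 h1) (h2.trans_le d2) h3
  have hin : ∀ b, ∀ x : ℂ, x ≠ 0 → ‖x‖ < d → 0 ≤ cmSg b * x.im → |x.re - co * ‖x‖| ≤ m * ‖x‖ →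
      z0 + e * x ∈ (closure G)ᶜ → z0 + e * x ∈ T b := by
    intro b x hx hxd hxb hxm hE
    obtain ⟨u, hu, hun, hue⟩ := H b x hx (hxd.trans_le d1) hxb (hxm.trans (by gcongr))
    have htb := K.tb (norm_pos_iff.2 hx) hun
    refine ⟨u, ⟨⟨hu, htb⟩, ?_⟩, hue⟩
    rw [← hue] at hE
    show cmSg b * u.im < 0
    by_contra hcon
    rcases (not_lt.1 hcon).eq_or_lt with h | h
    · have h0 : u.im = 0 := by
        have := cmSg_sq b; rcases mul_eq_zero.1 h.symm with h | h
        · rw [h] at this; simp at this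
        · exact h
      have hre : u = (u.re : ℂ) := by apply Complex.ext <;> simp [h0]
      rw [h0, abs_zero] at htb
      have hp : 0 ≤ u.re := by nlinarith
      refine hE (frontier_subset_closure ?_)
      rw [hre]; exact (K.P.g b).hL _ hp ((re_le_norm u).trans_lt (mem_ball_zero_iff.1 hu))
    · exact hE (subset_closure ((K.V b u hu htb).1 h))
  have hne : ∀ b, (A ∩ T b).Nonempty := by
    intro b
    set k := co + 3*m/4
    have hk : k^2 ≤ 1 := by
      have : |k| ≤ 1 := abs_le.2 ⟨by simp only [k]; linarith, by simp only [k]; linarith⟩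
      rw [← sq_abs]; nlinarith [abs_nonneg k]
    set x : ℂ := (d/2 : ℝ) * (⟨k, cmSg b * Real.sqrt (1 - k^2)⟩ : ℂ)
    have hxn : ‖x‖ = d/2 := by
      have : ‖(⟨k, cmSg b * Real.sqrt (1 - k^2)⟩ : ℂ)‖ = 1 := by
        rw [← pow_eq_one_iff_of_nonneg (norm_nonneg _) two_ne_zero, ← normSq_eq_norm_sq, normSq_apply]
        have := Real.mul_self_sqrt (show 0 ≤ 1 - k^2 by linarith)
        simp only; linear_combination (Real.sqrt (1 - k^2))^2 * cmSg_sq b + this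
      simp only [x]; rw [norm_mul, this, norm_real, Real.norm_of_nonneg (by linarith), mul_one]
    have hxr : x.re = d/2 * k := by simp only [x]; rw [re_ofReal_mul]
    have hxi : cmSg b * x.im = d/2 * Real.sqrt (1 - k^2) := by
      simp only [x]; rw [im_ofReal_mul]; linear_combination d/2 * Real.sqrt (1 - k^2) * cmSg_sq b
    have hxA : z0 + e * x ∈ A := ⟨x, ⟨by rw [hxn]; linarith, by rw [hxn]; linarith, by
      rw [hxn, hxr]; simp only [k]; nlinarith⟩, rfl⟩
    refine ⟨_, hxA, hin b x (norm_pos_iff.1 (by rw [hxn]; linarith)) (by rw [hxn]; linarith)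
      (by rw [hxi]; positivity) ?_ (hAE hxA)⟩
    rw [hxn, hxr, show d/2*k - co*(d/2) = 3*m/4*(d/2) by simp only [k]; ring, abs_of_nonneg (by positivity)]
    nlinarith
  refine ⟨ball z0 d, ball_mem_nhds _ hd, (A ∪ T true) ∪ T false,
    (hA.union' (hne true) (hT true)).union' ?_ (hT false), ?_, ?_⟩
  · obtain ⟨x, h1, h2⟩ := hne false; exact ⟨x, Or.inl h1, h2⟩
  · exact union_subset (union_subset hAE (hTE _)) (hTE _)
  · rintro z ⟨hz, hzE⟩
    set x := (z - z0) / e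
    have hxz : z0 + e * x = z := by have := K.e0; simp only [x]; field_simp; ring
    have hxn : ‖x‖ < d := by simp only [x]; rw [norm_div, K.e1, div_one, ← dist_eq_norm]; exact hz
    have hx0 : x ≠ 0 := by
      intro h; rw [h, mul_zero, add_zero] at hxz; rw [← hxz] at hzE
      have := (K.P.g true).hL 0 le_rfl (K.P.g true).R0
      rw [ofReal_zero, (K.P.g true).z] at this
      exact hzE (frontier_subset_closure this)
    by_cases h1 : (co + m/2) * ‖x‖ < x.re
    · exact Or.inl (Or.inl ⟨x, ⟨norm_pos_iff.2 hx0, hxn, h1⟩, hxz⟩)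
    by_cases h2 : x.re < (co - m) * ‖x‖
    · have := HB (-x) (neg_ne_zero.2 hx0) (by rw [norm_neg]; linarith) (by rw [norm_neg, neg_re]; linarith)
      rw [neg_mul_neg, hxz] at this
      exact absurd (subset_closure this) hzE
    obtain ⟨b, hb⟩ := cmSg_ex x.im
    have hN := norm_pos_iff.2 hx0
    have := hin b x hx0 hxn hb (by rw [abs_le]; constructor <;> nlinarith) (by rwa [hxz])
    rw [hxz] at this
    cases b
    · exact Or.inr this
    · exact Or.inl (Or.inr this)
end CmCorner
structure CmPt (G : Set ℂ) (z0 e : ℂ) (lam a : ℝ) : Prop where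
  e1 : ‖e‖ = 1
  hl : lam ∈ Ioo (0:ℝ) 2
  a0 : 0 < a
  ext : z0 + e * a ∈ (closure G)ᶜ
  lens : ∀ w : ℂ, w ≠ 0 → Real.cos (lam * Real.pi / 2) * ‖w‖ ≤ w.re → 1 + w ≠ 0 ∧ z0 + e * (a * w / (1 + w)) ∈ (closure G)ᶜ
  sec : ∀ η > 0, ∃ m > 0, ∃ δ > 0, ∀ x : ℂ, x ≠ 0 → ‖x‖ < δ → |x.re - Real.cos (lam * Real.pi / 2) * ‖x‖| ≤ m * ‖x‖ →
    ∃ z ∈ frontier G, ‖z0 + e * x - z‖ ≤ η * ‖x‖ ∧ ‖x‖ ≤ 2 * ‖z - z0‖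
  chart : ∃ c' > 0, ∃ ρ' > 0, ∀ z ∈ frontier G, z ≠ z0 →
    ‖z - z0‖ < ρ' → ∃ σ R', CmChart G z σ R' (c' * ‖z - z0‖) ∧ σ '' ball 0 R' ⊆ ball z (‖z - z0‖/2)
  A : CmCone (closure G)ᶜ z0 e (Real.cos (lam * Real.pi / 2))
  B : CmCone G z0 (-e) (-Real.cos (lam * Real.pi / 2))
structure CmDom (G E : Set ℂ) (l : ℝ) (γ : ℝ → ℂ) (lam a : ℂ → ℝ) (e : ℂ → ℂ) : Prop where
  o : IsOpen G
  b : Bornology.IsBounded G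
  cn : IsConnected G
  sc : SimplyConnectedSpace G
  cv : CmCurve (frontier G) E l γ
  EL : E ⊆ frontier G
  pt : ∀ z ∈ E, CmPt G z (e z) (lam z) (a z)
  smooth : ∀ z ∈ frontier G, z ∉ E → ∃ τ R r, CmChart G z τ R r
  ext : IsPreconnected (closure G)ᶜ
theorem cm_ext_conn {G L : Set ℂ} (hG : IsOpen G) (hne : G.Nonempty) (hL : IsPreconnected L) (hLe : L = frontier G)
    (h : ∀ z ∈ L, CmLC G z ∧ z ∈ closure (closure G)ᶜ) : IsPreconnected (closure G)ᶜ := by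
  intro u v hu hv huv hau hbv
  by_contra hcon
  set X := (closure G)ᶜ
  have hX : IsOpen X := isClosed_closure.isOpen_compl
  have hd : ∀ p ∈ X, p ∈ u → p ∈ v → False := fun p h1 h2 h3 => hcon ⟨p, h1, h2, h3⟩
  have key : ∀ A B : Set ℂ, IsOpen A → (X ∩ A).Nonempty → X ⊆ A ∪ B → IsOpen B → (∀ p ∈ X, p ∈ A → p ∈ B → False) →
      ∃ z ∈ L, ¬ ∃ O ∈ 𝓝 z, O ∩ X ⊆ B := by
    intro A B hA hAn hAB hB hdd
    by_contra! hall
    have hcl : IsClosed (X ∩ A) := by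
      refine isClosed_of_closure_subset fun p hp => ?_
      by_contra hpA
      by_cases hpX : p ∈ X
      · have hpB : p ∈ B := (hAB hpX).resolve_left fun h => hpA ⟨hpX, h⟩
        obtain ⟨q, ⟨hq1, hq2⟩, hq3, hq4⟩ := mem_closure_iff.1 hp (X ∩ B) (hX.inter hB) ⟨hpX, hpB⟩
        exact hdd q hq3 hq4 hq2
      · have hpL : p ∈ L := by
          rw [hLe, hG.frontier_eq]
          refine ⟨not_not.1 hpX, fun hpG => ?_⟩
          obtain ⟨q, hq1, hq2, hq3⟩ := mem_closure_iff.1 hp G hG hpG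
          exact hq2 (subset_closure hq1)
        obtain ⟨O, hO, hOB⟩ := hall p hpL
        obtain ⟨q, hq1, hq2, hq3⟩ := mem_closure_iff_nhds.1 hp O hO
        exact hdd q hq2 hq3 (hOB ⟨hq1, hq2⟩)
    have hu := IsClopen.eq_univ ⟨hcl, hX.inter hA⟩ hAn
    obtain ⟨g, hg⟩ := hne
    exact ((hu ▸ mem_univ g : g ∈ X ∩ A).1) (subset_closure hg)
  have hop : ∀ B : Set ℂ, IsOpen {z | ∃ O ∈ 𝓝 z, O ∩ X ⊆ B} := fun B => by
    refine isOpen_iff_mem_nhds.2 fun z ⟨O, hO, hOB⟩ => ?_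
    filter_upwards [eventually_mem_nhds_iff.2 hO] with y hy using ⟨O, hy, hOB⟩
  have hdi : ∀ z ∈ L, (∃ O ∈ 𝓝 z, O ∩ X ⊆ u) ∨ (∃ O ∈ 𝓝 z, O ∩ X ⊆ v) := by
    intro z hz
    obtain ⟨⟨O, hO, S, hS, hSX, hOS⟩, -⟩ := h z hz
    rcases IsPreconnected.subset_or_subset (hu.inter hX) (hv.inter hX) (disjoint_left.2 fun p h1 h2 => hd p h1.2 h1.1 h2.1)
      (fun p hp => (huv (hSX hp)).imp (⟨·, hSX hp⟩) (⟨·, hSX hp⟩)) hS with h | h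
    · exact Or.inl ⟨O, hO, hOS.trans (h.trans inter_subset_left)⟩
    · exact Or.inr ⟨O, hO, hOS.trans (h.trans inter_subset_left)⟩
  obtain ⟨z1, hz1, h1⟩ := key u v hu hau huv hv hd
  obtain ⟨z2, hz2, h2⟩ := key v u hv hbv (by rwa [union_comm]) hu fun p a b c => hd p a c b
  obtain ⟨z, hz, ⟨O1, hO1, hs1⟩, O2, hO2, hs2⟩ := hL _ _ (hop u) (hop v) hdi ⟨z1, hz1, (hdi z1 hz1).resolve_right h1⟩
    ⟨z2, hz2, (hdi z2 hz2).resolve_left h2⟩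
  obtain ⟨q, ⟨hq1, hq2⟩, hq3⟩ := mem_closure_iff_nhds.1 (h z hz).2 _ (inter_mem hO1 hO2)
  exact hd q hq3 (hs1 ⟨hq1, hq3⟩) (hs2 ⟨hq2, hq3⟩)
theorem cm_dom (D : JordanDomain) (B : PiecewiseAnalyticBoundary D) (hc : CmConf D.G) :
    ∃ (E : Set ℂ) (lam a : ℂ → ℝ) (e : ℂ → ℂ), CmDom D.G E D.l D.γ lam a e ∧ ∀ z ∈ E, ∃ i, lam z = B.extAngle i := by
  set E : Set ℂ := range fun i => B.τ i 1
  have hL : ∀ i, ∀ t ∈ Icc (0:ℝ) 1, B.τ i t ∈ frontier D.G := fun i t ht => by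
    rw [← B.cover]; exact mem_iUnion.2 ⟨i, _, ⟨t, ht, rfl⟩, rfl⟩
  have hEL : E ⊆ frontier D.G := by rintro _ ⟨i, rfl⟩; simpa using hL i 1 (by simp)
  have hmod : ∀ s : ℝ, ∃ k : ℤ, s - k * D.l ∈ Ico 0 D.l := fun s => by
    obtain ⟨k, hk, -⟩ := existsUnique_sub_zsmul_mem_Ico D.l_pos s 0
    exact ⟨k, by simpa using hk⟩
  have hper : ∀ (s : ℝ) (k : ℤ), D.γ (s - k * D.l) = D.γ s := fun s k => D.γ_periodic.sub_int_mul_eq k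
  have cv : CmCurve (frontier D.G) E D.l D.γ :=
    { lpos := D.l_pos, cont := D.γ_cont, per := D.γ_periodic
      inj := fun s t hst he => by
        obtain ⟨k, hk⟩ := hmod s; obtain ⟨j, hj⟩ := hmod t
        have := D.γ_injOn hk hj (by rw [hper, hper, he])
        have h2 : s - t = ((k - j : ℤ) : ℝ) * D.l := by push_cast; linarith
        rw [h2, abs_mul, abs_of_pos D.l_pos] at hst
        have h3 : |((k - j : ℤ):ℝ)| < 1 := by
          by_contra h; push Not at h; nlinarith [D.l_pos]
        have h4 : k - j = 0 := by rw [← Int.cast_abs] at h3; exact Int.abs_lt_one_iff.1 (by exact_mod_cast h3)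
        rw [h4] at h2; simp at h2; linarith
      mem := fun z => by
        rw [← D.γ_boundary]
        refine ⟨fun ⟨s, _, h⟩ => ⟨s, h⟩, fun ⟨s, h⟩ => ?_⟩
        obtain ⟨k, hk⟩ := hmod s
        exact ⟨_, hk, by rw [hper, h]⟩
      fin := finite_range _, speed := D.γ_unitSpeed
      arc := fun z hz => by
        rw [← B.cover] at hz
        obtain ⟨i, _, ⟨t, ht, rfl⟩, rfl⟩ := mem_iUnion.1 hz
        refine ⟨B.τ i, B.U i, B.U_open i, fun t ht => B.seg_sub i ⟨t, ht, rfl⟩, B.analytic i, B.inj i, hL i, ?_, ⟨i, rfl⟩, t, ht, rfl⟩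
        have hm := B.m_pos
        have hi := i.2
        refine ⟨⟨(i.1 + (B.m - 1)) % B.m, Nat.mod_lt _ hm⟩, ?_⟩
        show B.τ _ 1 = _
        rw [B.junction]; congr 1; apply Fin.ext
        show ((i.1 + (B.m - 1)) % B.m + 1) % B.m = i.1
        rw [Nat.mod_add_mod, show i.1 + (B.m - 1) + 1 = i.1 + B.m by omega, Nat.add_mod_right, Nat.mod_eq_of_lt hi] }
  have hK : ∀ z : ℂ, ∃ lam : ℝ, z ∈ E → (∃ i, lam = B.extAngle i) ∧ ∃ e τ R c C ρ κ D', CmCorner D.G z e (lam * Real.pi / 2) τ R c C ρ κ D' := by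
    intro z
    by_cases hz : z ∈ E
    · obtain ⟨i, rfl⟩ := hz
      obtain ⟨s, hs⟩ := (cv.mem _).1 (hEL ⟨i, rfl⟩)
      refine ⟨B.extAngle i, fun _ => ⟨⟨i, rfl⟩, ?_⟩⟩
      have := B.extAngle_spec i
      simp only at hs ⊢
      rw [← hs] at this ⊢
      exact cm_corner D.isOpen hc cv s (B.extAngle_mem i) this
    · exact ⟨0, fun h => absurd h hz⟩
  choose lam hlam using hK
  have hpt : ∀ z, ∃ (e : ℂ) (a : ℝ), z ∈ E → CmPt D.G z e (lam z) a := by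
    intro z
    by_cases hz : z ∈ E
    · obtain ⟨⟨i, hi⟩, e, τ, R, c, C, ρ, κ, D', K⟩ := hlam z hz
      obtain ⟨a0, ha0, H⟩ := K.lens
      obtain ⟨h1, h2⟩ := H (a0/2) (by linarith) (by linarith)
      exact ⟨e, a0/2, fun _ => ⟨K.e1, hi ▸ B.extAngle_mem i, by linarith, h1, h2, fun η hη => K.sector hη, K.chart, K.A, K.B⟩⟩
    · exact ⟨0, 0, fun h => absurd h hz⟩
  choose e a hpt using hpt
  have hsm : ∀ z ∈ frontier D.G, z ∉ E → ∃ τ R r, CmChart D.G z τ R r := fun z hz hzE => by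
    obtain ⟨s, rfl⟩ := (cv.mem _).1 hz
    exact cm_smooth_chart D.isOpen hc cv hzE
  refine ⟨E, lam, a, e, ⟨D.isOpen, D.bounded, D.connected, D.simplyConnected, cv, hEL, hpt, hsm, ?_⟩, fun z hz => (hlam z hz).1⟩
  have hLr : frontier D.G = range D.γ := by ext z; exact cv.mem z
  refine cm_ext_conn D.isOpen D.nonempty (L := frontier D.G) (hLr ▸ isPreconnected_range D.γ_cont) rfl fun z hz => ?_
  by_cases hzE : z ∈ E
  · obtain ⟨-, e, τ, R, c, C, ρ, κ, D', K⟩ := hlam z hzE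
    refine ⟨K.lc D.isOpen, ?_⟩
    have hc1 := K.cos1
    obtain ⟨δ, hδ, H⟩ := K.A ((1 - Real.cos (lam z * Real.pi / 2))/2) (by linarith)
    refine mem_closure_of_tendsto (b := 𝓝[>] (0:ℝ)) (f := fun t : ℝ => z + e * t)
      (tendsto_nhdsWithin_of_tendsto_nhds (Continuous.tendsto' (by fun_prop) _ _ (by simp))) ?_
    filter_upwards [Ioo_mem_nhdsGT hδ] with t ht
    refine H t (by exact_mod_cast ht.1.ne') (by simpa [abs_of_pos ht.1] using ht.2) ?_
    simp only [norm_real, Real.norm_eq_abs, abs_of_pos ht.1, ofReal_re]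
    nlinarith [ht.1]
  · obtain ⟨τ, R, r, h⟩ := hsm z hz hzE
    refine ⟨h.lc, ?_⟩
    obtain ⟨hR, hr, hd, hi, hz, hb, hu⟩ := h
    have hca := ((hd.differentiableAt (ball_mem_nhds _ hR)).continuousAt (x := 0))
    refine mem_closure_of_tendsto (b := 𝓝[>] (0:ℝ)) (f := fun t : ℝ => τ (-(t * I)))
      (tendsto_nhdsWithin_of_tendsto_nhds ?_) ?_
    · rw [← hz]; exact hca.tendsto.comp (Continuous.tendsto' (by fun_prop) _ _ (by simp))
    filter_upwards [Ioo_mem_nhdsGT hR] with t ht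
    exact (hu _ (by simpa [abs_of_pos ht.1] using ht.2)).2.2 (by simpa using ht.1)
theorem cm_cs {α : Type*} [MeasurableSpace α] {μ : Measure α} {k u : α → ℂ} {Q B : ℝ} (hQ : 0 < Q) (hB : 0 < B)
    (hk : AEStronglyMeasurable k μ) (hu : AEStronglyMeasurable u μ) (ik : Integrable (fun s => ‖k s‖^2) μ)
    (iu : Integrable (fun s => ‖u s‖^2) μ) (bk : ∫ s, ‖k s‖^2 ∂μ ≤ Q^2) (bu : ∫ s, ‖u s‖^2 ∂μ ≤ B^2) :
    Integrable (fun s => k s * u s) μ ∧ ∫ s, ‖k s * u s‖ ∂μ ≤ Q * B := by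
  have key : ∀ s, ‖k s * u s‖ ≤ B/(2*Q) * ‖k s‖^2 + Q/(2*B) * ‖u s‖^2 := fun s => by
    rw [norm_mul]
    have : B/(2*Q) * ‖k s‖^2 + Q/(2*B) * ‖u s‖^2 - ‖k s‖ * ‖u s‖ = (B * ‖k s‖ - Q * ‖u s‖)^2/(2*Q*B) := by
      field_simp; ring
    have : 0 ≤ (B * ‖k s‖ - Q * ‖u s‖)^2/(2*Q*B) := by positivity
    linarith
  have hi := (ik.const_mul (B/(2*Q))).add (iu.const_mul (Q/(2*B)))
  have h1 : Integrable (fun s => k s * u s) μ := hi.mono' (hk.mul hu) (ae_of_all _ key)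
  refine ⟨h1, (integral_mono h1.norm hi key).trans ?_⟩
  simp only [Pi.add_apply]
  rw [integral_add (ik.const_mul _) (iu.const_mul _), integral_const_mul, integral_const_mul]
  calc _ ≤ B/(2*Q) * Q^2 + Q/(2*B) * B^2 := by gcongr
    _ = Q * B := by field_simp; ring
noncomputable abbrev cmμ (l : ℝ) : Measure ℝ := volume.restrict (Ioc (0:ℝ) l)
structure CmK (γ : ℝ → ℂ) (l : ℝ) (n : ℕ) (k : ℝ → ℂ) (Q : ℝ) : Prop where
  Q0 : 0 < Q
  m : AEStronglyMeasurable k (cmμ l)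
  i2 : Integrable (fun s => ‖k s‖^2) (cmμ l)
  b : ∫ s, ‖k s‖^2 ∂(cmμ l) ≤ Q^2
  orth : ∀ P : Polynomial ℂ, P.natDegree ≤ n → ∫ s, k s * P.eval (γ s) ∂(cmμ l) = 0
theorem cm_runge {K : Set ℂ} (hK : IsCompact K) (hc : IsPreconnected Kᶜ) {t : ℂ} (ht : t ∉ K) {ε : ℝ} (hε : 0 < ε) :
    ∃ S : Polynomial ℂ, ∀ z ∈ K, ‖1 - (t - z) * S.eval z‖ ≤ ε := by
  haveI := isCompact_iff_compactSpace.1 hK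
  set A := (polynomialFunctions K).topologicalClosure
  have hcl : IsClosed (A : Set C(K, ℂ)) := Subalgebra.isClosed_topologicalClosure _
  set x0 : C(K, ℂ) := Polynomial.toContinuousMapOnAlgHom K Polynomial.X
  have hx0 : ∀ z : K, x0 z = z := fun z => by simp [x0]
  have hxA : x0 ∈ A := by
    refine (polynomialFunctions K).le_topologicalClosure ?_
    rw [← SetLike.mem_coe, polynomialFunctions_coe]; exact ⟨_, rfl⟩
  have hsp : spectrum ℂ x0 = K := by
    rw [ContinuousMap.spectrum_eq_range]; ext z
    exact ⟨fun ⟨y, hy⟩ => by rw [← hy, hx0]; exact y.2, fun hz => ⟨⟨z, hz⟩, hx0 _⟩⟩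
  have h1 := @Subalgebra.spectrum_eq_of_isPreconnected_compl ℂ C(K, ℂ) (Subalgebra ℂ C(K, ℂ)) _ _ _ _ _ _ _ A hcl ⟨x0, hxA⟩
    (by rw [hsp]; exact hc)
  have h2 : t ∉ spectrum ℂ (⟨x0, hxA⟩ : A) := by rw [h1, hsp]; exact ht
  rw [spectrum.mem_iff, not_not] at h2
  obtain ⟨b, hb⟩ := h2.exists_right_inv
  have hb' : ∀ z : K, (t - z) * (b : C(K, ℂ)) z = 1 := fun z => by
    have := congrArg (fun q : A => (q : C(K, ℂ)) z) hb
    simpa [hx0] using this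
  obtain ⟨M, hM⟩ := hK.isBounded.exists_norm_le
  have hMp : 0 < ‖t‖ + |M| + 1 := by positivity
  have hbc : (b : C(K, ℂ)) ∈ closure (polynomialFunctions K : Set C(K, ℂ)) := b.2
  obtain ⟨p, hp, hpd⟩ := Metric.mem_closure_iff.1 hbc (ε / (‖t‖ + |M| + 1)) (by positivity)
  rw [polynomialFunctions_coe] at hp
  obtain ⟨S, rfl⟩ := hp
  refine ⟨S, fun z hz => ?_⟩
  have h3 : ‖((b : C(K, ℂ)) - Polynomial.toContinuousMapOnAlgHom K S) ⟨z, hz⟩‖ ≤ ε / (‖t‖ + |M| + 1) :=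
    (ContinuousMap.norm_coe_le_norm _ _).trans (by rw [dist_eq_norm] at hpd; exact hpd.le)
  have e : 1 - (t - z) * S.eval z = (t - z) * ((b : C(K, ℂ)) ⟨z, hz⟩ - S.eval z) := by
    rw [mul_sub, hb' ⟨z, hz⟩]
  rw [e, norm_mul]
  have h4 : ‖t - z‖ ≤ ‖t‖ + |M| + 1 := by linarith [norm_sub_le t z, hM z hz, le_abs_self M]
  calc _ ≤ (‖t‖ + |M| + 1) * (ε / (‖t‖ + |M| + 1)) := by
        gcongr; simpa using h3
    _ = ε := by field_simp
theorem cm_far {K A : Set ℂ} {l : ℝ} {γ : ℝ → ℂ} (hl : 0 < l) (hK : IsCompact K) (hc : IsPreconnected Kᶜ) (hA : IsCompact A)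
    (hAK : A ⊆ Kᶜ) (hγ : Continuous γ) (hγK : ∀ s, γ s ∈ K) :
    ∃ C > 0, ∃ c > 0, ∀ n k Q, CmK γ l n k Q → ∀ t ∈ A, ‖∫ s, k s / (t - γ s) ∂(cmμ l)‖ ≤ C * Q * Real.exp (-(c * n)) := by
  have h1 : ∀ t ∈ A, ∃ S : Polynomial ℂ, ∃ r > 0, ∀ t' ∈ ball t r, ∀ z ∈ K, ‖1 - (t' - z) * S.eval z‖ ≤ 1/2 := by
    intro t ht
    obtain ⟨S, hS⟩ := cm_runge hK hc (hAK ht) (ε := 1/4) (by norm_num)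
    obtain ⟨B, hB⟩ := (hK.image S.continuous).isBounded.exists_norm_le
    refine ⟨S, 1/(4*(|B|+1)), by positivity, fun t' ht' z hz => ?_⟩
    have e : 1 - (t' - z) * S.eval z = (1 - (t - z) * S.eval z) - (t' - t) * S.eval z := by ring
    rw [e]
    have h2 : ‖(t' - t) * S.eval z‖ ≤ 1/4 := by
      rw [norm_mul]
      calc _ ≤ 1/(4*(|B|+1)) * (|B|+1) := by
            gcongr
            · exact (mem_ball_iff_norm.1 ht').le
            · linarith [hB _ ⟨z, hz, rfl⟩, le_abs_self B]
        _ = 1/4 := by field_simp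
    linarith [norm_sub_le (1 - (t - z) * S.eval z) ((t' - t) * S.eval z), hS z hz]
  choose! S r hr HS using h1
  obtain ⟨F, hF, hcov⟩ := hA.elim_nhds_subcover (fun t => ball t (r t)) fun t ht => ball_mem_nhds _ (hr t ht)
  set d := F.sup (fun t => (S t).natDegree) + 1
  obtain ⟨d1, hd1, Hd⟩ := Metric.exists_pos_forall_lt_edist hA hK.isClosed (disjoint_left.2 hAK)
  have hd1' : (0:ℝ) < d1 := by exact_mod_cast hd1
  have hdist : ∀ t ∈ A, ∀ z ∈ K, (d1:ℝ) ≤ ‖t - z‖ := fun t ht z hz => by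
    have := Hd t ht z hz
    rw [edist_nndist] at this
    rw [← dist_eq_norm]; exact_mod_cast this.le
  have hd0 : (0:ℝ) < d := by positivity
  have hl2 := Real.log_pos one_lt_two
  refine ⟨2 * Real.sqrt l / d1, by positivity, Real.log 2 / d, by positivity, fun n k Q hk t ht => ?_⟩
  obtain ⟨t0, ht0, htb⟩ := mem_iUnion₂.1 (hcov ht)
  have hR := HS t0 (hF t0 ht0) t htb
  set m := (n+1)/d
  set R : Polynomial ℂ := 1 - (Polynomial.C t - Polynomial.X) * S t0
  set P : Polynomial ℂ := S t0 * ∑ i ∈ Finset.range m, R^i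
  have hRe : ∀ z, R.eval z = 1 - (t - z) * (S t0).eval z := fun z => by simp [R]
  have hdS : (S t0).natDegree ≤ d - 1 := Finset.le_sup (f := fun t => (S t).natDegree) ht0
  have hRd : R.natDegree ≤ d := by
    refine (Polynomial.natDegree_sub_le _ _).trans (max_le (by simp) (Polynomial.natDegree_mul_le.trans ?_))
    have : (Polynomial.C t - Polynomial.X : Polynomial ℂ).natDegree ≤ 1 := (Polynomial.natDegree_sub_le _ _).trans (by simp)
    omega
  have hPd : P.natDegree ≤ n := by
    by_cases hm : m = 0
    · simp [P, hm]
    refine Polynomial.natDegree_mul_le.trans ?_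
    have h2 : (∑ i ∈ Finset.range m, R^i).natDegree ≤ (m-1)*d := by
      refine Polynomial.natDegree_sum_le_of_forall_le _ _ fun i hi => Polynomial.natDegree_pow_le.trans ?_
      exact Nat.mul_le_mul (Nat.le_sub_one_of_lt (Finset.mem_range.1 hi)) hRd
    have h3 : m * d ≤ n + 1 := Nat.div_mul_le_self _ _
    have h4 : (m-1)*d + d = m*d := by
      rw [← Nat.succ_mul, Nat.succ_eq_add_one, Nat.sub_add_cancel (Nat.one_le_iff_ne_zero.2 hm)]
    omega
  have hPe : ∀ z, (t - z) * P.eval z = 1 - R.eval z ^ m := fun z => by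
    have h2 := mul_neg_geom_sum (R.eval z) m
    rw [← h2]; simp only [P, Polynomial.eval_mul, Polynomial.eval_finsetSum, Polynomial.eval_pow, hRe]; ring
  have hne : ∀ s, t - γ s ≠ 0 := fun s h => by have := hdist t ht _ (hγK s); rw [h, norm_zero] at this; linarith
  set u : ℝ → ℂ := fun s => R.eval (γ s) ^ m / (t - γ s)
  have hun : ∀ s, ‖u s‖ ≤ (1/2)^m / d1 := fun s => by
    simp only [u, norm_div, norm_pow]
    gcongr
    · rw [hRe]; exact hR _ (hγK s)
    · exact hdist t ht _ (hγK s)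
  have huc : Continuous u := ((R.continuous.comp hγ).pow m).div (by fun_prop) hne
  have hB : (0:ℝ) < (1/2)^m / d1 * Real.sqrt l := by positivity
  have hun2 : ∀ s, ‖u s‖^2 ≤ ((1/2)^m / d1)^2 := fun s => by gcongr; exact hun s
  have hint : Integrable (fun s => ‖u s‖^2) (cmμ l) := Integrable.of_bound (by fun_prop) (((1/2)^m / d1)^2) (ae_of_all _ fun s => by
    rw [Real.norm_of_nonneg (by positivity)]; exact hun2 s)
  have bu : ∫ s, ‖u s‖^2 ∂(cmμ l) ≤ ((1/2)^m / d1 * Real.sqrt l)^2 := by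
    refine (integral_mono hint (integrable_const _) hun2).trans ?_
    rw [mul_pow, Real.sq_sqrt hl.le]
    simp [hl.le, mul_comm]
  obtain ⟨i1, b1⟩ := cm_cs hk.Q0 hB hk.m huc.aestronglyMeasurable hk.i2 hint hk.b bu
  have hint2 : Integrable (fun s => k s * P.eval (γ s)) (cmμ l) := by
    have hPc : Continuous fun s => P.eval (γ s) := P.continuous.comp hγ
    obtain ⟨B, hB⟩ := (hK.image P.continuous).isBounded.exists_norm_le
    have ik : Integrable k (cmμ l) := (memLp_one_iff_integrable.1 (((memLp_two_iff_integrable_sq_norm hk.m).2 hk.i2).mono_exponent (by norm_num)))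
    exact ik.mul_bdd (c := B) hPc.aestronglyMeasurable (ae_of_all _ fun s => hB _ ⟨_, hγK s, rfl⟩)
  have e1 : ∫ s, k s / (t - γ s) ∂(cmμ l) = ∫ s, k s * u s ∂(cmμ l) := by
    rw [← zero_add (∫ s, k s * u s ∂(cmμ l)), ← hk.orth P hPd, ← integral_add hint2 i1]
    refine integral_congr_ae (ae_of_all _ fun s => ?_)
    simp only [u]; rw [div_eq_iff (hne s)]
    have := hPe (γ s)
    field_simp [hne s]
    linear_combination (-k s) * this
  rw [e1]
  refine (norm_integral_le_integral_norm _).trans (b1.trans ?_)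
  have h5 : ((1:ℝ)/2)^m ≤ 2 * Real.exp (-(Real.log 2 / d * n)) := by
    have h6 : n + 1 < (m + 1) * d := by
      have := Nat.lt_div_mul_add (a := n+1) (b := d) (by omega); rw [add_mul, one_mul]; exact this
    have h7 : (n:ℝ) ≤ (m+1) * d := by exact_mod_cast (by omega : n ≤ (m+1)*d)
    have h8 : ((1:ℝ)/2)^m = Real.exp (-(Real.log 2 * m)) := by
      rw [mul_comm, ← mul_neg, Real.exp_nat_mul, Real.exp_neg, Real.exp_log two_pos, one_div]
    have h9 : (2:ℝ) = Real.exp (Real.log 2) := (Real.exp_log two_pos).symm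
    rw [h8]; nth_rewrite 2 [h9]; rw [← Real.exp_add]
    apply Real.exp_le_exp.2
    have h10 : Real.log 2 / d * n ≤ Real.log 2 * (m+1) := by
      rw [div_mul_eq_mul_div, div_le_iff₀ hd0]; nlinarith
    linarith
  calc Q * ((1/2)^m / d1 * Real.sqrt l) ≤ Q * (2 * Real.exp (-(Real.log 2 / d * n)) / d1 * Real.sqrt l) := by
        have := hk.Q0; gcongr
    _ = _ := by ring
theorem CmCurve.ker {L E : Set ℂ} {l : ℝ} {γ : ℝ → ℂ} (h : CmCurve L E l γ) (s0 : ℝ) :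
    ∃ C > 0, ∀ ρ > 0, Integrable (fun s => 1/(ρ + ‖γ s - γ s0‖)^2) (cmμ l) ∧ ∫ s, 1/(ρ + ‖γ s - γ s0‖)^2 ∂(cmμ l) ≤ C/ρ := by
  have hl := h.lpos
  obtain ⟨c, hc, H⟩ := h.arcl s0
  have hpi := Real.pi_pos
  refine ⟨Real.pi / c, by positivity, fun ρ hρ => ?_⟩
  have hcont : Continuous fun s => 1/(ρ + ‖γ s - γ s0‖)^2 := by
    have := h.cont
    refine Continuous.div (by fun_prop) (by fun_prop) fun s => by positivity
  have hper : Function.Periodic (fun s => 1/(ρ + ‖γ s - γ s0‖)^2) l := fun s => by simp only [h.per s]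
  refine ⟨(hcont.integrableOn_Icc).mono_set Ioc_subset_Icc_self, ?_⟩
  have e1 : ∫ s, 1/(ρ + ‖γ s - γ s0‖)^2 ∂(cmμ l) = ∫ s in Ioc (s0 - l/2) (s0 + l/2), 1/(ρ + ‖γ s - γ s0‖)^2 := by
    rw [cmμ, ← intervalIntegral.integral_of_le hl.le, ← intervalIntegral.integral_of_le (by linarith)]
    have := hper.intervalIntegral_add_eq 0 (s0 - l/2)
    rw [zero_add] at this
    rw [this]; congr 1; ring
  have hg : ∫ s : ℝ, (ρ^2)⁻¹ * (1 + (c/ρ * (s - s0))^2)⁻¹ = Real.pi / c / ρ := by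
    rw [integral_const_mul, integral_sub_right_eq_self (fun s => (1 + (c/ρ * s)^2)⁻¹) s0,
      Measure.integral_comp_mul_left (fun s => (1 + s^2)⁻¹), integral_univ_inv_one_add_sq, abs_of_pos (by positivity), smul_eq_mul]
    field_simp
  have hgi : Integrable fun s : ℝ => (ρ^2)⁻¹ * (1 + (c/ρ * (s - s0))^2)⁻¹ :=
    ((integrable_inv_one_add_sq.comp_mul_left' (by positivity : c/ρ ≠ 0)).comp_sub_right s0).const_mul _
  rw [e1, ← hg]
  refine (setIntegral_mono_on (hcont.integrableOn_Icc.mono_set Ioc_subset_Icc_self) hgi.integrableOn measurableSet_Ioc ?_).trans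
    (setIntegral_le_integral hgi (ae_of_all _ fun s => by positivity))
  intro s hs
  have h1 := H s (by rw [abs_le]; constructor <;> linarith [hs.1, hs.2])
  rw [← mul_inv, one_div]
  refine inv_anti₀ (by positivity) ?_
  have h2 : ρ^2 * (1 + (c/ρ*(s-s0))^2) = ρ^2 + (c * |s - s0|)^2 := by rw [mul_pow c, sq_abs]; field_simp
  rw [h2]
  have h3 : 0 ≤ c * |s - s0| := by positivity
  nlinarith
noncomputable def cmH (k γ : ℝ → ℂ) (l : ℝ) (t : ℂ) : ℂ := ∫ s, k s / (t - γ s) ∂(cmμ l)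
theorem CmK.int {γ k : ℝ → ℂ} {l Q : ℝ} {n : ℕ} (h : CmK γ l n k Q) : Integrable k (cmμ l) :=
  memLp_one_iff_integrable.1 (((memLp_two_iff_integrable_sq_norm h.m).2 h.i2).mono_exponent (by norm_num))
theorem cm_H_diff {K : Set ℂ} {γ k : ℝ → ℂ} {l : ℝ} (hK : IsClosed K) (hγ : Continuous γ) (hγK : ∀ s, γ s ∈ K)
    (hk : Integrable k (cmμ l)) : DifferentiableOn ℂ (cmH k γ l) Kᶜ := by
  intro t ht
  obtain ⟨ε, hε, hb⟩ := Metric.isOpen_iff.1 hK.isOpen_compl t ht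
  have hd : ∀ t' ∈ ball t (ε/2), ∀ s, ε/2 ≤ ‖t' - γ s‖ := by
    intro t' ht' s; by_contra! hh
    refine hb (mem_ball.2 ?_) (hγK s)
    calc dist (γ s) t ≤ dist (γ s) t' + dist t' t := dist_triangle _ _ _
      _ < ε/2+ε/2 := add_lt_add (by rw [dist_comm, dist_eq_norm]; exact hh) ht'
      _ = ε := by ring
  have htb : t ∈ ball t (ε/2) := mem_ball_self (by positivity)
  have hne : ∀ t' ∈ ball t (ε/2), ∀ s, t' - γ s ≠ 0 := fun t' ht' s h => by
    have := hd t' ht' s; rw [h, norm_zero] at this; linarith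
  have hm : ∀ t' ∈ ball t (ε/2), AEStronglyMeasurable (fun s => (t' - γ s)⁻¹) (cmμ l) := fun t' ht' =>
    (Continuous.inv₀ (by fun_prop) (hne t' ht')).aestronglyMeasurable
  refine (hasDerivAt_integral_of_dominated_loc_of_deriv_le (μ := cmμ l) (F := fun t s => k s/(t-γ s))
    (F' := fun t s => -(k s * ((t-γ s)⁻¹ * (t-γ s)⁻¹))) (x₀ := t) (s := ball t (ε/2)) (bound := fun s => ‖k s‖ * ((ε/2)⁻¹ * (ε/2)⁻¹))
    (ball_mem_nhds _ (by positivity)) ?_ ?_ ?_ ?_ ?_ ?_).2.differentiableAt.differentiableWithinAt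
  · filter_upwards [ball_mem_nhds t (half_pos hε)] with t' ht'
    simp only [div_eq_mul_inv]; exact hk.1.mul (hm t' ht')
  · simp only [div_eq_mul_inv]
    refine hk.mul_bdd (c := (ε/2)⁻¹) (hm t htb) (ae_of_all _ fun s => ?_)
    rw [norm_inv]; exact inv_anti₀ (by positivity) (hd t htb s)
  · exact (hk.1.mul ((hm t htb).mul (hm t htb))).neg
  · refine ae_of_all _ fun s t' ht' => ?_
    rw [norm_neg, norm_mul, norm_mul, norm_inv]
    have := inv_anti₀ (by positivity) (hd t' ht' s)
    gcongr
  · exact hk.norm.mul_const _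
  · refine ae_of_all _ fun s t' ht' => ?_
    have := (hasDerivAt_const t' (k s)).div ((hasDerivAt_id t').sub_const (γ s)) (hne t' ht' s)
    refine this.congr_deriv ?_
    have h0 := hne t' ht' s
    simp only [id]; field_simp; ring
theorem cm_gap {lam : ℝ} (hl : lam ∈ Ioo (0:ℝ) 2) : ∃ c > 0, ∀ ϑ : ℝ, |ϑ| ≤ Real.pi/2 →
    c * Real.cos ϑ ≤ Real.cos (lam * ϑ) - Real.cos (lam * Real.pi / 2) := by
  obtain ⟨h0, h2⟩ := hl
  have hpi := Real.pi_pos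
  set θ := lam * Real.pi / 2 with hθ
  have hθ0 : 0 < θ := by positivity
  have hθ1 : θ < Real.pi := by rw [hθ]; nlinarith
  set s := min (Real.sin (θ/2)) (Real.sin θ)
  have hs : 0 < s := lt_min (Real.sin_pos_of_pos_of_lt_pi (by linarith) (by linarith)) (Real.sin_pos_of_pos_of_lt_pi hθ0 hθ1)
  have main : ∀ ϑ : ℝ, 0 ≤ ϑ → ϑ ≤ Real.pi/2 → 2*s*lam/Real.pi * Real.cos ϑ ≤ Real.cos (lam * ϑ) - Real.cos θ := by
    intro ϑ h1 h3
    rw [Real.cos_sub_cos]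
    set ψ := Real.pi/2 - ϑ with hψ
    have e1 : (lam * ϑ + θ)/2 = θ - lam*ψ/2 := by rw [hθ, hψ]; ring
    have e2 : (lam * ϑ - θ)/2 = -(lam*ψ/2) := by rw [hθ, hψ]; ring
    rw [e1, e2, Real.sin_neg]
    have hψ0 : 0 ≤ ψ := by linarith
    have hlψ : lam*ψ/2 ≤ θ/2 := by rw [hθ, hψ]; nlinarith
    have a1 : 2/Real.pi * (lam*ψ/2) ≤ Real.sin (lam*ψ/2) := Real.mul_le_sin (by positivity) (by linarith)
    have a2 : s ≤ Real.sin (θ - lam*ψ/2) := by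
      have hp : 0 ≤ lam*ψ/2 := by positivity
      rcases le_total (θ - lam*ψ/2) (Real.pi/2) with h | h
      · exact (min_le_left _ _).trans (Real.sin_le_sin_of_le_of_le_pi_div_two (by linarith) h (by linarith))
      · rw [← Real.sin_pi_sub (θ - lam*ψ/2)]
        refine (min_le_right _ _).trans ?_
        rw [← Real.sin_pi_sub θ]
        exact Real.sin_le_sin_of_le_of_le_pi_div_two (by linarith) (by linarith) (by linarith)
    have a3 : Real.cos ϑ ≤ ψ := by rw [← Real.sin_pi_div_two_sub]; exact Real.sin_le hψ0
    have a4 : 0 ≤ 2/Real.pi * (lam*ψ/2) := by positivity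
    calc 2*s*lam/Real.pi * Real.cos ϑ ≤ 2*s*lam/Real.pi * ψ := by gcongr
      _ = 2 * (s * (2/Real.pi * (lam*ψ/2))) := by ring
      _ ≤ 2 * (Real.sin (θ - lam*ψ/2) * Real.sin (lam*ψ/2)) := by
          have := mul_le_mul a2 a1 a4 (hs.le.trans a2); linarith
      _ = _ := by ring
  refine ⟨2*s*lam/Real.pi, by positivity, fun ϑ h => ?_⟩
  have := main |ϑ| (abs_nonneg _) h
  rwa [Real.cos_abs, show lam * |ϑ| = |lam * ϑ| by rw [abs_mul, abs_of_pos h0], Real.cos_abs] at this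
theorem CmPt.bnd2 {G E : Set ℂ} {l a lam : ℝ} {γ : ℝ → ℂ} {z0 e : ℂ} (P : CmPt G z0 e lam a)
    (cv : CmCurve (frontier G) E l γ) (hz0 : z0 ∈ frontier G) :
    ∃ C > 0, ∀ n k Q, CmK γ l n k Q → ∀ (w : ℂ) (g : ℝ), 0 < g → w ≠ 0 → ‖w‖ ≤ 1/2 → (Real.cos (lam * Real.pi / 2) + g) * ‖w‖ ≤ w.re →
      ‖cmH k γ l (z0 + e * (a * w / (1 + w)))‖ ≤ C * Q / g * ‖w‖ ^ (-(1/2:ℝ)) := by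
  obtain ⟨s0, rfl⟩ := (cv.mem z0).1 hz0
  obtain ⟨C, hC, hker⟩ := cv.ker s0
  have e0 : e ≠ 0 := fun h => by have := P.e1; rw [h] at this; simp at this
  have a0 := P.a0
  have hL : ∀ s, γ s ∈ frontier G := fun s => (cv.mem _).2 ⟨s, rfl⟩
  set D : ℝ → ℂ := fun s => a - (γ s - γ s0)/e
  have hDn : ∀ s, D s ≠ 0 := fun s h => by
    refine P.ext (frontier_subset_closure ?_)
    have : γ s0 + e * a = γ s := by
      have h2 : (a:ℂ) = (γ s - γ s0)/e := sub_eq_zero.1 h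
      rw [h2]; field_simp; ring
    rw [this]; exact hL s
  have hDc : Continuous D := by have := cv.cont; fun_prop
  have hDp : Function.Periodic D l := fun s => by simp only [D, cv.per s]
  have hcomp : IsCompact (D '' Icc 0 l) := isCompact_Icc.image hDc
  have hDi : ∀ s, D s ∈ D '' Icc 0 l := fun s => by
    obtain ⟨y, hy, h⟩ := hDp.exists_mem_Ico₀ cv.lpos s
    exact ⟨y, Ico_subset_Icc_self hy, h.symm⟩
  obtain ⟨M, hM⟩ := hcomp.isBounded.exists_norm_le
  obtain ⟨p, ⟨sp, _, rfl⟩, hp⟩ := hcomp.exists_isMinOn ⟨_, hDi 0⟩ continuous_norm.continuousOn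
  set d0 := ‖D sp‖
  have hd0 : 0 < d0 := norm_pos_iff.2 (hDn sp)
  have hdl : ∀ s, d0 ≤ ‖D s‖ := fun s => hp (hDi s)
  set M1 := |M| + 1
  have hdu : ∀ s, ‖D s‖ ≤ M1 := fun s => by have := hM _ (hDi s); linarith [le_abs_self M]
  have hM1 : 1 ≤ M1 := by simp [M1]
  set c := d0/(9*M1)
  have hc : 0 < c := by positivity
  refine ⟨Real.sqrt C/c, by positivity, fun n k Q hk w g hg hw hw2 hwg => ?_⟩
  have hwp : 0 < ‖w‖ := norm_pos_iff.2 hw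
  have hco := Real.abs_cos_le_one (lam * Real.pi / 2)
  set co := Real.cos (lam * Real.pi / 2)
  have hg2 : g ≤ 2 := by
    have h1 : (co + g) * ‖w‖ ≤ 1 * ‖w‖ := by rw [one_mul]; exact hwg.trans (re_le_norm w)
    have := le_of_mul_le_mul_right h1 hwp
    linarith [(abs_le.1 hco).1]
  obtain ⟨h1w, hText⟩ := P.lens w hw (by nlinarith)
  set t := γ s0 + e * (a * w / (1 + w))
  have hlow : ∀ s, c * g * (‖w‖ + ‖γ s - γ s0‖) ≤ ‖t - γ s‖ := by
    intro s
    set x := (γ s - γ s0)/e with hx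
    set wz := x / D s with hwz
    have hxn : ‖x‖ = ‖γ s - γ s0‖ := by rw [hx, norm_div, P.e1, div_one]
    have hD : D s = a - x := rfl
    have hDs := hDn s
    have hac : (a:ℂ) ≠ 0 := by exact_mod_cast a0.ne'
    have h1wz : 1 + wz = a / D s := by rw [hwz]; field_simp; rw [hD]; ring
    have hTz : γ s0 + e * (a * wz / (1 + wz)) = γ s := by
      rw [h1wz, hwz]; field_simp; rw [hx]; field_simp; ring
    have h3 : wz.re ≤ co * ‖wz‖ := by
      by_cases h0 : wz = 0
      · simp [h0]
      · by_contra! hh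
        have := (P.lens wz h0 hh.le).2
        rw [hTz] at this
        exact this (frontier_subset_closure (hL s))
    have h4 : w.re - wz.re ≤ ‖w - wz‖ := by rw [← sub_re]; exact re_le_norm _
    have h5 : |‖w‖ - ‖wz‖| ≤ ‖w - wz‖ := abs_norm_sub_norm_le _ _
    have h6 : |co * (‖w‖ - ‖wz‖)| ≤ ‖w - wz‖ := by
      rw [abs_mul]; exact (mul_le_of_le_one_left (abs_nonneg _) hco).trans h5
    have h7 : g * ‖w‖ ≤ 2 * ‖w - wz‖ := by nlinarith [(abs_le.1 h6).1]
    have h8 : g * (‖w‖ + ‖wz‖) ≤ 6 * ‖w - wz‖ := by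
      nlinarith [(abs_le.1 h5).1, norm_nonneg (w - wz)]
    have e1 : t - γ s = e * ((w - wz) * D s / (1 + w)) := by
      rw [← hTz]; simp only [t]; rw [h1wz]; field_simp
      have : a = D s * (1 + wz) := by rw [h1wz]; field_simp
      rw [this]; ring
    have h9 : ‖1 + w‖ ≤ 3/2 := by linarith [norm_add_le 1 w, (norm_one : ‖(1:ℂ)‖ = 1)]
    have h10 : 0 < ‖1 + w‖ := norm_pos_iff.2 h1w
    have h11 : ‖γ s - γ s0‖ ≤ M1 * ‖wz‖ := by
      rw [← hxn, hwz, norm_div x]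
      have := hdu s
      have hDp : 0 < ‖D s‖ := norm_pos_iff.2 hDs
      rw [mul_div_assoc', le_div_iff₀ hDp, mul_comm]; gcongr
    rw [e1, norm_mul, P.e1, one_mul, norm_div, norm_mul, le_div_iff₀ h10]
    calc c * g * (‖w‖ + ‖γ s - γ s0‖) * ‖1 + w‖ ≤ c * g * (M1 * ‖w‖ + M1 * ‖wz‖) * (3/2) := by
          gcongr; nlinarith
      _ = d0 / 6 * (g * (‖w‖ + ‖wz‖)) := by simp only [c]; field_simp; ring
      _ ≤ d0/6 * (6 * ‖w - wz‖) := by gcongr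
      _ = ‖w - wz‖ * d0 := by ring
      _ ≤ _ := by gcongr; exact hdl s
  obtain ⟨ki, kb⟩ := hker ‖w‖ hwp
  have hne : ∀ s, t - γ s ≠ 0 := fun s h => by
    have := hlow s; rw [h, norm_zero] at this
    have : 0 < c * g * (‖w‖ + ‖γ s - γ s0‖) := by positivity
    linarith
  have hcu : Continuous fun s => (t - γ s)⁻¹ := Continuous.inv₀ (by have := cv.cont; fun_prop) hne
  have hu : ∀ s, ‖(t - γ s)⁻¹‖^2 ≤ ((c*g)^2)⁻¹ * (1/(‖w‖ + ‖γ s - γ s0‖)^2) := fun s => by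
    rw [norm_inv, one_div, ← mul_inv, ← mul_pow, inv_pow]
    exact inv_anti₀ (by positivity) (by gcongr; exact hlow s)
  have hui : Integrable (fun s => ‖(t - γ s)⁻¹‖^2) (cmμ l) := (ki.const_mul _).mono' (hcu.norm.pow 2).aestronglyMeasurable (ae_of_all _ fun s => by
    rw [Real.norm_of_nonneg (by positivity)]; exact hu s)
  have hB : ∫ s, ‖(t - γ s)⁻¹‖^2 ∂(cmμ l) ≤ (Real.sqrt C/c/g * ‖w‖ ^ (-(1/2:ℝ)))^2 := by
    refine (integral_mono hui (ki.const_mul _) hu).trans ?_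
    rw [integral_const_mul]
    have h1 : (‖w‖ ^ (-(1/2:ℝ)))^2 = 1/‖w‖ := by
      rw [← Real.rpow_natCast, ← Real.rpow_mul hwp.le]; norm_num [Real.rpow_neg_one]
    calc _ ≤ ((c*g)^2)⁻¹ * (C/‖w‖) := by gcongr
      _ = _ := by rw [mul_pow _ (‖w‖ ^ _), h1, div_pow, div_pow, Real.sq_sqrt hC.le]; field_simp
  obtain ⟨_, b1⟩ := cm_cs hk.Q0 (by positivity) hk.m hcu.aestronglyMeasurable hk.i2 hui hk.b hB
  unfold cmH
  simp only [div_eq_mul_inv] at b1 ⊢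
  refine (norm_integral_le_integral_norm _).trans (b1.trans (le_of_eq ?_))
  ring
theorem cm_hp {lam x0 c m : ℝ} (hl : lam ∈ Ioo (0:ℝ) 2) (hx : 0 < x0) (hc : 0 < c) (hm : 0 < m) :
    ∃ C > 0, ∃ c' > 0, ∀ (H : ℂ → ℂ) (A : ℝ) (n : ℕ), 1 ≤ n → 0 < A → DifferentiableOn ℂ H {ω | 0 < ω.re} →
    (∀ ω : ℂ, 0 < ω.re → ‖ω‖ ≤ x0 → ‖H ω‖ ≤ A * (‖ω‖/ω.re) * ‖ω‖^(-(lam/2))) →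
    (∀ ω : ℂ, 0 < ω.re → ‖ω‖ = x0 → ‖H ω‖ ≤ A * Real.exp (-(c*n))) →
    ∀ ω : ℂ, ω ≠ 0 → ‖ω‖ < x0 → m * ‖ω‖ ≤ ω.re → ‖H ω‖ ≤ C * A * ‖ω‖^(-(lam/2)) * Real.exp (-(c'*n*‖ω‖)) := by
  obtain ⟨h0, h2⟩ := hl
  set p := 1 - lam/2 with hp
  have hp0 : 0 < p := by linarith
  set c2 := c/x0 with hc2
  have hc20 : 0 < c2 := by positivity
  set C1 := Real.exp c2 + x0^(-p)
  have hC1 : 0 < C1 := by positivity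
  refine ⟨C1 * (2/(c2*m)) + Real.exp (c2/2)/m, by positivity, c2*m/2, by positivity, fun H A n hn hA hd hb ha ω hω hωx hωm => ?_⟩
  have hn' : (1:ℝ) ≤ n := by exact_mod_cast hn
  have hn0 : (0:ℝ) < n := by linarith
  have hωp := norm_pos_iff.2 hω
  have hre : 0 < ω.re := lt_of_lt_of_le (by positivity) hωm
  rcases le_or_gt ω.re (1/n) with hcase | hcase
  · have h3 : n * ‖ω‖ ≤ 1/m := by
      rw [le_div_iff₀ hm]; calc n * ‖ω‖ * m = n * (m * ‖ω‖) := by ring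
        _ ≤ n * (1/n) := by gcongr; exact hωm.trans hcase
        _ = 1 := by field_simp
    have h4 : 1 ≤ Real.exp (c2/2) * Real.exp (-(c2*m/2*n*‖ω‖)) := by
      rw [← Real.exp_add]; apply Real.one_le_exp
      have : c2*m/2*(n*‖ω‖) ≤ c2*m/2*(1/m) := by gcongr
      have e : c2*m/2*(1/m) = c2/2 := by field_simp
      linarith
    have h5 : ‖ω‖/ω.re ≤ 1/m := by rw [div_le_div_iff₀ hre hm]; linarith
    calc ‖H ω‖ ≤ A * (1/m) * ‖ω‖^(-(lam/2)) := (hb ω hre hωx.le).trans (by gcongr)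
      _ ≤ A * (1/m) * ‖ω‖^(-(lam/2)) * (Real.exp (c2/2) * Real.exp (-(c2*m/2*n*‖ω‖))) := le_mul_of_one_le_right (by positivity) h4
      _ = Real.exp (c2/2)/m * A * ‖ω‖^(-(lam/2)) * Real.exp (-(c2*m/2*n*‖ω‖)) := by ring
      _ ≤ _ := by
        gcongr
        exact le_add_of_nonneg_left (by positivity)
  set U : Set ℂ := {ω | 1/(n:ℝ) < ω.re} ∩ ball 0 x0
  have hUc : closure U ⊆ {ω : ℂ | 1/(n:ℝ) ≤ ω.re} ∩ closedBall 0 x0 := closure_minimal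
    (fun z hz => ⟨le_of_lt (show 1/(n:ℝ) < z.re from hz.1), ball_subset_closedBall hz.2⟩) ((isClosed_le (by fun_prop) (by fun_prop)).inter isClosed_closedBall)
  have hUo : IsOpen U := (isOpen_lt (by fun_prop) (by fun_prop)).inter isOpen_ball
  have hpos : ∀ z ∈ closure U, 0 < z.re := fun z hz => lt_of_lt_of_le (by positivity) (hUc hz).1
  set Ψ : ℂ → ℂ := fun z => H z * exp (c2 * n * z) * exp ((-p:ℝ) * log z)
  have hΨn : ∀ z : ℂ, 0 < z.re → ‖Ψ z‖ = ‖H z‖ * Real.exp (c2*n*z.re) * ‖z‖^(-p) := by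
    intro z hz
    have hz0 : 0 < ‖z‖ := norm_pos_iff.2 fun h => by simp [h] at hz
    simp only [Ψ, norm_mul, norm_exp]
    rw [re_ofReal_mul, log_re, Real.rpow_def_of_pos hz0, mul_comm (-p)]
    congr 3
    rw [← ofReal_natCast, ← ofReal_mul, re_ofReal_mul]
  have hΨd : DifferentiableOn ℂ Ψ {z | 0 < z.re} := by
    refine (hd.mul (by fun_prop)).mul (DifferentiableOn.cexp ?_)
    exact (differentiableOn_const _).mul fun z hz => (differentiableAt_log (Or.inl hz)).differentiableWithinAt
  have hmax := Complex.norm_le_of_forall_mem_frontier_norm_le (f := Ψ) (U := U) (C := A*n*C1) (isBounded_ball.subset inter_subset_right)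
    (hΨd.mono hpos).diffContOnCl (fun z hz => by
      rw [hUo.frontier_eq] at hz
      obtain ⟨hzr, hzx⟩ := hUc hz.1
      have hz0 := hpos z hz.1
      have hzn : 0 < ‖z‖ := norm_pos_iff.2 fun h => by simp [h] at hz0
      rw [mem_closedBall_zero_iff] at hzx
      rw [hΨn z hz0]
      by_cases h1 : ‖z‖ < x0
      · have h3 : z.re = 1/n := le_antisymm (not_lt.1 fun h => hz.2 ⟨h, mem_ball_zero_iff.2 h1⟩) hzr
        have h4 := hb z hz0 hzx
        rw [h3] at h4 ⊢
        have h5 : ‖z‖ * ‖z‖^(-(lam/2)) * ‖z‖^(-p) = 1 := by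
          nth_rewrite 1 [← Real.rpow_one ‖z‖]
          rw [← Real.rpow_add hzn, ← Real.rpow_add hzn, hp, show 1 + -(lam/2) + -(1 - lam/2) = 0 by ring, Real.rpow_zero]
        calc _ ≤ A * (‖z‖/(1/n)) * ‖z‖^(-(lam/2)) * Real.exp (c2*n*(1/n)) * ‖z‖^(-p) := by gcongr
          _ = A * n * Real.exp c2 * (‖z‖ * ‖z‖^(-(lam/2)) * ‖z‖^(-p)) := by
              rw [show c2*n*(1/n) = c2 by field_simp]; field_simp
          _ ≤ A * n * C1 := by
              rw [h5, mul_one]; gcongr; exact le_add_of_nonneg_right (by positivity)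
      · have h3 : ‖z‖ = x0 := le_antisymm hzx (not_lt.1 h1)
        have h4 := ha z hz0 h3
        rw [h3]
        have h5 : c2*n*z.re ≤ c*n := by
          calc c2*n*z.re ≤ c2*n*x0 := by gcongr; exact (re_le_norm z).trans hzx
            _ = c*n := by rw [hc2]; field_simp
        calc _ ≤ A * Real.exp (-(c*n)) * Real.exp (c*n) * x0^(-p) := by gcongr
          _ = A * 1 * x0^(-p) := by rw [mul_assoc A, ← Real.exp_add]; simp
          _ ≤ A * n * C1 := by gcongr; exact le_add_of_nonneg_left (by positivity)) (z := ω) (subset_closure ⟨hcase, mem_ball_zero_iff.2 hωx⟩)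
  rw [hΨn ω hre] at hmax
  have h6 : ‖H ω‖ ≤ A*n*C1 * Real.exp (-(c2*n*ω.re)) * ‖ω‖^p := by
    rw [Real.exp_neg, ← div_eq_mul_inv, ← inv_inv (‖ω‖^p), ← Real.rpow_neg hωp.le, ← div_eq_mul_inv, le_div_iff₀ (by positivity),
      le_div_iff₀ (by positivity)]
    linarith [hmax, mul_right_comm ‖H ω‖ (Real.exp (c2*n*ω.re)) (‖ω‖^(-p))]
  set y := c2*m/2*n*‖ω‖ with hy
  have hy0 : 0 < y := by positivity
  have h7 : Real.exp (-(c2*n*ω.re)) ≤ Real.exp (-y) * Real.exp (-y) := by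
    rw [← Real.exp_add]; apply Real.exp_le_exp.2
    have : c2*n*(m*‖ω‖) ≤ c2*n*ω.re := by gcongr
    rw [hy]; linarith
  have h8 : y * Real.exp (-y) ≤ 1 := by
    rw [Real.exp_neg, ← div_eq_mul_inv, div_le_one (Real.exp_pos _)]
    linarith [Real.add_one_le_exp y]
  have h9 : ‖ω‖^p = ‖ω‖ * ‖ω‖^(-(lam/2)) := by
    nth_rewrite 2 [← Real.rpow_one ‖ω‖]
    rw [← Real.rpow_add hωp]; congr 1
  calc ‖H ω‖ ≤ A*n*C1 * (Real.exp (-y) * Real.exp (-y)) * ‖ω‖^p := h6.trans (by gcongr)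
    _ = C1 * (2/(c2*m)) * A * ‖ω‖^(-(lam/2)) * Real.exp (-y) * (y * Real.exp (-y)) := by rw [h9, hy]; field_simp
    _ ≤ C1 * (2/(c2*m)) * A * ‖ω‖^(-(lam/2)) * Real.exp (-y) := mul_le_of_le_one_right (by positivity) h8
    _ ≤ _ := by
      gcongr
      exact le_add_of_nonneg_right (by positivity)
theorem CmDom.near {G E : Set ℂ} {l : ℝ} {γ : ℝ → ℂ} {lam a : ℂ → ℝ} {e : ℂ → ℂ} (dm : CmDom G E l γ lam a e) {z0 : ℂ} (hz : z0 ∈ E)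
    {m : ℝ} (hm : 0 < m) : ∃ δ > 0, ∃ C > 0, ∃ c > 0, ∀ n k Q, 1 ≤ n → CmK γ l n k Q → ∀ x : ℂ, x ≠ 0 → ‖x‖ < δ →
      (Real.cos (lam z0 * Real.pi / 2) + m) * ‖x‖ ≤ x.re →
      ‖cmH k γ l (z0 + e z0 * x)‖ ≤ C * Q * ‖x‖^(-(1/2:ℝ)) * Real.exp (-(c*n*‖x‖^(1/lam z0))) := by
  have P := dm.pt z0 hz
  obtain ⟨C2, hC2, B2⟩ := P.bnd2 dm.cv (dm.EL hz)
  have hl := P.hl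
  have a0 := P.a0
  have hpi := Real.pi_pos
  have hlens := P.lens
  set lam := lam z0
  set a := a z0
  set e := e z0
  obtain ⟨h0, h2⟩ := hl
  obtain ⟨c1, hc1, hgap⟩ := cm_gap (lam := lam) ⟨h0, h2⟩
  have hco := Real.abs_cos_le_one (lam * Real.pi / 2)
  set co := Real.cos (lam * Real.pi / 2) with hcod
  have hac : (a:ℂ) ≠ 0 := by exact_mod_cast a0.ne'
  set θ := lam * Real.pi / 2 with hθ
  have hθ0 : 0 < θ := by positivity
  have hθ1 : θ < Real.pi := by rw [hθ]; nlinarith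
  set W : ℂ → ℂ := fun ω => exp (lam * log ω)
  have hWn : ∀ ω : ℂ, ω ≠ 0 → ‖W ω‖ = ‖ω‖^lam := fun ω h => by
    simp only [W, norm_exp]
    rw [re_ofReal_mul, log_re, Real.rpow_def_of_pos (norm_pos_iff.2 h), mul_comm lam]
  have hWr : ∀ ω : ℂ, ω ≠ 0 → (W ω).re = ‖ω‖^lam * Real.cos (lam * ω.arg) := fun ω h => by
    simp only [W, exp_re]
    rw [re_ofReal_mul, im_ofReal_mul, log_re, log_im, Real.rpow_def_of_pos (norm_pos_iff.2 h), mul_comm lam (Real.log _)]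
  have hWg : ∀ ω : ℂ, ω ≠ 0 → 0 ≤ ω.re → (co + c1 * (ω.re/‖ω‖)) * ‖W ω‖ ≤ (W ω).re := fun ω h hr => by
    rw [hWn ω h, hWr ω h, mul_comm]
    have := hgap ω.arg (abs_arg_le_pi_div_two_iff.2 hr)
    rw [cos_arg h] at this
    gcongr; linarith
  have hWl : ∀ ω : ℂ, ω ≠ 0 → 0 ≤ ω.re → 1 + W ω ≠ 0 ∧ z0 + e * (a * W ω / (1 + W ω)) ∈ (closure G)ᶜ := fun ω h hr => by
    refine hlens _ (exp_ne_zero _) (le_trans ?_ (hWg ω h hr))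
    gcongr; have : 0 ≤ c1 * (ω.re/‖ω‖) := by positivity
    linarith
  set Tw : ℂ → ℂ := fun ω => z0 + e * (a * W ω / (1 + W ω))
  have hTc : ∀ ω : ℂ, ω ≠ 0 → 0 ≤ ω.re → DifferentiableAt ℂ Tw ω := fun ω h hr => by
    have hs : ω ∈ slitPlane := by
      rcases hr.lt_or_eq with h1 | h1
      · exact Or.inl h1
      · exact Or.inr fun h3 => h (Complex.ext h1.symm h3)
    have : DifferentiableAt ℂ W ω := ((differentiableAt_log hs).const_mul _).cexp
    exact (((this.const_mul _).div (this.const_add 1) (hWl ω h hr).1).const_mul e).const_add z0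
  set x0 : ℝ := (1/2)^(1/lam)
  have hx0 : 0 < x0 := by positivity
  have hx0l : x0^lam = 1/2 := by rw [← Real.rpow_mul (by norm_num)]; simp [h0.ne']
  set Arc : Set ℂ := sphere 0 x0 ∩ {ω | 0 ≤ ω.re}
  have hArc0 : ∀ ω ∈ Arc, ω ≠ 0 := fun ω h h3 => by
    have := mem_sphere_zero_iff_norm.1 h.1; rw [h3, norm_zero] at this; exact hx0.ne this
  have hArc : IsCompact (Tw '' Arc) := ((isCompact_sphere 0 x0).inter_right (isClosed_le (by fun_prop) (by fun_prop))).image_of_continuousOn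
    fun ω h => (hTc ω (hArc0 ω h) h.2).continuousAt.continuousWithinAt
  have hcl : ∀ s, γ s ∈ closure G := fun s => frontier_subset_closure ((dm.cv.mem _).2 ⟨s, rfl⟩)
  obtain ⟨C3, hC3, c3, hc3, B3⟩ := cm_far dm.cv.lpos dm.b.isCompact_closure dm.ext hArc
    (by rintro _ ⟨ω, h, rfl⟩; exact (hWl ω (hArc0 ω h) h.2).2) dm.cv.cont hcl
  set θ' := Real.arccos (co + m/2)
  by_cases hcm : co + m ≤ 1
  swap
  · refine ⟨1, one_pos, 1, one_pos, 1, one_pos, fun n k Q _ _ x hx _ h => absurd (h.trans (re_le_norm x)) ?_⟩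
    have := norm_pos_iff.2 hx
    push Not; push Not at hcm; nlinarith
  have hcom : |co + m/2| ≤ 1 := abs_le.2 ⟨by linarith [(abs_le.1 hco).1], by linarith⟩
  have hθ' : θ' < θ := by
    rw [← Real.arccos_cos hθ0.le hθ1.le]
    exact Real.arccos_lt_arccos (abs_le.1 hco).1 (by linarith) (by linarith)
  have hθ'0 : 0 ≤ θ' := Real.arccos_nonneg _
  have hq : θ'/lam < Real.pi/2 := by rw [div_lt_iff₀ h0]; linarith
  set m' := Real.cos (θ'/lam)
  have hm' : 0 < m' := Real.cos_pos_of_mem_Ioo ⟨by linarith [(by positivity : 0 ≤ θ'/lam)], hq⟩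
  obtain ⟨C4, hC4, c4, hc4, B4⟩ := cm_hp (lam := lam) ⟨h0, h2⟩ hx0 hc3 hm'
  refine ⟨min (a/4) (m*a/8) , by positivity, C4 * (C2/c1 + C3) * (2*a)^(1/2:ℝ), by positivity, c4 * (2*a)^(-(1/lam)), by positivity,
    fun n k Q hn hk x hx hxδ hxm => ?_⟩
  have hQ := hk.Q0
  have hxp := norm_pos_iff.2 hx
  have hxa : ‖x‖ < a/4 := hxδ.trans_le (min_le_left _ _)
  have hxa2 : ‖x‖ < m*a/8 := hxδ.trans_le (min_le_right _ _)
  have hna : ‖(a:ℂ)‖ = a := by rw [norm_real, Real.norm_of_nonneg a0.le]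
  have hd1 : 3/4*a ≤ ‖a - x‖ := by linarith [norm_sub_norm_le (a:ℂ) x]
  have hax : a - x ≠ 0 := norm_pos_iff.1 (by linarith)
  set w := x/(a - x) with hw
  have hw0 : w ≠ 0 := div_ne_zero hx hax
  have hwn : ‖w‖ = ‖x‖/‖a - x‖ := norm_div _ _
  have hwp := norm_pos_iff.2 hw0
  have hd2 : ‖a - x‖ ≤ 2*a := by linarith [norm_sub_le (a:ℂ) x]
  have hw1 : ‖x‖/(2*a) ≤ ‖w‖ := by rw [hwn]; gcongr
  have hw2 : ‖w‖ < 1/2 := by rw [hwn, div_lt_iff₀ (by linarith)]; linarith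
  have hwx : ‖w - x/a‖ ≤ 2*‖x‖^2/a^2 := by
    have : w - x/a = x^2/(a*(a-x)) := by rw [hw]; field_simp; ring
    rw [this, norm_div, norm_mul, norm_pow, hna, div_le_div_iff₀ (by positivity) (by positivity)]
    have : 0 ≤ ‖x‖^2*a := by positivity
    nlinarith
  have hxr : (x/a).re = x.re/a := div_ofReal_re _ _
  have hxan : ‖x/(a:ℂ)‖ = ‖x‖/a := by rw [norm_div, hna]
  have hws : (co + m/2) * ‖w‖ ≤ w.re := by
    have i1 : x.re/a - ‖w - x/a‖ ≤ w.re := by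
      rw [← hxr]; have := re_le_norm (x/a - w); rw [sub_re, norm_sub_rev] at this; linarith
    have i2 : (co + m/2) * (‖w‖ - ‖x‖/a) ≤ ‖w - x/a‖ := by
      refine (le_abs_self _).trans ?_
      rw [abs_mul]
      refine (mul_le_of_le_one_left (abs_nonneg _) hcom).trans ?_
      rw [← hxan]; exact abs_norm_sub_norm_le _ _
    have i3 : (co + m) * (‖x‖/a) ≤ x.re/a := by rw [mul_div_assoc']; gcongr
    have i4 : 2*(2*‖x‖^2/a^2) ≤ m/2*(‖x‖/a) := by
      rw [show 2*(2*‖x‖^2/a^2) = (4*‖x‖/a)*(‖x‖/a) by field_simp; ring]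
      exact mul_le_mul_of_nonneg_right (by rw [div_le_iff₀ a0]; linarith) (by positivity)
    linarith
  have harg : |w.arg| ≤ θ' := by
    have h5 : co + m/2 ≤ Real.cos w.arg := by rw [cos_arg hw0, le_div_iff₀ hwp]; exact hws
    rw [← Real.arccos_cos (abs_nonneg w.arg) (abs_arg_le_pi w), Real.cos_abs]
    exact Real.arccos_le_arccos h5
  set ω := exp ((1/lam:ℝ) * log w)
  have hlogω : log ω = (1/lam:ℝ) * log w := by
    have hb : |(1/lam) * w.arg| < Real.pi := by
      rw [abs_mul, abs_of_pos (by positivity), one_div, inv_mul_eq_div]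
      calc _ ≤ θ'/lam := by gcongr
        _ < _ := by linarith
    apply log_exp <;> rw [im_ofReal_mul, log_im] <;> linarith [(abs_lt.1 hb).1, (abs_lt.1 hb).2]
  have hω0 : ω ≠ 0 := exp_ne_zero _
  have hWω : W ω = w := by
    simp only [W]; rw [hlogω, ← mul_assoc, ← ofReal_mul, mul_one_div_cancel h0.ne', ofReal_one, one_mul, exp_log hw0]
  have hωn : ‖ω‖ = ‖w‖^(1/lam) := by
    simp only [ω, norm_exp]
    rw [re_ofReal_mul, log_re, Real.rpow_def_of_pos hwp, mul_comm]
  have hωr : m' * ‖ω‖ ≤ ω.re := by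
    have h6 : Real.cos ω.arg = ω.re/‖ω‖ := cos_arg hω0
    rw [← le_div_iff₀ (norm_pos_iff.2 hω0), ← h6]
    have h7 : ω.arg = w.arg/lam := by rw [← log_im, hlogω, im_ofReal_mul, log_im]; ring
    rw [h7, ← Real.cos_abs (w.arg/lam), abs_div, abs_of_pos h0]
    exact Real.cos_le_cos_of_nonneg_of_le_pi (by positivity) (by linarith) (by gcongr)
  have hωx : ‖ω‖ < x0 := by rw [hωn]; exact Real.rpow_lt_rpow hwp.le hw2 (by positivity)
  have hdiff : DifferentiableOn ℂ (fun ω => cmH k γ l (Tw ω)) {ω | 0 < ω.re} := fun ω hω => by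
    have hω : 0 < ω.re := hω
    have h3 : ω ≠ 0 := fun h => by simp [h] at hω
    have := (cm_H_diff isClosed_closure dm.cv.cont hcl hk.int _ (hWl ω h3 hω.le).2).differentiableAt
      (isClosed_closure.isOpen_compl.mem_nhds (hWl ω h3 hω.le).2)
    exact (DifferentiableAt.comp ω this (hTc ω h3 hω.le)).differentiableWithinAt
  have hfin := B4 (fun ω => cmH k γ l (Tw ω)) ((C2/c1 + C3) * Q) n hn (by positivity) hdiff
    (fun ω hω hωx => by
      have h3 : ω ≠ 0 := fun h => by simp [h] at hω
      have hp := norm_pos_iff.2 h3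
      have hWb : ‖W ω‖ ≤ 1/2 := by rw [hWn ω h3, ← hx0l]; gcongr
      have := B2 n k Q hk (W ω) (c1 * (ω.re/‖ω‖)) (by positivity) (exp_ne_zero _) hWb (hWg ω h3 hω.le)
      refine this.trans ?_
      rw [hWn ω h3, ← Real.rpow_mul hp.le, show lam * -(1/2) = -(lam/2) by ring]
      gcongr
      rw [show C2 * Q / (c1 * (ω.re/‖ω‖)) = C2/c1 * Q * (‖ω‖/ω.re) by field_simp]
      gcongr; linarith)
    (fun ω hω hωx => by
      refine (B3 n k Q hk _ ⟨ω, ⟨mem_sphere_zero_iff_norm.2 hωx, hω.le⟩, rfl⟩).trans ?_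
      gcongr; exact le_add_of_nonneg_left (by positivity)) ω hω0 hωx hωr
  have hTx : Tw ω = z0 + e * x := by
    simp only [Tw]; rw [hWω]; congr 2
    have : 1 + w = a/(a-x) := by rw [hw]; field_simp; ring
    rw [this, hw]; field_simp
  simp only [hTx] at hfin
  refine hfin.trans ?_
  have j1 : ‖ω‖^(-(lam/2)) ≤ (2*a)^(1/2:ℝ) * ‖x‖^(-(1/2:ℝ)) := by
    rw [hωn, ← Real.rpow_mul hwp.le, show 1/lam * -(lam/2) = -(1/2) by field_simp]
    calc ‖w‖^(-(1/2:ℝ)) ≤ (‖x‖/(2*a))^(-(1/2:ℝ)) := Real.rpow_le_rpow_of_nonpos (by positivity) hw1 (by norm_num)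
      _ = _ := by rw [Real.div_rpow hxp.le (by positivity), Real.rpow_neg (by positivity : 0 ≤ 2*a)]; field_simp
  have j2 : (2*a)^(-(1/lam)) * ‖x‖^(1/lam) ≤ ‖ω‖ := by
    rw [hωn]
    calc _ = (‖x‖/(2*a))^(1/lam) := by rw [Real.div_rpow hxp.le (by positivity), Real.rpow_neg (by positivity)]; field_simp
      _ ≤ _ := by gcongr
  calc _ ≤ C4 * ((C2/c1+C3)*Q) * ((2*a)^(1/2:ℝ) * ‖x‖^(-(1/2:ℝ))) * Real.exp (-(c4*n*((2*a)^(-(1/lam)) * ‖x‖^(1/lam)))) := by gcongr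
    _ = _ := by
      rw [show c4*n*((2*a)^(-(1/lam)) * ‖x‖^(1/lam)) = c4*(2*a)^(-(1/lam))*n*‖x‖^(1/lam) by ring]; ring
theorem cm_inv {σ : ℂ → ℂ} {U : Set ℂ} (hU : IsOpen U) (hd : DifferentiableOn ℂ σ U) (hi : InjOn σ U) :
    ∃ g : ℂ → ℂ, ∀ u ∈ U, g (σ u) = u ∧ HasDerivAt g (deriv σ u)⁻¹ (σ u) := by
  set g := Function.invFunOn σ U
  have hg : ∀ u ∈ U, g (σ u) = u := fun u hu => hi.leftInvOn_invFunOn hu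
  refine ⟨g, fun u hu => ⟨hg u hu, ?_⟩⟩
  have hs : HasStrictDerivAt σ (deriv σ u) u := (hd.analyticAt (hU.mem_nhds hu)).hasStrictDerivAt
  have h0 := cm_inj_deriv_ne hU hd hi hu
  exact (hs.to_local_left_inverse h0 (by filter_upwards [hU.mem_nhds hu] with v hv using hg v hv)).hasDerivAt
theorem cm_loc_ext {G : Set ℂ} {φ f : ℂ → ℂ} {ζ z : ℂ} {σ : ℂ → ℂ} {R r : ℝ} (hG : IsOpen G) (hφ : ConformalOnto G φ ζ)
    (hc : ContinuousOn φ (closure G)) (hf : DifferentiableOn ℂ f G) (hf2 : ∀ p ∈ G, f p ^ 2 = deriv φ p) (ch : CmChart G z σ R r)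
    (hnz : ∀ u ∈ ball (0:ℂ) R, 0 ≤ u.im → φ (σ u) ≠ 0) :
    ∃ Φ s : ℂ → ℂ, DifferentiableOn ℂ Φ (ball z r) ∧ DifferentiableOn ℂ s (ball z r) ∧
      (∀ p ∈ ball z r, s p ^ 2 = deriv Φ p ∧ s p ≠ 0 ∧ (p ∈ closure G → Φ p = φ p) ∧ (p ∈ G → s p = f p) ∧
        (p ∉ G → ∃ q ∈ σ '' ball 0 R, q ∈ closure G ∧ ‖Φ p‖ = ‖φ q‖⁻¹ ∧ ‖φ q‖ ≤ 1)) := by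
  obtain ⟨hR, hr, hσd, hσi, hσ0, hσb, hσs⟩ := ch
  have hnb := cm_norm_bd hG hφ hc
  have hcl : ∀ u ∈ ball (0:ℂ) R, 0 ≤ u.im → σ u ∈ closure G := fun u hu h => by
    rcases h.lt_or_eq with h1 | h1
    · exact subset_closure ((hσs u hu).1 h1)
    · exact frontier_subset_closure ((hσs u hu).2.1 h1.symm)
  have hlt : ∀ p ∈ G, ‖φ p‖ < 1 := fun p hp => mem_ball_zero_iff.1 (hφ.bijOn.mapsTo hp)
  have hdφ : DifferentiableOn ℂ φ G := fun p hp => (hφ.differentiable p hp).differentiableWithinAt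
  have hσat : ∀ u ∈ ball (0:ℂ) R, DifferentiableAt ℂ σ u := fun u hu => hσd.differentiableAt (isOpen_ball.mem_nhds hu)
  obtain ⟨Φ, hΦd, hΦu, hΦl⟩ := cm_reflect (Φ0 := fun u => φ (σ u)) (R := R)
    (hc.comp (hσd.continuousOn.mono inter_subset_left) fun u hu => hcl u hu.1 hu.2)
    (fun u hu h => (hφ.differentiable _ ((hσs u hu).1 h)).comp u (hσat u hu))
    (fun u hu h => hnb _ ((hσs u hu).2.1 h)) hnz
  have hup : IsOpen (ball (0:ℂ) R ∩ {u | 0 < u.im}) := isOpen_ball.inter (isOpen_lt (by fun_prop) (by fun_prop))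
  have hlo : IsOpen (ball (0:ℂ) R ∩ {u | u.im < 0}) := isOpen_ball.inter (isOpen_lt (by fun_prop) (by fun_prop))
  have hcj : ∀ u ∈ ball (0:ℂ) R, (starRingEnd ℂ) u ∈ ball (0:ℂ) R := fun u hu => by
    rw [mem_ball_zero_iff] at hu ⊢; rwa [norm_conj]
  have hΦinj : ∀ u ∈ ball (0:ℂ) R, ∀ v ∈ ball (0:ℂ) R, 0 < u.im → 0 < v.im → φ (σ u) = φ (σ v) → u = v := fun u hu v hv h1 h2 h =>
    hσi hu hv (hφ.bijOn.injOn ((hσs u hu).1 h1) ((hσs v hv).1 h2) h)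
  have hΦ' : ∀ u ∈ ball (0:ℂ) R, deriv Φ u ≠ 0 := by
    intro u hu
    rcases lt_trichotomy u.im 0 with h | h | h
    · refine cm_inj_deriv_ne hlo (hΦd.mono inter_subset_left) ?_ ⟨hu, h⟩
      rintro u ⟨hu, h1⟩ v ⟨hv, h2⟩ he
      rw [hΦl u hu (le_of_lt h1), hΦl v hv (le_of_lt h2)] at he
      have h3 := hΦinj _ (hcj u hu) _ (hcj v hv) (by simpa using h1) (by simpa using h2) ((starRingEnd ℂ).injective (inv_injective he))
      exact (starRingEnd ℂ).injective h3
    · have hR' : 0 < R - ‖u‖ := by rw [mem_ball_zero_iff] at hu; linarith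
      have hsub : ∀ v ∈ ball (0:ℂ) (R - ‖u‖), u + v ∈ ball (0:ℂ) R := fun v hv => by
        rw [mem_ball_zero_iff] at hv ⊢; linarith [norm_add_le u v]
      have := cm_hopf (Φ := fun v => Φ (u + v)) hR' (hΦd.comp (by fun_prop) hsub) (fun v hv hv' => by
        have him : 0 < (u + v).im := by rw [add_im, h, zero_add]; exact hv'
        rw [hΦu _ (hsub v hv) him.le]
        exact hlt _ ((hσs _ (hsub v hv)).1 him)) (by
        rw [add_zero, hΦu u hu h.ge]; exact hnb _ ((hσs u hu).2.1 h))
      rwa [deriv_comp_const_add, add_zero] at this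
    · refine cm_inj_deriv_ne hup (hΦd.mono inter_subset_left) ?_ ⟨hu, h⟩
      rintro u ⟨hu, h1⟩ v ⟨hv, h2⟩ he
      rw [hΦu u hu (le_of_lt h1), hΦu v hv (le_of_lt h2)] at he
      exact hΦinj u hu v hv h1 h2 he
  have hσ' : ∀ u ∈ ball (0:ℂ) R, deriv σ u ≠ 0 := fun u hu => cm_inj_deriv_ne isOpen_ball hσd hσi hu
  obtain ⟨s, hsd, hs0, hs2⟩ := cm_root_ball (f := fun u => deriv Φ u / deriv σ u) ((hΦd.deriv isOpen_ball).div (hσd.deriv isOpen_ball) hσ')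
    (fun u hu => div_ne_zero (hΦ' u hu) (hσ' u hu)) 2 two_ne_zero
  have hUc : IsPreconnected (ball (0:ℂ) R ∩ {u | 0 < u.im}) := ((convex_ball _ _).inter (convex_halfSpace_im_gt 0)).isPreconnected
  have hfd : ∀ u ∈ ball (0:ℂ) R, 0 < u.im → deriv Φ u = deriv φ (σ u) * deriv σ u := fun u hu h => by
    have : Φ =ᶠ[𝓝 u] φ ∘ σ := by
      filter_upwards [hup.mem_nhds ⟨hu, h⟩] with v hv using hΦu v hv.1 (le_of_lt hv.2)
    rw [this.deriv_eq, deriv_comp u (hφ.differentiable _ ((hσs u hu).1 h)) (hσat u hu)]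
  have hpm : ∃ ε : ℂ, ε^2 = 1 ∧ ∀ u ∈ ball (0:ℂ) R, 0 < u.im → f (σ u) = ε * s u := by
    have h1 : ContinuousOn (fun u => f (σ u)) (ball (0:ℂ) R ∩ {u | 0 < u.im}) := hf.continuousOn.comp (hσd.continuousOn.mono inter_subset_left)
      fun u hu => (hσs u hu.1).1 hu.2
    rcases hUc.eq_or_eq_neg_of_sq_eq h1 (hsd.continuousOn.mono inter_subset_left) (fun u hu => by
      simp only [Pi.pow_apply]
      rw [hf2 _ ((hσs u hu.1).1 hu.2), hs2 u hu.1, hfd u hu.1 hu.2, mul_div_cancel_right₀ _ (hσ' u hu.1)]) (fun {u} hu => hs0 u hu.1) with h | h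
    · exact ⟨1, by norm_num, fun u hu hi => by rw [one_mul]; exact h ⟨hu, hi⟩⟩
    · exact ⟨-1, by norm_num, fun u hu hi => by rw [neg_one_mul]; exact h ⟨hu, hi⟩⟩
  obtain ⟨ε, hε, hfs⟩ := hpm
  obtain ⟨g, hg⟩ := cm_inv isOpen_ball hσd hσi
  have hpull : ∀ p ∈ ball z r, ∃ u ∈ ball (0:ℂ) R, σ u = p ∧ g p = u ∧ HasDerivAt g (deriv σ u)⁻¹ p := fun p hp => by
    obtain ⟨u, hu, rfl⟩ := hσb hp
    exact ⟨u, hu, rfl, hg u hu⟩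
  have hcmp : ∀ F : ℂ → ℂ, DifferentiableOn ℂ F (ball 0 R) → ∀ p ∈ ball z r, DifferentiableAt ℂ (fun p => F (g p)) p := fun F hF p hp => by
    obtain ⟨u, hu, h1, h2, h3⟩ := hpull p hp
    exact DifferentiableAt.comp p (by rw [h2]; exact hF.differentiableAt (isOpen_ball.mem_nhds hu)) h3.differentiableAt
  refine ⟨fun p => Φ (g p), fun p => ε * s (g p), fun p hp => (hcmp Φ hΦd p hp).differentiableWithinAt,
    fun p hp => ((hcmp s hsd p hp).const_mul ε).differentiableWithinAt, fun p hp => ?_⟩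
  obtain ⟨u, hu, rfl, h2, h3⟩ := hpull p hp
  have hΦat : HasDerivAt Φ (deriv Φ u) (g (σ u)) := by
    rw [h2]; exact (hΦd.differentiableAt (isOpen_ball.mem_nhds hu)).hasDerivAt
  have hGu : σ u ∈ G → 0 < u.im := fun h => by
    by_contra! h4
    rcases h4.lt_or_eq with h5 | h5
    · exact (hσs u hu).2.2 h5 (subset_closure h)
    · have := (hσs u hu).2.1 h5; rw [hG.frontier_eq] at this; exact this.2 h
  refine ⟨?_, ?_, fun h => ?_, fun h => ?_, fun h => ?_⟩
  · have h5 : deriv (fun p => Φ (g p)) (σ u) = _ := (hΦat.comp (σ u) h3).deriv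
    change (ε * s (g (σ u)))^2 = _
    rw [h5, mul_pow, hε, one_mul, h2, hs2 u hu]; rfl
  · refine mul_ne_zero (fun h => by simp [h] at hε) ?_
    rw [h2]; exact hs0 u hu
  · have : 0 ≤ u.im := not_lt.1 fun h4 => (hσs u hu).2.2 h4 h
    change Φ (g (σ u)) = _
    rw [h2]; exact hΦu u hu this
  · change ε * s (g (σ u)) = _
    rw [h2]; exact (hfs u hu (hGu h)).symm
  · have hi : u.im ≤ 0 := not_lt.1 fun h4 => h ((hσs u hu).1 h4)
    have hi' : 0 ≤ ((starRingEnd ℂ) u).im := by rw [conj_im]; linarith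
    refine ⟨σ ((starRingEnd ℂ) u), ⟨_, hcj u hu, rfl⟩, hcl _ (hcj u hu) hi', ?_, ?_⟩
    · change ‖Φ (g (σ u))‖ = _
      rw [h2, hΦl u hu hi, norm_inv, norm_conj]
    · rcases hi'.lt_or_eq with h5 | h5
      · exact (hlt _ ((hσs _ (hcj u hu)).1 h5)).le
      · exact (hnb _ ((hσs _ (hcj u hu)).2.1 h5.symm)).le
theorem cm_glue {G A : Set ℂ} {r : ℂ → ℝ} {N0 : ℂ → ℂ} {Nz : ℂ → ℂ → ℂ} (hG : IsOpen G) (hA : A ⊆ closure G) (hr : ∀ z ∈ A, 0 < r z)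
    (h0 : DifferentiableOn ℂ N0 G) (hz : ∀ z ∈ A, DifferentiableOn ℂ (Nz z) (ball z (r z))) (he : ∀ z ∈ A, ∀ p ∈ ball z (r z), p ∈ G → Nz z p = N0 p) :
    ∃ N : ℂ → ℂ, DifferentiableOn ℂ N (G ∪ ⋃ z ∈ A, ball z (r z/3)) ∧ (∀ p ∈ G, N p = N0 p) ∧ ∀ z ∈ A, ∀ p ∈ ball z (r z/3), N p = Nz z p := by
  classical
  have key : ∀ z ∈ A, ∀ z' ∈ A, r z' ≤ r z → ∀ p, p ∈ ball z (r z/3) → p ∈ ball z' (r z'/3) → Nz z p = Nz z' p := by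
    intro z hzA z' hzA' hrr p hp hp'
    have hr0 := hr z hzA
    have hr0' := hr z' hzA'
    have hmem : z' ∈ ball z (r z) := by
      rw [mem_ball] at *
      calc dist z' z ≤ dist p z' + dist p z := by rw [dist_comm p z']; exact dist_triangle _ _ _
        _ < r z := by linarith
    set S := ball z (r z) ∩ ball z' (r z')
    have hS : IsOpen S := isOpen_ball.inter isOpen_ball
    obtain ⟨q, hqS, hqG⟩ := mem_closure_iff.1 (hA hzA') S hS ⟨hmem, mem_ball_self hr0'⟩
    have h1 : AnalyticOnNhd ℂ (Nz z) S := fun x hx => (hz z hzA).analyticAt (isOpen_ball.mem_nhds hx.1)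
    have h2 : AnalyticOnNhd ℂ (Nz z') S := fun x hx => (hz z' hzA').analyticAt (isOpen_ball.mem_nhds hx.2)
    refine h1.eqOn_of_preconnected_of_eventuallyEq h2 ((convex_ball _ _).inter (convex_ball _ _)).isPreconnected hqS ?_
      ⟨ball_subset_ball (by linarith) hp, ball_subset_ball (by linarith) hp'⟩
    filter_upwards [hS.mem_nhds hqS, hG.mem_nhds hqG] with y hy hyG
    rw [he z hzA y hy.1 hyG, he z' hzA' y hy.2 hyG]
  set N : ℂ → ℂ := fun p => if p ∈ G then N0 p else if h : ∃ z ∈ A, p ∈ ball z (r z/3) then Nz h.choose p else 0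
  have hN0 : ∀ p ∈ G, N p = N0 p := fun p hp => if_pos hp
  have hNz : ∀ z ∈ A, ∀ p ∈ ball z (r z/3), N p = Nz z p := fun z hzA p hp => by
    by_cases hpG : p ∈ G
    · rw [hN0 p hpG, he z hzA p (ball_subset_ball (by linarith [hr z hzA]) hp) hpG]
    · have hex : ∃ z ∈ A, p ∈ ball z (r z/3) := ⟨z, hzA, hp⟩
      simp only [N, if_neg hpG, dif_pos hex]
      obtain ⟨h1, h2⟩ := hex.choose_spec
      rcases le_total (r hex.choose) (r z) with h | h
      · exact (key z hzA _ h1 h p hp h2).symm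
      · exact key _ h1 z hzA h p h2 hp
  refine ⟨N, ?_, hN0, hNz⟩
  rintro p (hp | hp)
  · exact ((h0.differentiableAt (hG.mem_nhds hp)).congr_of_eventuallyEq (by filter_upwards [hG.mem_nhds hp] with y hy using hN0 y hy)).differentiableWithinAt
  · obtain ⟨z, hzA, hp⟩ := mem_iUnion₂.1 hp
    refine (((hz z hzA).differentiableAt (isOpen_ball.mem_nhds (ball_subset_ball (by linarith [hr z hzA]) hp))).congr_of_eventuallyEq ?_).differentiableWithinAt
    filter_upwards [isOpen_ball.mem_nhds hp] with y hy using hNz z hzA y hy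
theorem cm_decay {G : Set ℂ} {z0 e ζ : ℂ} {lam a : ℝ} {φ : ℂ → ℂ} (P : CmPt G z0 e lam a) (hG : IsOpen G) (hb : Bornology.IsBounded G)
    (hz0 : z0 ∈ frontier G) (hφ : ConformalOnto G φ ζ) (hc : ContinuousOn φ (closure G)) :
    ∃ C > 0, ∃ δ > 0, ∀ z ∈ closure G, ‖z - z0‖ < δ → Real.exp (-(C * ‖z - z0‖^(1/(2-lam)))) ≤ ‖φ z‖ := by
  obtain ⟨h0, h2⟩ := P.hl
  have a0 := P.a0
  have e0 : e ≠ 0 := fun h => by have := P.e1; rw [h] at this; simp at this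
  have hac : (a:ℂ) ≠ 0 := by exact_mod_cast a0.ne'
  have hnb := cm_norm_bd hG hφ hc
  have hpi := Real.pi_pos
  set κ := 1/(2-lam) with hκ
  have hκ0 : 0 < κ := by have : 0 < 2 - lam := by linarith
                         positivity
  set y : ℂ → ℂ := fun z => ((z - z0)/e) / ((z - z0)/e - a)
  have hD : ∀ z ∈ closure G, (z - z0)/e - a ≠ 0 := fun z hz h => by
    refine P.ext ?_
    rw [← sub_eq_zero.1 h]; field_simp; simpa using hz
  have hyn : ∀ z, ‖y z‖ = ‖z - z0‖/‖(z - z0)/e - a‖ := fun z => by simp only [y, norm_div, P.e1, div_one]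
  have hy0 : ∀ z ∈ closure G, z ≠ z0 → y z ≠ 0 := fun z hz h => div_ne_zero (div_ne_zero (sub_ne_zero.2 h) e0) (hD z hz)
  have hyr : ∀ z ∈ closure G, z ≠ z0 → -Real.cos (lam * Real.pi/2) * ‖y z‖ < (y z).re := fun z hz h => by
    by_contra! hh
    obtain ⟨h3, h4⟩ := P.lens (-y z) (neg_ne_zero.2 (hy0 z hz h)) (by rw [norm_neg, neg_re]; linarith)
    refine h4 ?_
    have hDz := hD z hz
    have e1 : 1 + -y z = -a/((z - z0)/e - a) := by rw [eq_div_iff hDz, add_mul, neg_mul, div_mul_cancel₀ _ hDz]; ring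
    have : z0 + e * (a * -y z/(1 + -y z)) = z := by
      have ha : (a:ℂ) ≠ 0 := ofReal_ne_zero.2 P.a0.ne'
      rw [e1, show (a:ℂ) * -y z/(-a/((z - z0)/e - a)) = (z - z0)/e by
        rw [div_div_eq_mul_div, div_eq_iff (neg_ne_zero.2 ha), mul_assoc, neg_mul, div_mul_cancel₀ _ hDz]; ring, mul_div_cancel₀ _ e0]; ring
    rwa [this]
  have harg : ∀ z ∈ closure G, z ≠ z0 → |(y z).arg * κ| < Real.pi/2 := fun z hz h => by
    have h5 := hyr z hz h
    have hp := norm_pos_iff.2 (hy0 z hz h)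
    rw [← lt_div_iff₀ hp, ← cos_arg (hy0 z hz h), ← Real.cos_pi_sub] at h5
    rw [abs_mul, abs_of_pos hκ0, hκ, mul_one_div, div_lt_iff₀ (by linarith)]
    by_contra! hh
    have := Real.cos_le_cos_of_nonneg_of_le_pi (x := Real.pi - lam*Real.pi/2) (y := |(y z).arg|) (by nlinarith) (abs_arg_le_pi _) (by linarith)
    rw [Real.cos_abs] at this; linarith
  have hslit : ∀ z ∈ closure G, z ≠ z0 → y z ∈ slitPlane := fun z hz h => by
    rw [mem_slitPlane_iff_arg]
    refine ⟨fun h5 => ?_, hy0 z hz h⟩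
    have := harg z hz h
    rw [h5, abs_of_pos (by positivity), hκ, mul_one_div, div_lt_iff₀ (by linarith)] at this
    nlinarith
  set q : ℂ → ℂ := fun z => y z ^ (κ:ℂ)
  have hqr : ∀ z ∈ closure G, z ≠ z0 → 0 < (q z).re := fun z hz h => by
    simp only [q]; rw [cpow_def_of_ne_zero (hy0 z hz h), exp_re, im_mul_ofReal, log_im]
    exact mul_pos (Real.exp_pos _) (Real.cos_pos_of_mem_Ioo (abs_lt.1 (harg z hz h)))
  have hqr' : ∀ z ∈ closure G, 0 ≤ (q z).re := fun z hz => by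
    by_cases h : z = z0
    · have : y z0 = 0 := by simp [y]
      simp only [q]; rw [h, this, zero_cpow (by exact_mod_cast hκ0.ne')]; simp
    · exact (hqr z hz h).le
  have hyd : ∀ z ∈ closure G, DifferentiableAt ℂ y z := fun z hz => by
    refine DifferentiableAt.div (by fun_prop) (by fun_prop) (hD z hz)
  have hqc : ContinuousOn q (closure G) := fun z hz => by
    refine (ContinuousAt.comp (f := y) (g := fun x => x ^ (κ:ℂ)) (continuousAt_cpow_const_of_re_pos ?_ (by simpa using hκ0))
      (hyd z hz).continuousAt).continuousWithinAt
    by_cases h : z = z0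
    · left; rw [h]; simp [y]
    · exact (hslit z hz h).imp le_of_lt id
  have hne : ∀ z ∈ G, z ≠ z0 := fun z hz h => by rw [hG.frontier_eq] at hz0; exact hz0.2 (h ▸ hz)
  have hqd : DifferentiableOn ℂ q G := fun z hz => ((hyd z (subset_closure hz)).cpow (differentiableAt_const _)
    (hslit z (subset_closure hz) (hne z hz))).differentiableWithinAt
  have hK : IsCompact (closure G ∩ {z | ‖φ z‖ ≤ 1/2}) := hb.isCompact_closure.of_isClosed_subset
    (hc.norm.preimage_isClosed_of_isClosed isClosed_closure isClosed_Iic) inter_subset_left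
  obtain ⟨c0, hc0, hc0'⟩ := hK.exists_forall_le' (f := fun z => (q z).re) (a := 0) (continuous_re.comp_continuousOn (hqc.mono inter_subset_left))
    (fun z hz => hqr z hz.1 fun h => by have := hnb z0 hz0; have h7 : ‖φ z‖ ≤ 1/2 := hz.2; rw [h, this] at h7; norm_num at h7)
  set C0 := Real.log 2/c0
  have hC0 : 0 < C0 := div_pos (Real.log_pos one_lt_two) hc0
  set U : Set ℂ := G ∩ {z | 1/2 < ‖φ z‖}
  have hφG := hc.mono subset_closure
  have hU : IsOpen U := hφG.norm.isOpen_inter_preimage hG isOpen_Ioi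
  have hUc : closure U ⊆ closure G ∩ {z | 1/2 ≤ ‖φ z‖} := closure_minimal (fun z hz => ⟨subset_closure hz.1, le_of_lt (show 1/2 < ‖φ z‖ from hz.2)⟩)
    (hc.norm.preimage_isClosed_of_isClosed isClosed_closure isClosed_Ici)
  have hpos : ∀ z ∈ closure U, 0 < ‖φ z‖ := fun z hz => lt_of_lt_of_le (by norm_num) (hUc hz).2
  set g : ℂ → ℂ := fun z => exp (-(C0 * q z)) / φ z
  have hgn : ∀ z, ‖g z‖ = Real.exp (-(C0 * (q z).re)) / ‖φ z‖ := fun z => by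
    simp only [g, norm_div, norm_exp, neg_re, re_ofReal_mul]
  have hgd : DiffContOnCl ℂ g U := by
    refine ⟨?_, ?_⟩
    · refine DifferentiableOn.div (((hqd.mono inter_subset_left).const_mul _).neg.cexp)
        (fun z hz => (hφ.differentiable z hz.1).differentiableWithinAt) fun z hz => norm_pos_iff.1 (hpos z (subset_closure hz))
    · have := hqc.mono (hUc.trans inter_subset_left)
      exact ContinuousOn.div ((continuousOn_const.mul this).neg.cexp) (hc.mono (hUc.trans inter_subset_left)) fun z hz => norm_pos_iff.1 (hpos z hz)
  have hmax : ∀ z ∈ closure U, ‖g z‖ ≤ 1 := fun z hz => norm_le_of_forall_mem_frontier_norm_le (hb.subset inter_subset_left) hgd (fun z hz => by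
    rw [hU.frontier_eq] at hz
    obtain ⟨hz1, hz2⟩ := hUc hz.1
    rw [hgn, div_le_one (hpos z hz.1)]
    by_cases hzG : z ∈ G
    · have h6 : ‖φ z‖ ≤ 1/2 := not_lt.1 fun h => hz.2 ⟨hzG, h⟩
      have h7 := hc0' z ⟨hz1, h6⟩
      refine le_trans ?_ (show 1/2 ≤ ‖φ z‖ from hz2)
      rw [show (1/2:ℝ) = Real.exp (-Real.log 2) by rw [Real.exp_neg, Real.exp_log two_pos, one_div], Real.exp_le_exp]
      have : C0 * c0 = Real.log 2 := div_mul_cancel₀ _ hc0.ne'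
      have : C0 * c0 ≤ C0 * (q z).re := by gcongr
      linarith
    · rw [hnb z (by rw [hG.frontier_eq]; exact ⟨hz1, hzG⟩), Real.exp_le_one_iff]
      have := hqr' z hz1; nlinarith) hz
  obtain ⟨δ, hδ, hδ'⟩ := Metric.continuousOn_iff.1 hc z0 (frontier_subset_closure hz0) (1/2) (by norm_num)
  refine ⟨C0 * (2/a)^κ, by positivity, min δ (a/2), by positivity, fun z hz hzd => ?_⟩
  by_cases hzG : z ∈ G
  swap
  · rw [hnb z (by rw [hG.frontier_eq]; exact ⟨hz, hzG⟩), Real.exp_le_one_iff, neg_nonpos]; positivity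
  have h8 : 1/2 < ‖φ z‖ := by
    have := hδ' z hz (by rw [dist_eq_norm]; exact hzd.trans_le (min_le_left _ _))
    rw [dist_eq_norm, norm_sub_rev] at this
    have h9 := norm_sub_norm_le (φ z0) (φ z); rw [hnb z0 hz0] at h9; linarith
  have h9 := hmax z (subset_closure ⟨hzG, h8⟩)
  rw [hgn, div_le_one (by linarith)] at h9
  refine le_trans (Real.exp_le_exp.2 (neg_le_neg ?_)) h9
  rw [mul_assoc, ← Real.mul_rpow (by positivity) (norm_nonneg _)]
  gcongr
  refine (re_le_norm _).trans ?_
  simp only [q]; rw [norm_cpow_real]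
  refine Real.rpow_le_rpow (norm_nonneg _) ?_ hκ0.le
  rw [hyn, div_mul_eq_mul_div, div_le_div_iff₀ (norm_pos_iff.2 (hD z hz)) a0]
  have h10 : ‖z - z0‖ < a/2 := hzd.trans_le (min_le_right _ _)
  have h11 := norm_sub_norm_le (a:ℂ) ((z - z0)/e)
  rw [norm_sub_rev (a:ℂ), norm_div, P.e1, norm_real, Real.norm_of_nonneg a0.le] at h11
  nlinarith [norm_nonneg (z - z0)]
structure CmExt (G E W : Set ℂ) (lam : ℂ → ℝ) (φ φt f : ℂ → ℂ) (ρ1 : ℝ) : Prop where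
  Wo : IsOpen W
  WG : G ⊆ W
  WL : ∀ z ∈ frontier G, z ∉ E → z ∈ W
  WE : ∀ z ∈ E, z ∉ W
  cor : ∀ z0 ∈ E, ∃ c > 0, ∃ ρ > 0, ∀ z ∈ frontier G, z ≠ z0 → ‖z - z0‖ < ρ → ball z (c * ‖z - z0‖) ⊆ W
  dφ : DifferentiableOn ℂ φt W
  df : DifferentiableOn ℂ f W
  sq : ∀ p ∈ W, f p ^ 2 = deriv φt p
  ne : ∀ p ∈ W, f p ≠ 0
  eq : ∀ p ∈ closure G, p ∈ W → φt p = φ p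
  out : ∀ p ∈ W, p ∉ G → 1 ≤ ‖φt p‖
  bd : ∀ p ∈ W, ‖φt p‖ < 1/ρ1
  fb : ∀ z0 ∈ E, ∃ C > 0, ∃ δ > 0, ∀ p ∈ W, ‖p - z0‖ < δ → ‖f p‖ ≤ C * ‖p - z0‖^((1/(2 - lam z0) - 1)/2)
theorem CmDom.exists_charts {G E : Set ℂ} {l : ℝ} {γ : ℝ → ℂ} {lam a : ℂ → ℝ} {e : ℂ → ℂ} (dm : CmDom G E l γ lam a e) {φ : ℂ → ℂ} {ζ : ℂ}
    (hφ : ConformalOnto G φ ζ) (hc : ContinuousOn φ (closure G)) {ρ1 : ℝ} (hρ1 : ρ1 < 1) :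
    ∃ ρ > 0, ρ ≤ 1/2 ∧ (∀ z0 ∈ E, (∀ p ∈ closure G, ‖p - z0‖ < 2*ρ → Real.exp (-(ρ⁻¹ * ‖p - z0‖^(1/(2-lam z0)))) ≤ ‖φ p‖) ∧
      (∀ z' ∈ E, z' ≠ z0 → 2*ρ ≤ ‖z' - z0‖)) ∧
    ∀ z ∈ frontier G, z ∉ E → ∃ σ R r, CmChart G z σ R r ∧ (∀ u ∈ ball (0:ℂ) R, σ u ∈ closure G → ρ1 < ‖φ (σ u)‖) ∧ ∀ z0 ∈ E,
      r ≤ ‖z - z0‖/2 ∧ (‖z - z0‖ < ρ → ρ * ‖z - z0‖ ≤ r ∧ σ '' ball 0 R ⊆ ball z (‖z - z0‖/2)) := by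
  have hnb := cm_norm_bd dm.o hφ hc
  have hnear : ∀ z ∈ frontier G, ∃ δ > 0, ∀ p ∈ closure G, ‖p - z‖ < δ → ρ1 < ‖φ p‖ := fun z hz => by
    obtain ⟨δ, hδ, hδ'⟩ := Metric.continuousOn_iff.1 hc z (frontier_subset_closure hz) (1 - ρ1) (by linarith)
    refine ⟨δ, hδ, fun p hp h => ?_⟩
    have := hδ' p hp (by rwa [dist_eq_norm])
    rw [dist_eq_norm, norm_sub_rev] at this
    have h9 := norm_sub_norm_le (φ z) (φ p); rw [hnb z hz] at h9; linarith
  have hev : ∀ᶠ ρ : ℝ in 𝓝[>] 0, ∀ z0 ∈ E, (∀ z ∈ frontier G, z ≠ z0 → ‖z - z0‖ < ρ → ∃ σ R, CmChart G z σ R (ρ * ‖z - z0‖) ∧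
      σ '' ball 0 R ⊆ ball z (‖z - z0‖/2)) ∧ (∀ p ∈ closure G, ‖p - z0‖ < 2*ρ → ρ1 < ‖φ p‖) ∧
      (∀ p ∈ closure G, ‖p - z0‖ < 2*ρ → Real.exp (-(ρ⁻¹ * ‖p - z0‖^(1/(2-lam z0)))) ≤ ‖φ p‖) ∧ (∀ z' ∈ E, z' ≠ z0 → 2*ρ ≤ ‖z' - z0‖) := by
    rw [Filter.eventually_all_finite dm.cv.fin]
    intro z0 hz0
    obtain ⟨c', hc', ρ', hρ', h1⟩ := (dm.pt z0 hz0).chart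
    obtain ⟨δ, hδ, h2⟩ := hnear z0 (dm.EL hz0)
    obtain ⟨C, hC, δ', hδ', h3⟩ := cm_decay (dm.pt z0 hz0) dm.o dm.b (dm.EL hz0) hφ hc
    have h4 : ∀ᶠ ρ : ℝ in 𝓝[>] 0, ∀ z' ∈ E, z' ≠ z0 → 2*ρ ≤ ‖z' - z0‖ := by
      rw [Filter.eventually_all_finite dm.cv.fin]
      intro z' _
      by_cases h : z' = z0
      · exact Eventually.of_forall fun _ h' => absurd h h'
      · filter_upwards [Ioo_mem_nhdsGT (half_pos (norm_pos_iff.2 (sub_ne_zero.2 h)))] with ρ hρ _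
        linarith [hρ.2]
    filter_upwards [h4, Ioo_mem_nhdsGT (show 0 < min (min c' ρ') (min (δ/2) (min (δ'/2) C⁻¹)) by positivity)] with ρ h5 ⟨hρ0, h6⟩
    simp only [lt_min_iff] at h6
    obtain ⟨⟨i1, i2⟩, i3, i4, i5⟩ := h6
    refine ⟨fun z hz hne hd => ?_, fun p hp hd => h2 p hp (by linarith), fun p hp hd => le_trans ?_ (h3 p hp (by linarith)), h5⟩
    · obtain ⟨σ, R, ⟨j1, j2, j3, j4, j5, j6, j7⟩, h8⟩ := h1 z hz hne (by linarith)
      have hp : 0 < ‖z - z0‖ := norm_pos_iff.2 (sub_ne_zero.2 hne)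
      exact ⟨σ, R, ⟨j1, by positivity, j3, j4, j5, (ball_subset_ball (by gcongr)).trans j6, j7⟩, h8⟩
    · apply Real.exp_le_exp.2; apply neg_le_neg; gcongr
      rw [le_inv_comm₀ hC hρ0]; exact i5.le
  obtain ⟨ρ, hρ, hρ0, hρ2⟩ := (hev.and (Ioo_mem_nhdsGT (show (0:ℝ) < 1/2 by norm_num))).exists
  refine ⟨ρ, hρ0, hρ2.le, fun z0 hz0 => (hρ z0 hz0).2.2, fun z hz hzE => ?_⟩
  by_cases hex : ∃ z0 ∈ E, ‖z - z0‖ < ρ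
  · obtain ⟨z0, hz0, hd⟩ := hex
    obtain ⟨k1, k2, k3, k4⟩ := hρ z0 hz0
    obtain ⟨σ, R, hch, him⟩ := k1 z hz (fun h => hzE (h ▸ hz0)) hd
    refine ⟨σ, R, _, hch, fun u hu hcl => k2 _ hcl ?_, fun z' hz' => ?_⟩
    · have h1 := mem_ball_iff_norm.1 (him ⟨u, hu, rfl⟩)
      have : ‖σ u - z0‖ ≤ ‖σ u - z‖ + ‖z - z0‖ := norm_sub_le_norm_sub_add_norm_sub _ _ _
      linarith
    · by_cases h : z' = z0
      · subst h; exact ⟨by nlinarith [norm_nonneg (z - z')], fun _ => ⟨le_rfl, him⟩⟩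
      · have h1 := k4 z' hz' h
        have h2 : ‖z' - z0‖ ≤ ‖z - z'‖ + ‖z - z0‖ := by rw [norm_sub_rev z z']; exact norm_sub_le_norm_sub_add_norm_sub _ _ _
        exact ⟨by nlinarith [norm_nonneg (z - z0)], fun h3 => by linarith⟩
  · push Not at hex
    obtain ⟨τ, R, r, h1, h2, h3, h4, h5, h6, h7⟩ := dm.smooth z hz hzE
    obtain ⟨δ, hδ, h8⟩ := hnear z hz
    have h0R : (0:ℂ) ∈ ball (0:ℂ) R := mem_ball_self h1
    have hat := h3.analyticAt (isOpen_ball.mem_nhds h0R)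
    obtain ⟨R', hR', h9⟩ := Metric.mem_nhds_iff.1 (Filter.inter_mem (isOpen_ball.mem_nhds h0R)
      (hat.continuousAt.preimage_mem_nhds (by rw [h5]; exact ball_mem_nhds z hδ)))
    have hopen : τ '' ball 0 R' ∈ 𝓝 z := by
      have := hat.hasStrictDerivAt.map_nhds_eq (cm_inj_deriv_ne isOpen_ball h3 h4 h0R)
      rw [h5] at this; rw [← this]; exact image_mem_map (ball_mem_nhds _ hR')
    obtain ⟨r', hr', h10⟩ := Metric.mem_nhds_iff.1 (Filter.inter_mem hopen (dm.cv.fin.isClosed.isOpen_compl.mem_nhds hzE))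
    have hs : ball 0 R' ⊆ ball (0:ℂ) R := fun u hu => (h9 hu).1
    refine ⟨τ, R', r'/2, ⟨hR', by positivity, h3.mono hs, h4.mono hs, h5, fun p hp => (h10 (ball_subset_ball (by linarith) hp)).1, fun u hu => h7 u (hs hu)⟩,
      fun u hu hcl => h8 _ hcl (mem_ball_iff_norm.1 (h9 hu).2), fun z0 hz0 => ⟨?_, fun h => absurd (hex z0 hz0) (not_le.2 h)⟩⟩
    by_contra! hh
    exact (h10 (mem_ball_iff_norm'.2 (by linarith) : z0 ∈ ball z r')).2 hz0
theorem CmDom.exists_ext {G E : Set ℂ} {l : ℝ} {γ : ℝ → ℂ} {lam a : ℂ → ℝ} {e : ℂ → ℂ} (dm : CmDom G E l γ lam a e) {φ : ℂ → ℂ} {ζ : ℂ}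
    (hφ : ConformalOnto G φ ζ) (hc : ContinuousOn φ (closure G)) {ρ1 : ℝ} (hρ0 : 0 < ρ1) (hρ1 : ρ1 < 1) :
    ∃ W φt f, CmExt G E W lam φ φt f ρ1 := by
  have hnb := cm_norm_bd dm.o hφ hc
  have hG := dm.o
  have hdφ : DifferentiableOn ℂ φ G := fun p hp => (hφ.differentiable p hp).differentiableWithinAt
  have hlt : ∀ p ∈ G, ‖φ p‖ < 1 := fun p hp => mem_ball_zero_iff.1 (hφ.bijOn.mapsTo hp)
  have hle : ∀ p ∈ closure G, ‖φ p‖ ≤ 1 := fun p hp => by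
    by_cases h : p ∈ G
    · exact (hlt p h).le
    · exact (hnb p (by rw [hG.frontier_eq]; exact ⟨hp, h⟩)).le
  obtain ⟨f0, hf0, hf02⟩ := cm_sqrt_sc hG dm.sc (hdφ.deriv hG) fun z hz => cm_inj_deriv_ne hG hdφ hφ.bijOn.injOn hz
  obtain ⟨ρ, hρ, hρh, hE, hch⟩ := dm.exists_charts hφ hc hρ1
  set A := frontier G \ E
  have hch' : ∀ z ∈ A, ∃ (S : Set ℂ) (r : ℝ) (Φ s : ℂ → ℂ), 0 < r ∧ ball z r ⊆ S ∧ DifferentiableOn ℂ Φ (ball z r) ∧ DifferentiableOn ℂ s (ball z r) ∧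
      (∀ p ∈ S, p ∈ closure G → ρ1 < ‖φ p‖) ∧ (∀ p ∈ ball z r, s p ^ 2 = deriv Φ p ∧ s p ≠ 0 ∧ (p ∈ closure G → Φ p = φ p) ∧ (p ∈ G → s p = f0 p) ∧
        (p ∉ G → ∃ q ∈ S, q ∈ closure G ∧ ‖Φ p‖ = ‖φ q‖⁻¹ ∧ ‖φ q‖ ≤ 1)) ∧ ∀ z0 ∈ E, r ≤ ‖z - z0‖/2 ∧ (‖z - z0‖ < ρ → ρ * ‖z - z0‖ ≤ r ∧
          S ⊆ ball z (‖z - z0‖/2)) := by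
    intro z hz
    obtain ⟨σ, R, r, h1, h2, h3⟩ := hch z hz.1 hz.2
    obtain ⟨Φ, s, h4, h5, h6⟩ := cm_loc_ext hG hφ hc hf0 (fun p _ => hf02 p) h1 (fun u hu him => by
      have hcl : σ u ∈ closure G := by
        rcases him.lt_or_eq with h | h
        · exact subset_closure ((h1.2.2.2.2.2.2 u hu).1 h)
        · exact frontier_subset_closure ((h1.2.2.2.2.2.2 u hu).2.1 h.symm)
      exact norm_pos_iff.1 (hρ0.trans (h2 u hu hcl)))
    refine ⟨σ '' ball 0 R, r, Φ, s, h1.2.1, h1.2.2.2.2.2.1, h4, h5, ?_, h6, h3⟩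
    rintro _ ⟨u, hu, rfl⟩ hcl; exact h2 u hu hcl
  choose! S r Φ s hr hS hΦ hs hSρ hprop hrE using hch'
  have hAc : A ⊆ closure G := fun z hz => frontier_subset_closure hz.1
  obtain ⟨φt, t1, t2, t3⟩ := cm_glue (Nz := Φ) hG hAc hr hdφ hΦ fun z hz p hp hpG => (hprop z hz p hp).2.2.1 (subset_closure hpG)
  obtain ⟨f, f1, f2, f3⟩ := cm_glue (Nz := s) hG hAc hr hf0 hs fun z hz p hp hpG => (hprop z hz p hp).2.2.2.1 hpG
  set W : Set ℂ := G ∪ ⋃ z ∈ A, ball z (r z/3)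
  have hW : IsOpen W := hG.union (isOpen_biUnion fun z _ => isOpen_ball)
  have hBW : ∀ z ∈ A, ball z (r z/3) ⊆ W := fun z hz => (subset_biUnion_of_mem (u := fun z => ball z (r z/3)) hz).trans subset_union_right
  have hsub : ∀ z ∈ A, ball z (r z/3) ⊆ ball z (r z) := fun z hz => ball_subset_ball (by linarith [hr z hz])
  have hcase : ∀ p ∈ W, p ∈ G ∨ ∃ z ∈ A, p ∈ ball z (r z/3) := fun p hp => hp.imp id fun h => by simpa using h
  have hdz : ∀ z ∈ A, ∀ p ∈ ball z (r z/3), deriv φt p = deriv (Φ z) p := fun z hz p hp =>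
    Filter.EventuallyEq.deriv_eq (by filter_upwards [isOpen_ball.mem_nhds hp] with y hy using t3 z hz y hy)
  have hd0 : ∀ p ∈ G, deriv φt p = deriv φ p := fun p hp =>
    Filter.EventuallyEq.deriv_eq (by filter_upwards [hG.mem_nhds hp] with y hy using t2 y hy)
  have hsq : ∀ p ∈ W, f p ^ 2 = deriv φt p := fun p hp => by
    rcases hcase p hp with h | ⟨z, hz, h⟩
    · rw [f2 p h, hd0 p h, hf02]
    · rw [f3 z hz p h, hdz z hz p h]; exact (hprop z hz p (hsub z hz h)).1
  have hWE : ∀ z0 ∈ E, ∀ z ∈ A, ∀ p ∈ ball z (r z/3), ‖p - z‖ < ‖z - z0‖/6 := fun z0 hz0 z hz p hp => by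
    have := (hrE z hz z0 hz0).1
    have := mem_ball_iff_norm.1 hp; linarith
  have hnear : ∀ z0 ∈ E, ∀ z ∈ frontier G, z ≠ z0 → ‖z - z0‖ < ρ → z ∈ A ∧ ρ * ‖z - z0‖ ≤ r z := fun z0 hz0 z hz hne hd => by
    have hzA : z ∈ A := ⟨hz, fun h => by linarith [(hE z0 hz0).2 z h hne, norm_nonneg (z - z0)]⟩
    exact ⟨hzA, ((hrE z hzA z0 hz0).2 hd).1⟩
  refine ⟨W, φt, f, ⟨hW, subset_union_left, fun z hz hzE => hBW z ⟨hz, hzE⟩ (mem_ball_self (by linarith [hr z ⟨hz, hzE⟩])), fun z0 hz0 hzW => ?_,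
    fun z0 hz0 => ⟨ρ/3, by positivity, ρ, hρ, fun z hz hne hd => ?_⟩, t1, f1, hsq, fun p hp => ?_, fun p hp hpW => ?_, fun p hp hpG => ?_, fun p hp => ?_, fun z0 hz0 => ?_⟩⟩
  · rcases hcase z0 hzW with h | ⟨z, hz, h⟩
    · have := dm.EL hz0; rw [hG.frontier_eq] at this; exact this.2 h
    · have := hWE z0 hz0 z hz z0 h; rw [norm_sub_rev] at this; linarith [norm_nonneg (z - z0)]
  · obtain ⟨hzA, h⟩ := hnear z0 hz0 z hz hne hd
    exact (ball_subset_ball (by linarith)).trans (hBW z hzA)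
  · rcases hcase p hp with h | ⟨z, hz, h⟩
    · intro h0; have := hsq p hp; rw [h0, hd0 p h] at this
      exact cm_inj_deriv_ne hG hdφ hφ.bijOn.injOn h (by rw [← this]; norm_num)
    · rw [f3 z hz p h]; exact (hprop z hz p (hsub z hz h)).2.1
  · rcases hcase p hpW with h | ⟨z, hz, h⟩
    · exact t2 p h
    · rw [t3 z hz p h]; exact (hprop z hz p (hsub z hz h)).2.2.1 hp
  · obtain ⟨z, hz, h⟩ := (hcase p hp).resolve_left hpG
    obtain ⟨q, hq, hqc, hqn, hq1⟩ := (hprop z hz p (hsub z hz h)).2.2.2.2 hpG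
    rw [t3 z hz p h, hqn]
    exact (one_le_inv₀ (hρ0.trans (hSρ z hz q hq hqc))).2 hq1
  · by_cases hpG : p ∈ G
    · rw [t2 p hpG]; exact (hlt p hpG).trans ((one_lt_div hρ0).2 hρ1)
    · obtain ⟨z, hz, h⟩ := (hcase p hp).resolve_left hpG
      obtain ⟨q, hq, hqc, hqn, hq1⟩ := (hprop z hz p (hsub z hz h)).2.2.2.2 hpG
      rw [t3 z hz p h, hqn, one_div]
      exact inv_strictAnti₀ hρ0 (hSρ z hz q hq hqc)
  · set κ := 1/(2 - lam z0) with hκ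
    have hκ0 : 0 < κ := by have := (dm.pt z0 hz0).hl.2; have : 0 < 2 - lam z0 := by linarith
                           positivity
    obtain ⟨hdec, -⟩ := hE z0 hz0
    have key : ∀ p ∈ W, ‖p - z0‖ < ρ/2 → ∃ Ψ : ℂ → ℂ, deriv φt p = deriv Ψ p ∧ DifferentiableOn ℂ Ψ (ball p (ρ/12*‖p - z0‖)) ∧
        ∀ y ∈ ball p (ρ/12*‖p - z0‖), Real.exp (-(ρ⁻¹ * (2*‖p - z0‖)^κ)) ≤ ‖Ψ y‖ ∧ ‖Ψ y‖ ≤ Real.exp (ρ⁻¹ * (2*‖p - z0‖)^κ) := by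
      intro p hp hpd
      have hlow : ∀ y ∈ closure G, ‖y - z0‖ ≤ 2*‖p - z0‖ → Real.exp (-(ρ⁻¹ * (2*‖p - z0‖)^κ)) ≤ ‖φ y‖ := fun y hy hd =>
        le_trans (Real.exp_le_exp.2 (neg_le_neg (by gcongr))) (hdec y hy (by linarith))
      have hexp1 : 1 ≤ Real.exp (ρ⁻¹ * (2*‖p - z0‖)^κ) := Real.one_le_exp (by positivity)
      by_cases hz : ∃ z ∈ A, p ∈ ball z (r z/3)
      · obtain ⟨z, hz, h⟩ := hz
        have h1 := hWE z0 hz0 z hz p h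
        have h2 : ‖z - z0‖ ≤ ‖p - z‖ + ‖p - z0‖ := by rw [norm_sub_rev p z]; exact norm_sub_le_norm_sub_add_norm_sub _ _ _
        have h3 : ‖p - z0‖ ≤ ‖p - z‖ + ‖z - z0‖ := norm_sub_le_norm_sub_add_norm_sub _ _ _
        obtain ⟨h4, h5⟩ := (hrE z hz z0 hz0).2 (by linarith)
        have hz2 : ρ * ‖p - z0‖ ≤ 2 * r z := by nlinarith
        have hbs : ball p (ρ/12*‖p - z0‖) ⊆ ball z (r z) := fun y hy => by
          rw [mem_ball] at *; have := dist_triangle y p z; linarith [hr z hz]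
        have hSd : ∀ y ∈ S z, ‖y - z0‖ ≤ 2*‖p - z0‖ := fun y hy => by
          have i1 := mem_ball_iff_norm.1 (h5 hy)
          have i2 : ‖y - z0‖ ≤ ‖y - z‖ + ‖z - z0‖ := norm_sub_le_norm_sub_add_norm_sub _ _ _
          linarith
        refine ⟨Φ z, hdz z hz p h, (hΦ z hz).mono hbs, fun y hy => ?_⟩
        have hy' := hbs hy
        by_cases hyG : y ∈ G
        · rw [(hprop z hz y hy').2.2.1 (subset_closure hyG)]
          exact ⟨hlow y (subset_closure hyG) (hSd y (hS z hz hy')), (hlt y hyG).le.trans hexp1⟩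
        · obtain ⟨q, hq, hqc, hqn, hq1⟩ := (hprop z hz y hy').2.2.2.2 hyG
          have h6 := hlow q hqc (hSd q hq)
          have h7 : 0 < ‖φ q‖ := (Real.exp_pos _).trans_le h6
          rw [hqn]
          refine ⟨(Real.exp_le_one_iff.2 (neg_nonpos.2 (by positivity))).trans ((one_le_inv₀ h7).2 hq1), ?_⟩
          rw [Real.exp_neg] at h6
          exact inv_le_of_inv_le₀ (by positivity) h6
      · push Not at hz
        have hpG := (hcase p hp).resolve_right fun ⟨z, h1, h2⟩ => hz z h1 h2
        have hpne : p ≠ z0 := fun h => by have := dm.EL hz0; rw [hG.frontier_eq, ← h] at this; exact this.2 hpG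
        have hpp : 0 < ‖p - z0‖ := norm_pos_iff.2 (sub_ne_zero.2 hpne)
        have hbG : ball p (ρ/12*‖p - z0‖) ⊆ G := by
          refine (convex_ball _ _).isPreconnected.subset_of_closure_inter_subset hG ⟨p, mem_ball_self (by positivity), hpG⟩ ?_
          rintro y ⟨hy, hyb⟩
          by_contra hyG
          have hyL : y ∈ frontier G := by rw [hG.frontier_eq]; exact ⟨hy, hyG⟩
          have i1 := mem_ball_iff_norm.1 hyb
          have i2 : ‖p - z0‖ ≤ ‖y - p‖ + ‖y - z0‖ := by rw [norm_sub_rev y p]; exact norm_sub_le_norm_sub_add_norm_sub _ _ _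
          have i3 : ‖y - z0‖ ≤ ‖y - p‖ + ‖p - z0‖ := norm_sub_le_norm_sub_add_norm_sub _ _ _
          have i4 : ρ/12*‖p - z0‖ ≤ ‖p - z0‖/24 := by nlinarith
          obtain ⟨hyA, i5⟩ := hnear z0 hz0 y hyL (fun h => by rw [h] at i1 i2; rw [sub_self, norm_zero] at i2; linarith) (by linarith)
          refine hz y hyA (mem_ball_iff_norm'.2 ?_)
          have : ρ * (‖p - z0‖*(23/24)) ≤ ρ * ‖y - z0‖ := by gcongr; linarith
          nlinarith
        refine ⟨φ, hd0 p hpG, hdφ.mono hbG, fun y hy => ⟨hlow y (subset_closure (hbG hy)) ?_, (hlt y (hbG hy)).le.trans hexp1⟩⟩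
        have i1 := mem_ball_iff_norm.1 hy
        have i3 : ‖y - z0‖ ≤ ‖y - p‖ + ‖p - z0‖ := norm_sub_le_norm_sub_add_norm_sub _ _ _
        nlinarith
    set C := 8 * (ρ⁻¹ * 2^κ) / (ρ/12) * Real.exp (ρ⁻¹ * 2^κ)
    have hC : 0 < C := by positivity
    refine ⟨Real.sqrt C, Real.sqrt_pos.2 hC, ρ/2, by positivity, fun p hp hpd => ?_⟩
    obtain ⟨Ψ, k1, k2, k3⟩ := key p hp hpd
    have hpne : p ≠ z0 := fun h => by
      rcases hcase p hp with h1 | ⟨z, hz, h1⟩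
      · have := dm.EL hz0; rw [hG.frontier_eq, ← h] at this; exact this.2 h1
      · have := hWE z0 hz0 z hz p h1; rw [h, norm_sub_rev] at this; linarith [norm_nonneg (z - z0)]
    have hpp : 0 < ‖p - z0‖ := norm_pos_iff.2 (sub_ne_zero.2 hpne)
    have hdb := cm_deriv_bound (by positivity) (by positivity : 0 < ρ⁻¹ * (2*‖p - z0‖)^κ) k2 (fun y hy => (k3 y hy).1) (fun y hy => (k3 y hy).2)
    have h2 : ‖f p‖^2 ≤ (Real.sqrt C * ‖p - z0‖^((κ - 1)/2))^2 := by
      rw [← norm_pow, hsq p hp, k1, mul_pow, Real.sq_sqrt hC.le, ← Real.rpow_natCast (‖p - z0‖^((κ-1)/2)), ← Real.rpow_mul hpp.le]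
      refine hdb.trans ?_
      have e1 : ‖p - z0‖^((κ-1)/2*(2:ℕ)) = ‖p - z0‖^κ/‖p - z0‖ := by rw [← Real.rpow_sub_one hpp.ne']; congr 1; push_cast; ring
      rw [e1, Real.mul_rpow (by norm_num) hpp.le]
      have h3 : ‖p - z0‖^κ ≤ 1 := Real.rpow_le_one hpp.le (by linarith) hκ0.le
      calc _ ≤ 8 * (ρ⁻¹ * (2^κ * ‖p - z0‖^κ)) / (ρ/12*‖p - z0‖) * Real.exp (ρ⁻¹ * (2^κ * 1)) := by gcongr
        _ = _ := by simp only [C]; rw [mul_one]; field_simp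
    exact le_of_sq_le_sq h2 (by positivity)
theorem cm_gam (X : Type*) [NormedAddCommGroup X] [NormedSpace ℝ X] [MeasureSpace X] [Nontrivial X] [FiniteDimensional ℝ X] [BorelSpace X]
    [(volume : Measure X).IsAddHaarMeasure] {p q : ℝ} (hp : 0 < p) (hq : 0 < q + Module.finrank ℝ X) :
    ∃ C > 0, ∀ b > 0, Integrable (fun x : X => ‖x‖^q * Real.exp (-b * ‖x‖^p)) ∧
    ∫ x : X, ‖x‖^q * Real.exp (-b * ‖x‖^p) = C * b^(-(q + Module.finrank ℝ X)/p) := by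
  set d := Module.finrank ℝ X with hd
  have hd0 : 0 < d := Module.finrank_pos
  have hg : 0 < Real.Gamma ((q+d)/p) := Real.Gamma_pos_of_pos (div_pos hq hp)
  have hv : 0 < volume.real (ball (0:X) 1) := ENNReal.toReal_pos (measure_ball_pos _ _ one_pos).ne' measure_ball_lt_top.ne
  refine ⟨d * volume.real (ball (0:X) 1) * (1/p * Real.Gamma ((q+d)/p)), by positivity, fun b hb => ?_⟩
  have e : ∫ x : X, ‖x‖^q * Real.exp (-b * ‖x‖^p) = d * volume.real (ball (0:X) 1) * (1/p * Real.Gamma ((q+d)/p)) * b^(-(q+d)/p) := by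
    rw [integral_fun_norm_addHaar volume (fun r => r^q * Real.exp (-b * r^p)), ← hd]
    have : ∫ y in Ioi (0:ℝ), y^(d-1) • (y^q * Real.exp (-b * y^p)) = ∫ y in Ioi (0:ℝ), y^(q+d-1) * Real.exp (-b * y^p) :=
      setIntegral_congr_fun measurableSet_Ioi fun y hy => by
        simp only [smul_eq_mul]
        rw [← mul_assoc, ← Real.rpow_natCast, ← Real.rpow_add hy, Nat.cast_pred hd0]; ring_nf
    rw [this, _root_.integral_rpow_mul_exp_neg_mul_rpow hp (by linarith) hb, sub_add_cancel]
    simp only [nsmul_eq_mul, smul_eq_mul]; ring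
  refine ⟨?_, e⟩
  by_contra h
  rw [integral_undef h] at e
  have : 0 < d * volume.real (ball (0:X) 1) * (1/p * Real.Gamma ((q+d)/p)) * b^(-(q+d)/p) := by positivity
  linarith
theorem cm_disc : ∃ C > 0, ∀ ε > 0, ∀ z z0 : ℂ, IntegrableOn (fun t => 1/‖t - z‖) (ball z0 (2*ε)) ∧
    ∫ t in ball z0 (2*ε), 1/‖t - z‖ ≤ C * ε^2/(ε + ‖z - z0‖) := by
  obtain ⟨C, hC, h⟩ := cm_gam ℂ (p := 1) (q := -1) one_pos (by rw [Complex.finrank_real_complex]; norm_num)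
  have hpi := Real.pi_pos
  refine ⟨30 * Real.exp 1 * C + 16 * Real.pi, by positivity, fun ε hε z z0 => ?_⟩
  have hz := norm_nonneg (z - z0)
  set R := 2*ε + ‖z - z0‖
  have hR : 0 < R := by positivity
  obtain ⟨h1, h2⟩ := h (1/R) (by positivity)
  have h3 := (h1.comp_sub_right z).const_mul (Real.exp 1)
  have h4 : ∀ t ∈ ball z0 (2*ε), 1/‖t - z‖ ≤ Real.exp 1 * (‖t - z‖^(-1:ℝ) * Real.exp (-(1/R) * ‖t - z‖^(1:ℝ))) := fun t ht => by
    have h5 : ‖t - z‖ ≤ R := by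
      have := norm_sub_le_norm_sub_add_norm_sub t z0 z
      rw [mem_ball_iff_norm] at ht; rw [norm_sub_rev z0 z] at this; linarith
    have : ‖t - z‖/R ≤ 1 := (div_le_one hR).2 h5
    rw [Real.rpow_one, Real.rpow_neg_one, mul_left_comm, ← Real.exp_add, one_div]
    refine le_mul_of_one_le_right (by positivity) (Real.one_le_exp ?_)
    rw [neg_mul, one_div_mul_eq_div]; linarith
  have hi : IntegrableOn (fun t => 1/‖t - z‖) (ball z0 (2*ε)) :=
    Integrable.mono' h3.integrableOn (Measurable.aestronglyMeasurable (by fun_prop)) ((ae_restrict_iff' measurableSet_ball).2 (ae_of_all _ fun t ht => by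
      rw [Real.norm_of_nonneg (by positivity)]; exact h4 t ht))
  refine ⟨hi, ?_⟩
  have h0 : 0 < ε + ‖z - z0‖ := by positivity
  rw [le_div_iff₀ h0]
  by_cases hc : ‖z - z0‖ ≤ 4*ε
  · have i1 : ∫ t in ball z0 (2*ε), 1/‖t - z‖ ≤ Real.exp 1 * (C * R) := by
      refine (setIntegral_mono_on hi h3.integrableOn measurableSet_ball h4).trans
        ((setIntegral_le_integral h3 (ae_of_all _ fun t => by positivity)).trans ?_)
      rw [integral_const_mul, integral_sub_right_eq_self (fun t : ℂ => ‖t‖^(-1:ℝ) * Real.exp (-(1/R) * ‖t‖^(1:ℝ))) z, h2, Complex.finrank_real_complex]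
      norm_num [Real.rpow_neg_one]
    have i2 : R ≤ 6*ε := by change 2*ε + ‖z - z0‖ ≤ _; linarith
    have i3 := i1.trans (by gcongr : _ ≤ Real.exp 1 * (C * (6*ε)))
    calc _ ≤ Real.exp 1 * (C * (6*ε)) * (5*ε) := by gcongr <;> linarith
      _ ≤ _ := by nlinarith [mul_pos hpi (sq_pos_of_pos hε)]
  · have i1 : ∫ t in ball z0 (2*ε), 1/‖t - z‖ ≤ ∫ t in ball z0 (2*ε), 2/‖z - z0‖ :=
      setIntegral_mono_on hi (integrableOn_const measure_ball_lt_top.ne) measurableSet_ball fun t ht => by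
        have := norm_sub_le_norm_sub_add_norm_sub z t z0
        rw [mem_ball_iff_norm] at ht; rw [norm_sub_rev z t] at this
        rw [div_le_div_iff₀ (by linarith) (by linarith)]; linarith
    rw [setIntegral_const, Measure.real, Complex.volume_ball] at i1
    simp only [ENNReal.toReal_mul, ENNReal.toReal_pow, ENNReal.toReal_ofReal (by positivity : 0 ≤ 2*ε), ENNReal.coe_toReal, NNReal.coe_real_pi, smul_eq_mul] at i1
    have hq : 0 < ‖z - z0‖ := by linarith
    calc _ ≤ ((2*ε)^2 * Real.pi * (2/‖z - z0‖)) * (2*‖z - z0‖) := by gcongr; linarith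
      _ = 16 * Real.pi * ε^2 := by field_simp; ring
      _ ≤ _ := by have := Real.exp_pos 1; gcongr; nlinarith [mul_pos this hC]
theorem cm_fub {γ : ℝ → ℂ} {l R M : ℝ} (hγ : Continuous γ) (hR : 0 < R) {k : ℝ → ℂ} {U : ℂ → ℂ} (hk : Integrable k (cmμ l)) (hU : AEStronglyMeasurable U)
    (hM : ∀ t, ‖U t‖ ≤ M) (hUR : ∀ t, t ∉ ball 0 (2*R) → U t = 0) :
    (∀ s, Integrable fun t => U t/(t - γ s)) ∧ Integrable (fun s => k s * ∫ t, U t/(t - γ s)) (cmμ l) ∧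
    ∫ s, (k s * ∫ t, U t/(t - γ s)) ∂(cmμ l) = ∫ t, U t * cmH k γ l t := by
  obtain ⟨C, hC, hd⟩ := cm_disc
  have M0 : 0 ≤ M := (norm_nonneg _).trans (hM 0)
  set g : ℝ → ℂ → ℝ := fun s => (ball (0:ℂ) (2*R)).indicator fun t => M * (1/‖t - γ s‖)
  have hg : ∀ s, Integrable (g s) := fun s => (integrable_indicator_iff measurableSet_ball).2 ((hd R hR (γ s) 0).1.const_mul M)
  have hgi : ∀ s, ∫ t, g s t ≤ M * (C * R) := fun s => by
    rw [integral_indicator measurableSet_ball, integral_const_mul]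
    refine mul_le_mul_of_nonneg_left ((hd R hR (γ s) 0).2.trans ?_) M0
    rw [div_le_iff₀ (by positivity)]; nlinarith [mul_nonneg (mul_pos hC hR).le (norm_nonneg (γ s - 0))]
  have hle : ∀ s t, ‖U t/(t - γ s)‖ ≤ g s t := fun s t => by
    by_cases h : t ∈ ball (0:ℂ) (2*R)
    · simp only [g, indicator_of_mem h]; rw [norm_div, div_eq_mul_one_div]; gcongr; exact hM t
    · simp only [g, indicator_of_notMem h, hUR t h]; simp
  have hi : ∀ s, Integrable fun t => U t/(t - γ s) := fun s => (hg s).mono' (hU.mul (Measurable.aestronglyMeasurable (f := fun t => (t - γ s)⁻¹) (by fun_prop))) (ae_of_all _ (hle s))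
  have hm : AEStronglyMeasurable (fun p : ℝ × ℂ => k p.1 * (U p.2/(p.2 - γ p.1))) ((cmμ l).prod volume) := by
    have : Measurable fun p : ℝ × ℂ => (p.2 - γ p.1)⁻¹ := by have := hγ.measurable; fun_prop
    exact (hk.1.comp_fst).mul ((hU.comp_snd).mul this.aestronglyMeasurable)
  have hI : Integrable (fun p : ℝ × ℂ => k p.1 * (U p.2/(p.2 - γ p.1))) ((cmμ l).prod volume) := by
    refine (integrable_prod_iff hm).2 ⟨ae_of_all _ fun s => (hi s).const_mul (k s), (hk.norm.mul_const (M*(C*R))).mono' hm.norm.integral_prod_right' (ae_of_all _ fun s => ?_)⟩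
    rw [Real.norm_of_nonneg (integral_nonneg fun _ => norm_nonneg _)]
    simp only [norm_mul, integral_const_mul]
    exact mul_le_mul_of_nonneg_left ((integral_mono (hi s).norm (hg s) (hle s)).trans (hgi s)) (norm_nonneg _)
  refine ⟨hi, ?_, ?_⟩
  · have := hI.integral_prod_left
    simpa only [integral_const_mul] using this
  · have := integral_integral_swap (f := fun s t => k s * (U t/(t - γ s))) hI
    simp only [integral_const_mul] at this
    rw [this]
    refine integral_congr_ae (ae_of_all _ fun t => ?_)
    simp only [cmH]; rw [← integral_const_mul]; congr 1; ext s; ring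
theorem CmCurve.l2 {L E : Set ℂ} {l : ℝ} {γ : ℝ → ℂ} (h : CmCurve L E l γ) {W : Set ℂ} (hW : IsOpen W) (hWL : ∀ z ∈ L, z ∉ E → z ∈ W) {N : ℂ → ℂ}
    (hN : ContinuousOn N W) {b : ℂ → ℝ} (hb : ∀ z ∈ E, -(1/2) < b z) (hNb : ∀ z ∈ E, ∃ M > 0, ∃ δ > 0, ∀ p ∈ W, ‖p - z‖ < δ → ‖N p‖ ≤ M * ‖p - z‖^b z) :
    (∀ᵐ s ∂(cmμ l), γ s ∉ E) ∧ AEStronglyMeasurable (fun s => N (γ s)) (cmμ l) ∧ Integrable (fun s => ‖N (γ s)‖^2) (cmμ l) := by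
  have hae0 : ∀ᵐ s : ℝ, γ s ∉ E := by
    have : {s | γ s ∈ E}.Countable := by
      have : {s | γ s ∈ E} ⊆ ⋃ n : ℤ, {s | s ∈ Ico ((n:ℝ)*l) (n*l + l) ∧ γ s ∈ E} := fun s hs => by
        refine mem_iUnion.2 ⟨⌊s/l⌋, ⟨?_, ?_⟩, hs⟩
        · have := Int.floor_le (s/l); rwa [le_div_iff₀ h.lpos] at this
        · have := Int.lt_floor_add_one (s/l); rw [div_lt_iff₀ h.lpos] at this; linarith
      exact (countable_iUnion fun n => (h.finE _).countable).mono this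
    exact measure_eq_zero_iff_ae_notMem.1 (this.measure_zero _)
  have hae : ∀ᵐ s ∂(cmμ l), γ s ∉ E := ae_restrict_of_ae hae0
  have hS : IsOpen (γ ⁻¹' W) := hW.preimage h.cont
  have hSm : ∀ s, γ s ∉ E → s ∈ γ ⁻¹' W := fun s hs => hWL _ ((h.mem _).2 ⟨s, rfl⟩) hs
  have hco : ContinuousOn (fun s => N (γ s)) (γ ⁻¹' W) := hN.comp h.cont.continuousOn fun s hs => hs
  have hms : AEStronglyMeasurable (fun s => N (γ s)) := by
    have := hco.aestronglyMeasurable (μ := volume) hS.measurableSet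
    rwa [Measure.restrict_eq_self_of_ae_mem (hae0.mono hSm)] at this
  refine ⟨hae, hms.restrict, ?_⟩
  refine IntegrableOn.mono_set ((LocallyIntegrableOn.integrableOn_isCompact · isCompact_Icc) fun s0 _ => ?_) Ioc_subset_Icc_self
  refine IntegrableAtFilter.filter_mono nhdsWithin_le_nhds ?_
  by_cases hs0 : γ s0 ∈ E
  · obtain ⟨M, hM, δ, hδ, H⟩ := hNb _ hs0
    obtain ⟨c, hc, hcl⟩ := h.arcl s0
    set b' := min (b (γ s0)) 0
    have hb' : -(1/2) < b' := lt_min (hb _ hs0) (by norm_num)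
    obtain ⟨C, hC, hg⟩ := cm_gam ℝ (p := 1) (q := 2*b') one_pos (by rw [Module.finrank_self]; push_cast; linarith)
    have hg2 := ((hg 1 one_pos).1.comp_sub_right s0).const_mul (Real.exp 1 * (M^2 * c^(2*b')))
    obtain ⟨d, hd, hd'⟩ := Metric.continuousAt_iff.1 (h.cont.continuousAt (x := s0)) (min δ 1) (by positivity)
    have hl := h.lpos
    refine ⟨ball s0 (min d (min 1 (l/2))), ball_mem_nhds _ (by positivity), hg2.integrableOn.mono' (hms.norm.pow 2).restrict ?_⟩
    refine (ae_restrict_iff' measurableSet_ball).2 (hae0.mp ((measure_eq_zero_iff_ae_notMem.1 (measure_singleton s0)).mono fun s hs hsE hsb => ?_))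
    have hsb' := mem_ball.1 hsb
    have h1 := hd' (hsb'.trans_le (min_le_left _ _))
    have h2 : |s - s0| < min 1 (l/2) := hsb'.trans_le (min_le_right _ _)
    have h3 := hcl s (h2.le.trans (min_le_right _ _))
    have h4 : 0 < |s - s0| := abs_pos.2 (sub_ne_zero.2 hs)
    rw [dist_eq_norm] at h1
    have h5 : 0 < ‖γ s - γ s0‖ := by nlinarith
    have h6 : ‖N (γ s)‖ ≤ M * (c * |s - s0|)^b' := (H _ (hSm s hsE) (h1.trans_le (min_le_left _ _))).trans (by
      gcongr
      exact (Real.rpow_le_rpow_of_exponent_ge h5 (h1.le.trans (min_le_right _ _)) (min_le_left _ _)).trans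
        (Real.rpow_le_rpow_of_nonpos (by positivity) h3 (min_le_right _ _)))
    rw [Real.norm_of_nonneg (by positivity)]
    calc ‖N (γ s)‖^2 ≤ (M * (c * |s - s0|)^b')^2 := by gcongr
      _ = M^2 * c^(2*b') * |s - s0|^(2*b') := by
        rw [mul_pow, ← Real.rpow_natCast (_^b'), ← Real.rpow_mul (by positivity), Real.mul_rpow hc.le h4.le]; push_cast; ring_nf
      _ ≤ _ := by
        rw [Real.rpow_one, Real.norm_eq_abs, mul_left_comm (Real.exp 1 * _), mul_comm (|s - s0|^(2*b'))]
        refine mul_le_mul_of_nonneg_right ?_ (by positivity)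
        rw [mul_right_comm, ← Real.exp_add]
        refine le_mul_of_one_le_left (by positivity) (Real.one_le_exp ?_)
        linarith [h2.trans_le (min_le_left _ _)]
  · have hs := hS.mem_nhds (hSm s0 hs0)
    exact Tendsto.integrableAtFilter ⟨_, univ_mem, (hms.norm.pow 2).restrict⟩ (Measure.finiteAt_nhds _ _) ((hco.continuousAt hs).norm.pow 2)
theorem CmPt.cut {G W : Set ℂ} {z0 e : ℂ} {lam a : ℝ} (P : CmPt G z0 e lam a) (hWG : G ⊆ W)
    (cor : ∃ c > 0, ∃ ρ > 0, ∀ z ∈ frontier G, z ≠ z0 → ‖z - z0‖ < ρ → ball z (c * ‖z - z0‖) ⊆ W) :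
    ∃ m > 0, ∀ d > 0, ∃ δ > 0, ∃ C > 0, ∃ Φ : ℂ → ℝ, δ ≤ d ∧ (∀ t, t ≠ z0 → ContDiffAt ℝ 1 Φ t) ∧ (∀ t, 0 ≤ Φ t ∧ Φ t ≤ 1) ∧
      (∀ t ∈ closure G, t ≠ z0 → ∀ᶠ s in 𝓝 t, Φ s = 1) ∧ (∀ t, d ≤ ‖t - z0‖ → ∀ᶠ s in 𝓝 t, Φ s = 1) ∧
      (∀ t ∉ W, t ≠ z0 → ‖t - z0‖ < δ → ∀ᶠ s in 𝓝 t, Φ s = 0) ∧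
      ∀ x, x ≠ 0 → ‖x‖ < δ → ‖fderiv ℝ Φ (z0 + e*x)‖ ≤ C/‖x‖ ∧
        (fderiv ℝ Φ (z0 + e*x) ≠ 0 → (Real.cos (lam * Real.pi/2) + m) * ‖x‖ ≤ x.re) := by
  obtain ⟨c, hc, ρ, hρ, cor⟩ := cor
  set co := Real.cos (lam * Real.pi/2)
  obtain ⟨m, hm, δ1, hδ1, hsec⟩ := P.sec (min (c/4) 1) (by positivity)
  obtain ⟨δ2, hδ2, hA⟩ := P.A (m/4) (by positivity)
  obtain ⟨δ3, hδ3, hB⟩ := P.B m hm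
  have e0 : e ≠ 0 := fun h => by have := P.e1; rw [h] at this; simp at this
  set δ0 := min (min δ1 δ2) (min δ3 (ρ/2))
  have hδ0 : 0 < δ0 := by positivity
  have d1 : δ0 ≤ δ1 := (min_le_left _ _).trans (min_le_left _ _)
  have d2 : δ0 ≤ δ2 := (min_le_left _ _).trans (min_le_right _ _)
  have d3 : δ0 ≤ δ3 := (min_le_right _ _).trans (min_le_left _ _)
  have d4 : δ0 ≤ ρ/2 := (min_le_right _ _).trans (min_le_right _ _)
  have hin : ∀ x, x ≠ 0 → ‖x‖ < δ0 → x.re ≤ (co + m) * ‖x‖ → z0 + e*x ∈ W := fun x hx hxd h => by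
    by_cases h1 : x.re < (co - m) * ‖x‖
    · have := hB (-x) (neg_ne_zero.2 hx) (by rw [norm_neg]; linarith) (by rw [norm_neg, neg_re]; linarith)
      rw [neg_mul_neg] at this; exact hWG this
    · obtain ⟨z, hz, h2, h3⟩ := hsec x hx (by linarith) (abs_le.2 ⟨by linarith, by linarith⟩)
      have hx0 : 0 < ‖x‖ := norm_pos_iff.2 hx
      have i1 : min (c/4) 1 * ‖x‖ ≤ c/4 * ‖x‖ := by gcongr; exact min_le_left _ _
      have i2 : min (c/4) 1 * ‖x‖ ≤ 1 * ‖x‖ := by gcongr; exact min_le_right _ _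
      have i3 : ‖z - z0‖ ≤ ‖z0 + e*x - z‖ + ‖x‖ := by
        have := norm_sub_le_norm_sub_add_norm_sub z (z0 + e*x) z0
        rwa [norm_sub_rev z (z0 + e*x), add_sub_cancel_left, norm_mul, P.e1, one_mul] at this
      have i4 : 0 < ‖z - z0‖ := by linarith
      refine cor z hz (fun h => by simp [h] at i4) (by linarith) (mem_ball_iff_norm.2 ?_)
      nlinarith
  have hxe : ∀ t, z0 + e * ((t - z0)/e) = t := fun t => by rw [mul_div_cancel₀ _ e0]; ring
  have hxn : ∀ t, ‖(t - z0)/e‖ = ‖t - z0‖ := fun t => by rw [norm_div, P.e1, div_one]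
  set q : ℂ → ℝ := fun v => (v/e).re/‖v‖ - co
  set Θ : ℂ → ℝ := fun v => Real.smoothTransition (3 - 4/m * q v)
  have hq : ∀ v, v ≠ 0 → ContDiffAt ℝ 1 q v := fun v hv => by
    have : ContDiffAt ℝ 1 (fun v : ℂ => (v/e).re) v := reCLM.contDiff.contDiffAt.comp v (contDiffAt_id.div_const e)
    exact (this.div (contDiffAt_norm ℝ hv) (norm_ne_zero_iff.2 hv)).sub contDiffAt_const
  have hΘ : ∀ v, v ≠ 0 → ContDiffAt ℝ 1 Θ v := fun v hv =>
    (Real.smoothTransition.contDiff (n := 1)).contDiffAt.comp v (contDiffAt_const.sub (contDiffAt_const.mul (hq v hv)))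
  have hΘ1 : ∀ v, q v < m/2 → Θ v = 1 := fun v h => Real.smoothTransition.one_of_one_le (by
    have : 4/m * q v ≤ 4/m * (m/2) := by gcongr
    have e2 : 4/m * (m/2) = 2 := by field_simp; norm_num
    linarith)
  have hΘ0 : ∀ v, 3*m/4 < q v → Θ v = 0 := fun v h => Real.smoothTransition.zero_of_nonpos (by
    have : 4/m * (3*m/4) ≤ 4/m * q v := by gcongr
    have e2 : 4/m * (3*m/4) = 3 := by field_simp
    linarith)
  have hqr : ∀ (r : ℝ) v, 0 < r → q (r • v) = q v := fun r v hr => by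
    simp only [q, real_smul, norm_mul, norm_real, Real.norm_of_nonneg hr.le, mul_div_assoc, re_ofReal_mul, mul_div_mul_left _ _ hr.ne']
  obtain ⟨C, hC⟩ := (isCompact_sphere (0:ℂ) 1).exists_bound_of_continuousOn (f := fderiv ℝ Θ) fun v hv => by
    refine ((hΘ v fun h => ?_).continuousAt_fderiv one_ne_zero).continuousWithinAt
    rw [h] at hv; simp at hv
  have hΘd : ∀ v, v ≠ 0 → ‖fderiv ℝ Θ v‖ ≤ (|C| + 1)/‖v‖ := fun v hv => by
    have hv' : 0 < ‖v‖ := norm_pos_iff.2 hv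
    have h1 : fderiv ℝ Θ v = ‖v‖⁻¹ • fderiv ℝ Θ (‖v‖⁻¹ • v) := by
      rw [← fderiv_comp_smul]; congr 1; ext w; simp only [Θ, hqr _ _ (inv_pos.2 hv')]
    rw [h1, norm_smul, norm_inv, norm_norm, mul_comm, ← div_eq_mul_inv]
    gcongr
    have := hC (‖v‖⁻¹ • v) (by rw [mem_sphere_zero_iff_norm, norm_smul, norm_inv, norm_norm, inv_mul_cancel₀ hv'.ne'])
    linarith [le_abs_self C]
  have hqev : ∀ t, t ≠ z0 → ContinuousAt (fun s => q (s - z0)) t := fun t ht =>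
    ContinuousAt.comp (f := fun s => s - z0) (hq _ (sub_ne_zero.2 ht)).continuousAt (by fun_prop)
  refine ⟨m/2, by positivity, fun d hd => ?_⟩
  set δ := min δ0 d/3
  have hδ : 0 < δ := by positivity
  have hδ' : 2*δ < δ0 := by have : δ ≤ δ0/3 := by simp only [δ]; gcongr; exact min_le_left _ _
                            linarith
  have hδd : 2*δ < d := by have : δ ≤ d/3 := by simp only [δ]; gcongr; exact min_le_right _ _
                           linarith
  obtain ⟨b, b1, b0, bc, bn, bl⟩ : ∃ b : ℂ → ℝ, (∀ s, ‖s - z0‖ < δ → b s = 1) ∧ (∀ s, 2*δ < ‖s - z0‖ → b s = 0) ∧ ContDiff ℝ 1 b ∧ (∀ s, 0 ≤ b s) ∧ ∀ s, b s ≤ 1 := by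
    let b : ContDiffBump z0 := ⟨δ, 2*δ, hδ, by linarith⟩
    exact ⟨b, fun s hs => b.one_of_mem_closedBall (mem_closedBall_iff_norm.2 hs.le), fun s hs => b.zero_of_le_dist (by rw [dist_eq_norm]; exact hs.le), b.contDiff, b.nonneg', fun s => b.le_one⟩
  set Φ : ℂ → ℝ := fun t => 1 - b t * (1 - Θ (t - z0))
  have hfar : ∀ t, 2*δ < ‖t - z0‖ → ∀ᶠ s in 𝓝 t, Φ s = 1 := fun t ht => by
    filter_upwards [(by fun_prop : Continuous fun s : ℂ => ‖s - z0‖).continuousAt.eventually_const_lt ht] with s hs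
    have : b s = 0 := b0 s hs
    simp only [Φ, this]; ring
  have hnr : ∀ t, ‖t - z0‖ < δ → ∀ᶠ s in 𝓝 t, Φ s = Θ (s - z0) := fun t ht => by
    filter_upwards [(by fun_prop : Continuous fun s : ℂ => ‖s - z0‖).continuousAt.eventually_lt_const ht] with s hs
    have : b s = 1 := b1 s hs
    simp only [Φ, this]; ring
  have hone : ∀ t, t ≠ z0 → q (t - z0) < m/2 → ∀ᶠ s in 𝓝 t, Φ s = 1 := fun t ht h => by
    filter_upwards [(hqev t ht).eventually_lt_const h] with s hs
    simp only [Φ, hΘ1 _ hs]; ring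
  refine ⟨δ, hδ, |C| + 1, by positivity, Φ, by linarith, fun t ht => ?_, fun t => ?_, fun t ht htz => ?_, fun t ht => hfar t (by linarith), fun t ht htz htd => ?_,
    fun x hx hxd => ?_⟩
  · have : ContDiffAt ℝ 1 (fun t => Θ (t - z0)) t := ContDiffAt.comp (g := Θ) (f := fun t => t - z0) t (hΘ _ (sub_ne_zero.2 ht)) (contDiffAt_id.sub contDiffAt_const)
    exact contDiffAt_const.sub (bc.contDiffAt.mul (contDiffAt_const.sub this))
  · have h1 := bn t; have h2 := bl t
    have h3 := Real.smoothTransition.nonneg (3 - 4/m * q (t - z0)); have h4 := Real.smoothTransition.le_one (3 - 4/m * q (t - z0))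
    simp only [Φ, Θ]; constructor <;> nlinarith
  · by_cases h : ‖t - z0‖ < δ0
    · refine hone t htz ?_
      have h0 : 0 < ‖t - z0‖ := norm_pos_iff.2 (sub_ne_zero.2 htz)
      have : ¬ (co + m/4) * ‖t - z0‖ < ((t - z0)/e).re := fun h' => by
        have := hA ((t - z0)/e) (div_ne_zero (sub_ne_zero.2 htz) e0) (by rw [hxn]; linarith) (by rw [hxn]; exact h')
        rw [hxe] at this; exact this ht
      push Not at this
      rw [← div_le_iff₀ h0] at this
      simp only [q]; linarith
    · exact hfar t (by push Not at h; linarith)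
  · have h0 : 0 < ‖t - z0‖ := norm_pos_iff.2 (sub_ne_zero.2 htz)
    have : ¬ ((t - z0)/e).re ≤ (co + m) * ‖t - z0‖ := fun h' => by
      have := hin ((t - z0)/e) (div_ne_zero (sub_ne_zero.2 htz) e0) (by rw [hxn]; linarith) (by rw [hxn]; exact h')
      rw [hxe] at this; exact ht this
    push Not at this
    rw [← lt_div_iff₀ h0] at this
    filter_upwards [hnr t htd, (hqev t htz).eventually_const_lt (show 3*m/4 < q (t - z0) by simp only [q]; linarith)] with s h1 h2
    rw [h1, hΘ0 _ h2]
  · set t := z0 + e*x with ht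
    have hv : t - z0 = e*x := by rw [ht]; ring
    have hn : ‖t - z0‖ = ‖x‖ := by rw [hv, norm_mul, P.e1, one_mul]
    have htz : t ≠ z0 := fun h => by rw [h, sub_self, norm_zero] at hn; exact hx (norm_eq_zero.1 hn.symm)
    constructor
    · rw [EventuallyEq.fderiv_eq (f := fun s => Θ (s - z0)) (hnr t (by rwa [hn])), fderiv_comp_sub, ← hn]
      exact hΘd _ (sub_ne_zero.2 htz)
    · contrapose!
      intro h
      have : q (t - z0) < m/2 := by
        have : x.re/‖x‖ < co + m/2 := (div_lt_iff₀ (norm_pos_iff.2 hx)).2 h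
        simp only [q, hv, mul_div_cancel_left₀ _ e0, norm_mul, P.e1, one_mul]; linarith
      rw [EventuallyEq.fderiv_eq (f := fun _ => (1:ℝ)) (hone t htz this)]; exact fderiv_const_apply _
theorem CmDom.cut {G E W : Set ℂ} {l : ℝ} {γ : ℝ → ℂ} {lam a : ℂ → ℝ} {e : ℂ → ℂ} (dm : CmDom G E l γ lam a e) (hW : IsOpen W) (hWG : G ⊆ W)
    (hWL : ∀ z ∈ frontier G, z ∉ E → z ∈ W)
    (cor : ∀ z0 ∈ E, ∃ c > 0, ∃ ρ > 0, ∀ z ∈ frontier G, z ≠ z0 → ‖z - z0‖ < ρ → ball z (c * ‖z - z0‖) ⊆ W) :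
    ∃ r0 > 0, (∀ z ∈ E, ∀ z' ∈ E, z ≠ z' → r0 < ‖z - z'‖) ∧ ∃ m : ℂ → ℝ, (∀ z ∈ E, 0 < m z) ∧ ∀ d > 0, ∃ χ : ℂ → ℝ, ∃ A, ∃ C > 0, IsCompact A ∧ A ⊆ (closure G)ᶜ ∧ A ⊆ W ∧ (∀ t ∉ E, ContDiffAt ℝ 1 χ t) ∧
      (∀ t, 0 ≤ χ t ∧ χ t ≤ 1) ∧ (∀ t ∈ closure G, t ∉ E → χ t = 1) ∧ HasCompactSupport χ ∧ (∀ t ∉ W, t ∉ E → ∀ᶠ s in 𝓝 t, χ s = 0) ∧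
      ∀ t ∉ E, fderiv ℝ χ t ≠ 0 → (t ∈ A ∧ ‖fderiv ℝ χ t‖ ≤ C) ∨ ∃ z ∈ E, ∃ x, x ≠ 0 ∧ t = z + e z * x ∧ ‖x‖ < d ∧
        (Real.cos (lam z * Real.pi/2) + m z) * ‖x‖ ≤ x.re ∧ ‖fderiv ℝ χ t‖ ≤ C/‖x‖ := by
  have hE := dm.cv.fin
  choose! m hm H using fun z (hz : z ∈ E) => (dm.pt z hz).cut hWG (cor z hz)
  have h0 : ∀ᶠ r in 𝓝[>] (0:ℝ), ∀ z ∈ E, ∀ z' ∈ E, z ≠ z' → r < ‖z - z'‖ := by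
    rw [Filter.eventually_all_finite hE]; intro z hz
    rw [Filter.eventually_all_finite hE]; intro z' hz'
    by_cases h : z = z'
    · simp [h]
    · filter_upwards [mem_nhdsWithin_of_mem_nhds (Iio_mem_nhds (norm_pos_iff.2 (sub_ne_zero.2 h)))] with r hr _ using hr
  obtain ⟨r, hrs, hr⟩ := (h0.and self_mem_nhdsWithin).exists
  replace hr : 0 < r := hr
  refine ⟨r, hr, hrs, m, hm, fun d hd => ?_⟩
  set d' := min d (r/2)
  have hd' : 0 < d' := by positivity
  have hdr : d' ≤ r/2 := min_le_right _ _
  choose! δ hδ C hC Φ hδd p1 p2 p3 p4 p5 p6 using fun z (hz : z ∈ E) => H z hz d' hd'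
  have hK : IsCompact (closure G) := dm.b.isCompact_closure
  have hU : IsOpen (W ∪ ⋃ z ∈ E, ball z (δ z)) := hW.union (isOpen_biUnion fun _ _ => isOpen_ball)
  obtain ⟨η, hη, hηU⟩ := hK.exists_cthickening_subset_open hU (fun z hz => by
    by_cases hzG : z ∈ G
    · exact Or.inl (hWG hzG)
    have hzL : z ∈ frontier G := by rw [dm.o.frontier_eq]; exact ⟨hz, hzG⟩
    by_cases hzE : z ∈ E
    · exact Or.inr (mem_biUnion hzE (mem_ball_self (hδ z hzE)))
    · exact Or.inl (hWL z hzL hzE))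
  obtain ⟨ψ, hψ1, hψ0, hψ⟩ := exists_contMDiffMap_one_nhds_of_subset_interior (n := 1) (modelWithCornersSelf ℝ ℂ) (isClosed_closure (s := G))
    (interior_maximal ((thickening_subset_cthickening η (closure G))) isOpen_thickening |>.trans' (self_subset_thickening hη _))
  have hψd : ContDiff ℝ 1 ψ := contMDiff_iff_contDiff.1 ψ.contMDiff
  rw [eventually_nhdsSet_iff_forall] at hψ1
  set S := hE.toFinset
  have hS : ∀ {z}, z ∈ S ↔ z ∈ E := hE.mem_toFinset
  set χ : ℂ → ℝ := fun t => ψ t * ∏ z ∈ S, Φ z t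
  have f1 : ∀ t ∈ closure G, t ∉ E → ∀ᶠ s in 𝓝 t, χ s = 1 := fun t ht htE => by
    filter_upwards [hψ1 t ht, (Filter.eventually_all_finset S).2 fun z hz => p3 z (hS.1 hz) t ht fun h => htE (h ▸ hS.1 hz)] with s h1 h2
    simp only [χ, h1, Finset.prod_eq_one h2, one_mul]
  have f3 : ∀ t ∉ E, ContDiffAt ℝ 1 χ t := fun t ht => hψd.contDiffAt.mul (contDiffAt_prod fun z hz => p1 z (hS.1 hz) t fun h => ht (h ▸ hS.1 hz))
  have f5 : ∀ t ∉ W, t ∉ E → ∀ᶠ s in 𝓝 t, χ s = 0 := fun t ht htE => by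
    by_cases h : t ∈ cthickening η (closure G)
    · obtain ⟨z, hz, hzt⟩ := mem_iUnion₂.1 ((hηU h).resolve_left ht)
      filter_upwards [p5 z hz t ht (fun h => htE (h ▸ hz)) (mem_ball_iff_norm.1 hzt)] with s h1
      have : ∏ z ∈ S, Φ z s = 0 := Finset.prod_eq_zero (hS.2 hz) h1
      simp only [χ, this, mul_zero]
    · filter_upwards [isClosed_cthickening.isOpen_compl.mem_nhds h] with s h1
      simp only [χ, hψ0 s h1, zero_mul]
  have f2 : ∀ t, 0 ≤ χ t ∧ χ t ≤ 1 := fun t => by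
    have h1 : 0 ≤ ∏ z ∈ S, Φ z t := Finset.prod_nonneg fun z hz => (p2 z (hS.1 hz) t).1
    have h2 : ∏ z ∈ S, Φ z t ≤ 1 := Finset.prod_le_one (fun z hz => (p2 z (hS.1 hz) t).1) fun z hz => (p2 z (hS.1 hz) t).2
    have h3 : 0 ≤ ψ t := (hψ t).1
    exact ⟨mul_nonneg h3 h1, mul_le_one₀ (hψ t).2 h1 h2⟩
  have f4 : HasCompactSupport χ := HasCompactSupport.intro (hK.cthickening (r := η)) fun t ht => by simp only [χ, hψ0 t ht, zero_mul]
  have hκ : ∀ z ∈ E, ∃ κ > 0, ∀ s ∈ ball z κ, ψ s = 1 := fun z hz => Metric.eventually_nhds_iff_ball.1 (hψ1 z (frontier_subset_closure (dm.EL hz)))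
  choose! κ hκ0 hκ using hκ
  set A : Set ℂ := (⋂ z ∈ E, {t : ℂ | min (δ z) (κ z) ≤ ‖t - z‖}) ∩ (tsupport χ ∩ (interior {t | χ t = 1})ᶜ)
  have hAE : ∀ t ∈ A, t ∉ E := fun t ht h => by
    have : min (δ t) (κ t) ≤ ‖t - t‖ := mem_iInter₂.1 ht.1 t h
    rw [sub_self, norm_zero] at this
    exact (lt_min (hδ t h) (hκ0 t h)).not_ge this
  have hAc : IsCompact A := (f4.isCompact.inter_right isOpen_interior.isClosed_compl).inter_left
    (isClosed_biInter fun z _ => isClosed_le continuous_const (by fun_prop))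
  obtain ⟨B, hB⟩ := hAc.exists_bound_of_continuousOn (f := fderiv ℝ χ) fun t ht => ((f3 t (hAE t ht)).continuousAt_fderiv one_ne_zero).continuousWithinAt
  have hCS : ∀ z ∈ E, C z ≤ |B| + 1 + ∑ z ∈ S, C z := fun z hz => by
    have := Finset.single_le_sum (fun z hz => (hC z (hS.1 hz)).le) (hS.2 hz)
    linarith [abs_nonneg B]
  have hC0 : 0 ≤ ∑ z ∈ S, C z := Finset.sum_nonneg fun z hz => (hC z (hS.1 hz)).le
  refine ⟨χ, A, |B| + 1 + ∑ z ∈ S, C z, by positivity, hAc, fun t ht h => ?_, fun t ht => ?_, f3, f2, fun t ht htE => (f1 t ht htE).self_of_nhds, f4, f5, fun t htE hne => ?_⟩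
  · exact ht.2.2 (mem_interior_iff_mem_nhds.2 (f1 t h (hAE t ht)))
  · by_contra h
    exact notMem_tsupport_iff_eventuallyEq.2 (f5 t h (hAE t ht)) ht.2.1
  · by_cases hz : ∃ z ∈ E, ‖t - z‖ < min (δ z) (κ z)
    · obtain ⟨z, hz, hzt⟩ := hz
      right
      have hez := (dm.pt z hz).e1
      have e0 : e z ≠ 0 := fun h => by rw [h] at hez; simp at hez
      have hzd := hzt.trans_le (min_le_left _ _)
      have hte : t = z + e z * ((t - z)/e z) := by rw [mul_div_cancel₀ _ e0]; ring
      have hn : ‖(t - z)/e z‖ = ‖t - z‖ := by rw [norm_div, hez, div_one]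
      have hx : (t - z)/e z ≠ 0 := div_ne_zero (sub_ne_zero.2 fun h => htE (h ▸ hz)) e0
      have hf : fderiv ℝ χ t = fderiv ℝ (Φ z) t := by
        refine EventuallyEq.fderiv_eq ?_
        filter_upwards [isOpen_ball.mem_nhds (mem_ball_iff_norm.2 (hzt.trans_le (min_le_right _ _))), (Filter.eventually_all_finset (S.erase z)).2 fun z' hz' => p4 z' (hS.1 (Finset.mem_of_mem_erase hz')) t (by
          have h1 := hrs z' (hS.1 (Finset.mem_of_mem_erase hz')) z hz (Finset.ne_of_mem_erase hz')
          have h2 := norm_sub_le_norm_sub_add_norm_sub z' t z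
          rw [norm_sub_rev z' t] at h2
          linarith [hδd z hz])] with s h1 h2
        simp only [χ]
        rw [← Finset.mul_prod_erase S _ (hS.2 hz), Finset.prod_eq_one h2, hκ z hz s h1]; ring
      obtain ⟨h1, h2⟩ := p6 z hz _ hx (by rwa [hn])
      rw [← hte, ← hf] at h1 h2
      refine ⟨z, hz, _, hx, hte, by rw [hn]; linarith [hδd z hz, min_le_left d (r/2)], h2 hne, h1.trans ?_⟩
      gcongr; exact hCS z hz
    · left
      push Not at hz
      have htA : t ∈ A := by
        refine ⟨mem_iInter₂.2 hz, support_fderiv_subset ℝ hne, fun h => hne ?_⟩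
        · rw [EventuallyEq.fderiv_eq (f := fun _ => (1:ℝ)) (mem_interior_iff_mem_nhds.1 h)]; exact fderiv_const_apply _
      exact ⟨htA, (hB t htA).trans (by linarith [le_abs_self B])⟩
theorem CmDom.maj {G E W : Set ℂ} {l : ℝ} {γ : ℝ → ℂ} {lam a : ℂ → ℝ} {e : ℂ → ℂ} (dm : CmDom G E l γ lam a e) (hW : IsOpen W) (hWG : G ⊆ W)
    (hWL : ∀ z ∈ frontier G, z ∉ E → z ∈ W) (hWE : ∀ z ∈ E, z ∉ W)
    (cor : ∀ z0 ∈ E, ∃ c > 0, ∃ ρ > 0, ∀ z ∈ frontier G, z ≠ z0 → ‖z - z0‖ < ρ → ball z (c * ‖z - z0‖) ⊆ W)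
    {N : ℂ → ℂ} (hN : ContinuousOn N W) {b : ℂ → ℝ} (hb : ∀ z ∈ E, -(1/2) < b z)
    (hNb : ∀ z ∈ E, ∃ M > 0, ∃ δ > 0, ∀ p ∈ W, ‖p - z‖ < δ → ‖N p‖ ≤ M * ‖p - z‖^b z) {κ : ℝ} (hκ : ∀ z ∈ E, κ ≤ lam z * (b z + 1/2)) :
    ∃ r0 > 0, (∀ z ∈ E, ∀ z' ∈ E, z ≠ z' → r0 < ‖z - z'‖) ∧ ∃ χ : ℂ → ℝ, (∀ t ∉ E, ContDiffAt ℝ 1 χ t) ∧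
      (∀ t, 0 ≤ χ t ∧ χ t ≤ 1) ∧ (∀ t ∈ closure G, t ∉ E → χ t = 1) ∧ HasCompactSupport χ ∧ (∀ t ∉ W, t ∉ E → ∀ᶠ s in 𝓝 t, χ s = 0) ∧
      ∃ C > 0, ∃ g : ℕ → ℂ → ℝ, ∀ n, 1 ≤ n → Integrable (g n) ∧ (∀ t, 0 ≤ g n t) ∧ ∫ t, g n t ≤ C * (n:ℝ)^(-κ) ∧
        ∀ k Q, CmK γ l n k Q → ∀ t ∈ W, ‖N t‖ * ‖fderiv ℝ χ t‖ * ‖cmH k γ l t‖ ≤ Q * g n t := by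
  have hE := dm.cv.fin
  obtain ⟨r0, hr0, sep, m, hm, hcut⟩ := dm.cut hW hWG hWL cor
  choose! δ1 hδ1 C1 hC1 c1 hc1 hH using fun z (hz : z ∈ E) => dm.near hz (hm z hz)
  choose! M hM δ2 hδ2 hNb using hNb
  have hd : ∃ d > 0, ∀ z ∈ E, d ≤ δ1 z ∧ d ≤ δ2 z := by
    have : ∀ᶠ d in 𝓝[>] (0:ℝ), ∀ z ∈ E, d ≤ δ1 z ∧ d ≤ δ2 z := by
      rw [Filter.eventually_all_finite hE]; intro z hz
      filter_upwards [mem_nhdsWithin_of_mem_nhds (Iio_mem_nhds (hδ1 z hz)), mem_nhdsWithin_of_mem_nhds (Iio_mem_nhds (hδ2 z hz))] with d h1 h2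
      exact ⟨le_of_lt h1, le_of_lt h2⟩
    obtain ⟨d, h1, h2⟩ := (this.and self_mem_nhdsWithin).exists
    exact ⟨d, h2, h1⟩
  obtain ⟨d, hd, hdz⟩ := hd
  obtain ⟨χ, A, C, hC, hA, hAK, hAW, x1, x2, x3, x4, x5, x6⟩ := hcut d hd
  refine ⟨r0, hr0, sep, χ, x1, x2, x3, x4, x5, ?_⟩
  obtain ⟨CA, hCA, cA, hcA, hfar⟩ := cm_far dm.cv.lpos dm.b.isCompact_closure dm.ext hA hAK dm.cv.cont fun s => frontier_subset_closure (dm.cv.memL s)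
  obtain ⟨BA, hBA⟩ := hA.exists_bound_of_continuousOn (hN.mono hAW)
  have hl : ∀ z ∈ E, 0 < lam z := fun z hz => (dm.pt z hz).hl.1
  choose! Cg hCg hg using fun z (hz : z ∈ E) => cm_gam ℂ (p := 1/lam z) (q := b z - 3/2) (one_div_pos.2 (hl z hz)) (by
    rw [Complex.finrank_real_complex]; push_cast; linarith [hb z hz])
  obtain ⟨Ce, hCe⟩ := ((tendsto_rpow_mul_exp_neg_mul_atTop_nhds_zero κ cA hcA).comp tendsto_natCast_atTop_atTop).bddAbove_range
  replace hCe : ∀ n : ℕ, 1 ≤ n → Real.exp (-(cA*n)) ≤ Ce * (n:ℝ)^(-κ) := fun n hn => by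
    have h1 : (n:ℝ)^κ * Real.exp (-cA * n) ≤ Ce := hCe ⟨n, rfl⟩
    have hn0 : (0:ℝ) < n := by exact_mod_cast hn
    rw [Real.rpow_neg hn0.le, ← div_eq_mul_inv, le_div_iff₀ (by positivity), ← neg_mul, mul_comm]; exact h1
  set S := hE.toFinset
  have hS : ∀ {z}, z ∈ S ↔ z ∈ E := hE.mem_toFinset
  set g1 : ℂ → ℕ → ℂ → ℝ := fun z n t => M z * C * C1 z * (‖t - z‖^(b z - 3/2) * Real.exp (-(c1 z * n) * ‖t - z‖^(1/lam z)))
  set BB := |BA| * C * CA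
  have hBB : 0 ≤ BB := by positivity
  have g0 : ∀ z ∈ E, ∀ n t, 0 ≤ g1 z n t := fun z hz n t => by have := hM z hz; have := hC1 z hz; positivity
  have gi : ∀ z ∈ E, ∀ n, 1 ≤ n → Integrable (g1 z n) ∧ ∫ t, g1 z n t ≤ M z * C * C1 z * (Cg z * c1 z^(-(lam z * (b z + 1/2)))) * (n:ℝ)^(-κ) := fun z hz n hn => by
    have hn0 : (0:ℝ) < n := by exact_mod_cast hn
    have hn1 : (1:ℝ) ≤ n := by exact_mod_cast hn
    have := hM z hz; have := hC1 z hz; have hc := hc1 z hz; have := hCg z hz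
    obtain ⟨h1, h2⟩ := hg z hz (c1 z * n) (by positivity)
    refine ⟨(h1.comp_sub_right z).const_mul _, ?_⟩
    simp only [g1]
    rw [integral_const_mul, integral_sub_right_eq_self (fun t : ℂ => ‖t‖^(b z - 3/2) * Real.exp (-(c1 z * n) * ‖t‖^(1/lam z))) z, h2, Complex.finrank_real_complex,
      show -(b z - 3/2 + (2:ℕ))/(1/lam z) = -(lam z * (b z + 1/2)) by push_cast; rw [div_div_eq_mul_div, div_one]; ring, Real.mul_rpow hc.le hn0.le, ← mul_assoc (Cg z), ← mul_assoc]
    refine mul_le_mul_of_nonneg_left ?_ (by positivity)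
    exact Real.rpow_le_rpow_of_exponent_le hn1 (neg_le_neg (hκ z hz))
  have hAi : Integrable (A.indicator fun _ : ℂ => (1:ℝ)) := (integrable_indicator_iff hA.measurableSet).2 (integrableOn_const hA.measure_lt_top.ne)
  have hA0 : ∀ t, 0 ≤ A.indicator (fun _ : ℂ => (1:ℝ)) t := fun t => indicator_nonneg (fun _ _ => zero_le_one) t
  set TA := ∫ t, A.indicator (fun _ : ℂ => (1:ℝ)) t
  have hTA : 0 ≤ TA := integral_nonneg hA0
  refine ⟨|BB * Ce * TA + ∑ z ∈ S, M z * C * C1 z * (Cg z * c1 z^(-(lam z * (b z + 1/2))))| + 1, by positivity,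
    fun n t => BB * Real.exp (-(cA*n)) * A.indicator (fun _ => (1:ℝ)) t + ∑ z ∈ S, g1 z n t, fun n hn => ?_⟩
  have is : Integrable fun t => ∑ z ∈ S, g1 z n t := integrable_finsetSum _ fun z hz => (gi z (hS.1 hz) n hn).1
  have n0 : ∀ t, 0 ≤ ∑ z ∈ S, g1 z n t := fun t => Finset.sum_nonneg fun z hz => g0 z (hS.1 hz) n t
  refine ⟨(hAi.const_mul _).add is, fun t => ?_, ?_, fun k Q hk t ht => ?_⟩
  · have := hA0 t; have := n0 t; positivity
  · rw [integral_add (hAi.const_mul _) is, integral_const_mul, integral_finsetSum _ fun z hz => (gi z (hS.1 hz) n hn).1]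
    have h1 : BB * Real.exp (-(cA*n)) * TA ≤ BB * (Ce * (n:ℝ)^(-κ)) * TA := by gcongr; exact hCe n hn
    have h2 := Finset.sum_le_sum fun z hz => (gi z (hS.1 hz) n hn).2
    rw [← Finset.sum_mul] at h2
    have h3 : (0:ℝ) ≤ (n:ℝ)^(-κ) := by positivity
    nlinarith [le_abs_self (BB * Ce * TA + ∑ z ∈ S, M z * C * C1 z * (Cg z * c1 z^(-(lam z * (b z + 1/2)))))]
  · have hQ := hk.Q0
    by_cases hne : fderiv ℝ χ t = 0
    · have := hA0 t; have := n0 t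
      rw [hne, norm_zero, mul_zero, zero_mul]; positivity
    rcases x6 t (fun h => hWE t h ht) hne with ⟨hA, h1⟩ | ⟨z, hz, x, hx, htx, hxd, hcone, h1⟩
    · have h2 := hfar n k Q hk t hA
      have h3 := (hBA t hA).trans (le_abs_self BA)
      beta_reduce; rw [indicator_of_mem hA]
      calc _ ≤ |BA| * C * (CA * Q * Real.exp (-(cA*n))) := by gcongr; exact h2
        _ = Q * (BB * Real.exp (-(cA*n)) * 1) := by ring
        _ ≤ _ := by have := n0 t; gcongr; linarith
    · have hx0 : 0 < ‖x‖ := norm_pos_iff.2 hx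
      have hN' : ‖t - z‖ = ‖x‖ := by rw [htx, add_sub_cancel_left, norm_mul, (dm.pt z hz).e1, one_mul]
      have h2 := hH z hz n k Q hn hk x hx (hxd.trans_le (hdz z hz).1) hcone
      have h3 := hNb z hz t ht (by rw [hN']; exact hxd.trans_le (hdz z hz).2)
      rw [← htx] at h2
      rw [hN'] at h3
      have := hM z hz
      calc _ ≤ M z * ‖x‖^b z * (C/‖x‖) * (C1 z * Q * ‖x‖^(-(1/2:ℝ)) * Real.exp (-(c1 z*n*‖x‖^(1/lam z)))) := by gcongr
        _ = Q * g1 z n t := by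
          simp only [g1, hN']
          rw [show b z - 3/2 = b z + -1 + -(1/2) by ring, Real.rpow_add hx0, Real.rpow_add hx0, Real.rpow_neg_one, neg_mul]; ring
        _ ≤ _ := by
          have h4 := Finset.single_le_sum (fun z hz => g0 z (hS.1 hz) n t) (hS.2 hz)
          have := hA0 t
          have : 0 ≤ BB * Real.exp (-(cA*n)) * A.indicator (fun _ => (1:ℝ)) t := by positivity
          gcongr; linarith
noncomputable def cmD (a : ℂ →L[ℝ] ℝ) : ℂ := (1/2) * (a 1 + I * a I)
theorem cmD_le (a : ℂ →L[ℝ] ℝ) : ‖cmD a‖ ≤ ‖a‖ := by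
  have h1 : ‖((a 1 : ℝ) : ℂ)‖ ≤ ‖a‖ := by rw [norm_real]; simpa using a.le_opNorm 1
  have h2 : ‖((a I : ℝ) : ℂ)‖ ≤ ‖a‖ := by rw [norm_real]; simpa using a.le_opNorm I
  have := norm_add_le ((a 1 : ℝ) : ℂ) (I * (a I : ℝ))
  rw [norm_mul, norm_I, one_mul] at this
  rw [cmD, norm_mul]; norm_num; linarith
theorem cm_dbar_mul {W : Set ℂ} (hW : IsOpen W) {N : ℂ → ℂ} (hN : DifferentiableOn ℂ N W) {u : ℂ → ℝ} (hu : ContDiff ℝ 1 u)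
    (h0 : ∀ t ∉ W, ∀ᶠ s in 𝓝 t, u s = 0) : ContDiff ℝ 1 (fun t => (u t : ℂ) * N t) ∧ ∀ t, cmDbar (fun t => (u t : ℂ) * N t) t = N t * cmD (fderiv ℝ u t) := by
  have hz : ∀ t ∉ W, (fun t => (u t : ℂ) * N t) =ᶠ[𝓝 t] fun _ => 0 := fun t ht => by
    filter_upwards [h0 t ht] with s hs; simp [hs]
  have huc : ContDiff ℝ 1 fun t => (u t : ℂ) := ofRealCLM.contDiff.comp hu
  refine ⟨contDiff_iff_contDiffAt.2 fun t => ?_, fun t => ?_⟩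
  · by_cases ht : t ∈ W
    · exact huc.contDiffAt.mul ((hN.contDiffOn hW).contDiffAt (hW.mem_nhds ht) |>.restrict_scalars ℝ)
    · exact contDiffAt_const.congr_of_eventuallyEq (hz t ht)
  · by_cases ht : t ∈ W
    · have h1 := (hN.differentiableAt (hW.mem_nhds ht)).hasDerivAt.hasFDerivAt.restrictScalars ℝ
      have h2 : HasFDerivAt (fun t => (u t : ℂ)) (ofRealCLM.comp (fderiv ℝ u t)) t := ofRealCLM.hasFDerivAt.comp t (hu.differentiable one_ne_zero t).hasFDerivAt
      rw [cmDbar, (h2.fun_mul h1).fderiv, cmD]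
      simp [-mul_eq_mul_left_iff]
      ring_nf; rw [I_sq]; ring
    · rw [cmDbar, (hz t ht).fderiv_eq, EventuallyEq.fderiv_eq (f := fun _ => (0:ℝ)) (h0 t ht)]
      simp [cmD]
set_option maxHeartbeats 1600000 in
theorem CmDom.est {G E W : Set ℂ} {l : ℝ} {γ : ℝ → ℂ} {lam a : ℂ → ℝ} {e : ℂ → ℂ} (dm : CmDom G E l γ lam a e) (hW : IsOpen W) (hWG : G ⊆ W)
    (hWL : ∀ z ∈ frontier G, z ∉ E → z ∈ W) (hWE : ∀ z ∈ E, z ∉ W)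
    (cor : ∀ z0 ∈ E, ∃ c > 0, ∃ ρ > 0, ∀ z ∈ frontier G, z ≠ z0 → ‖z - z0‖ < ρ → ball z (c * ‖z - z0‖) ⊆ W)
    {N0 : ℂ → ℂ} (hN0 : ContinuousOn N0 W) {b : ℂ → ℝ} (hb : ∀ z ∈ E, -(1/2) < b z)
    (hNb : ∀ z ∈ E, ∃ M > 0, ∃ δ > 0, ∀ p ∈ W, ‖p - z‖ < δ → ‖N0 p‖ ≤ M * ‖p - z‖^b z) {κ : ℝ} (hκ : ∀ z ∈ E, κ ≤ lam z * (b z + 1/2)) :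
    ∃ C > 0, ∀ N : ℂ → ℂ, DifferentiableOn ℂ N W → ∀ A0 > 0, (∀ p ∈ W, ‖N p‖ ≤ A0 * ‖N0 p‖) → ∀ n k Q, 1 ≤ n → CmK γ l n k Q →
      ‖∫ s, k s * N (γ s) ∂(cmμ l)‖ ≤ C * A0 * Q * (n:ℝ)^(-κ) := by
  have hE := dm.cv.fin
  obtain ⟨r0, hr0, sep, χ, x1, x2, x3, x4, x5, C, hC, g, hg⟩ := dm.maj hW hWG hWL hWE cor hN0 hb hNb hκ
  set S := hE.toFinset
  have hS : ∀ {z}, z ∈ S ↔ z ∈ E := hE.mem_toFinset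
  have hpi := Real.pi_pos
  refine ⟨(1 + S.card) * C/Real.pi, by positivity, fun N hN A0 hA0 hNN n k Q hn hk => ?_⟩
  obtain ⟨gi, g0, gb, hg⟩ := hg n hn
  have hQ := hk.Q0
  choose! M hM δ hδ hNb using hNb
  have hNb' : ∀ z ∈ E, ∃ M > 0, ∃ δ > 0, ∀ p ∈ W, ‖p - z‖ < δ → ‖N p‖ ≤ M * ‖p - z‖^b z := fun z hz =>
    ⟨A0 * M z, mul_pos hA0 (hM z hz), δ z, hδ z hz, fun p hp h => (hNN p hp).trans (by rw [mul_assoc]; gcongr; exact hNb z hz p hp h)⟩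
  obtain ⟨l1, l2, l3⟩ := dm.cv.l2 hW hWL hN.continuousOn hb hNb'
  choose! M' hM' δ' hδ' hNb' using hNb'
  have hkN := (cm_cs (Q := Q) (B := Real.sqrt (∫ s, ‖N (γ s)‖^2 ∂(cmμ l)) + 1) hQ (by positivity) hk.m l2 hk.i2 l3 hk.b (by
    have h0 : 0 ≤ ∫ s, ‖N (γ s)‖^2 ∂(cmμ l) := integral_nonneg fun s => by positivity
    nlinarith [Real.sq_sqrt h0, Real.sqrt_nonneg (∫ s, ‖N (γ s)‖^2 ∂(cmμ l))])).1
  obtain ⟨β, β1, β0, βc, βn, βl, βs⟩ : ∃ b : ℂ → ℝ, (∀ s, ‖s‖ < 1 → b s = 1) ∧ (∀ s, 2 ≤ ‖s‖ → b s = 0) ∧ ContDiff ℝ 1 b ∧ (∀ s, 0 ≤ b s) ∧ (∀ s, b s ≤ 1) ∧ HasCompactSupport b := by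
    let b : ContDiffBump (0:ℂ) := ⟨1, 2, one_pos, by norm_num⟩
    exact ⟨b, fun s hs => b.one_of_mem_closedBall (mem_closedBall_iff_norm.2 (by simpa using hs.le)), fun s hs => b.zero_of_le_dist (by simpa using hs), b.contDiff, b.nonneg', fun s => b.le_one, b.hasCompactSupport⟩
  obtain ⟨K, hK⟩ := (βs.fderiv ℝ).exists_bound_of_continuous (βc.continuous_fderiv one_ne_zero)
  have K0 : 0 ≤ K := (norm_nonneg _).trans (hK 0)
  set ω : ℝ → ℂ → ℝ := fun ε t => 1 - ∑ z ∈ S, β (ε⁻¹ • (t - z))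
  have wc : ∀ ε, ContDiff ℝ 1 (ω ε) := fun ε => contDiff_const.sub (ContDiff.sum fun z _ => βc.comp ((contDiff_id.sub contDiff_const).const_smul _))
  have wb : ∀ ε t, |ω ε t| ≤ 1 + S.card := fun ε t => by
    have h1 : 0 ≤ ∑ z ∈ S, β (ε⁻¹ • (t - z)) := Finset.sum_nonneg fun _ _ => βn _
    have h2 : ∑ z ∈ S, β (ε⁻¹ • (t - z)) ≤ ∑ z ∈ S, (1:ℝ) := Finset.sum_le_sum fun _ _ => βl _
    rw [Finset.sum_const, nsmul_eq_mul, mul_one] at h2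
    have h3 : (0:ℝ) ≤ S.card := by positivity
    exact abs_le.2 ⟨by simp only [ω]; linarith, by simp only [ω]; linarith⟩
  have nsc : ∀ (ε : ℝ) (v : ℂ), 0 < ε → ‖ε⁻¹ • v‖ = ‖v‖/ε := fun ε v h => by rw [norm_smul, norm_inv, Real.norm_of_nonneg h.le, div_eq_inv_mul]
  have w1 : ∀ ε > 0, ∀ t, (∀ z ∈ E, 2*ε ≤ ‖t - z‖) → ω ε t = 1 := fun ε hε t h => by
    simp only [ω]
    rw [Finset.sum_eq_zero fun z hz => β0 _ (by rw [nsc _ _ hε, le_div_iff₀ hε]; exact h z (hS.1 hz)), sub_zero]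
  have w0 : ∀ ε > 0, 3*ε ≤ r0 → ∀ z ∈ E, ∀ᶠ t in 𝓝 z, ω ε t = 0 := fun ε hε hr z hz => by
    filter_upwards [ball_mem_nhds z hε] with t ht
    rw [mem_ball_iff_norm] at ht
    simp only [ω]
    rw [Finset.sum_eq_single_of_mem z (hS.2 hz), β1 _ (by rw [nsc _ _ hε, div_lt_one hε]; exact ht), sub_self]
    intro z' hz' hne
    refine β0 _ ?_
    have h1 := sep z hz z' (hS.1 hz') hne.symm
    have h2 := norm_sub_le_norm_sub_add_norm_sub z t z'
    rw [norm_sub_rev z t] at h2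
    rw [nsc _ _ hε, le_div_iff₀ hε]; linarith
  have wd : ∀ ε > 0, ∀ t, ‖fderiv ℝ (ω ε) t‖ ≤ ∑ z ∈ S, (ball z (2*(2*ε))).indicator (fun t => if ε ≤ ‖t - z‖ then K/ε else 0) t := fun ε hε t => by
    have h1 : ∀ z ∈ S, HasFDerivAt (fun t => β (ε⁻¹ • (t - z))) (ε⁻¹ • fderiv ℝ β (ε⁻¹ • (t - z))) t := fun z _ => by
      have := ((βc.differentiable one_ne_zero (ε⁻¹ • (t - z))).hasFDerivAt).comp t (((hasFDerivAt_id t).sub_const z).const_smul ε⁻¹)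
      refine HasFDerivAt.congr_fderiv this ?_; ext v; simp
    have h2 : HasFDerivAt (ω ε) (-∑ z ∈ S, ε⁻¹ • fderiv ℝ β (ε⁻¹ • (t - z))) t := (HasFDerivAt.fun_sum h1).const_sub 1
    rw [h2.fderiv, norm_neg]
    refine (norm_sum_le _ _).trans (Finset.sum_le_sum fun z _ => ?_)
    rw [norm_smul, norm_inv, Real.norm_of_nonneg hε.le, ← div_eq_inv_mul]
    have hc : Continuous fun v : ℂ => ‖v‖ := continuous_norm
    by_cases h4 : t ∈ ball z (2*(2*ε))
    · rw [indicator_of_mem h4]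
      split_ifs with h5
      · gcongr; exact hK _
      · rw [EventuallyEq.fderiv_eq (f := fun _ => (1:ℝ)), fderiv_const_apply, norm_zero, zero_div]
        filter_upwards [hc.continuousAt.eventually_lt_const (show ‖ε⁻¹ • (t - z)‖ < 1 by rw [nsc _ _ hε, div_lt_one hε]; exact not_le.1 h5)] with v hv using β1 v hv
    · rw [indicator_of_notMem h4, EventuallyEq.fderiv_eq (f := fun _ => (0:ℝ)), fderiv_const_apply, norm_zero, zero_div]
      rw [mem_ball_iff_norm, not_lt] at h4
      filter_upwards [hc.continuousAt.eventually_const_lt (show 2 < ‖ε⁻¹ • (t - z)‖ by rw [nsc _ _ hε, lt_div_iff₀ hε]; linarith)] with v hv using β0 v hv.le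
  choose! s0 hs0 using fun z (hz : z ∈ E) => (dm.cv.mem z).1 (dm.EL hz)
  choose! Ck hCk hker using fun z (hz : z ∈ E) => dm.cv.ker (s0 z)
  obtain ⟨Cd, hCd, hdisc⟩ := cm_disc
  set err : ℝ → ℝ := fun ε => ∑ z ∈ S, M' z * (1 + 4^b z) * ε^b z * (K/ε) * (Cd * (2*ε)^2) * (Q * Real.sqrt (Ck z/(2*ε)))
  have herr : Tendsto err (𝓝[>] 0) (𝓝 0) := by
    rw [show 𝓝 (0:ℝ) = 𝓝 (∑ z ∈ S, 0) by simp]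
    refine tendsto_finsetSum _ fun z hz => ?_
    have h1 : Tendsto (fun ε : ℝ => M' z * (1 + 4^b z) * K * (Cd * 4) * (Q * Real.sqrt (Ck z/2)) * ε^(b z + 1/2)) (𝓝[>] 0) (𝓝 0) := by
      have h2 : (0:ℝ) < b z + 1/2 := by linarith [hb z (hS.1 hz)]
      have := ((Real.continuousAt_rpow_const 0 (b z + 1/2) (Or.inr h2.le)).tendsto.mono_left nhdsWithin_le_nhds : Tendsto _ (𝓝[>] (0:ℝ)) _).const_mul (M' z * (1 + 4^b z) * K * (Cd * 4) * (Q * Real.sqrt (Ck z/2)))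
      rwa [Real.zero_rpow h2.ne', mul_zero] at this
    refine h1.congr' ?_
    filter_upwards [self_mem_nhdsWithin] with ε hε
    replace hε : 0 < ε := hε
    rw [Real.rpow_add hε, ← Real.sqrt_eq_rpow, ← div_div, Real.sqrt_div' _ hε.le]
    have := Real.sq_sqrt hε.le
    have h3 : 0 < Real.sqrt ε := Real.sqrt_pos.2 hε
    field_simp
    rw [this]; ring
  have key : ∀ᶠ ε in 𝓝[>] (0:ℝ), ‖∫ s, k s * ((ω ε (γ s) * χ (γ s) : ℝ) * N (γ s)) ∂(cmμ l)‖ ≤ 1/Real.pi * ((1 + S.card) * (A0 * Q * ∫ t, g n t) + err ε) := by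
    have hsm : ∀ᶠ ε in 𝓝[>] (0:ℝ), ∀ z ∈ E, 4*ε < δ' z := by
      rw [Filter.eventually_all_finite hE]; intro z hz
      filter_upwards [mem_nhdsWithin_of_mem_nhds (Iio_mem_nhds (show 0 < δ' z/4 by have := hδ' z hz; positivity))] with ε h1
      have : ε < δ' z/4 := h1
      linarith
    filter_upwards [hsm, self_mem_nhdsWithin, mem_nhdsWithin_of_mem_nhds (Iic_mem_nhds (show 0 < r0/3 by positivity))] with ε hsm hε hr
    replace hε : 0 < ε := hε
    replace hr : 3*ε ≤ r0 := by have : ε ≤ r0/3 := hr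
                                linarith
    set u : ℂ → ℝ := fun t => ω ε t * χ t
    have u0 : ∀ t ∉ W, ∀ᶠ s in 𝓝 t, u s = 0 := fun t ht => by
      by_cases h : t ∈ E
      · filter_upwards [w0 ε hε hr t h] with s hs; simp only [u, hs, zero_mul]
      · filter_upwards [x5 t ht h] with s hs; simp only [u, hs, mul_zero]
    have uc : ContDiff ℝ 1 u := contDiff_iff_contDiffAt.2 fun t => by
      by_cases h : t ∈ E
      · exact contDiffAt_const.congr_of_eventuallyEq (u0 t (hWE t h))
      · exact (wc ε).contDiffAt.mul (x1 t h)
    have ud : ∀ t, fderiv ℝ u t = ω ε t • fderiv ℝ χ t + χ t • fderiv ℝ (ω ε) t := fun t => by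
      by_cases h : t ∈ E
      · rw [EventuallyEq.fderiv_eq (f := fun _ => (0:ℝ)) (u0 t (hWE t h)), EventuallyEq.fderiv_eq (f₁ := ω ε) (f := fun _ => (0:ℝ)) (w0 ε hε hr t h), (w0 ε hε hr t h).self_of_nhds]
        simp
      · exact fderiv_fun_mul ((wc ε).differentiable one_ne_zero t) ((x1 t h).differentiableAt one_ne_zero)
    obtain ⟨Fc, Fd⟩ := cm_dbar_mul hW hN uc u0
    set F : ℂ → ℂ := fun t => (u t : ℂ) * N t
    have Fs : HasCompactSupport F := x4.mono' fun t ht => by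
      refine subset_tsupport _ fun h => ht ?_
      simp only [F, u, h]; simp
    set U : ℂ → ℂ := fun t => N t * (ω ε t * cmD (fderiv ℝ χ t))
    set V : ℂ → ℂ := fun t => N t * (χ t * cmD (fderiv ℝ (ω ε) t))
    have hUV : ∀ t, cmDbar F t = U t + V t := fun t => by
      rw [Fd, ud]; simp only [U, V, cmD]
      simp; ring
    have cD : ∀ {f : ℂ → ℂ →L[ℝ] ℝ} {t}, ContinuousAt f t → ContinuousAt (fun t => cmD (f t)) t := fun {f t} h => by
      simp only [cmD]; fun_prop
    have Uc : Continuous U := continuous_iff_continuousAt.2 fun t => by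
      by_cases ht : t ∈ W
      · have h1 := (hN.continuousOn).continuousAt (hW.mem_nhds ht)
        have h2 := cD ((x1 t fun h => hWE t h ht).continuousAt_fderiv one_ne_zero)
        have h3 := (wc ε).continuous.continuousAt (x := t)
        simp only [U]; fun_prop
      · refine (continuousAt_const (y := (0:ℂ))).congr (EventuallyEq.symm ?_)
        by_cases h : t ∈ E
        · filter_upwards [w0 ε hε hr t h] with s hs; simp [U, hs]
        · filter_upwards [(x5 t ht h).eventually_nhds] with s hs
          simp only [U]; rw [EventuallyEq.fderiv_eq (f := fun _ => (0:ℝ)) hs]; simp [cmD]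
    have Us : HasCompactSupport U := (x4.fderiv ℝ).mono' fun t ht => subset_tsupport _ fun h => ht (by simp only [U, h]; simp [cmD])
    have Dc : Continuous (cmDbar F) := by
      have := Fc.continuous_fderiv one_ne_zero
      unfold cmDbar; fun_prop
    have Vc : Continuous V := by
      rw [show V = fun t => cmDbar F t - U t by ext t; rw [hUV]; ring]; exact Dc.sub Uc
    have Vs : HasCompactSupport V := x4.mono' fun t ht => subset_tsupport _ fun h => ht (by simp only [V, h]; simp)
    have fub : ∀ {U : ℂ → ℂ}, Continuous U → HasCompactSupport U → (∀ s, Integrable fun t => U t/(t - γ s)) ∧ Integrable (fun s => k s * ∫ t, U t/(t - γ s)) (cmμ l) ∧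
        ∫ s, (k s * ∫ t, U t/(t - γ s)) ∂(cmμ l) = ∫ t, U t * cmH k γ l t := fun {U} h1 h2 => by
      obtain ⟨MU, hMU⟩ := h2.exists_bound_of_continuous h1
      obtain ⟨R, hR⟩ := (isBounded_iff_subset_ball (0:ℂ)).1 h2.isCompact.isBounded
      refine cm_fub (R := |R| + 1) dm.cv.cont (by positivity) hk.int h1.aestronglyMeasurable hMU fun t ht => image_eq_zero_of_notMem_tsupport fun h => ht ?_
      exact ball_subset_ball (by linarith [le_abs_self R, abs_nonneg R]) (hR h)
    obtain ⟨fU1, fU2, fU3⟩ := fub Uc Us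
    obtain ⟨fV1, fV2, -⟩ := fub Vc Vs
    have h1 : ∀ s, k s * ((ω ε (γ s) * χ (γ s) : ℝ) * N (γ s)) = -(1/Real.pi) * (k s * (∫ t, U t/(t - γ s)) + k s * ∫ t, V t/(t - γ s)) := fun s => by
      have := cm_pompeiu Fc Fs (γ s)
      simp only [hUV, add_div] at this
      rw [integral_add (fU1 s) (fV1 s)] at this
      rw [← mul_add, this]; simp only [F, u]
      have : (Real.pi:ℂ) ≠ 0 := ofReal_ne_zero.2 hpi.ne'
      field_simp
    simp_rw [h1]
    rw [integral_const_mul, integral_add fU2 fV2, fU3, norm_mul, norm_neg, ← ofReal_one, ← ofReal_div, norm_real, Real.norm_of_nonneg (by positivity)]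
    refine mul_le_mul_of_nonneg_left ((norm_add_le _ _).trans (add_le_add ?_ ?_)) (by positivity)
    · rw [← integral_const_mul, ← integral_const_mul]
      refine norm_integral_le_of_norm_le ((gi.const_mul _).const_mul _) (ae_of_all _ fun t => ?_)
      by_cases ht : t ∈ W
      · simp only [U, norm_mul, norm_real, Real.norm_eq_abs]
        have h2 := hg k Q hk t ht
        have h3 := hNN t ht
        have h4 := wb ε t
        have h5 := cmD_le (fderiv ℝ χ t)
        calc _ ≤ (A0 * ‖N0 t‖) * ((1 + S.card) * ‖fderiv ℝ χ t‖) * ‖cmH k γ l t‖ := by gcongr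
          _ = (1 + S.card) * A0 * (‖N0 t‖ * ‖fderiv ℝ χ t‖ * ‖cmH k γ l t‖) := by ring
          _ ≤ (1 + S.card) * A0 * (Q * g n t) := by gcongr
          _ = _ := by ring
      · have : U t = 0 := by
          by_cases h : t ∈ E
          · simp [U, (w0 ε hε hr t h).self_of_nhds]
          · simp only [U]; rw [EventuallyEq.fderiv_eq (f := fun _ => (0:ℝ)) (x5 t ht h)]; simp [cmD]
        have := g0 t
        rw [‹U t = 0›, zero_mul, norm_zero]; positivity
    · set cz : ℂ → ℝ := fun z => M' z * (1 + 4^b z) * ε^b z * (K/ε)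
      have cz0 : ∀ z ∈ S, 0 ≤ cz z := fun z hz => by have := hM' z (hS.1 hz); positivity
      have hV : ∀ s, ‖∫ t, V t/(t - γ s)‖ ≤ ∑ z ∈ S, cz z * (Cd * (2*ε)^2/(2*ε + ‖γ s - z‖)) := fun s => by
        have h2 : ∀ z ∈ S, Integrable ((ball z (2*(2*ε))).indicator fun t => cz z * (1/‖t - γ s‖)) := fun z _ =>
          (integrable_indicator_iff measurableSet_ball).2 ((hdisc (2*ε) (by positivity) (γ s) z).1.const_mul _)
        refine (norm_integral_le_of_norm_le (integrable_finsetSum _ h2) (ae_of_all _ fun t => ?_)).trans ?_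
        · rw [norm_div]
          simp only [V, norm_mul, norm_real, Real.norm_of_nonneg (x2 t).1]
          by_cases ht : t ∈ W
          swap
          · have : χ t = 0 ∨ fderiv ℝ (ω ε) t = 0 := by
              by_cases h : t ∈ E
              · right; rw [EventuallyEq.fderiv_eq (f := fun _ => (0:ℝ)) (w0 ε hε hr t h)]; simp
              · left; exact (x5 t ht h).self_of_nhds
            have h3 : ‖N t‖ * (χ t * ‖cmD (fderiv ℝ (ω ε) t)‖)/‖t - γ s‖ = 0 := by
              rcases this with h | h <;> simp [h, cmD]
            rw [h3]
            exact Finset.sum_nonneg fun z hz => indicator_nonneg (fun t _ => mul_nonneg (cz0 z hz) (by positivity)) t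
          have h4 := (cmD_le _).trans (wd ε hε t)
          calc _ ≤ ‖N t‖ * (1 * ∑ z ∈ S, (ball z (2*(2*ε))).indicator (fun t => if ε ≤ ‖t - z‖ then K/ε else 0) t)/‖t - γ s‖ := by gcongr; exact (x2 t).2
            _ = ∑ z ∈ S, ‖N t‖ * (ball z (2*(2*ε))).indicator (fun t => if ε ≤ ‖t - z‖ then K/ε else 0) t/‖t - γ s‖ := by rw [one_mul, Finset.mul_sum, Finset.sum_div]
            _ ≤ _ := by
              refine Finset.sum_le_sum fun z hz => ?_
              have hm := hM' z (hS.1 hz)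
              by_cases h5 : t ∈ ball z (2*(2*ε))
              swap
              · simp [indicator_of_notMem h5]
              rw [indicator_of_mem h5, indicator_of_mem h5, mul_one_div]
              gcongr
              have h6 : ‖t - z‖ < 4*ε := by rw [mem_ball_iff_norm] at h5; linarith
              split_ifs with h7
              · simp only [cz]
                refine mul_le_mul_of_nonneg_right ((hNb' z (hS.1 hz) t ht (h6.trans (hsm z (hS.1 hz)))).trans ?_) (by positivity)
                rw [mul_assoc]; gcongr
                have e1 : 0 < ε^b z := by positivity
                have e2 : 0 < (4:ℝ)^b z * ε^b z := by positivity
                rcases le_total 0 (b z) with h | h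
                · have := Real.rpow_le_rpow (norm_nonneg _) h6.le h
                  rw [Real.mul_rpow (by norm_num) hε.le] at this; linarith
                · have := Real.rpow_le_rpow_of_nonpos hε h7 h; linarith
              · rw [mul_zero]; exact cz0 z hz
        · rw [integral_finsetSum _ h2]
          refine Finset.sum_le_sum fun z hz => ?_
          rw [integral_indicator measurableSet_ball, integral_const_mul]
          exact mul_le_mul_of_nonneg_left (hdisc (2*ε) (by positivity) (γ s) z).2 (cz0 z hz)
      have hz1 : ∀ z ∈ S, Integrable (fun s => cz z * (Cd * (2*ε)^2) * ‖k s * ((1/(2*ε + ‖γ s - z‖) : ℝ) : ℂ)‖) (cmμ l) ∧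
          ∫ s, cz z * (Cd * (2*ε)^2) * ‖k s * ((1/(2*ε + ‖γ s - z‖) : ℝ) : ℂ)‖ ∂(cmμ l) ≤ cz z * (Cd * (2*ε)^2) * (Q * Real.sqrt (Ck z/(2*ε))) := fun z hz => by
        have hzE := hS.1 hz
        obtain ⟨k1, k2⟩ := hker z hzE (2*ε) (by positivity)
        rw [hs0 z hzE] at k1 k2
        have hck := hCk z hzE
        have hq : ∀ s, ‖((1/(2*ε + ‖γ s - z‖) : ℝ) : ℂ)‖^2 = 1/(2*ε + ‖γ s - z‖)^2 := fun s => by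
          rw [norm_real, Real.norm_of_nonneg (by positivity), div_pow, one_pow]
        have hγ := dm.cv.cont
        obtain ⟨c1, c2⟩ := cm_cs (k := k) (u := fun s => ((1/(2*ε + ‖γ s - z‖) : ℝ) : ℂ)) hQ (show 0 < Real.sqrt (Ck z/(2*ε)) by positivity) hk.m
          (Continuous.aestronglyMeasurable (continuous_ofReal.comp (continuous_const.div (by fun_prop) fun s => by positivity))) hk.i2
          (by simp_rw [hq]; exact k1) hk.b (by simp_rw [hq]; rw [Real.sq_sqrt (by positivity)]; exact k2)
        refine ⟨c1.norm.const_mul _, ?_⟩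
        rw [integral_const_mul]
        have := cz0 z hz
        gcongr
      refine (norm_integral_le_of_norm_le (integrable_finsetSum _ fun z hz => (hz1 z hz).1) (ae_of_all _ fun s => ?_)).trans ?_
      · rw [norm_mul]
        refine (mul_le_mul_of_nonneg_left (hV s) (norm_nonneg _)).trans_eq ?_
        rw [Finset.mul_sum]
        refine Finset.sum_congr rfl fun z _ => ?_
        rw [norm_mul, norm_real, Real.norm_of_nonneg (by positivity)]; ring
      · rw [integral_finsetSum _ fun z hz => (hz1 z hz).1]
        exact Finset.sum_le_sum fun z hz => (hz1 z hz).2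
  have lim : Tendsto (fun ε => ∫ s, k s * ((ω ε (γ s) * χ (γ s) : ℝ) * N (γ s)) ∂(cmμ l)) (𝓝[>] (0:ℝ)) (𝓝 (∫ s, k s * N (γ s) ∂(cmμ l))) := by
    refine tendsto_integral_filter_of_dominated_convergence (fun s => (1 + S.card) * ‖k s * N (γ s)‖) (Eventually.of_forall fun ε => ?_) (Eventually.of_forall fun ε => ?_) (hkN.norm.const_mul _) ?_
    · refine hk.m.mul ((AEStronglyMeasurable.congr (f := fun s => ((ω ε (γ s) : ℝ) : ℂ)) ?_ ?_).mul l2)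
      · exact (continuous_ofReal.comp ((wc ε).continuous.comp dm.cv.cont)).aestronglyMeasurable
      · filter_upwards [l1] with s hs
        rw [x3 _ (frontier_subset_closure (dm.cv.memL s)) hs, mul_one]
    · filter_upwards with s
      rw [mul_left_comm, norm_mul, norm_real, norm_mul]
      refine mul_le_mul_of_nonneg_right ?_ (norm_nonneg _)
      rw [Real.norm_of_nonneg (x2 _).1]
      exact (mul_le_of_le_one_right (norm_nonneg _) (x2 _).2).trans (wb ε _)
    · filter_upwards [l1] with s hs
      refine tendsto_const_nhds.congr' ?_
      have : ∀ᶠ ε in 𝓝[>] (0:ℝ), ∀ z ∈ E, 2*ε ≤ ‖γ s - z‖ := by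
        rw [Filter.eventually_all_finite hE]; intro z hz
        have h1 : 0 < ‖γ s - z‖ := norm_pos_iff.2 (sub_ne_zero.2 fun h => hs (h ▸ hz))
        filter_upwards [mem_nhdsWithin_of_mem_nhds (Iio_mem_nhds (half_pos h1))] with ε h2
        have : ε < ‖γ s - z‖/2 := h2
        linarith
      filter_upwards [this, self_mem_nhdsWithin] with ε h1 h2
      rw [w1 ε h2 _ h1, x3 _ (frontier_subset_closure (dm.cv.memL s)) hs]; simp
  have := le_of_tendsto_of_tendsto lim.norm ((herr.const_add _).const_mul _) key
  refine this.trans ?_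
  calc 1/Real.pi * ((1 + S.card) * (A0 * Q * ∫ t, g n t) + 0) ≤ 1/Real.pi * ((1 + S.card) * (A0 * Q * (C * (n:ℝ)^(-κ))) + 0) := by gcongr
    _ = _ := by ring
theorem cm_two {g : ℝ → ℝ} {l : ℝ} {S : Set ℝ} (hS : S.Finite)
    (hi : ∀ s ∈ Ico 0 l, ∀ t ∈ Ico 0 l, s ∉ S → t ∉ S → ∀ m : ℤ, g s = g t + 2*Real.pi*m → s = t)
    {b α β : ℝ} (hαβ : α < β) (m : ℤ) (hb : 0 ≤ b)
    (h1 : ∀ y ∈ Ioo α β, ∃ s ∈ Icc 0 b, g s = y) (h2 : ∀ y ∈ Ioo α β, ∃ t ∈ Icc b l, g t + 2*Real.pi*m = y) : False := by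
  set T : Set ℝ := insert b (insert l S)
  have hT : T.Finite := (hS.insert l).insert b
  obtain ⟨y, hy, hy2⟩ := (Ioo_infinite hαβ).exists_notMem_finite ((hT.image g).union (hT.image fun t => g t + 2*Real.pi*m))
  obtain ⟨s, hs, e1⟩ := h1 y hy
  obtain ⟨t, ht, e2⟩ := h2 y hy
  have hsT : s ∉ T := fun h => hy2 (Or.inl ⟨s, h, e1⟩)
  have htT : t ∉ T := fun h => hy2 (Or.inr ⟨t, h, e2⟩)
  simp only [T, mem_insert_iff, not_or] at hsT htT
  have hlt : t < l := lt_of_le_of_ne ht.2 htT.2.1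
  have := hi s ⟨hs.1, by linarith [hs.2, ht.1]⟩ t ⟨by linarith [ht.1], hlt⟩ hsT.2.2 htT.2.2 m (by rw [e1, e2])
  exact hsT.1 (le_antisymm hs.2 (this ▸ ht.1))
theorem cm_theta {g : ℝ → ℝ} {l : ℝ} {S : Set ℝ} (hl : 0 < l) (hS : S.Finite) (hg : Continuous g)
    (hi : ∀ s ∈ Ico 0 l, ∀ t ∈ Ico 0 l, s ∉ S → t ∉ S → ∀ m : ℤ, g s = g t + 2*Real.pi*m → s = t)
    {m0 : ℤ} (hm : g l = g 0 + 2*Real.pi*m0) :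
    ∃ σ : ℝ, (σ = 1 ∨ σ = -1) ∧ (∀ s ∈ Ioo 0 l, ∀ κ, HasDerivAt g κ s → 0 ≤ σ * κ) ∧ σ * (g l - g 0) = 2*Real.pi := by
  have hinj : InjOn g (Icc 0 l) := by
    have key : ∀ s ∈ Icc 0 l, ∀ t ∈ Icc 0 l, s < t → g s ≠ g t := fun s hs t ht hst he => by
      by_cases hc : ∀ c ∈ Icc s t, g c = g s
      · obtain ⟨c, hc1, hc2⟩ := (Ioo_infinite hst).exists_notMem_finite hS
        obtain ⟨d, hd1, hd2⟩ := (Ioo_infinite hst).exists_notMem_finite (hS.insert c)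
        simp only [mem_insert_iff, not_or] at hd2
        exact hd2.1 (hi d ⟨by linarith [hs.1, hd1.1], by linarith [hd1.2, ht.2]⟩ c ⟨by linarith [hs.1, hc1.1], by linarith [hc1.2, ht.2]⟩ hd2.2 hc2 0
          (by rw [hc d ⟨hd1.1.le, hd1.2.le⟩, hc c ⟨hc1.1.le, hc1.2.le⟩]; simp))
      · push Not at hc
        obtain ⟨c, hc1, hc2⟩ := hc
        refine cm_two hS hi (b := c) (α := min (g s) (g c)) (β := max (g s) (g c)) (min_lt_max.2 hc2.symm) 0 (hs.1.trans hc1.1) ?_ ?_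
        · intro y hy
          obtain ⟨x, hx, e⟩ := intermediate_value_uIcc (hg.continuousOn (s := [[s, c]])) ⟨hy.1.le, hy.2.le⟩
          rw [uIcc_of_le hc1.1] at hx
          exact ⟨x, ⟨hs.1.trans hx.1, hx.2⟩, e⟩
        · intro y hy
          obtain ⟨x, hx, e⟩ := intermediate_value_uIcc (hg.continuousOn (s := [[t, c]])) (show y ∈ [[g t, g c]] by rw [← he]; exact ⟨hy.1.le, hy.2.le⟩)
          rw [uIcc_of_ge hc1.2] at hx
          exact ⟨x, ⟨hx.1, hx.2.trans ht.2⟩, by simpa using e⟩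
    intro s hs t ht he
    by_contra hne
    rcases lt_or_gt_of_ne hne with h | h
    · exact key s hs t ht h he
    · exact key t ht s hs h he.symm
  have h0 : (0:ℝ) ∈ Icc 0 l := ⟨le_rfl, hl.le⟩
  have hl' : l ∈ Icc 0 l := ⟨hl.le, le_rfl⟩
  have hpi := Real.pi_pos
  obtain ⟨σ, hσ, hmono⟩ : ∃ σ : ℝ, (σ = 1 ∨ σ = -1) ∧ StrictMonoOn (fun s => σ * g s) (Icc 0 l) := by
    rcases hg.continuousOn.strictMonoOn_of_injOn_Icc' hl.le hinj with h | h
    · exact ⟨1, Or.inl rfl, by simpa using h⟩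
    · exact ⟨-1, Or.inr rfl, fun s hs t ht hst => by simpa using h hs ht hst⟩
  have hσ2 : σ * σ = 1 := by rcases hσ with h | h <;> rw [h] <;> norm_num
  refine ⟨σ, hσ, fun s hs κ hκ => ?_, ?_⟩
  · have h1 := (hκ.const_mul σ)
    rw [← h1.deriv]
    have : MonotoneOn (fun s => σ * g s) (Icc 0 l) := hmono.monotoneOn
    have h2 := this.derivWithin_nonneg (x := s)
    rwa [h1.hasDerivWithinAt.derivWithin (uniqueDiffOn_Icc hl s ⟨hs.1.le, hs.2.le⟩), ← h1.deriv] at h2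
  · have hlt := hmono h0 hl' hl
    obtain ⟨k, hk, hk'⟩ : ∃ k : ℤ, σ * (g l - g 0) = 2*Real.pi*k ∧ ∀ m : ℤ, ∃ m' : ℤ, (m':ℝ) = σ * m := by
      rcases hσ with h | h
      · exact ⟨m0, by rw [h, hm]; ring, fun m => ⟨m, by rw [h]; ring⟩⟩
      · exact ⟨-m0, by rw [h, hm]; push_cast; ring, fun m => ⟨-m, by rw [h]; push_cast; ring⟩⟩
    simp only at hlt
    have hk0 : 0 < k := by
      by_contra hcon
      have : (k:ℝ) ≤ 0 := by exact_mod_cast not_lt.1 hcon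
      nlinarith
    rcases eq_or_lt_of_le (Int.add_one_le_iff.2 hk0) with h | h
    · rw [hk, ← h]; simp
    exfalso
    have hk2 : (2:ℝ) ≤ k := by exact_mod_cast (by omega : (2:ℤ) ≤ k)
    have hgl : σ * g 0 + 2*Real.pi*2 ≤ σ * g l := by nlinarith
    have hgσ : Continuous fun s => σ * g s := by fun_prop
    obtain ⟨u, hu, hu2⟩ := intermediate_value_Icc hl.le hgσ.continuousOn (show σ * g 0 + 2*Real.pi ∈ Icc (σ * g 0) (σ * g l) from ⟨by linarith, by linarith⟩)
    simp only at hu2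
    refine cm_two (g := fun s => σ * g s) (l := l) hS (fun s hs t ht h1 h2 m hm => ?_) (b := u) (α := σ * g 0) (β := σ * g 0 + 2*Real.pi) (by linarith) (-1) hu.1 ?_ ?_
    · obtain ⟨m', e⟩ := hk' m
      refine hi s hs t ht h1 h2 m' ?_
      rw [e]
      have : σ * (σ * g s) = σ * (σ * g t) + σ * (2*Real.pi*m) := by rw [hm]; ring
      rw [← mul_assoc, ← mul_assoc, hσ2] at this
      linarith
    · intro y hy
      exact intermediate_value_Icc hu.1 hgσ.continuousOn (show y ∈ Icc (σ * g 0) (σ * g u) from ⟨hy.1.le, by linarith [hy.2]⟩)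
    · intro y hy
      obtain ⟨x, hx, e⟩ := intermediate_value_Icc hu.2 hgσ.continuousOn (show y + 2*Real.pi ∈ Icc (σ * g u) (σ * g l) from ⟨by linarith [hy.1], by linarith [hy.2]⟩)
      exact ⟨x, hx, by simp only at e ⊢; rw [e]; push_cast; ring⟩
theorem cm_lift {ψ : ℝ → ℂ} (hψ : Continuous ψ) (h1 : ∀ s, ‖ψ s‖ = 1) :
    ∃ g : ℝ → ℝ, Continuous g ∧ (∀ s, ψ s = exp (g s * I)) ∧ ∀ s ψ', HasDerivAt ψ ψ' s → ∃ κ : ℝ, HasDerivAt g κ s ∧ ψ' = κ * I * ψ s := by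
  obtain ⟨f, hf, he⟩ := Complex.exists_continuousOn_eqOn_exp_comp (U := (univ : Set ℝ)) (g := ψ) (@SimplyConnectedSpace.ofContractible _ _ (convex_univ.contractibleSpace univ_nonempty)) isOpen_univ hψ.continuousOn
    (by rintro ⟨s, -, hs⟩; have := h1 s; rw [hs] at this; simp at this)
  rw [continuousOn_univ] at hf
  have he' : ∀ s, ψ s = exp ((f s).im * I) := fun s => by
    have h2 : exp (f s) = ψ s := he (mem_univ s)
    have h3 := h1 s
    rw [← h2, Complex.norm_exp, Real.exp_eq_one_iff] at h3
    rw [← h2]; congr 1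
    apply Complex.ext <;> simp [h3]
  refine ⟨fun s => (f s).im, by fun_prop, he', fun s ψ' h => ?_⟩
  have hne : ψ s ≠ 0 := fun h => by have := h1 s; rw [h] at this; simp at this
  have hd : HasDerivAt (fun t => (((f t).im : ℂ)) * I) (ψ' / ψ s) s := by
    have h2 : HasDerivAt (fun t => log (ψ t / ψ s) + ((f s).im : ℂ) * I) (ψ' / ψ s) s := by
      have := (h.div_const (ψ s)).clog_real (by rw [div_self hne]; exact Complex.one_mem_slitPlane)
      rw [div_self hne, div_one] at this
      exact this.add_const _
    refine h2.congr_of_eventuallyEq ?_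
    have : ∀ᶠ t in 𝓝 s, |(f t).im - (f s).im| < 1 := by
      have : Continuous fun t => |(f t).im - (f s).im| := by fun_prop
      exact this.continuousAt.eventually_lt_const (by simp)
    filter_upwards [this] with t ht
    rw [abs_lt] at ht
    have hpi := Real.pi_gt_three
    rw [he' t, he' s, ← Complex.exp_sub, Complex.log_exp (by simp; linarith) (by simp; linarith)]; ring
  have h3 : HasDerivAt (fun t => ((((f t).im : ℂ)) * I).im) (ψ' / ψ s).im s :=
    (Complex.imCLM.hasFDerivAt.comp_hasDerivAt s hd)
  have h4 : HasDerivAt (fun t => ((((f t).im : ℂ)) * I).re) (ψ' / ψ s).re s :=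
    (Complex.reCLM.hasFDerivAt.comp_hasDerivAt s hd)
  simp only [mul_im, ofReal_re, I_im, ofReal_im, I_re, mul_re, mul_zero, mul_one, zero_mul, sub_zero, add_zero, zero_add, sub_self] at h3 h4
  refine ⟨_, h3, ?_⟩
  have h5 := h4.unique (hasDerivAt_const s 0)
  rw [show (((ψ' / ψ s).im : ℝ) : ℂ) * I = ψ' / ψ s from by apply Complex.ext <;> simp [h5], div_mul_cancel₀ _ hne]
theorem CmCurve.dγ {L E : Set ℂ} {l : ℝ} {γ : ℝ → ℂ} (h : CmCurve L E l γ) {s : ℝ} (hs : γ s ∉ E) : HasDerivAt γ (deriv γ s) s ∧ ‖deriv γ s‖ = 1 := by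
  obtain ⟨τ, R, hR, hd, hi, h0, -, h1⟩ := h.smooth hs
  have := cm_inj_deriv_ne isOpen_ball hd hi (mem_ball_self hR)
  rw [h1.deriv]
  refine ⟨h1, ?_⟩
  rw [norm_div, norm_real, norm_norm, div_self (norm_ne_zero_iff.2 this)]
theorem CmCurve.ftc {L E : Set ℂ} {l : ℝ} {γ : ℝ → ℂ} (h : CmCurve L E l γ) {F : Type*} [NormedAddCommGroup F] [NormedSpace ℝ F] [CompleteSpace F]
    {u u' : ℝ → F} (hu : Continuous u) (hd : ∀ s ∈ Ioo 0 l, γ s ∉ E → HasDerivAt u (u' s) s) (hi : Integrable u' (cmμ l)) {s t : ℝ}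
    (hs : s ∈ Icc 0 l) (ht : t ∈ Icc 0 l) : ∫ x in s..t, u' x = u t - u s := by
  refine integral_eq_of_hasDerivAt_off_countable u u' (s := {s ∈ Ico 0 l | γ s ∈ E}) ?_ hu.continuousOn ?_ ?_
  · have := (h.finE 0).countable; rwa [zero_add] at this
  · rintro x ⟨hx, hx2⟩
    have hx' : x ∈ Ioo 0 l := ⟨lt_of_le_of_lt (le_min hs.1 ht.1) hx.1, lt_of_lt_of_le hx.2 (max_le hs.2 ht.2)⟩
    exact hd x hx' fun hE => hx2 ⟨⟨hx'.1.le, hx'.2⟩, hE⟩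
  · refine intervalIntegrable_iff.2 (IntegrableOn.mono_set hi ?_)
    exact Ioc_subset_Ioc (le_min hs.1 ht.1) (max_le hs.2 ht.2)
theorem CmCurve.tang {L E : Set ℂ} {l : ℝ} {γ : ℝ → ℂ} (h : CmCurve L E l γ) (hae : ∀ᵐ s ∂(cmμ l), γ s ∉ E) (n : ℕ) : CmK γ l n (deriv γ) (√l) := by
  have hn : ∀ᵐ s ∂(cmμ l), ‖deriv γ s‖ = 1 := hae.mono fun s hs => (h.dγ hs).2
  have hm := (stronglyMeasurable_deriv γ).aestronglyMeasurable (μ := cmμ l)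
  have h2 : (fun s => ‖deriv γ s‖^2) =ᵐ[cmμ l] fun _ => 1 := hn.mono fun s hs => by simp [hs]
  refine ⟨Real.sqrt_pos.2 h.lpos, hm, (integrable_const (1:ℝ)).congr h2.symm, ?_, fun P hP => ?_⟩
  · rw [integral_congr_ae h2, Real.sq_sqrt h.lpos.le]; simp [h.lpos.le]
  · obtain ⟨Q, hQ⟩ : ∃ Q : Polynomial ℂ, Polynomial.derivative Q = P := by
      clear hP
      induction P using Polynomial.induction_on' with
      | add p q hp hq => obtain ⟨a, rfl⟩ := hp; obtain ⟨b, rfl⟩ := hq; exact ⟨a + b, by simp⟩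
      | monomial k c => exact ⟨Polynomial.monomial (k+1) (c/(k+1)), by
          rw [Polynomial.derivative_monomial]; push_cast; rw [div_mul_cancel₀ _ (by exact_mod_cast k.succ_ne_zero)]⟩
    have hi : Integrable (fun s => deriv γ s * P.eval (γ s)) (cmμ l) := by
      have hPc : Continuous fun s => P.eval (γ s) := P.continuous.comp h.cont
      have : Integrable (fun s => P.eval (γ s)) (cmμ l) := (hPc.integrableOn_Icc (a := 0) (b := l)).mono_set Ioc_subset_Icc_self
      exact this.bdd_mul hm (hn.mono fun s hs => hs.le)
    have := h.ftc (u := fun s => Q.eval (γ s)) (Q.continuous.comp h.cont) (fun s _ hs => by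
      have := (Q.hasDerivAt (γ s)).comp_of_eq s (h.dγ hs).1 rfl
      rw [hQ, mul_comm] at this; exact this) hi ⟨le_rfl, h.lpos.le⟩ ⟨h.lpos.le, le_rfl⟩
    rw [intervalIntegral.integral_of_le h.lpos.le] at this
    rw [this, show γ l = γ 0 by simpa using h.per 0, sub_self]
namespace CmExt
variable {G E W : Set ℂ} {l : ℝ} {γ : ℝ → ℂ} {lam a : ℂ → ℝ} {e : ℂ → ℂ} {φ φt f : ℂ → ℂ} {ρ1 : ℝ} {ζ : ℂ}
theorem inj (X : CmExt G E W lam φ φt f ρ1) (hφ : ConformalOnto G φ ζ) {z w : ℂ} (hn : ‖φt z‖ = 1) (hz : z ∈ W) (hw : w ∈ W)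
    (he : φt z = φt w) : z = w := by
  by_contra hne
  obtain ⟨U, V, hU, hV, hzU, hwV, hd⟩ := t2_separation hne
  have hop : ∀ z ∈ W, ∀ U, IsOpen U → z ∈ U → φt '' (U ∩ W) ∈ 𝓝 (φt z) := fun z hz U hU hzU => by
    have hA := (X.dφ.analyticAt (X.Wo.mem_nhds hz)).hasStrictDerivAt
    rw [← hA.map_nhds_eq (by rw [← X.sq z hz]; exact pow_ne_zero 2 (X.ne z hz))]
    exact image_mem_map (inter_mem (hU.mem_nhds hzU) (X.Wo.mem_nhds hz))
  have h2 := hop w hw V hV hwV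
  rw [← he] at h2
  have hcl : φt z ∈ closure (ball (0:ℂ) 1) := by rw [closure_ball _ one_ne_zero]; simp [hn]
  obtain ⟨y, ⟨⟨p, hp, e1⟩, q, hq, e2⟩, hy⟩ := mem_closure_iff_nhds.1 hcl _ (inter_mem (hop z hz U hU hzU) h2)
  rw [mem_ball_zero_iff] at hy
  have hpG : p ∈ G := by by_contra h; have := X.out p hp.2 h; rw [e1] at this; linarith
  have hqG : q ∈ G := by by_contra h; have := X.out q hq.2 h; rw [e2] at this; linarith
  rw [X.eq p (subset_closure hpG) hp.2] at e1
  rw [X.eq q (subset_closure hqG) hq.2] at e2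
  have := hφ.bijOn.injOn hpG hqG (e1.trans e2.symm)
  exact disjoint_left.1 hd hp.1 (this ▸ hq.1)
theorem dψ (X : CmExt G E W lam φ φt f ρ1) (dm : CmDom G E l γ lam a e) {s : ℝ} (hs : γ s ∉ E) :
    HasDerivAt (fun t => φ (γ t)) (f (γ s)^2 * deriv γ s) s := by
  have hW := X.WL _ (dm.cv.memL s) hs
  have h1 := (X.dφ.differentiableAt (X.Wo.mem_nhds hW)).hasDerivAt.comp_of_eq s (dm.cv.dγ hs).1 rfl
  rw [← X.sq _ hW] at h1
  refine h1.congr_of_eventuallyEq ?_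
  filter_upwards [dm.cv.cont.continuousAt.preimage_mem_nhds (X.Wo.mem_nhds hW)] with t ht
  exact (X.eq _ (frontier_subset_closure (dm.cv.memL t)) ht).symm
theorem bb (dm : CmDom G E l γ lam a e) : ∀ z ∈ E, -(1/4) < (1/(2 - lam z) - 1)/2 := fun z hz => by
  have h := (dm.pt z hz).hl
  have : 1/2 < 1/(2 - lam z) := one_div_lt_one_div_of_lt (by linarith [h.2]) (by linarith [h.1])
  linarith
theorem fl2 (X : CmExt G E W lam φ φt f ρ1) (dm : CmDom G E l γ lam a e) :
    (∀ᵐ s ∂(cmμ l), γ s ∉ E) ∧ AEStronglyMeasurable (fun s => f (γ s)) (cmμ l) ∧ Integrable (fun s => ‖f (γ s)‖^2) (cmμ l) :=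
  dm.cv.l2 X.Wo X.WL X.df.continuousOn (fun z hz => by linarith [bb dm z hz]) X.fb
theorem sgn (X : CmExt G E W lam φ φt f ρ1) (dm : CmDom G E l γ lam a e) (hφ : ConformalOnto G φ ζ) (hc : ContinuousOn φ (closure G)) :
    ∃ σ : ℝ, (σ = 1 ∨ σ = -1) ∧ (∀ s ∈ Ioo 0 l, γ s ∉ E → f (γ s)^2 * deriv γ s = σ * ‖f (γ s)‖^2 * I * φ (γ s)) ∧
      ∫ s, ‖f (γ s)‖^2 ∂(cmμ l) = 2 * Real.pi := by
  have hcv := dm.cv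
  have hn : ∀ s, ‖φ (γ s)‖ = 1 := fun s => cm_norm_bd dm.o hφ hc _ (hcv.memL s)
  have hcont : Continuous fun s => φ (γ s) := hc.comp_continuous hcv.cont fun s => frontier_subset_closure (hcv.memL s)
  obtain ⟨g, hg, hge, hgd⟩ := cm_lift hcont hn
  have hEW : ∀ s, γ s ∉ E → γ s ∈ W ∧ φt (γ s) = φ (γ s) := fun s hs =>
    have := X.WL _ (hcv.memL s) hs
    ⟨this, X.eq _ (frontier_subset_closure (hcv.memL s)) this⟩
  have hfin := hcv.finE 0
  rw [zero_add] at hfin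
  obtain ⟨m0, hm0⟩ : ∃ m0 : ℤ, g l = g 0 + 2*Real.pi*m0 := by
    have : exp (g l * I) = exp (g 0 * I) := by rw [← hge, ← hge, show γ l = γ 0 by simpa using hcv.per 0]
    obtain ⟨n, hn⟩ := Complex.exp_eq_exp_iff_exists_int.1 this
    refine ⟨n, ?_⟩
    have := congrArg Complex.im hn
    simp at this
    linarith
  obtain ⟨σ, hσ, hmono, htot⟩ := cm_theta hcv.lpos hfin hg (fun s hs t ht h1 h2 m hm => by
    have hs' : γ s ∉ E := fun h => h1 ⟨hs, h⟩
    have ht' : γ t ∉ E := fun h => h2 ⟨ht, h⟩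
    have : φ (γ s) = φ (γ t) := by
      rw [hge, hge, Complex.exp_eq_exp_iff_exists_int]
      exact ⟨m, by rw [hm]; push_cast; ring⟩
    have := X.inj hφ (by rw [(hEW s hs').2, hn]) (hEW s hs').1 (hEW t ht').1 (by rw [(hEW s hs').2, (hEW t ht').2, this])
    exact hcv.inj s t (by rw [abs_lt]; constructor <;> linarith [hs.1, hs.2, ht.1, ht.2]) this) hm0
  have hσ2 : σ * σ = 1 := by rcases hσ with h | h <;> rw [h] <;> norm_num
  have key : ∀ s ∈ Ioo 0 l, γ s ∉ E → HasDerivAt g (σ * ‖f (γ s)‖^2) s ∧ f (γ s)^2 * deriv γ s = σ * ‖f (γ s)‖^2 * I * φ (γ s) := fun s hs hsE => by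
    obtain ⟨κ, h1, h2⟩ := hgd s _ (X.dψ dm hsE)
    have h3 := hmono s hs κ h1
    have h4 : σ * κ = ‖f (γ s)‖^2 := by
      have := congrArg norm h2
      rw [norm_mul, norm_pow, (hcv.dγ hsE).2, norm_mul, norm_mul, norm_I, hn, norm_real, mul_one, mul_one, mul_one, Real.norm_eq_abs] at this
      rw [this, ← abs_of_nonneg h3, abs_mul]
      rcases hσ with h | h <;> simp [h]
    have h5 : κ = σ * ‖f (γ s)‖^2 := by rw [← h4, ← mul_assoc, hσ2, one_mul]
    rw [← h5]
    exact ⟨h1, by rw [h2, h5]; push_cast; ring⟩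
  refine ⟨σ, hσ, fun s hs h => (key s hs h).2, ?_⟩
  have := hcv.ftc hg (fun s hs h => (key s hs h).1) ((X.fl2 dm).2.2.const_mul σ) ⟨le_rfl, hcv.lpos.le⟩ ⟨hcv.lpos.le, le_rfl⟩
  rw [intervalIntegral.integral_of_le hcv.lpos.le, integral_const_mul] at this
  rw [← htot, ← this, ← mul_assoc, hσ2, one_mul]
end CmExt
theorem CmExt.rep {G E W : Set ℂ} {l : ℝ} {γ : ℝ → ℂ} {lam a : ℂ → ℝ} {e : ℂ → ℂ} {φ φt f : ℂ → ℂ} {ρ1 : ℝ} {ζ : ℂ}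
    (X : CmExt G E W lam φ φt f ρ1) (dm : CmDom G E l γ lam a e) (hφ : ConformalOnto G φ ζ) (hc : ContinuousOn φ (closure G)) (hζ : ζ ∈ G) (P : Polynomial ℂ) :
    f ζ * ∫ s, P.eval (γ s) * (starRingEnd ℂ) (f (γ s)) ∂(cmμ l) = 2 * Real.pi * P.eval ζ := by
  obtain ⟨σ, hσ, hs, htot⟩ := X.sgn dm hφ hc
  obtain ⟨hae, hfm, hf2⟩ := X.fl2 dm
  set β := fun z => (1/(2 - lam z) - 1)/2
  have hbb : ∀ z ∈ E, -(1/4) < β z := bb dm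
  set u := fun z => P.eval z * f ζ - P.eval ζ * f z with hu
  have hζW := X.WG hζ
  have hWn := X.Wo.mem_nhds hζW
  have hφζ : φt ζ = 0 := by rw [X.eq ζ (subset_closure hζ) hζW, hφ.map_center]
  have huζ : u ζ = 0 := by simp only [hu]; ring
  have hud : DifferentiableOn ℂ u W := (P.differentiable.differentiableOn.mul_const _).sub (X.df.const_mul _)
  have hφ0 : ∀ p ∈ W, p ≠ ζ → φt p ≠ 0 := fun p hp hne h0 => by
    by_cases hpG : p ∈ G
    · rw [X.eq p (subset_closure hpG) hp, ← hφ.map_center] at h0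
      exact hne (hφ.bijOn.injOn hpG hζ h0)
    · have := X.out p hp hpG
      rw [h0, norm_zero] at this; linarith
  set N := fun p => f p * (dslope u ζ p / dslope φt ζ p) with hN
  have hNe : ∀ p, p ≠ ζ → N p = f p * (u p / φt p) := fun p hp => by
    simp only [hN]
    rw [dslope_of_ne _ hp, dslope_of_ne _ hp, slope_def_field, slope_def_field, huζ, hφζ, sub_zero, sub_zero, div_div_div_cancel_right₀ (sub_ne_zero.2 hp)]
  have hNd : DifferentiableOn ℂ N W := by
    refine X.df.mul (((Complex.differentiableOn_dslope hWn).2 hud).div ((Complex.differentiableOn_dslope hWn).2 X.dφ) fun p hp => ?_)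
    by_cases h : p = ζ
    · rw [h, dslope_same, ← X.sq ζ hζW]; exact pow_ne_zero 2 (X.ne ζ hζW)
    · rw [dslope_of_ne _ h, slope_def_field, hφζ, sub_zero]
      exact div_ne_zero (hφ0 p hp h) (sub_ne_zero.2 h)
  have hNb : ∀ z ∈ E, ∃ M > 0, ∃ δ > 0, ∀ p ∈ W, ‖p - z‖ < δ → ‖N p‖ ≤ M * ‖p - z‖^(min (2*β z) 0) := fun z hz => by
    obtain ⟨C, hC, δ, hδ, hfb⟩ := X.fb z hz
    have hzf := dm.EL hz
    have hzc := frontier_subset_closure hzf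
    have hzζ : z ≠ ζ := fun h => by
      have := hzf; rw [dm.o.frontier_eq] at this; exact this.2 (h ▸ hζ)
    obtain ⟨δ1, hδ1, h1⟩ := Metric.continuousOn_iff.1 hc z hzc (1/2) (by norm_num)
    obtain ⟨δ2, hδ2, h2⟩ := Metric.continuousAt_iff.1 (P.continuous.continuousAt (x := z)) 1 one_pos
    set K := (‖P.eval z‖ + 1) * ‖f ζ‖
    refine ⟨2 * (C * (K + ‖P.eval ζ‖ * C)) + 1, by positivity, min (min δ 1) (min (min δ1 δ2) ‖z - ζ‖), ?_, fun p hp hpz => ?_⟩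
    · have := norm_pos_iff.2 (sub_ne_zero.2 hzζ); positivity
    simp only [lt_min_iff] at hpz
    obtain ⟨⟨a1, a2⟩, ⟨a3, a4⟩, a5⟩ := hpz
    have hpζ : p ≠ ζ := fun h => by rw [h, norm_sub_rev] at a5; exact lt_irrefl _ a5
    have hφh : 1/2 ≤ ‖φt p‖ := by
      by_cases hpG : p ∈ G
      · rw [X.eq p (subset_closure hpG) hp]
        have h3 := h1 p (subset_closure hpG) (by rwa [dist_eq_norm])
        rw [dist_eq_norm, norm_sub_rev] at h3
        have := cm_norm_bd dm.o hφ hc z hzf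
        have := norm_sub_norm_le (φ z) (φ p)
        linarith
      · linarith [X.out p hp hpG]
    have hp0 : 0 < ‖p - z‖ := norm_pos_iff.2 (sub_ne_zero.2 fun h => X.WE z hz (h ▸ hp))
    set t := ‖p - z‖^(min (2*β z) 0 / 2) with ht
    have ht1 : 1 ≤ t := Real.one_le_rpow_of_pos_of_le_one_of_nonpos hp0 a2.le (by linarith [min_le_right (2*β z) 0])
    have hft : ‖f p‖ ≤ C * t := (hfb p hp a1).trans (mul_le_mul_of_nonneg_left
      (Real.rpow_le_rpow_of_exponent_ge hp0 a2.le (show min (2*β z) 0 / 2 ≤ β z by linarith [min_le_left (2*β z) 0])) hC.le)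
    have ht2 : ‖p - z‖^(min (2*β z) 0) = t * t := by rw [ht, ← Real.rpow_add hp0]; ring_nf
    have hPb : ‖P.eval p‖ ≤ ‖P.eval z‖ + 1 := by
      have h3 := h2 (show dist p z < δ2 by rwa [dist_eq_norm])
      rw [dist_eq_norm] at h3
      have := norm_sub_norm_le (P.eval p) (P.eval z)
      linarith
    have hub : ‖u p‖ ≤ (K + ‖P.eval ζ‖ * C) * t := by
      have e1 : ‖u p‖ ≤ ‖P.eval p‖ * ‖f ζ‖ + ‖P.eval ζ‖ * ‖f p‖ := by
        simp only [hu]; refine (norm_sub_le _ _).trans ?_; rw [norm_mul, norm_mul]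
      have e2 : ‖P.eval p‖ * ‖f ζ‖ ≤ K := mul_le_mul_of_nonneg_right hPb (norm_nonneg _)
      have e3 := mul_le_mul_of_nonneg_left hft (norm_nonneg (P.eval ζ))
      have e4 : 0 ≤ K := by positivity
      nlinarith
    rw [hNe p hpζ, norm_mul, norm_div, ht2]
    have : ‖u p‖ / ‖φt p‖ ≤ 2 * ((K + ‖P.eval ζ‖ * C) * t) := by
      rw [div_le_iff₀ (by linarith)]; nlinarith [norm_nonneg (u p)]
    calc ‖f p‖ * (‖u p‖ / ‖φt p‖) ≤ (C * t) * (2 * ((K + ‖P.eval ζ‖ * C) * t)) := by gcongr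
      _ ≤ _ := by nlinarith
  obtain ⟨κ, hκ, hκ0⟩ : ∃ κ : ℝ, (∀ z ∈ E, κ ≤ lam z * (min (2*β z) 0 + 1/2)) ∧ 0 < κ := by
    have : ∀ᶠ κ : ℝ in 𝓝[>] 0, ∀ z ∈ E, κ ≤ lam z * (min (2*β z) 0 + 1/2) :=
      (eventually_all_finite dm.cv.fin).2 fun z hz => nhdsWithin_le_nhds (eventually_le_nhds (mul_pos (dm.pt z hz).hl.1 (by
        have : -(1/2) < min (2*β z) 0 := lt_min (by linarith [hbb z hz]) (by norm_num)
        linarith)))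
    exact (this.and self_mem_nhdsWithin).exists
  obtain ⟨C, hC, hest⟩ := dm.est X.Wo X.WG X.WL X.WE X.cor hNd.continuousOn (fun z hz => lt_min (by linarith [hbb z hz]) (by norm_num)) hNb hκ
  have hzero : ∫ s, deriv γ s * N (γ s) ∂(cmμ l) = 0 := by
    have h1 : Tendsto (fun n : ℕ => C * 1 * √l * (n:ℝ)^(-κ)) atTop (𝓝 (C * 1 * √l * 0)) :=
      ((tendsto_rpow_neg_atTop hκ0).comp tendsto_natCast_atTop_atTop).const_mul _
    rw [mul_zero] at h1
    have := ge_of_tendsto h1 ((eventually_ge_atTop 1).mono fun n hn => hest N hNd 1 one_pos (fun p _ => by rw [one_mul]) n _ _ hn (dm.cv.tang hae n))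
    exact norm_le_zero_iff.1 this
  have hne : ∀ᵐ s ∂(cmμ l), s ∈ Ioo 0 l := by
    have h1 : ∀ᵐ s ∂(cmμ l), s ∈ Ioc 0 l := ae_restrict_mem measurableSet_Ioc
    have h2 : ∀ᵐ s ∂(cmμ l), s ≠ l := ae_restrict_of_ae (Measure.ae_ne volume l)
    filter_upwards [h1, h2] with s a b using ⟨a.1, lt_of_le_of_ne a.2 b⟩
  have hσ0 : (σ:ℂ) * I ≠ 0 := by rcases hσ with h | h <;> simp [h]
  have hcong : (fun s => deriv γ s * N (γ s)) =ᵐ[cmμ l] fun s => (σ * I) * (u (γ s) * (starRingEnd ℂ) (f (γ s))) := by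
    filter_upwards [hae, hne] with s h1 h2
    have h3 := hs s h2 h1
    have hL := dm.cv.memL s
    have hW := X.WL _ hL h1
    have hn := cm_norm_bd dm.o hφ hc _ hL
    have hφe := X.eq _ (frontier_subset_closure hL) hW
    have h0 : φ (γ s) ≠ 0 := fun h => by rw [h] at hn; simp at hn
    rw [hNe _ (fun h => h0 (by rw [h, hφ.map_center])), hφe]
    have hf0 := X.ne _ hW
    have h4 : f (γ s) * (starRingEnd ℂ) (f (γ s)) = (‖f (γ s)‖:ℂ)^2 := by rw [Complex.mul_conj, Complex.normSq_eq_norm_sq]; push_cast; rfl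
    rw [← h4] at h3
    have h5 : f (γ s) * deriv γ s = σ * (starRingEnd ℂ) (f (γ s)) * I * φ (γ s) := mul_left_cancel₀ hf0 (by rw [← mul_assoc, ← pow_two, h3]; ring)
    field_simp
    linear_combination (u (γ s)) * h5
  rw [integral_congr_ae hcong, integral_const_mul] at hzero
  have hz2 := (mul_eq_zero.1 hzero).resolve_left hσ0
  have hfc : AEStronglyMeasurable (fun s => (starRingEnd ℂ) (f (γ s))) (cmμ l) := Complex.continuous_conj.comp_aestronglyMeasurable hfm
  have hfi : Integrable (fun s => (starRingEnd ℂ) (f (γ s))) (cmμ l) := by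
    have : MemLp (fun s => (starRingEnd ℂ) (f (γ s))) 2 (cmμ l) := (memLp_two_iff_integrable_sq_norm hfc).2 (by simpa using hf2)
    exact this.integrable (by norm_num)
  have hPi : Integrable (fun s => P.eval (γ s) * (starRingEnd ℂ) (f (γ s))) (cmμ l) := by
    have hPc : Continuous fun s => P.eval (γ s) := P.continuous.comp dm.cv.cont
    obtain ⟨M, hM⟩ := (isCompact_Icc (a := (0:ℝ)) (b := l)).exists_bound_of_continuousOn hPc.continuousOn
    exact hfi.bdd_mul hPc.aestronglyMeasurable ((ae_restrict_mem measurableSet_Ioc).mono fun s hs => hM s ⟨hs.1.le, hs.2⟩)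
  have hff : ∀ s, f (γ s) * (starRingEnd ℂ) (f (γ s)) = ((‖f (γ s)‖^2 : ℝ) : ℂ) := fun s => by rw [Complex.mul_conj, Complex.normSq_eq_norm_sq]
  have : (fun s => u (γ s) * (starRingEnd ℂ) (f (γ s))) = fun s => f ζ * (P.eval (γ s) * (starRingEnd ℂ) (f (γ s))) - P.eval ζ * ((‖f (γ s)‖^2 : ℝ) : ℂ) := by
    funext s; rw [← hff]; simp only [hu]; ring
  have hf3 : Integrable (fun s => ((‖f (γ s)‖^2 : ℝ) : ℂ)) (cmμ l) := hf2.ofReal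
  rw [this, integral_sub (hPi.const_mul _) (hf3.const_mul _), integral_const_mul, integral_const_mul, integral_complex_ofReal, htot] at hz2
  rw [sub_eq_zero.1 hz2]; push_cast; ring
structure CmBl (G : Set ℂ) (ζ : ℂ) (u : ℂ → ℂ) : Prop where
  c : ContinuousOn u (closure G)
  d : DifferentiableOn ℂ u G
  n : ∀ p ∈ frontier G, ‖u p‖ = 1
  z : u ζ = 0
  e : deriv u ζ ≠ 0
  i : ∀ p ∈ G, p ≠ ζ → u p ≠ 0
theorem CmBl.dc {G : Set ℂ} {ζ : ℂ} {u v : ℂ → ℂ} (hG : IsOpen G) (hζ : ζ ∈ G) (hu : CmBl G ζ u) (hv : CmBl G ζ v) :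
    DiffContOnCl ℂ (fun p => dslope u ζ p / dslope v ζ p) G ∧ ∀ p, p ≠ ζ → dslope u ζ p / dslope v ζ p = u p / v p := by
  have hn := hG.mem_nhds hζ
  have hcl : closure G ∈ 𝓝 ζ := mem_of_superset hn subset_closure
  have hne : ∀ p ∈ closure G, dslope v ζ p ≠ 0 := fun p hp => by
    by_cases h : p = ζ
    · rw [h, dslope_same]; exact hv.e
    · rw [dslope_of_ne _ h, slope_def_field, hv.z, sub_zero]
      refine div_ne_zero ?_ (sub_ne_zero.2 h)
      by_cases hpG : p ∈ G
      · exact hv.i p hpG h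
      · have := hv.n p (by rw [hG.frontier_eq]; exact ⟨hp, hpG⟩)
        intro h0; rw [h0, norm_zero] at this; exact zero_ne_one this
  refine ⟨⟨?_, ?_⟩, fun p hp => ?_⟩
  · exact ((Complex.differentiableOn_dslope hn).2 hu.d).div ((Complex.differentiableOn_dslope hn).2 hv.d) fun p hp => hne p (subset_closure hp)
  · exact ((continuousOn_dslope hcl).2 ⟨hu.c, hu.d.differentiableAt hn⟩).div ((continuousOn_dslope hcl).2 ⟨hv.c, hv.d.differentiableAt hn⟩) hne
  · rw [dslope_of_ne _ hp, dslope_of_ne _ hp, slope_def_field, slope_def_field, hu.z, hv.z, sub_zero, sub_zero, div_div_div_cancel_right₀ (sub_ne_zero.2 hp)]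
theorem CmBl.uniq {G : Set ℂ} {ζ : ℂ} {u v : ℂ → ℂ} (hG : IsOpen G) (hb : Bornology.IsBounded G) (hcn : IsPreconnected G) (hζ : ζ ∈ G) (hu : CmBl G ζ u) (hv : CmBl G ζ v) :
    ∃ η : ℂ, ‖η‖ = 1 ∧ ∀ p ∈ closure G, u p = η * v p := by
  have key : ∀ {u v : ℂ → ℂ}, CmBl G ζ u → CmBl G ζ v → ∀ p ∈ closure G, ‖dslope u ζ p / dslope v ζ p‖ ≤ 1 := fun {u v} hu hv p hp =>
    Complex.norm_le_of_forall_mem_frontier_norm_le hb (CmBl.dc hG hζ hu hv).1 (fun q hq => by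
      have hqζ : q ≠ ζ := fun h => by rw [hG.frontier_eq] at hq; exact hq.2 (h ▸ hζ)
      rw [(CmBl.dc hG hζ hu hv).2 q hqζ, norm_div, hu.n q hq, hv.n q hq, div_one]) hp
  obtain ⟨h1, h2⟩ := CmBl.dc hG hζ hu hv
  have hζ1 : ‖dslope u ζ ζ / dslope v ζ ζ‖ = 1 := by
    refine le_antisymm (key hu hv ζ (subset_closure hζ)) ?_
    have h3 := key hv hu ζ (subset_closure hζ)
    have h4 := norm_pos_iff.2 hu.e
    have h5 := norm_pos_iff.2 hv.e
    rw [dslope_same, dslope_same, norm_div] at h3 ⊢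
    rw [div_le_one h4] at h3
    rwa [one_le_div h5]
  have hmax : IsMaxOn (norm ∘ fun p => dslope u ζ p / dslope v ζ p) G ζ := fun p hp => by
    simp only [mem_ofPred_eq, Function.comp, hζ1]; exact key hu hv p (subset_closure hp)
  have := Complex.eqOn_closure_of_isPreconnected_of_isMaxOn_norm hcn hG h1 hζ hmax
  refine ⟨_, hζ1, fun p hp => ?_⟩
  by_cases hpζ : p = ζ
  · rw [hpζ, hu.z, hv.z, mul_zero]
  have h3 := this hp
  simp only [Function.const] at h3
  rw [h2 p hpζ] at h3
  have hv0 : v p ≠ 0 := by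
    by_cases hpG : p ∈ G
    · exact hv.i p hpG hpζ
    · have := hv.n p (by rw [hG.frontier_eq]; exact ⟨hp, hpG⟩)
      intro h0; rw [h0, norm_zero] at this; exact zero_ne_one this
  rw [← h3, div_mul_cancel₀ _ hv0]
theorem CmBl.of {G : Set ℂ} {φ : ℂ → ℂ} {ζ : ℂ} (hG : IsOpen G) (hφ : ConformalOnto G φ ζ) (hc : ContinuousOn φ (closure G)) (hζ : ζ ∈ G) : CmBl G ζ φ where
  c := hc
  d := fun z hz => (hφ.differentiable z hz).differentiableWithinAt
  n := cm_norm_bd hG hφ hc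
  z := hφ.map_center
  e := by obtain ⟨c, h, h2⟩ := hφ.deriv_center_pos; rw [h2]; exact_mod_cast h.ne'
  i := fun p hp h h0 => h (hφ.bijOn.injOn hp hζ (by rw [h0, hφ.map_center]))
theorem cm_mobsq (x w : ℂ) : ‖x - w‖^2 - ‖1 - (starRingEnd ℂ) w * x‖^2 = (‖x‖^2 - 1) * (1 - ‖w‖^2) := by
  simp only [← Complex.normSq_eq_norm_sq, Complex.normSq_apply]; simp; ring
theorem cm_mobd {w η : ℂ} {g : ℂ → ℂ} {g' p : ℂ} (h : HasDerivAt g g' p) (h0 : 1 - (starRingEnd ℂ) w * g p ≠ 0) :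
    HasDerivAt (fun p => η * ((g p - w) / (1 - (starRingEnd ℂ) w * g p))) (η * ((1 - ‖w‖^2) * g' / (1 - (starRingEnd ℂ) w * g p)^2)) p := by
  have := ((h.sub_const w).fun_div ((h.const_mul ((starRingEnd ℂ) w)).const_sub 1) h0).const_mul η
  refine this.congr_deriv ?_
  rw [show ((‖w‖:ℂ))^2 = w * (starRingEnd ℂ) w by rw [Complex.mul_conj, Complex.normSq_eq_norm_sq]; push_cast; rfl]
  ring
theorem CmExt.mob {G E W : Set ℂ} {l : ℝ} {γ : ℝ → ℂ} {lam a : ℂ → ℝ} {e : ℂ → ℂ} {φ φ0 φt0 f0 : ℂ → ℂ} {ρ1 r : ℝ} {ζ ζ0 : ℂ}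
    (X : CmExt G E W lam φ0 φt0 f0 ρ1) (dm : CmDom G E l γ lam a e) (hφ0 : ConformalOnto G φ0 ζ0) (hc0 : ContinuousOn φ0 (closure G))
    (hφ : ConformalOnto G φ ζ) (hc : ContinuousOn φ (closure G)) (hζ : ζ ∈ G) (hr : ‖φ0 ζ‖ ≤ r) (hr1 : r < ρ1) (hρ1 : ρ1 < 1) :
    ∃ φt f ρ2, CmExt G E W lam φ φt f ρ2 ∧ ∀ p ∈ W, ‖f p‖ ≤ (1 - r/ρ1)⁻¹ * ‖f0 p‖ := by
  set w := φ0 ζ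
  have hr0 : 0 ≤ r := (norm_nonneg _).trans hr
  have hρ0 : 0 < ρ1 := by linarith
  have hd0 : 0 < 1 - r/ρ1 := by rw [sub_pos, div_lt_one hρ0]; exact hr1
  have hw1 : ‖w‖ < 1 := by linarith
  have hden : ∀ x : ℂ, ‖x‖ ≤ 1/ρ1 → 1 - r/ρ1 ≤ ‖1 - (starRingEnd ℂ) w * x‖ := fun x hx => by
    have h1 := norm_sub_norm_le 1 ((starRingEnd ℂ) w * x)
    rw [norm_one, norm_mul, RCLike.norm_conj] at h1
    have h2 : ‖w‖ * ‖x‖ ≤ r * (1/ρ1) := mul_le_mul hr hx (norm_nonneg _) hr0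
    rw [mul_one_div] at h2
    linarith
  have hden0 : ∀ x : ℂ, ‖x‖ ≤ 1/ρ1 → 1 - (starRingEnd ℂ) w * x ≠ 0 := fun x hx h => by
    have := hden x hx; rw [h, norm_zero] at this; linarith
  have h1ρ : 1 ≤ 1/ρ1 := by rw [one_le_div hρ0]; exact hρ1.le
  have hB0 : ∀ p ∈ closure G, ‖φ0 p‖ ≤ 1 := fun p hp => by
    by_cases hpG : p ∈ G
    · have := hφ0.bijOn.mapsTo hpG; rw [mem_ball_zero_iff] at this; exact this.le
    · exact (cm_norm_bd dm.o hφ0 hc0 p (by rw [dm.o.frontier_eq]; exact ⟨hp, hpG⟩)).le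
  have hw2 : (1:ℂ) - (‖w‖:ℂ)^2 ≠ 0 := by
    have : (1:ℝ) - ‖w‖^2 ≠ 0 := by nlinarith [norm_nonneg w]
    exact_mod_cast this
  obtain ⟨η, hη, hηe⟩ := CmBl.uniq dm.o dm.b dm.cn.isPreconnected hζ (CmBl.of dm.o hφ hc hζ)
    (v := fun p => 1 * ((φ0 p - w) / (1 - (starRingEnd ℂ) w * φ0 p))) (by
    have hdz := fun p (hp : p ∈ G) => cm_mobd (η := 1) (hφ0.differentiable p hp).hasDerivAt (hden0 _ ((hB0 p (subset_closure hp)).trans h1ρ))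
    refine ⟨?_, fun p hp => (hdz p hp).differentiableAt.differentiableWithinAt, fun p hp => ?_, by simp [w], ?_, fun p hp hne h0 => ?_⟩
    · exact continuousOn_const.mul ((hc0.sub continuousOn_const).div (continuousOn_const.sub (continuousOn_const.mul hc0)) fun p hp => hden0 _ ((hB0 p hp).trans h1ρ))
    · have hn := cm_norm_bd dm.o hφ0 hc0 p hp
      have h2 := cm_mobsq (φ0 p) w
      rw [hn] at h2
      have h3 : ‖φ0 p - w‖ = ‖1 - (starRingEnd ℂ) w * φ0 p‖ := by
        rw [← abs_norm, ← abs_norm (1 - _), ← sq_eq_sq_iff_abs_eq_abs]; linarith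
      rw [one_mul, norm_div, h3, div_self (norm_ne_zero_iff.2 (hden0 _ (by rw [hn]; exact h1ρ)))]
    · rw [(hdz ζ hζ).deriv, one_mul]
      exact div_ne_zero (mul_ne_zero hw2 (cm_inj_deriv_ne dm.o (fun z hz => (hφ0.differentiable z hz).differentiableWithinAt) hφ0.bijOn.injOn hζ))
        (pow_ne_zero 2 (hden0 _ ((hB0 ζ (subset_closure hζ)).trans h1ρ)))
    · rw [one_mul, div_eq_zero_iff] at h0
      rcases h0 with h0 | h0
      · exact hne (hφ0.bijOn.injOn hp hζ (sub_eq_zero.1 h0))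
      · exact hden0 _ ((hB0 p (subset_closure hp)).trans h1ρ) h0)
  obtain ⟨c, hcc⟩ := IsAlgClosed.exists_pow_nat_eq (η * (1 - (‖w‖:ℂ)^2)) two_pos
  have hη0 : η ≠ 0 := fun h => by rw [h, norm_zero] at hη; exact zero_ne_one hη
  have hc0' : c ≠ 0 := fun h => mul_ne_zero hη0 hw2 (by rw [← hcc, h]; simp)
  have hcn : ‖c‖ ≤ 1 := by
    have h1 : ‖c‖^2 = ‖(1:ℂ) - (‖w‖:ℂ)^2‖ := by rw [← norm_pow, hcc, norm_mul, hη, one_mul]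
    rw [show (1:ℂ) - (‖w‖:ℂ)^2 = ((1 - ‖w‖^2 : ℝ) : ℂ) by push_cast; rfl, norm_real, Real.norm_of_nonneg (by nlinarith [norm_nonneg w])] at h1
    nlinarith [norm_nonneg c, sq_nonneg ‖w‖]
  have hW0 := fun p hp => hden0 _ (X.bd p hp).le
  have hdz := fun p (hp : p ∈ W) => cm_mobd (η := η) (X.dφ.differentiableAt (X.Wo.mem_nhds hp)).hasDerivAt (hW0 p hp)
  have hfle : ∀ p ∈ W, ‖c * (f0 p / (1 - (starRingEnd ℂ) w * φt0 p))‖ ≤ (1 - r/ρ1)⁻¹ * ‖f0 p‖ := fun p hp => by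
    rw [norm_mul, norm_div, inv_mul_eq_div]
    calc _ ≤ 1 * (‖f0 p‖ / (1 - r/ρ1)) := by gcongr; exact hden _ (X.bd p hp).le
      _ = _ := one_mul _
  refine ⟨fun p => η * ((φt0 p - w) / (1 - (starRingEnd ℂ) w * φt0 p)), fun p => c * (f0 p / (1 - (starRingEnd ℂ) w * φt0 p)), ((1/ρ1 + 2) / (1 - r/ρ1))⁻¹,
    ⟨X.Wo, X.WG, X.WL, X.WE, X.cor, fun p hp => (hdz p hp).differentiableAt.differentiableWithinAt, ?_, fun p hp => ?_, fun p hp => ?_, fun p hp hpW => ?_, fun p hp hpG => ?_, fun p hp => ?_, fun z0 hz0 => ?_⟩, hfle⟩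
  · exact (X.df.div ((X.dφ.const_mul _).const_sub 1) hW0).const_mul c
  · rw [(hdz p hp).deriv, mul_pow, hcc, div_pow, X.sq p hp]; ring
  · exact mul_ne_zero hc0' (div_ne_zero (X.ne p hp) (hW0 p hp))
  · rw [hηe p hp, X.eq p hp hpW, one_mul]
  · rw [norm_mul, hη, one_mul, norm_div, one_le_div (norm_pos_iff.2 (hW0 p hp))]
    have h1 := X.out p hp hpG
    have h2 := cm_mobsq (φt0 p) w
    have : 0 ≤ (‖φt0 p‖^2 - 1) * (1 - ‖w‖^2) := mul_nonneg (by nlinarith) (by nlinarith [norm_nonneg w])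
    exact abs_le_of_sq_le_sq' (by linarith) (norm_nonneg _) |>.2
  · rw [norm_mul, hη, one_mul, norm_div, one_div, inv_inv]
    have h1 := X.bd p hp
    refine div_lt_div₀ ?_ (hden _ h1.le) (by positivity) hd0
    have := norm_sub_le (φt0 p) w
    linarith
  · obtain ⟨C, hC, δ, hδ, h⟩ := X.fb z0 hz0
    refine ⟨(1 - r/ρ1)⁻¹ * C, by positivity, δ, hδ, fun p hp hpz => (hfle p hp).trans ?_⟩
    rw [mul_assoc]; exact mul_le_mul_of_nonneg_left (h p hp hpz) (by positivity)
theorem cm_span {p : ℕ → Polynomial ℂ} (h1 : ∀ k, (p k).natDegree = k) (h2 : ∀ k, (p k).leadingCoeff ≠ 0) :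
    ∀ (n : ℕ) (P : Polynomial ℂ), P.natDegree ≤ n → ∃ c : ℕ → ℂ, P = ∑ k ∈ Finset.range (n+1), Polynomial.C (c k) * p k := by
  have hz : ∀ (n : ℕ) (P : Polynomial ℂ), P.natDegree ≤ n → (P - Polynomial.C (P.coeff n / (p n).leadingCoeff) * p n).coeff n = 0 := fun n P hP => by
    rw [Polynomial.coeff_sub, Polynomial.coeff_C_mul, Polynomial.leadingCoeff, h1 n, div_mul_cancel₀ _ (by have := h2 n; rwa [Polynomial.leadingCoeff, h1 n] at this), sub_self]
  have hd : ∀ (n : ℕ) (P : Polynomial ℂ), P.natDegree ≤ n → (P - Polynomial.C (P.coeff n / (p n).leadingCoeff) * p n).natDegree ≤ n := fun n P hP =>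
    (Polynomial.natDegree_sub_le _ _).trans (max_le hP ((Polynomial.natDegree_C_mul_le _ _).trans (h1 n).le))
  intro n
  induction n with
  | zero =>
    intro P hP
    refine ⟨fun _ => P.coeff 0 / (p 0).leadingCoeff, ?_⟩
    have a1 := Polynomial.eq_C_of_natDegree_le_zero (hd 0 P hP)
    rw [hz 0 P hP, Polynomial.C_0, sub_eq_zero] at a1
    simpa using a1
  | succ n ih =>
    intro P hP
    obtain ⟨c, hc⟩ := ih (P - Polynomial.C (P.coeff (n+1) / (p (n+1)).leadingCoeff) * p (n+1)) (by
      rw [Polynomial.natDegree_le_iff_coeff_eq_zero]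
      intro N hN
      rcases eq_or_lt_of_le (Nat.succ_le_of_lt hN) with h | h
      · rw [← h]; exact hz (n+1) P hP
      · exact Polynomial.coeff_eq_zero_of_natDegree_lt (lt_of_le_of_lt (hd (n+1) P hP) h))
    refine ⟨fun k => if k = n+1 then P.coeff (n+1) / (p (n+1)).leadingCoeff else c k, ?_⟩
    rw [Finset.sum_range_succ]
    simp only [if_true]
    rw [Finset.sum_congr rfl (g := fun k => Polynomial.C (c k) * p k) fun k hk => by rw [if_neg (by have := Finset.mem_range.1 hk; omega)], ← hc]
    ring
theorem cm_fin {D : JordanDomain} {E W : Set ℂ} {lam a : ℂ → ℝ} {e : ℂ → ℂ} {φ φt f : ℂ → ℂ} {ρ1 : ℝ} {ζ : ℂ} {p : ℕ → Polynomial ℂ} (hp : D.IsONPolys p)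
    (dm : CmDom D.G E D.l D.γ lam a e) (X : CmExt D.G E W lam φ φt f ρ1) (hφ : ConformalOnto D.G φ ζ) (hc : ContinuousOn φ (closure D.G)) (hζ : ζ ∈ D.G) {n : ℕ} {C : ℝ} (hC : 0 < C)
    (hest : ∀ k Q, CmK D.γ D.l n k Q → ‖∫ s, k s * f (D.γ s) ∂(cmμ D.l)‖ ≤ C * Q) :
    ∀ z ∈ closure D.G, ‖φ z - Jfun D p ζ n z‖ ≤ 8 * √(2*Real.pi) * C := by
  obtain ⟨hp1, hp2, hp3⟩ := hp
  obtain ⟨σ, -, -, htot⟩ := X.sgn dm hφ hc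
  obtain ⟨hae, hfm, hf2⟩ := X.fl2 dm
  have hrep := X.rep dm hφ hc hζ
  set l := D.l
  set γ := D.γ
  have hl := dm.cv.lpos
  have hl0 : (l:ℂ) ≠ 0 := by exact_mod_cast hl.ne'
  have hpi : ((Real.pi:ℝ):ℂ) ≠ 0 := by exact_mod_cast Real.pi_ne_zero
  have hfζ := X.ne ζ (X.WG hζ)
  have hfζ' : (starRingEnd ℂ) (f ζ) ≠ 0 := by simpa using hfζ
  have hpc : ∀ P : Polynomial ℂ, Continuous fun s => P.eval (γ s) := fun P => P.continuous.comp dm.cv.cont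
  have hci : ∀ {u : ℝ → ℂ}, Continuous u → Integrable u (cmμ l) := fun {u} hu => (hu.integrableOn_Icc (a := 0) (b := l)).mono_set Ioc_subset_Icc_self
  have hci' : ∀ {u : ℝ → ℝ}, Continuous u → Integrable u (cmμ l) := fun {u} hu => (hu.integrableOn_Icc (a := 0) (b := l)).mono_set Ioc_subset_Icc_self
  have hfc : AEStronglyMeasurable (fun s => (starRingEnd ℂ) (f (γ s))) (cmμ l) := Complex.continuous_conj.comp_aestronglyMeasurable hfm
  have hfi : Integrable (fun s => (starRingEnd ℂ) (f (γ s))) (cmμ l) := by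
    have : MemLp (fun s => (starRingEnd ℂ) (f (γ s))) 2 (cmμ l) := (memLp_two_iff_integrable_sq_norm hfc).2 (by simpa using hf2)
    exact this.integrable (by norm_num)
  have hPi : ∀ P : Polynomial ℂ, Integrable (fun s => P.eval (γ s) * (starRingEnd ℂ) (f (γ s))) (cmμ l) := fun P => by
    obtain ⟨M, hM⟩ := (isCompact_Icc (a := (0:ℝ)) (b := l)).exists_bound_of_continuousOn (hpc P).continuousOn
    exact hfi.bdd_mul (hpc P).aestronglyMeasurable ((ae_restrict_mem measurableSet_Ioc).mono fun s hs => hM s ⟨hs.1.le, hs.2⟩)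
  have hPP : ∀ P R : Polynomial ℂ, Integrable (fun s => P.eval (γ s) * (starRingEnd ℂ) (R.eval (γ s))) (cmμ l) := fun P R =>
    hci ((hpc P).mul (Complex.continuous_conj.comp (hpc R)))
  have hON : ∀ j k, ∫ s, (p j).eval (γ s) * (starRingEnd ℂ) ((p k).eval (γ s)) ∂(cmμ l) = if j = k then (l:ℂ) else 0 := fun j k => by
    have := hp3 j k
    rw [intervalIntegral.integral_of_le hl.le, one_div, inv_mul_eq_iff_eq_mul₀ hl0] at this
    rw [this]; split_ifs <;> simp
  set S : Polynomial ℂ := ∑ k ∈ Finset.range (n+1), Polynomial.C ((starRingEnd ℂ) ((p k).eval ζ)) * p k with hS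
  set K : ℝ := ∑ k ∈ Finset.range (n+1), ‖(p k).eval ζ‖^2 with hK
  have hSζ : S.eval ζ = K := by
    simp only [hS, hK, Polynomial.eval_finsetSum, Polynomial.eval_mul, Polynomial.eval_C]
    push_cast
    exact Finset.sum_congr rfl fun k _ => by rw [mul_comm, Complex.mul_conj, Complex.normSq_eq_norm_sq]; push_cast; rfl
  have hK0 : 0 < K := by
    refine Finset.sum_pos' (fun k _ => sq_nonneg _) ⟨0, by simp, ?_⟩
    obtain ⟨c, hc0, hc1⟩ := hp2 0
    rw [Polynomial.leadingCoeff, hp1 0] at hc1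
    rw [Polynomial.eq_C_of_natDegree_eq_zero (hp1 0), Polynomial.eval_C, hc1, norm_real]
    have := Real.norm_of_nonneg hc0.le
    rw [this]; positivity
  have hKC : (K:ℂ) ≠ 0 := by exact_mod_cast hK0.ne'
  set c0 : ℂ := 2*Real.pi / (l * (starRingEnd ℂ) (f ζ)) with hc0
  set q : Polynomial ℂ := Polynomial.C c0 * S with hq
  have hSd : S.natDegree ≤ n := Polynomial.natDegree_sum_le_of_forall_le _ _ fun k hk => (Polynomial.natDegree_C_mul_le _ _).trans (by
    rw [hp1 k]; have := Finset.mem_range.1 hk; omega)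
  have hqd : q.natDegree ≤ n := (Polynomial.natDegree_C_mul_le _ _).trans hSd
  have hPS : ∀ j ≤ n, ∫ s, (p j).eval (γ s) * (starRingEnd ℂ) (q.eval (γ s)) ∂(cmμ l) = ∫ s, (p j).eval (γ s) * (starRingEnd ℂ) (f (γ s)) ∂(cmμ l) := fun j hj => by
    have e1 : ∀ s, (p j).eval (γ s) * (starRingEnd ℂ) (q.eval (γ s)) = ∑ k ∈ Finset.range (n+1), ((starRingEnd ℂ) c0 * (p k).eval ζ) * ((p j).eval (γ s) * (starRingEnd ℂ) ((p k).eval (γ s))) := fun s => by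
      simp only [hq, hS, Polynomial.eval_mul, Polynomial.eval_C, Polynomial.eval_finsetSum, map_mul, map_sum, Complex.conj_conj, Finset.mul_sum]
      exact Finset.sum_congr rfl fun k _ => by ring
    simp only [e1]
    rw [integral_finsetSum _ fun k _ => (hPP _ _).const_mul _]
    simp only [integral_const_mul, hON, mul_ite, mul_zero, Finset.sum_ite_eq, Finset.mem_range]
    rw [if_pos (by omega)]
    refine mul_left_cancel₀ hfζ ?_
    rw [hrep, hc0]
    simp only [map_div₀, map_mul, Complex.conj_conj, Complex.conj_ofReal, map_ofNat]
    field_simp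
  have horth : ∀ P : Polynomial ℂ, P.natDegree ≤ n → ∫ s, P.eval (γ s) * (starRingEnd ℂ) (q.eval (γ s)) ∂(cmμ l) = ∫ s, P.eval (γ s) * (starRingEnd ℂ) (f (γ s)) ∂(cmμ l) := fun P hP => by
    obtain ⟨c, hPc⟩ := cm_span hp1 (fun k => by obtain ⟨c, h, h'⟩ := hp2 k; rw [h']; exact_mod_cast h.ne') n P hP
    have e1 : ∀ u : ℝ → ℂ, ∀ s, P.eval (γ s) * u s = ∑ k ∈ Finset.range (n+1), c k * ((p k).eval (γ s) * u s) := fun u s => by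
      rw [hPc]; simp only [Polynomial.eval_mul, Polynomial.eval_C, Polynomial.eval_finsetSum, Finset.sum_mul, mul_assoc]
    rw [funext (e1 fun s => (starRingEnd ℂ) (q.eval (γ s))), funext (e1 fun s => (starRingEnd ℂ) (f (γ s))), integral_finsetSum _ fun k _ => (hPP _ _).const_mul _,
      integral_finsetSum _ fun k _ => (hPi (p k)).const_mul _]
    refine Finset.sum_congr rfl fun k hk => ?_
    rw [integral_const_mul, integral_const_mul, hPS k (by have := Finset.mem_range.1 hk; omega)]
  set T : ℝ := ∫ s, ‖q.eval (γ s)‖^2 ∂(cmμ l) with hT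
  have hsqc : ∀ z : ℂ, z * (starRingEnd ℂ) z = ((‖z‖^2 : ℝ) : ℂ) := fun z => by rw [Complex.mul_conj, Complex.normSq_eq_norm_sq]
  have hqf : ∫ s, q.eval (γ s) * (starRingEnd ℂ) (f (γ s)) ∂(cmμ l) = T := by
    rw [← horth q hqd, hT, ← integral_complex_ofReal]; simp only [hsqc]
  have hTK : (T:ℂ) * (l * (f ζ * (starRingEnd ℂ) (f ζ))) = (2*Real.pi)^2 * K := by
    have := hrep q
    rw [hqf, hq, Polynomial.eval_mul, Polynomial.eval_C, hSζ, hc0] at this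
    field_simp at this ⊢
    linear_combination (this)
  have hn2 : f ζ * (starRingEnd ℂ) (f ζ) = (starRingEnd ℂ) (f ζ)^2 := by
    obtain ⟨c, hc1, hc2⟩ := hφ.deriv_center_pos
    have h1 : f ζ^2 = c := by
      rw [X.sq ζ (X.WG hζ), ← hc2]
      exact EventuallyEq.deriv_eq (mem_of_superset (dm.o.mem_nhds hζ) fun z hz => X.eq z (subset_closure hz) (X.WG hz))
    have h2 : ‖f ζ‖^2 = c := by rw [← norm_pow, h1, norm_real, Real.norm_of_nonneg hc1.le]
    rw [hsqc, h2, ← map_pow, h1, Complex.conj_ofReal]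
  have hT0 : 0 < T := by
    have h1 : 0 ≤ T := integral_nonneg fun s => by positivity
    refine lt_of_le_of_ne h1 fun h => ?_
    rw [← h, ofReal_zero, zero_mul] at hTK
    exact mul_ne_zero (pow_ne_zero 2 (mul_ne_zero two_ne_zero hpi)) hKC hTK.symm
  have hTC : (T:ℂ) ≠ 0 := by exact_mod_cast hT0.ne'
  have hAq : ∀ z, (2*Real.pi/l)/K * (S^2).eval z = (2*Real.pi/T) * (q.eval z)^2 := fun z => by
    rw [hn2] at hTK
    rw [hq, Polynomial.eval_mul, Polynomial.eval_C, Polynomial.eval_pow, hc0]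
    field_simp
    linear_combination (S.eval z^2) * hTK
  have hJd : ∀ z, HasDerivAt (Jfun D p ζ n) ((2*Real.pi/T) * (q.eval z)^2) z := fun z => by
    rw [← hAq, Polynomial.eval_eq_sum_range]
    have e1 : (((2 * Real.pi / l : ℝ) : ℂ) / (∑ k ∈ Finset.range (n + 1), ((‖(p k).eval ζ‖ : ℂ)) ^ 2)) = (2*Real.pi/l)/K := by rw [hK]; push_cast; rfl
    rw [← e1]
    refine HasDerivAt.const_mul _ (HasDerivAt.fun_sum fun i _ => HasDerivAt.const_mul _ ?_)
    have h1 := ((hasDerivAt_pow (i+1) z).sub_const (ζ^(i+1))).div_const ((i:ℂ)+1)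
    refine h1.congr_deriv ?_
    have : (i:ℂ) + 1 ≠ 0 := by exact_mod_cast i.succ_ne_zero
    push_cast; field_simp
  have hJζ : Jfun D p ζ n ζ = 0 := by simp [Jfun]
  set h := fun s => f (γ s) - q.eval (γ s) with hh
  set H : ℝ := ∫ s, ‖h s‖^2 ∂(cmμ l) with hH
  have hqm := (hpc q).aestronglyMeasurable (μ := cmμ l)
  have hhm : AEStronglyMeasurable h (cmμ l) := hfm.sub hqm
  have iq2 : Integrable (fun s => ‖q.eval (γ s)‖^2) (cmμ l) := hci' ((hpc q).norm.pow 2)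
  have if2c : Integrable (fun s => ((‖f (γ s)‖^2 : ℝ) : ℂ)) (cmμ l) := hf2.ofReal
  have iq2c : Integrable (fun s => ((‖q.eval (γ s)‖^2 : ℝ) : ℂ)) (cmμ l) := iq2.ofReal
  have iqfc : Integrable (fun s => (starRingEnd ℂ) (q.eval (γ s) * (starRingEnd ℂ) (f (γ s)))) (cmμ l) := by
    have := (Complex.conjCLE : ℂ →L[ℝ] ℂ).integrable_comp (hPi q); exact this
  have hqfc : ∫ s, (starRingEnd ℂ) (q.eval (γ s) * (starRingEnd ℂ) (f (γ s))) ∂(cmμ l) = T := by rw [integral_conj, hqf, Complex.conj_ofReal]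
  have htotc : ∫ s, ((‖f (γ s)‖^2 : ℝ) : ℂ) ∂(cmμ l) = ((2*Real.pi : ℝ) : ℂ) := by rw [integral_complex_ofReal, htot]
  have hfh : ∫ s, (starRingEnd ℂ) (h s) * f (γ s) ∂(cmμ l) = ((2*Real.pi - T : ℝ) : ℂ) := by
    have e1 : ∀ s, (starRingEnd ℂ) (h s) * f (γ s) = ((‖f (γ s)‖^2 : ℝ) : ℂ) - (starRingEnd ℂ) (q.eval (γ s) * (starRingEnd ℂ) (f (γ s))) := fun s => by
      rw [← hsqc]; simp only [hh, map_sub, map_mul, Complex.conj_conj]; ring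
    rw [funext e1, integral_sub if2c iqfc, htotc, hqfc]; push_cast; rfl
  have e2 : ∀ s, ((‖h s‖^2 : ℝ) : ℂ) = (((‖f (γ s)‖^2 : ℝ) : ℂ) - (starRingEnd ℂ) (q.eval (γ s) * (starRingEnd ℂ) (f (γ s)))) - (q.eval (γ s) * (starRingEnd ℂ) (f (γ s)) - ((‖q.eval (γ s)‖^2 : ℝ) : ℂ)) := fun s => by
    rw [← hsqc, ← hsqc, ← hsqc]; simp only [hh, map_sub, map_mul, Complex.conj_conj]; ring
  have i1 : Integrable (fun s => ((‖f (γ s)‖^2 : ℝ) : ℂ) - (starRingEnd ℂ) (q.eval (γ s) * (starRingEnd ℂ) (f (γ s)))) (cmμ l) := if2c.sub iqfc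
  have i2 : Integrable (fun s => q.eval (γ s) * (starRingEnd ℂ) (f (γ s)) - ((‖q.eval (γ s)‖^2 : ℝ) : ℂ)) (cmμ l) := (hPi q).sub iq2c
  have ih2 : Integrable (fun s => ‖h s‖^2) (cmμ l) := by
    have : Integrable (fun s => ((‖h s‖^2 : ℝ) : ℂ)) (cmμ l) := by
      rw [funext e2]; exact i1.sub i2
    exact this.re
  have hHT : H = 2*Real.pi - T := by
    have : (H:ℂ) = ((2*Real.pi - T : ℝ) : ℂ) := by
      rw [hH, ← integral_complex_ofReal, funext e2, integral_sub i1 i2, integral_sub if2c iqfc, integral_sub (hPi q) iq2c, htotc, hqfc, hqf, integral_complex_ofReal]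
      push_cast; ring
    exact_mod_cast this
  have hH0 : 0 ≤ H := integral_nonneg fun s => by positivity
  have hHC : H ≤ C^2 := by
    rcases eq_or_lt_of_le hH0 with h0 | h0
    · rw [← h0]; positivity
    have hsH := Real.sq_sqrt hH0
    have := hest (fun s => (starRingEnd ℂ) (h s)) (√H) ⟨Real.sqrt_pos.2 h0, Complex.continuous_conj.comp_aestronglyMeasurable hhm, by simpa using ih2, by
      simp only [RCLike.norm_conj, hsH]; exact hH.symm.le, fun P hP => by
      have e3 : ∀ s, (starRingEnd ℂ) (h s) * P.eval (γ s) = P.eval (γ s) * (starRingEnd ℂ) (f (γ s)) - P.eval (γ s) * (starRingEnd ℂ) (q.eval (γ s)) := fun s => by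
        simp only [hh, map_sub]; ring
      rw [funext e3, integral_sub (hPi P) (hPP P q), horth P hP, sub_self]⟩
    rw [hfh, ← hHT, norm_real, Real.norm_of_nonneg hH0] at this
    have h1 := Real.sqrt_pos.2 h0
    have : √H ≤ C := by nlinarith
    nlinarith
  have hsp : 0 < √(2*Real.pi) := Real.sqrt_pos.2 (by positivity)
  have hsp2 : √(2*Real.pi)^2 = 2*Real.pi := Real.sq_sqrt (by positivity)
  obtain ⟨ihf, hcs⟩ := cm_cs hC hsp hhm hfm ih2 hf2 hHC (by rw [htot, hsp2])
  have hHc : H ≤ C * √(2*Real.pi) := by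
    refine (abs_le_of_sq_le_sq' ?_ (by positivity)).2
    rw [mul_pow, hsp2]; nlinarith
  set u' := fun s => (f (γ s)^2 - (2*Real.pi/T) * (q.eval (γ s))^2) * deriv γ s with hu'
  set g := fun s => (2 * ‖h s * f (γ s)‖ + ‖h s‖^2) + (2*Real.pi/T - 1) * ‖q.eval (γ s)‖^2 with hg
  have hT1 : 0 ≤ 2*Real.pi/T - 1 := by rw [sub_nonneg, le_div_iff₀ hT0]; linarith
  have ig1 : Integrable (fun s => 2 * ‖h s * f (γ s)‖ + ‖h s‖^2) (cmμ l) := (ihf.norm.const_mul 2).add ih2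
  have ig : Integrable g (cmμ l) := ig1.add (iq2.const_mul _)
  have hug : ∀ᵐ s ∂(cmμ l), ‖u' s‖ ≤ g s := by
    filter_upwards [hae] with s hs
    rw [hu', norm_mul, (dm.cv.dγ hs).2, mul_one]
    have e4 : f (γ s)^2 - (2*Real.pi/T) * (q.eval (γ s))^2 = 2 * (h s * f (γ s)) - h s^2 - ((2*Real.pi/T - 1 : ℝ) : ℂ) * (q.eval (γ s))^2 := by
      simp only [hh]; push_cast; ring
    rw [e4]
    refine (norm_sub_le _ _).trans (add_le_add ((norm_sub_le _ _).trans_eq ?_) ?_)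
    · rw [norm_mul 2, norm_pow, Complex.norm_ofNat]
    · rw [norm_mul, norm_pow, norm_real, Real.norm_of_nonneg hT1]
  have iu' : Integrable u' (cmμ l) := ig.mono' (((hfm.pow 2).sub ((hqm.pow 2).const_mul _)).mul (stronglyMeasurable_deriv γ).aestronglyMeasurable) hug
  set ε := 4 * √(2*Real.pi) * C with hε
  have hgε : ∫ s, g s ∂(cmμ l) ≤ ε := by
    rw [hg, integral_add ig1 (iq2.const_mul _), integral_add (ihf.norm.const_mul 2) ih2, integral_const_mul, integral_const_mul, ← hT, ← hH]
    have : (2*Real.pi/T - 1) * T = H := by rw [hHT]; field_simp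
    rw [this]; linarith
  set u := fun z => φ z - Jfun D p ζ n z
  have huc : ContinuousOn u (closure D.G) := hc.sub fun z _ => (hJd z).continuousAt.continuousWithinAt
  have hucl : DiffContOnCl ℂ u D.G := ⟨fun z hz => ((hφ.differentiable z hz).sub (hJd z).differentiableAt).differentiableWithinAt, huc⟩
  have hfr : ∀ z ∈ frontier D.G, ‖u z - u (γ 0)‖ ≤ ε := fun z hz => by
    obtain ⟨t, ht, rfl⟩ := dm.cv.exParam hz 0
    rw [zero_add] at ht
    have h1 := dm.cv.ftc (u := fun s => u (γ s)) (huc.comp_continuous dm.cv.cont fun s => frontier_subset_closure (dm.cv.memL s)) (fun s _ hs => by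
      have h2 := (X.dψ dm hs).sub ((hJd (γ s)).comp_of_eq s (dm.cv.dγ hs).1 rfl)
      rw [← sub_mul] at h2; exact h2) iu' ⟨le_rfl, hl.le⟩ ⟨ht.1, ht.2.le⟩
    rw [← h1, intervalIntegral.integral_of_le ht.1]
    have hsub : Ioc 0 t ⊆ Ioc 0 l := Ioc_subset_Ioc_right ht.2.le
    have hr : volume.restrict (Ioc 0 t) ≤ cmμ l := Measure.restrict_mono_set _ hsub
    refine (norm_integral_le_of_norm_le (ig.mono_measure hr) (ae_mono hr hug)).trans (le_trans ?_ hgε)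
    exact integral_mono_measure hr (hug.mono fun s hs => (norm_nonneg _).trans hs) ig
  have hall : ∀ z ∈ closure D.G, ‖u z - u (γ 0)‖ ≤ ε := fun z hz =>
    Complex.norm_le_of_forall_mem_frontier_norm_le dm.b (f := fun z => u z - u (γ 0)) (hucl.sub_const _) hfr hz
  have huζ : u ζ = 0 := by simp only [u]; rw [hφ.map_center, hJζ, sub_zero]
  intro z hz
  have h1 := hall z hz
  have h2 := hall ζ (subset_closure hζ)
  rw [huζ, zero_sub, norm_neg] at h2
  have h3 : ‖u z‖ ≤ ‖u z - u (γ 0)‖ + ‖u (γ 0)‖ := by simpa using norm_add_le (u z - u (γ 0)) (u (γ 0))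
  change ‖u z‖ ≤ _
  linarith
end

theorem conformalMap_uniform_rate
    (D : JordanDomain) (B : PiecewiseAnalyticBoundary D)
    (lam : ℝ) (hlam0 : 0 < lam) (hlam2 : lam < 2)
    (hmin : ∀ i, lam ≤ B.extAngle i) (hattained : ∃ i, B.extAngle i = lam)
    (p : ℕ → Polynomial ℂ) (hp : D.IsONPolys p)
    (F : Set ℂ) (hF : IsCompact F) (hFG : F ⊆ D.G) :
    ∃ C : ℝ, 0 < C ∧ ∀ ζ ∈ F, ∀ φ : ℂ → ℂ,
      ConformalOnto D.G φ ζ → ContinuousOn φ (closure D.G) →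
      ∀ n : ℕ, 0 < n →
        supNormOn (closure D.G) (fun z => φ z - Jfun D p ζ n z) ≤
          C * (n : ℝ) ^ (-(lam / (4 - 2 * lam))) := by
  
  by_cases hex : ∃ ζ0 ∈ F, ∃ φ0, ConformalOnto D.G φ0 ζ0 ∧ ContinuousOn φ0 (closure D.G)
  swap
  · exact ⟨1, one_pos, fun ζ hζ φ h1 h2 => absurd ⟨ζ, hζ, φ, h1, h2⟩ hex⟩
  obtain ⟨ζ0, hζ0, φ0, hφ0, hc0⟩ := hex
  obtain ⟨E, lm, a, e, dm, hl⟩ := cm_dom D B ⟨φ0, ζ0, hφ0, hc0⟩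
  obtain ⟨x, hx, hm⟩ := hF.exists_isMaxOn ⟨ζ0, hζ0⟩ (hc0.norm.mono (hFG.trans subset_closure))
  set r := ‖φ0 x‖
  have hr0 : 0 ≤ r := norm_nonneg _
  have hr1 : r < 1 := mem_ball_zero_iff.1 (hφ0.bijOn.mapsTo (hFG hx))
  obtain ⟨W, φt0, f0, X0⟩ := dm.exists_ext hφ0 hc0 (ρ1 := (1 + r)/2) (by linarith) (by linarith)
  obtain ⟨C1, hC1, hest⟩ := dm.est X0.Wo X0.WG X0.WL X0.WE X0.cor X0.df.continuousOn (fun z hz => by linarith [CmExt.bb dm z hz]) X0.fb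
    (κ := lam / (4 - 2 * lam)) fun z hz => by
      obtain ⟨i, hi⟩ := hl z hz
      have h1 := (B.extAngle_mem i).2
      have h2 := hmin i
      rw [← hi] at h1 h2
      have h3 : 2 - lm z ≠ 0 := by linarith
      have : lm z * ((1/(2 - lm z) - 1)/2 + 1/2) = lm z / (4 - 2 * lm z) := by
        rw [show 4 - 2 * lm z = 2 * (2 - lm z) by ring]; field_simp; ring
      rw [this]
      exact div_le_div₀ (by linarith) h2 (by linarith) (by linarith)
  set A := (1 - r/((1 + r)/2))⁻¹
  have hA : 0 < A := inv_pos.2 (by rw [sub_pos, div_lt_one (by linarith)]; linarith)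
  refine ⟨8 * √(2*Real.pi) * (C1 * A), by positivity, fun ζ hζ φ hφ hc n hn => ?_⟩
  obtain ⟨φt, f, ρ2, X, hX⟩ := X0.mob dm hφ0 hc0 hφ hc (hFG hζ) (hm hζ) (by linarith) (by linarith)
  have hn' : (0:ℝ) < n := by exact_mod_cast hn
  have hκ := Real.rpow_pos_of_pos hn' (-(lam / (4 - 2 * lam)))
  have h := cm_fin hp dm X hφ hc (hFG hζ) (n := n) (C := C1 * A * (n:ℝ)^(-(lam / (4 - 2 * lam)))) (by positivity) fun k Q hk =>
    (hest f X.df A hA hX n k Q hn hk).trans_eq (by ring)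
  have : Nonempty (closure D.G) := D.nonempty.closure.to_subtype
  exact ciSup_le fun z => (h z z.2).trans_eq (by ring)
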